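/- Let γ(t) = (t, t²) be the parabolic curve in ℝ², and let b : ℝ² → ℂ be locally integrable with ‖b‖_{BMO_γ} < ∞. Then for every p ∈ (1, ∞) there is a constant C depending only on p (and not on b) such that for every compactly supported smooth function f : ℝ² → ℂ for which the principal value defining [b, H_γ]f exists, one has ‖[b, H_γ]f‖_{L^p(ℝ²)} ≤ C ‖b‖_{BMO_γ} ‖f‖_{L^p(ℝ²)}. In particular the commutator [b, H_γ] extends to a bounded operator from L^p(ℝ²) to itself with operator norm at most C ‖b‖_{BMO_γ}. -/

import Mathlib

open MeasureTheory Set Filter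

noncomputable section

/-- The parabolic curve `γ(t) = (t, t²)` in `ℝ²`. -/
def pgamma (t : ℝ) : ℝ × ℝ := (t, t ^ 2)

/-- A parabolic cube `Q = I ×ˢ J` where `I, J` are intervals with `|J| = |I|²`;
`l = |I|` is the side length `ℓ(Q)`. -/
def IsPCube (Q : Set (ℝ × ℝ)) (l : ℝ) : Prop :=
  0 < l ∧ ∃ a c : ℝ, Q = Ico a (a + l) ×ˢ Ico c (c + l ^ 2)

/-- The average `b_Q = |Q|⁻¹ ∫_Q b`. -/
def avgC (Q : Set (ℝ × ℝ)) (b : ℝ × ℝ → ℂ) : ℂ :=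
  (volume Q).toReal⁻¹ • ∫ x in Q, b x

/-- The mean oscillation `|Q|⁻¹ ∫_Q |b - b_Q|`. -/
def oscC (Q : Set (ℝ × ℝ)) (b : ℝ × ℝ → ℂ) : ℝ :=
  (volume Q).toReal⁻¹ * ∫ x in Q, ‖b x - avgC Q b‖

/-- `HasPV F L` : the principal value `lim_{ε → 0⁺} ∫_{ε ≤ |t| ≤ 1/ε} F(t) dt = L`. -/
def HasPV (F : ℝ → ℂ) (L : ℂ) : Prop :=
  Tendsto (fun ε : ℝ => ∫ t in {t : ℝ | ε ≤ |t| ∧ |t| ≤ ε⁻¹}, F t)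
    (nhdsWithin 0 (Set.Ioi 0)) (nhds L)

/-- The integrand of the commutator `[b, H_γ] f (x) = p.v. ∫ (b(x) - b(x-γ(t))) f(x-γ(t)) dt/t`. -/
def commKer (b f : ℝ × ℝ → ℂ) (x : ℝ × ℝ) (t : ℝ) : ℂ :=
  (b x - b (x - pgamma t)) * f (x - pgamma t) / (t : ℂ)

namespace ParabolicCommutator

/-! ### Dyadic parabolic cubes -/

/-- The index of the dyadic parabolic cube of side `2 ^ j` containing `x`. -/
def idx (j : ℤ) (x : ℝ × ℝ) : ℤ × ℤ := (⌊x.1 / 2 ^ j⌋, ⌊x.2 / 4 ^ j⌋)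

/-- The dyadic parabolic cube of side `2 ^ j` with index `n`. -/
def cube (j : ℤ) (n : ℤ × ℤ) : Set (ℝ × ℝ) := {x | idx j x = n}

/-- Two indices are neighbours if both coordinates differ by at most one. -/
def nbr (n n' : ℤ × ℤ) : Prop := |n.1 - n'.1| ≤ 1 ∧ |n.2 - n'.2| ≤ 1

/-- The union of the cubes neighbouring the cube with index `n`. -/
def tri (j : ℤ) (n : ℤ × ℤ) : Set (ℝ × ℝ) := {x | nbr (idx j x) n}

lemma nbr_refl (n : ℤ × ℤ) : nbr n n := by simp [nbr]

lemma nbr_symm {n n' : ℤ × ℤ} (h : nbr n n') : nbr n' n := by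
  unfold nbr at *; rw [abs_sub_comm n'.1, abs_sub_comm n'.2]; exact h

lemma mem_cube {j : ℤ} {n : ℤ × ℤ} {x : ℝ × ℝ} : x ∈ cube j n ↔ idx j x = n := Iff.rfl

lemma mem_tri {j : ℤ} {n : ℤ × ℤ} {x : ℝ × ℝ} : x ∈ tri j n ↔ nbr (idx j x) n := Iff.rfl

lemma cube_subset_tri (j : ℤ) (n : ℤ × ℤ) : cube j n ⊆ tri j n := fun x hx => by
  rw [mem_cube] at hx; rw [mem_tri, hx]; exact nbr_refl n

lemma floor_coarse {c : ℕ} {j k : ℤ} (hc : c ≠ 0) (h : j ≤ k) (t : ℝ) :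
    ⌊t / (c : ℝ) ^ k⌋ = ⌊t / (c : ℝ) ^ j⌋ / ((c ^ (k - j).toNat : ℕ) : ℤ) := by
  rw [← Int.floor_div_natCast]
  congr 1
  have hc' : (c : ℝ) ≠ 0 := by exact_mod_cast hc
  push_cast
  rw [div_div, ← zpow_natCast, ← zpow_add₀ hc', Int.toNat_of_nonneg (by omega)]
  congr 2; ring

lemma idx_coarse {j k : ℤ} (h : j ≤ k) (x : ℝ × ℝ) :
    idx k x = ((idx j x).1 / ((2 ^ (k - j).toNat : ℕ) : ℤ),
      (idx j x).2 / ((4 ^ (k - j).toNat : ℕ) : ℤ)) := by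
  have h2 := floor_coarse (c := 2) (by norm_num) h x.1
  have h4 := floor_coarse (c := 4) (by norm_num) h x.2
  push_cast at h2 h4 ⊢
  simp only [idx, h2, h4]

lemma idx_eq_mono {j k : ℤ} (h : j ≤ k) {x y : ℝ × ℝ} (hxy : idx j x = idx j y) :
    idx k x = idx k y := by
  rw [idx_coarse h, idx_coarse h y, hxy]

lemma abs_div_sub_div_le_one {a b c : ℤ} (hc : 0 < c) (h : |a - b| ≤ 1) :
    |a / c - b / c| ≤ 1 := by
  rw [abs_le] at *
  have h1 : a / c ≤ (b + c) / c := Int.ediv_le_ediv hc (by omega)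
  have h2 : b / c ≤ (a + c) / c := Int.ediv_le_ediv hc (by omega)
  rw [Int.add_ediv_of_dvd_right (dvd_refl c), Int.ediv_self hc.ne'] at h1 h2
  omega

lemma nbr_mono {j k : ℤ} (h : j ≤ k) {x y : ℝ × ℝ} (hxy : nbr (idx j x) (idx j y)) :
    nbr (idx k x) (idx k y) := by
  rw [idx_coarse h, idx_coarse h y]
  exact ⟨abs_div_sub_div_le_one (by positivity) hxy.1,
    abs_div_sub_div_le_one (by positivity) hxy.2⟩

lemma abs_floor_sub_floor_le_one {a b : ℝ} (h : |a - b| < 1) : |⌊a⌋ - ⌊b⌋| ≤ 1 := by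
  rw [abs_lt] at h
  have h1 : ⌊a⌋ < ⌊b⌋ + 2 := by
    rw [Int.floor_lt]; push_cast; linarith [Int.lt_floor_add_one b]
  have h2 : ⌊b⌋ < ⌊a⌋ + 2 := by
    rw [Int.floor_lt]; push_cast; linarith [Int.lt_floor_add_one a]
  rw [abs_le]; omega

lemma nbr_of_close {j : ℤ} {x y : ℝ × ℝ} (h1 : |x.1 - y.1| < 2 ^ j) (h2 : |x.2 - y.2| < 4 ^ j) :
    nbr (idx j x) (idx j y) := by
  constructor <;> apply abs_floor_sub_floor_le_one
  · rwa [← sub_div, abs_div, abs_of_pos (a := (2 : ℝ) ^ j) (by positivity),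
      div_lt_one (by positivity)]
  · rwa [← sub_div, abs_div, abs_of_pos (a := (4 : ℝ) ^ j) (by positivity),
      div_lt_one (by positivity)]

lemma close_of_idx_eq {j : ℤ} {x y : ℝ × ℝ} (h : idx j x = idx j y) :
    |x.1 - y.1| < 2 ^ j ∧ |x.2 - y.2| < 4 ^ j := by
  simp only [idx, Prod.mk.injEq] at h
  have := Int.abs_sub_lt_one_of_floor_eq_floor h.1
  have h2 := Int.abs_sub_lt_one_of_floor_eq_floor h.2
  constructor
  · rwa [← sub_div, abs_div, abs_of_pos (a := (2 : ℝ) ^ j) (by positivity),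
      div_lt_one (by positivity)] at this
  · rwa [← sub_div, abs_div, abs_of_pos (a := (4 : ℝ) ^ j) (by positivity),
      div_lt_one (by positivity)] at h2

lemma floor_div_eq_iff {c t : ℝ} (hc : 0 < c) (n : ℤ) :
    ⌊t / c⌋ = n ↔ t ∈ Ico (n * c) ((n + 1) * c) := by
  rw [Int.floor_eq_iff, mem_Ico, le_div_iff₀ hc, div_lt_iff₀ hc]

lemma cube_eq_prod (j : ℤ) (n : ℤ × ℤ) :
    cube j n = Ico (n.1 * (2 : ℝ) ^ j) ((n.1 + 1) * 2 ^ j) ×ˢ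
      Ico (n.2 * (4 : ℝ) ^ j) ((n.2 + 1) * 4 ^ j) := by
  ext x
  rw [mem_cube, mem_prod, ← floor_div_eq_iff (by positivity), ← floor_div_eq_iff (by positivity)]
  simp [idx, Prod.ext_iff]

lemma four_zpow (j : ℤ) : (4 : ℝ) ^ j = (2 ^ j) ^ 2 := by
  rw [← zpow_natCast, ← zpow_mul, mul_comm, zpow_mul]; norm_num

lemma eight_zpow (j : ℤ) : (8 : ℝ) ^ j = 2 ^ j * 4 ^ j := by
  rw [← mul_zpow]; norm_num

@[fun_prop]
lemma measurable_idx (j : ℤ) : Measurable (idx j) := by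
  unfold idx; fun_prop

lemma measurableSet_cube (j : ℤ) (n : ℤ × ℤ) : MeasurableSet (cube j n) :=
  measurable_idx j (measurableSet_singleton n)

lemma measurableSet_tri (j : ℤ) (n : ℤ × ℤ) : MeasurableSet (tri j n) :=
  measurable_idx j (MeasurableSet.of_discrete (s := {n' | nbr n' n}))

lemma volume_cube (j : ℤ) (n : ℤ × ℤ) : volume (cube j n) = ENNReal.ofReal (8 ^ j) := by
  rw [cube_eq_prod, Measure.volume_eq_prod, Measure.prod_prod, Real.volume_Ico, Real.volume_Ico,
    ← ENNReal.ofReal_mul (by ring_nf; positivity), eight_zpow]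
  congr 1; ring

lemma iUnion_cube (j : ℤ) : ⋃ n, cube j n = univ := by
  ext x; simp [mem_cube]

lemma pairwise_disjoint_cube (j : ℤ) : Pairwise (Function.onFun Disjoint (cube j)) := by
  intro n n' h
  rw [Function.onFun, Set.disjoint_left]
  intro x hx hx'
  rw [mem_cube] at hx hx'
  exact h (hx.symm.trans hx')

/-- Sets that are unions of dyadic cubes of scale `k`. -/
def DMeas (k : ℤ) (S : Set (ℝ × ℝ)) : Prop := ∀ x y, idx k x = idx k y → x ∈ S → y ∈ S

lemma DMeas.exists_eq {k : ℤ} {S : Set (ℝ × ℝ)} (h : DMeas k S) :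
    S = idx k ⁻¹' (idx k '' S) := by
  ext x
  constructor
  · intro hx; exact ⟨x, hx, rfl⟩
  · rintro ⟨y, hy, hxy⟩; exact h y x hxy hy

lemma DMeas.measurableSet {k : ℤ} {S : Set (ℝ × ℝ)} (h : DMeas k S) : MeasurableSet S := by
  rw [h.exists_eq]
  exact measurable_idx k (MeasurableSet.of_discrete)

lemma DMeas.mono {k l : ℤ} (hkl : k ≤ l) {S : Set (ℝ × ℝ)} (h : DMeas l S) : DMeas k S :=
  fun x y hxy hx => h x y (idx_eq_mono hkl hxy) hx

lemma DMeas.cube_subset_or {k : ℤ} {S : Set (ℝ × ℝ)} (h : DMeas k S) (n : ℤ × ℤ) :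
    cube k n ⊆ S ∨ Disjoint (cube k n) S := by
  by_cases hd : Disjoint (cube k n) S
  · exact Or.inr hd
  · left
    rw [Set.not_disjoint_iff] at hd
    obtain ⟨x, hx, hxS⟩ := hd
    intro y hy
    exact h x y (hx.trans hy.symm) hxS

lemma dMeas_cube {k l : ℤ} (hkl : k ≤ l) (n : ℤ × ℤ) : DMeas k (cube l n) := by
  intro x y hxy hx
  rw [mem_cube] at *
  rw [← hx, idx_eq_mono hkl hxy]

lemma dMeas_tri {k l : ℤ} (hkl : k ≤ l) (n : ℤ × ℤ) : DMeas k (tri l n) := by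
  intro x y hxy hx
  rw [mem_tri] at *
  rwa [← idx_eq_mono hkl hxy]

lemma lintegral_eq_tsum_cube (k : ℤ) (φ : ℝ × ℝ → ENNReal) :
    ∫⁻ x, φ x = ∑' n, ∫⁻ x in cube k n, φ x := by
  rw [← lintegral_iUnion (measurableSet_cube k) (pairwise_disjoint_cube k), iUnion_cube,
    setLIntegral_univ]

lemma setLIntegral_eq_tsum_cube (k : ℤ) {S : Set (ℝ × ℝ)} (hS : MeasurableSet S)
    (φ : ℝ × ℝ → ENNReal) :
    ∫⁻ x in S, φ x = ∑' n, ∫⁻ x in cube k n ∩ S, φ x := by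
  rw [← lintegral_indicator hS, lintegral_eq_tsum_cube k]
  congr 1; ext n
  rw [setLIntegral_indicator hS, inter_comm]

/-- An integral inequality on cubes passes to unions of cubes. -/
lemma setLIntegral_le_of_cube {k : ℤ} {S : Set (ℝ × ℝ)} (hS : DMeas k S) {φ ψ : ℝ × ℝ → ENNReal}
    (h : ∀ n, cube k n ⊆ S → ∫⁻ x in cube k n, φ x ≤ ∫⁻ x in cube k n, ψ x) :
    ∫⁻ x in S, φ x ≤ ∫⁻ x in S, ψ x := by
  rw [setLIntegral_eq_tsum_cube k hS.measurableSet, setLIntegral_eq_tsum_cube k hS.measurableSet ψ]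
  refine ENNReal.tsum_le_tsum fun n => ?_
  rcases hS.cube_subset_or n with hn | hn
  · rw [inter_eq_left.mpr hn]; exact h n hn
  · simp [hn.inter_eq]

lemma abs_setIntegral_le_of_cube {k : ℤ} {S : Set (ℝ × ℝ)} (hS : DMeas k S)
    {φ ψ : ℝ × ℝ → ℝ} (hφ : Integrable φ) (hψ : Integrable ψ)
    (h : ∀ n, cube k n ⊆ S → |∫ x in cube k n, φ x| ≤ ∫ x in cube k n, ψ x) :
    |∫ x in S, φ x| ≤ ∫ x in S, ψ x := by
  have key : ∀ φ : ℝ × ℝ → ℝ, Integrable φ →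
      HasSum (fun n => ∫ x in cube k n ∩ S, φ x) (∫ x in S, φ x) := by
    intro φ hφ
    have := hasSum_integral_iUnion (f := S.indicator φ) (μ := volume) (measurableSet_cube k)
      (pairwise_disjoint_cube k) (hφ.indicator hS.measurableSet).integrableOn
    rw [iUnion_cube, setIntegral_univ, integral_indicator hS.measurableSet] at this
    simpa only [setIntegral_indicator hS.measurableSet] using this
  have h1 := key φ hφ
  have h2 := key ψ hψ
  have hle : ∀ n, |∫ x in cube k n ∩ S, φ x| ≤ ∫ x in cube k n ∩ S, ψ x := by
    intro n
    rcases hS.cube_subset_or n with hn | hn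
    · rw [inter_eq_left.mpr hn]; exact h n hn
    · simp [hn.inter_eq]
  rw [← h1.tsum_eq, ← h2.tsum_eq, abs_le]
  constructor
  · rw [← tsum_neg]
    exact h2.summable.neg.tsum_le_tsum (fun n => (abs_le.mp (hle n)).1) h1.summable
  · exact h1.summable.tsum_le_tsum (fun n => (abs_le.mp (hle n)).2) h2.summable

/-- The nine offsets of neighbouring cubes. -/
def offs : Finset (ℤ × ℤ) := Finset.Icc (-1) 1 ×ˢ Finset.Icc (-1) 1

lemma card_offs : offs.card = 9 := by decide

lemma nbr_iff_offs {n n' : ℤ × ℤ} : nbr n n' ↔ ∃ d ∈ offs, n = n' + d := by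
  constructor
  · intro h
    refine ⟨n - n', ?_, by abel⟩
    simp only [offs, Finset.mem_product, Finset.mem_Icc, Prod.fst_sub, Prod.snd_sub]
    exact ⟨abs_le.mp h.1, abs_le.mp h.2⟩
  · rintro ⟨d, hd, rfl⟩
    simp only [offs, Finset.mem_product, Finset.mem_Icc] at hd
    simp only [nbr, Prod.fst_add, Prod.snd_add, add_sub_cancel_left, abs_le]
    exact hd

/-- The translation vector taking a cube of scale `k` to its neighbour of offset `d`. -/
def shiftVec (k : ℤ) (d : ℤ × ℤ) : ℝ × ℝ := (d.1 * 2 ^ k, d.2 * 4 ^ k)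

lemma idx_add_shiftVec (k : ℤ) (d : ℤ × ℤ) (x : ℝ × ℝ) :
    idx k (x + shiftVec k d) = idx k x + d := by
  have h2 : (2 : ℝ) ^ k ≠ 0 := by positivity
  have h4 : (4 : ℝ) ^ k ≠ 0 := by positivity
  simp [idx, shiftVec, add_div, h2, h4, Prod.ext_iff]

lemma tri_eq_biUnion (k : ℤ) (n : ℤ × ℤ) : tri k n = ⋃ d ∈ offs, cube k (n + d) := by
  ext x
  simp [mem_tri, nbr_iff_offs, mem_cube]

lemma setLIntegral_tri (k : ℤ) (n : ℤ × ℤ) (φ : ℝ × ℝ → ENNReal) :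
    ∫⁻ x in tri k n, φ x = ∑ d ∈ offs, ∫⁻ x in cube k (n + d), φ x := by
  rw [tri_eq_biUnion, lintegral_biUnion_finset]
  · intro d _ d' _ h
    exact pairwise_disjoint_cube k (by simpa using h)
  · intro d _; exact measurableSet_cube k _

lemma volume_tri (k : ℤ) (n : ℤ × ℤ) : volume (tri k n) = 9 * ENNReal.ofReal (8 ^ k) := by
  have := setLIntegral_tri k n 1
  simp only [Pi.one_apply, setLIntegral_one, volume_cube, Finset.sum_const, card_offs] at this
  simpa using this

/-- Averaging over neighbouring cubes multiplies the integral by at most nine. -/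
lemma lintegral_tri_avg (k : ℤ) (φ : ℝ × ℝ → ENNReal) :
    ∫⁻ x, (ENNReal.ofReal (8 ^ k))⁻¹ * ∫⁻ y in tri k (idx k x), φ y = 9 * ∫⁻ x, φ x := by
  have h0 : ENNReal.ofReal (8 ^ k) ≠ 0 := by
    rw [Ne, ENNReal.ofReal_eq_zero, not_le]; positivity
  rw [lintegral_eq_tsum_cube k]
  have : ∀ n, ∫⁻ x in cube k n, (ENNReal.ofReal (8 ^ k))⁻¹ * ∫⁻ y in tri k (idx k x), φ y =
      ∑ d ∈ offs, ∫⁻ y in cube k (n + d), φ y := by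
    intro n
    rw [setLIntegral_congr_fun (g := fun _ => (ENNReal.ofReal (8 ^ k))⁻¹ * ∫⁻ y in tri k n, φ y)
      (measurableSet_cube k n) (fun x hx => by rw [mem_cube] at hx; simp only [hx]),
      setLIntegral_const, volume_cube, mul_comm, ← mul_assoc,
      ENNReal.mul_inv_cancel h0 ENNReal.ofReal_ne_top, one_mul, setLIntegral_tri]
  simp_rw [this]
  rw [Summable.tsum_finsetSum (fun _ _ => ENNReal.summable)]
  have h2 : ∀ d ∈ offs, ∑' n, ∫⁻ y in cube k (n + d), φ y = ∫⁻ x, φ x := by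
    intro d _
    rw [lintegral_eq_tsum_cube k φ]
    exact (Equiv.addRight d).tsum_eq (fun n => ∫⁻ y in cube k n, φ y)
  rw [Finset.sum_congr rfl h2, Finset.sum_const, card_offs]
  simp

/-! ### Stopping scales and the maximal function -/

/-- The points whose largest scale `≤ hi` with `x ∈ S k` is `k`. -/
def topSet (S : ℤ → Set (ℝ × ℝ)) (hi k : ℤ) : Set (ℝ × ℝ) :=
  {x | x ∈ S k ∧ ∀ m, k < m → m ≤ hi → x ∉ S m}

lemma dMeas_topSet {S : ℤ → Set (ℝ × ℝ)} (hS : ∀ k, DMeas k (S k)) (hi k : ℤ) :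
    DMeas k (topSet S hi k) := by
  intro x y hxy hx
  refine ⟨hS k x y hxy hx.1, fun m hm hmi hy => hx.2 m hm hmi ?_⟩
  exact hS m y x (idx_eq_mono hm.le hxy.symm) hy

lemma disjoint_topSet (S : ℤ → Set (ℝ × ℝ)) {hi k l : ℤ} (hk : k ≤ hi) (hl : l ≤ hi)
    (hkl : k ≠ l) : Disjoint (topSet S hi k) (topSet S hi l) := by
  rw [Set.disjoint_left]
  intro x hx hx'
  rcases lt_or_gt_of_ne hkl with h | h
  · exact hx.2 l h hl hx'.1
  · exact hx'.2 k h hk hx.1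

lemma exists_mem_topSet (S : ℤ → Set (ℝ × ℝ)) {hi k : ℤ} (hk : k ≤ hi) {x : ℝ × ℝ}
    (hx : x ∈ S k) : ∃ m, k ≤ m ∧ m ≤ hi ∧ x ∈ topSet S hi m := by
  obtain ⟨m, ⟨hm1, hm2⟩, hm3⟩ := Int.exists_greatest_of_bdd
    (P := fun m => (k ≤ m ∧ m ≤ hi) ∧ x ∈ S m) ⟨hi, fun z hz => hz.1.2⟩ ⟨k, ⟨le_rfl, hk⟩, hx⟩
  refine ⟨m, hm1.1, hm1.2, hm2, fun l hl hli hxl => ?_⟩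
  exact absurd (hm3 l ⟨⟨by omega, hli⟩, hxl⟩) (by omega)

lemma sum_setLIntegral_topSet_le {S : ℤ → Set (ℝ × ℝ)} (hS : ∀ k, DMeas k (S k)) (lo hi : ℤ)
    (φ : ℝ × ℝ → ENNReal) :
    ∑ k ∈ Finset.Icc lo hi, ∫⁻ x in topSet S hi k, φ x ≤ ∫⁻ x, φ x := by
  rw [← lintegral_biUnion_finset]
  · exact setLIntegral_le_lintegral _ _
  · intro k hk l hl h
    simp only [Finset.coe_Icc, mem_Icc] at hk hl
    exact disjoint_topSet S hk.2 hl.2 h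
  · intro k _; exact (dMeas_topSet hS hi k).measurableSet

/-- The points whose cube of scale `k` has `φ`-average above `a`. -/
def heavy (φ : ℝ × ℝ → ENNReal) (a : ENNReal) (k : ℤ) : Set (ℝ × ℝ) :=
  {x | a * ENNReal.ofReal (8 ^ k) < ∫⁻ y in cube k (idx k x), φ y}

/-- The points having a neighbouring cube of scale `k` with `φ`-average above `a`. -/
def nheavy (φ : ℝ × ℝ → ENNReal) (a : ENNReal) (k : ℤ) : Set (ℝ × ℝ) :=
  {x | ∃ n, nbr n (idx k x) ∧ a * ENNReal.ofReal (8 ^ k) < ∫⁻ y in cube k n, φ y}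

lemma dMeas_heavy (φ : ℝ × ℝ → ENNReal) (a : ENNReal) (k : ℤ) : DMeas k (heavy φ a k) := by
  intro x y hxy hx
  simp only [heavy, mem_ofPred_eq] at *
  rwa [← hxy]

lemma dMeas_nheavy (φ : ℝ × ℝ → ENNReal) (a : ENNReal) (k : ℤ) : DMeas k (nheavy φ a k) := by
  intro x y hxy hx
  simp only [nheavy, mem_ofPred_eq] at *
  rwa [← hxy]

lemma heavy_subset_nheavy (φ : ℝ × ℝ → ENNReal) (a : ENNReal) (k : ℤ) :
    heavy φ a k ⊆ nheavy φ a k := fun x hx => ⟨idx k x, nbr_refl _, hx⟩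

/-- The weak type estimate for dyadic parabolic cubes. -/
lemma mul_volume_nheavy_le (φ : ℝ × ℝ → ENNReal) (a : ENNReal) (lo hi : ℤ) :
    a * volume (⋃ k ∈ Finset.Icc lo hi, nheavy φ a k) ≤ 9 * ∫⁻ x, φ x := by
  have hsub : (⋃ k ∈ Finset.Icc lo hi, nheavy φ a k) ⊆
      ⋃ k ∈ Finset.Icc lo hi, ⋃ d ∈ offs, (fun x => x + shiftVec k d) ⁻¹'
        topSet (heavy φ a) hi k := by
    intro x hx
    simp only [mem_iUnion, Finset.mem_Icc, exists_prop] at hx ⊢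
    obtain ⟨k, ⟨hlo, hhi⟩, n, hn, hnφ⟩ := hx
    obtain ⟨d, hd, rfl⟩ := nbr_iff_offs.mp hn
    have hy : x + shiftVec k d ∈ heavy φ a k := by
      simpa only [heavy, mem_ofPred_eq, idx_add_shiftVec] using hnφ
    obtain ⟨m, hkm, hmi, hm⟩ := exists_mem_topSet (heavy φ a) hhi hy
    have hnb : nbr (idx m (x + shiftVec k d)) (idx m x) := by
      refine nbr_mono hkm ?_
      rwa [idx_add_shiftVec]
    obtain ⟨d', hd', h'⟩ := nbr_iff_offs.mp hnb
    refine ⟨m, ⟨by omega, hmi⟩, d', hd', ?_⟩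
    refine dMeas_topSet (dMeas_heavy φ a) hi m _ _ ?_ hm
    rw [h', idx_add_shiftVec]
  have hvol : ∀ k, a * volume (topSet (heavy φ a) hi k) ≤
      ∫⁻ x in topSet (heavy φ a) hi k, φ x := by
    intro k
    rw [← setLIntegral_const]
    refine setLIntegral_le_of_cube (dMeas_topSet (dMeas_heavy φ a) hi k) fun n hn => ?_
    rw [setLIntegral_const, volume_cube]
    by_cases hne : (cube k n).Nonempty
    · obtain ⟨x, hx⟩ := hne
      have := (hn hx).1
      rw [heavy, mem_ofPred_eq, mem_cube.mp hx] at this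
      exact this.le
    · have := volume_cube k n
      rw [not_nonempty_iff_eq_empty.mp hne] at this
      simp [← this]
  calc a * volume (⋃ k ∈ Finset.Icc lo hi, nheavy φ a k)
      ≤ a * ∑ k ∈ Finset.Icc lo hi, ∑ d ∈ offs, volume (topSet (heavy φ a) hi k) := by
        gcongr
        refine (measure_mono hsub).trans ((measure_biUnion_finset_le _ _).trans ?_)
        refine Finset.sum_le_sum fun k _ => (measure_biUnion_finset_le _ _).trans ?_
        refine Finset.sum_le_sum fun d _ => ?_
        rw [measure_preimage_add_right]
    _ = 9 * ∑ k ∈ Finset.Icc lo hi, a * volume (topSet (heavy φ a) hi k) := by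
        simp only [Finset.sum_const, card_offs, nsmul_eq_mul, ← Finset.mul_sum]
        push_cast; ring
    _ ≤ 9 * ∫⁻ x, φ x := by
        gcongr
        exact (Finset.sum_le_sum fun k _ => hvol k).trans
          (sum_setLIntegral_topSet_le (dMeas_heavy φ a) lo hi φ)

/-- The maximal function over neighbourhoods of dyadic cubes with scales in `[lo, hi]`. -/
def MF (lo hi : ℤ) (φ : ℝ × ℝ → ENNReal) (x : ℝ × ℝ) : ENNReal :=
  ⨆ k ∈ Finset.Icc lo hi, (ENNReal.ofReal (8 ^ k))⁻¹ * ∫⁻ y in tri k (idx k x), φ y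

lemma le_MF {lo hi k : ℤ} (h1 : lo ≤ k) (h2 : k ≤ hi) (φ : ℝ × ℝ → ENNReal) (x : ℝ × ℝ) :
    (ENNReal.ofReal (8 ^ k))⁻¹ * ∫⁻ y in tri k (idx k x), φ y ≤ MF lo hi φ x :=
  le_biSup (fun k => (ENNReal.ofReal (8 ^ k))⁻¹ * ∫⁻ y in tri k (idx k x), φ y)
    (Finset.mem_Icc.mpr ⟨h1, h2⟩)

lemma measurable_MF (lo hi : ℤ) (φ : ℝ × ℝ → ENNReal) : Measurable (MF lo hi φ) := by
  unfold MF
  refine Measurable.biSup _ (Finset.countable_toSet _) fun k _ => ?_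
  exact (Measurable.of_discrete (f := fun n : ℤ × ℤ =>
    (ENNReal.ofReal (8 ^ k))⁻¹ * ∫⁻ y in tri k n, φ y)).comp (measurable_idx k)

lemma eight_pos (k : ℤ) : ENNReal.ofReal ((8 : ℝ) ^ k) ≠ 0 := by
  rw [Ne, ENNReal.ofReal_eq_zero, not_le]; positivity

lemma MF_le_const {lo hi : ℤ} {φ : ℝ × ℝ → ENNReal} {c : ENNReal} (h : ∀ x, φ x ≤ c)
    (x : ℝ × ℝ) : MF lo hi φ x ≤ 9 * c := by
  refine iSup₂_le fun k _ => ?_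
  calc _ ≤ (ENNReal.ofReal (8 ^ k))⁻¹ * ∫⁻ y in tri k (idx k x), c := by
        gcongr with y; exact h y
    _ = 9 * c * ((ENNReal.ofReal (8 ^ k))⁻¹ * ENNReal.ofReal (8 ^ k)) := by
        rw [setLIntegral_const, volume_tri]; ring
    _ = 9 * c := by
        rw [ENNReal.inv_mul_cancel (eight_pos k) ENNReal.ofReal_ne_top, mul_one]

lemma MF_le_add {lo hi : ℤ} {φ ψ χ : ℝ × ℝ → ENNReal} (hψ : Measurable ψ)
    (h : ∀ x, φ x ≤ ψ x + χ x) (x : ℝ × ℝ) :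
    MF lo hi φ x ≤ MF lo hi ψ x + MF lo hi χ x := by
  refine iSup₂_le fun k hk => ?_
  rw [Finset.mem_Icc] at hk
  refine le_trans ?_ (add_le_add (le_MF hk.1 hk.2 ψ x) (le_MF hk.1 hk.2 χ x))
  rw [← mul_add, ← lintegral_add_left hψ]
  gcongr with y; exact h y

lemma mul_volume_MF_gt_le (lo hi : ℤ) (φ : ℝ × ℝ → ENNReal) (a : ENNReal) :
    a * volume {x | 9 * a < MF lo hi φ x} ≤ 9 * ∫⁻ x, φ x := by
  refine le_trans ?_ (mul_volume_nheavy_le φ a lo hi)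
  gcongr
  intro x hx
  simp only [mem_ofPred_eq, MF, lt_iSup_iff] at hx
  obtain ⟨k, hk, hx⟩ := hx
  simp only [mem_iUnion]
  refine ⟨k, hk, ?_⟩
  by_contra hcon
  simp only [nheavy, mem_ofPred_eq, not_exists, not_and, not_lt] at hcon
  refine absurd hx (not_lt.mpr ?_)
  rw [setLIntegral_tri]
  calc _ ≤ (ENNReal.ofReal (8 ^ k))⁻¹ * ∑ d ∈ offs, a * ENNReal.ofReal (8 ^ k) := by
        gcongr with d hd
        exact hcon _ (nbr_iff_offs.mpr ⟨d, hd, rfl⟩)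
    _ = 9 * a * ((ENNReal.ofReal (8 ^ k))⁻¹ * ENNReal.ofReal (8 ^ k)) := by
        rw [Finset.sum_const, card_offs, nsmul_eq_mul]; push_cast; ring
    _ = 9 * a := by
        rw [ENNReal.inv_mul_cancel (eight_pos k) ENNReal.ofReal_ne_top, mul_one]

lemma volume_MF_gt_le {lo hi : ℤ} {u : ℝ × ℝ → ℝ} (hu : Measurable u) {t : ℝ} (ht : 0 < t) :
    volume {x | ENNReal.ofReal t < MF lo hi (fun x => ENNReal.ofReal (u x)) x} ≤
      ENNReal.ofReal (162 / t) * ∫⁻ x, {x | t < 18 * u x}.indicator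
        (fun x => ENNReal.ofReal (u x)) x := by
  set φ := {x | t < 18 * u x}.indicator (fun x => ENNReal.ofReal (u x)) with hφ
  have hms : MeasurableSet {x | t < 18 * u x} := measurableSet_lt measurable_const (by fun_prop)
  have hφm : Measurable φ := (by fun_prop : Measurable fun x => ENNReal.ofReal (u x)).indicator hms
  have hle : ∀ x, ENNReal.ofReal (u x) ≤ φ x + ENNReal.ofReal (t / 18) := by
    intro x
    by_cases hx : t < 18 * u x
    · rw [hφ, indicator_of_mem (by exact hx)]; exact le_self_add
    · exact le_add_left (ENNReal.ofReal_le_ofReal (by linarith))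
  have hsub : {x | ENNReal.ofReal t < MF lo hi (fun x => ENNReal.ofReal (u x)) x} ⊆
      {x | 9 * ENNReal.ofReal (t / 18) < MF lo hi φ x} := by
    intro x hx
    rw [mem_ofPred_eq] at *
    have h9 : (9 : ENNReal) = ENNReal.ofReal 9 := by simp
    have h1 := (MF_le_add (lo := lo) (hi := hi) (χ := fun _ => ENNReal.ofReal (t / 18)) hφm hle x).trans
      (add_le_add_right (MF_le_const (fun _ => le_rfl) x) _)
    rw [h9, ← ENNReal.ofReal_mul (by norm_num)] at h1 ⊢
    by_contra hcon
    rw [not_lt] at hcon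
    have h2 := hx.trans_le (h1.trans (add_le_add_left hcon _))
    rw [← ENNReal.ofReal_add (by positivity) (by positivity)] at h2
    have := (ENNReal.ofReal_lt_ofReal_iff_of_nonneg ht.le).mp h2
    linarith
  have h2 := mul_volume_MF_gt_le lo hi φ (ENNReal.ofReal (t / 18))
  have h0 : ENNReal.ofReal (t / 18) ≠ 0 := by
    rw [Ne, ENNReal.ofReal_eq_zero, not_le]; positivity
  calc _ ≤ volume {x | 9 * ENNReal.ofReal (t / 18) < MF lo hi φ x} := measure_mono hsub
    _ = (ENNReal.ofReal (t / 18))⁻¹ * (ENNReal.ofReal (t / 18) *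
          volume {x | 9 * ENNReal.ofReal (t / 18) < MF lo hi φ x}) := by
        rw [← mul_assoc, ENNReal.inv_mul_cancel h0 ENNReal.ofReal_ne_top, one_mul]
    _ ≤ (ENNReal.ofReal (t / 18))⁻¹ * (9 * ∫⁻ x, φ x) := by gcongr
    _ = _ := by
        have h9 : (9 : ENNReal) = ENNReal.ofReal 9 := by simp
        rw [← mul_assoc, h9, ← ENNReal.ofReal_inv_of_pos (by positivity),
          ← ENNReal.ofReal_mul (by positivity)]
        congr 2
        field_simp; norm_num

lemma lintegral_Ioo_rpow {q c : ℝ} (hq : 1 < q) (hc : 0 ≤ c) :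
    ∫⁻ t in Ioo 0 c, ENNReal.ofReal (t ^ (q - 2)) = ENNReal.ofReal (c ^ (q - 1) / (q - 1)) := by
  rw [Measure.restrict_congr_set (Ioo_ae_eq_Ioc (μ := volume))]
  have hi : IntervalIntegrable (fun t : ℝ => t ^ (q - 2)) volume 0 c :=
    intervalIntegral.intervalIntegrable_rpow' (by linarith)
  rw [← ofReal_integral_eq_lintegral_ofReal, ← intervalIntegral.integral_of_le hc,
    integral_rpow (Or.inl (by linarith)), Real.zero_rpow (by linarith)]
  · congr 1; ring_nf
  · exact (intervalIntegrable_iff_integrableOn_Ioc_of_le hc).mp hi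
  · filter_upwards [ae_restrict_mem measurableSet_Ioc] with t ht
    exact Real.rpow_nonneg ht.1.le _

/-- The strong type estimate for the maximal function. -/
lemma lintegral_MF_rpow_le {q : ℝ} (hq : 1 < q) {lo hi : ℤ} {u : ℝ × ℝ → ℝ} (hu : Measurable u)
    (h0 : ∀ x, 0 ≤ u x) {M : ℝ} (hM : ∀ x, u x ≤ M) :
    ∫⁻ x, (MF lo hi (fun x => ENNReal.ofReal (u x)) x) ^ q ≤
      ENNReal.ofReal (q * 162 * 18 ^ (q - 1) / (q - 1)) * ∫⁻ x, ENNReal.ofReal (u x ^ q) := by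
  set m := MF lo hi (fun x => ENNReal.ofReal (u x)) with hm
  have hfin : ∀ x, m x ≠ ⊤ := fun x => ne_top_of_le_ne_top (b := 9 * ENNReal.ofReal M)
    (ENNReal.mul_ne_top (by simp) ENNReal.ofReal_ne_top)
    (MF_le_const (fun x => ENNReal.ofReal_le_ofReal (hM x)) x)
  have hmm : Measurable m := measurable_MF lo hi _
  have hq0 : 0 < q := by linarith
  calc ∫⁻ x, m x ^ q = ∫⁻ x, ENNReal.ofReal ((m x).toReal ^ q) := by
        congr 1; ext x
        rw [← ENNReal.ofReal_rpow_of_nonneg ENNReal.toReal_nonneg hq0.le,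
          ENNReal.ofReal_toReal (hfin x)]
    _ = ENNReal.ofReal q * ∫⁻ t in Ioi 0, volume {x | t < (m x).toReal} *
          ENNReal.ofReal (t ^ (q - 1)) :=
        lintegral_rpow_eq_lintegral_meas_lt_mul volume (ae_of_all _ fun x => ENNReal.toReal_nonneg)
          (hmm.ennreal_toReal.aemeasurable) hq0
    _ ≤ ENNReal.ofReal q * ∫⁻ t in Ioi 0, ∫⁻ x, {x : ℝ × ℝ | t < 18 * u x}.indicator
          (fun x => ENNReal.ofReal (u x)) x * ENNReal.ofReal (162 * t ^ (q - 2)) := by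
        gcongr ENNReal.ofReal q * ?_
        refine setLIntegral_mono' measurableSet_Ioi fun t (ht : 0 < t) => ?_
        have hset : {x | t < (m x).toReal} = {x | ENNReal.ofReal t < m x} := by
          ext x; rw [mem_ofPred_eq, mem_ofPred_eq, ENNReal.ofReal_lt_iff_lt_toReal ht.le (hfin x)]
        rw [hset, lintegral_mul_const' _ _ ENNReal.ofReal_ne_top]
        refine (mul_le_mul_left (volume_MF_gt_le hu ht) _).trans (le_of_eq ?_)
        rw [mul_comm (ENNReal.ofReal (162 / t)), mul_assoc, ← ENNReal.ofReal_mul (by positivity)]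
        congr 2
        rw [show q - 1 = (q - 2) + 1 by ring, Real.rpow_add_one ht.ne']
        field_simp
    _ = ENNReal.ofReal q * ∫⁻ x, ∫⁻ t in Ioi 0, {x : ℝ × ℝ | t < 18 * u x}.indicator
          (fun x => ENNReal.ofReal (u x)) x * ENNReal.ofReal (162 * t ^ (q - 2)) := by
        rw [lintegral_lintegral_swap]
        refine Measurable.aemeasurable ?_
        refine Measurable.mul ?_ (by fun_prop)
        have : (Function.uncurry fun (t : ℝ) (x : ℝ × ℝ) => {x : ℝ × ℝ | t < 18 * u x}.indicator
            (fun x => ENNReal.ofReal (u x)) x) = {p : ℝ × (ℝ × ℝ) | p.1 < 18 * u p.2}.indicator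
            (fun p => ENNReal.ofReal (u p.2)) := by
          ext p; rfl
        change Measurable (Function.uncurry fun (t : ℝ) (x : ℝ × ℝ) =>
          {x : ℝ × ℝ | t < 18 * u x}.indicator (fun x => ENNReal.ofReal (u x)) x)
        rw [this]
        exact (by fun_prop : Measurable fun p : ℝ × (ℝ × ℝ) =>
          ENNReal.ofReal (u p.2)).indicator (measurableSet_lt measurable_fst (by fun_prop))
    _ = ENNReal.ofReal q * ∫⁻ x, ENNReal.ofReal (162 * 18 ^ (q - 1) / (q - 1)) *
          ENNReal.ofReal (u x ^ q) := by
        congr 2; ext x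
        have : ∀ t, {x : ℝ × ℝ | t < 18 * u x}.indicator (fun x => ENNReal.ofReal (u x)) x *
            ENNReal.ofReal (162 * t ^ (q - 2)) = (Iio (18 * u x)).indicator
            (fun t => ENNReal.ofReal (u x * 162) * ENNReal.ofReal (t ^ (q - 2))) t := by
          intro t
          by_cases ht : t < 18 * u x
          · rw [indicator_of_mem (by exact ht), indicator_of_mem (by exact ht),
              ENNReal.ofReal_mul (h0 x), mul_assoc, ENNReal.ofReal_mul (by norm_num)]
          · rw [indicator_of_notMem (by exact ht), indicator_of_notMem (by exact ht), zero_mul]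
        simp_rw [this]
        rw [setLIntegral_indicator measurableSet_Iio, Iio_inter_Ioi,
          lintegral_const_mul' _ _ ENNReal.ofReal_ne_top,
          lintegral_Ioo_rpow hq (by linarith [h0 x]), ← ENNReal.ofReal_mul (by linarith [h0 x]),
          ← ENNReal.ofReal_mul (by have : 0 < q - 1 := by linarith
                                   positivity)]
        congr 1
        rw [Real.mul_rpow (by norm_num) (h0 x)]
        rcases (h0 x).eq_or_lt with h | h
        · rw [← h, Real.zero_rpow hq0.ne']; ring
        · rw [show u x ^ q = u x ^ (q - 1) * u x by rw [← Real.rpow_add_one h.ne']; ring_nf]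
          ring
    _ = _ := by
        rw [lintegral_const_mul' _ _ ENNReal.ofReal_ne_top, ← mul_assoc,
          ← ENNReal.ofReal_mul hq0.le]
        congr 2; ring

section

/-! ### Bounded measurable functions with bounded support -/

/-- Bounded measurable functions with bounded support. -/
structure Nice {X : Type*} [NormedAddCommGroup X] [MeasurableSpace X] (f : X → ℝ) : Prop where
  meas : Measurable f
  bdd : ∃ M, ∀ x, |f x| ≤ M
  supp : ∃ R, ∀ x, R < ‖x‖ → f x = 0

section general

variable {X Y : Type*} [NormedAddCommGroup X] [MeasurableSpace X] [NormedAddCommGroup Y]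
  [MeasurableSpace Y] {f g : X → ℝ}

lemma Nice.of_supp (hf : Nice f) (hg : Measurable g) (hb : ∃ M, ∀ x, |g x| ≤ M)
    (h : ∀ x, f x = 0 → g x = 0) : Nice g :=
  ⟨hg, hb, hf.supp.imp fun _ hR x hx => h x (hR x hx)⟩

lemma Nice.exists_pos_bdd (hf : Nice f) : ∃ M, 0 < M ∧ ∀ x, |f x| ≤ M := by
  obtain ⟨M, hM⟩ := hf.bdd
  exact ⟨max M 1, by positivity, fun x => (hM x).trans (le_max_left _ _)⟩

lemma Nice.exists_pos_supp (hf : Nice f) : ∃ R, 0 < R ∧ ∀ x, R < ‖x‖ → f x = 0 := by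
  obtain ⟨R, hR⟩ := hf.supp
  exact ⟨max R 1, by positivity, fun x hx => hR x ((le_max_left _ _).trans_lt hx)⟩

lemma Nice.mul_bdd (hf : Nice f) (hg : Measurable g) (hb : ∃ M, ∀ x, |g x| ≤ M) :
    Nice (fun x => f x * g x) := by
  refine hf.of_supp (hf.meas.mul hg) ?_ fun x hx => by rw [hx, zero_mul]
  obtain ⟨M, hM0, hM⟩ := hf.exists_pos_bdd
  obtain ⟨M', hM'⟩ := hb
  refine ⟨M * M', fun x => ?_⟩
  rw [abs_mul]
  exact mul_le_mul (hM x) (hM' x) (abs_nonneg _) hM0.le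

lemma Nice.mul (hf : Nice f) (hg : Nice g) : Nice (fun x => f x * g x) :=
  hf.mul_bdd hg.meas hg.bdd

lemma Nice.const_mul (hf : Nice f) (c : ℝ) : Nice (fun x => c * f x) := by
  simpa only [mul_comm] using hf.mul_bdd (g := fun _ => c) measurable_const ⟨|c|, fun _ => le_rfl⟩

lemma Nice.add (hf : Nice f) (hg : Nice g) : Nice (fun x => f x + g x) := by
  refine ⟨hf.meas.add hg.meas, ?_, ?_⟩
  · obtain ⟨M, hM⟩ := hf.bdd
    obtain ⟨M', hM'⟩ := hg.bdd
    exact ⟨M + M', fun x => (abs_add_le _ _).trans (add_le_add (hM x) (hM' x))⟩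
  · obtain ⟨R, hR⟩ := hf.supp
    obtain ⟨R', hR'⟩ := hg.supp
    refine ⟨max R R', fun x hx => ?_⟩
    rw [max_lt_iff] at hx
    rw [hR x hx.1, hR' x hx.2, add_zero]

lemma Nice.neg (hf : Nice f) : Nice (fun x => -f x) := by
  simpa using hf.const_mul (-1)

lemma Nice.sub (hf : Nice f) (hg : Nice g) : Nice (fun x => f x - g x) := by
  simpa only [sub_eq_add_neg] using hf.add hg.neg

lemma nice_zero : Nice (fun _ : X => (0 : ℝ)) :=
  ⟨measurable_const, ⟨0, by simp⟩, ⟨0, by simp⟩⟩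

lemma nice_sum {ι : Type*} (s : Finset ι) {F : ι → X → ℝ} (h : ∀ i ∈ s, Nice (F i)) :
    Nice (fun x => ∑ i ∈ s, F i x) := by
  classical
  induction s using Finset.induction_on with
  | empty => simpa using nice_zero
  | insert a s ha ih =>
    simp only [Finset.sum_insert ha]
    exact (h a (Finset.mem_insert_self a s)).add
      (ih fun i hi => h i (Finset.mem_insert_of_mem hi))

lemma Nice.indicator (hf : Nice f) {S : Set X} (hS : MeasurableSet S) : Nice (S.indicator f) := by
  refine hf.of_supp (hf.meas.indicator hS) ?_ fun x hx => by
    by_cases h : x ∈ S <;> simp [h, hx]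
  obtain ⟨M, hM0, hM⟩ := hf.exists_pos_bdd
  refine ⟨M, fun x => ?_⟩
  by_cases h : x ∈ S <;> simp [h, hM x, hM0.le]

lemma Nice.abs (hf : Nice f) : Nice (fun x => |f x|) := by
  refine hf.of_supp (by have := hf.meas; fun_prop) ?_ fun x hx => by rw [hx, abs_zero]
  simpa using hf.bdd

lemma Nice.abs_rpow (hf : Nice f) {r : ℝ} (hr : 0 < r) : Nice (fun x => |f x| ^ r) := by
  refine hf.of_supp (by have := hf.meas; fun_prop) ?_ fun x hx => by
    rw [hx, abs_zero, Real.zero_rpow hr.ne']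
  obtain ⟨M, hM⟩ := hf.bdd
  refine ⟨M ^ r, fun x => ?_⟩
  rw [abs_of_nonneg (by positivity)]
  exact Real.rpow_le_rpow (abs_nonneg _) (hM x) hr.le

lemma Nice.sq (hf : Nice f) : Nice (fun x => f x ^ 2) := by
  simpa only [pow_two] using hf.mul hf

lemma Nice.comp_sub_right [MeasurableSub X] (hf : Nice f) (w : X) : Nice (fun x => f (x - w)) := by
  refine ⟨hf.meas.comp (measurable_sub_const w), hf.bdd.imp fun M hM x => hM _, ?_⟩
  obtain ⟨R, hR⟩ := hf.supp
  refine ⟨R + ‖w‖, fun x hx => hR _ ?_⟩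
  linarith [norm_sub_norm_le x w]

lemma Nice.integrable [BorelSpace X] [ProperSpace X] [SecondCountableTopology X]
    (hf : Nice f) {μ : Measure X} [IsFiniteMeasureOnCompacts μ] : Integrable f μ := by
  obtain ⟨R, hR⟩ := hf.supp
  obtain ⟨M, hM⟩ := hf.bdd
  have h1 : IntegrableOn f (Metric.closedBall 0 R) μ :=
    Measure.integrableOn_of_bounded (isCompact_closedBall 0 R).measure_lt_top.ne
      hf.meas.aestronglyMeasurable (ae_of_all _ hM)
  rw [integrableOn_iff_integrable_of_support_subset] at h1
  · exact h1
  · intro x hx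
    rw [mem_closedBall_zero_iff]
    by_contra hcon
    exact hx (hR x (not_le.mp hcon))

lemma Nice.integral_prod_right [BorelSpace Y] [ProperSpace Y] [SecondCountableTopology Y]
    {F : X × Y → ℝ} (hF : Nice F)
    {μ : Measure Y} [IsFiniteMeasureOnCompacts μ] [SFinite μ] :
    Nice (fun x => ∫ y, F (x, y) ∂μ) := by
  obtain ⟨R, hR⟩ := hF.supp
  obtain ⟨M, hM0, hM⟩ := hF.exists_pos_bdd
  refine ⟨(hF.meas.stronglyMeasurable.integral_prod_right').measurable, ?_, R, ?_⟩
  · refine ⟨M * μ.real (Metric.closedBall 0 R), fun x => ?_⟩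
    have hs : ∀ y, y ∉ Metric.closedBall (0 : Y) R → F (x, y) = 0 := by
      intro y hy
      rw [mem_closedBall_zero_iff, not_le] at hy
      exact hR _ (hy.trans_le (norm_snd_le (x, y)))
    rw [← setIntegral_eq_integral_of_forall_compl_eq_zero hs]
    exact norm_setIntegral_le_of_norm_le_const (f := fun y => F (x, y))
      (isCompact_closedBall 0 R).measure_lt_top fun y _ => hM (x, y)
  · intro x hx
    have : ∀ y, F (x, y) = 0 := fun y => hR _ (hx.trans_le (norm_fst_le (x, y)))
    simp [this]

end general

/-- The square of the `L²` norm. -/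
def N2 (f : ℝ × ℝ → ℝ) : ℝ := ∫ x, f x ^ 2

lemma N2_nonneg (f : ℝ × ℝ → ℝ) : 0 ≤ N2 f := integral_nonneg fun _ => sq_nonneg _

variable {f g : ℝ × ℝ → ℝ}

lemma N2_const_mul (c : ℝ) (f : ℝ × ℝ → ℝ) : N2 (fun x => c * f x) = c ^ 2 * N2 f := by
  simp only [N2, mul_pow, integral_const_mul]

lemma N2_comp_sub (f : ℝ × ℝ → ℝ) (w : ℝ × ℝ) : N2 (fun x => f (x - w)) = N2 f := by
  unfold N2; exact integral_sub_right_eq_self (fun x => f x ^ 2) w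

lemma N2_add (hf : Nice f) (hg : Nice g) :
    N2 (fun x => f x + g x) = N2 f + 2 * (∫ x, f x * g x) + N2 g := by
  unfold N2
  rw [← integral_const_mul, ← integral_add hf.sq.integrable ((hf.mul hg).const_mul 2).integrable,
    ← integral_add (hf.sq.add ((hf.mul hg).const_mul 2)).integrable hg.sq.integrable]
  congr 1; ext x; ring

lemma sq_integral_mul_le (hf : Nice f) (hg : Nice g) : (∫ x, f x * g x) ^ 2 ≤ N2 f * N2 g := by
  have h : ∀ s : ℝ, 0 ≤ N2 g * (s * s) + (2 * ∫ x, f x * g x) * s + N2 f := by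
    intro s
    have h1 := N2_nonneg (fun x => f x + s * g x)
    rw [N2_add hf (hg.const_mul s), N2_const_mul] at h1
    have h2 : ∫ x, f x * (s * g x) = s * ∫ x, f x * g x := by
      rw [← integral_const_mul]; congr 1; ext x; ring
    rw [h2] at h1
    linarith
  have := discrim_le_zero h
  unfold discrim at this
  nlinarith

lemma abs_integral_mul_le (hf : Nice f) (hg : Nice g) :
    |∫ x, f x * g x| ≤ √(N2 f) * √(N2 g) := by
  rw [← Real.sqrt_mul (N2_nonneg f), ← Real.sqrt_sq_eq_abs]
  exact Real.sqrt_le_sqrt (sq_integral_mul_le hf hg)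

lemma sqrt_N2_add_le (hf : Nice f) (hg : Nice g) :
    √(N2 (fun x => f x + g x)) ≤ √(N2 f) + √(N2 g) := by
  rw [Real.sqrt_le_left (by positivity), N2_add hf hg]
  have h := (le_abs_self _).trans (abs_integral_mul_le hf hg)
  nlinarith [Real.sq_sqrt (N2_nonneg f), Real.sq_sqrt (N2_nonneg g)]

lemma le_sq_of_le_mul_sqrt {a Z : ℝ} (ha : 0 ≤ a) (h : a ≤ Z * √a) : a ≤ Z ^ 2 := by
  rcases ha.eq_or_lt with h0 | h0
  · rw [← h0]; positivity
  · have hs := Real.sqrt_pos.mpr h0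
    have h2 := Real.sq_sqrt ha
    have : √a ≤ Z := by
      by_contra hcon
      nlinarith
    nlinarith

/-! ### Averaging operators along parabolas -/

/-- The parabola `e (t, t²)`. -/
def sh (e t : ℝ) : ℝ × ℝ := (e * t, e * t ^ 2)

@[fun_prop]
lemma continuous_sh (e : ℝ) : Continuous (sh e) := by unfold sh; fun_prop

@[fun_prop]
lemma measurable_sh (e : ℝ) : Measurable (sh e) := (continuous_sh e).measurable

lemma sh_neg (e t : ℝ) : sh (-e) t = -sh e t := by simp [sh]

/-- The operator `f ↦ ∫ k(t) f(x - e (t, t²)) dt`. -/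
def Top (k : ℝ → ℝ) (e : ℝ) (f : ℝ × ℝ → ℝ) (x : ℝ × ℝ) : ℝ := ∫ t, k t * f (x - sh e t)

lemma nice_Top_integrand {k : ℝ → ℝ} (hk : Nice k) (e : ℝ) (hf : Nice f) :
    Nice (fun p : (ℝ × ℝ) × ℝ => k p.2 * f (p.1 - sh e p.2)) := by
  obtain ⟨M, hM0, hM⟩ := hf.exists_pos_bdd
  obtain ⟨R, hR0, hR⟩ := hf.exists_pos_supp
  obtain ⟨M', hM0', hM'⟩ := hk.exists_pos_bdd
  obtain ⟨R', hR0', hR'⟩ := hk.exists_pos_supp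
  have hfm := hf.meas
  have hkm := hk.meas
  refine ⟨by fun_prop, ⟨M' * M, fun p => ?_⟩, R' + R + |e| * (R' + R' ^ 2), fun p hp => ?_⟩
  · rw [abs_mul]; exact mul_le_mul (hM' _) (hM _) (abs_nonneg _) hM0'.le
  · by_cases h : R' < ‖p.2‖
    · rw [hR' _ h, zero_mul]
    · rw [not_lt] at h
      have h1 : ‖p.1‖ > R + |e| * (R' + R' ^ 2) := by
        rcases (lt_max_iff (a := R' + R + |e| * (R' + R' ^ 2))).mp hp with h2 | h2
        · linarith
        · exfalso
          have : 0 ≤ |e| * (R' + R' ^ 2) := by positivity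
          linarith
      have h2 : ‖sh e p.2‖ ≤ |e| * (R' + R' ^ 2) := by
        rw [Real.norm_eq_abs] at h
        have h3 : |p.2| ^ 2 ≤ R' ^ 2 := by gcongr
        rw [sh, Prod.norm_def, max_le_iff, Real.norm_eq_abs, Real.norm_eq_abs, abs_mul, abs_mul,
          abs_pow]
        constructor <;> gcongr
        · nlinarith
        · linarith
      rw [hR _ (by linarith [norm_sub_norm_le p.1 (sh e p.2)]), mul_zero]

lemma nice_Top {k : ℝ → ℝ} (hk : Nice k) (e : ℝ) (hf : Nice f) : Nice (Top k e f) :=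
  (nice_Top_integrand hk e hf).integral_prod_right

/-- Fubini for pairings of averages. -/
lemma integral_avg_mul {F : (ℝ × ℝ) × ℝ → ℝ} (hF : Nice F) (hg : Nice g) :
    ∫ x, (∫ t, F (x, t)) * g x = ∫ t, ∫ x, F (x, t) * g x := by
  have h : Nice (fun p : (ℝ × ℝ) × ℝ => F p * g p.1) :=
    hF.mul_bdd (by have := hg.meas; fun_prop) (hg.bdd.imp fun M hM p => hM _)
  rw [← integral_integral_swap (by exact h.integrable)]
  simp_rw [integral_mul_const]

lemma Top_adjoint {k : ℝ → ℝ} (hk : Nice k) (e : ℝ) (hf : Nice f) (hg : Nice g) :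
    ∫ x, Top k e f x * g x = ∫ x, f x * Top k (-e) g x := by
  have h1 := integral_avg_mul (nice_Top_integrand hk e hf) hg
  have h2 := integral_avg_mul (nice_Top_integrand hk (-e) hg) hf
  simp only [Top]
  rw [h1]
  simp_rw [mul_comm (f _)]
  rw [h2]
  congr 1; ext t
  rw [← integral_add_right_eq_self _ (sh e t)]
  congr 1; ext x
  simp only [add_sub_cancel_right, sh_neg, sub_neg_eq_add]; ring

/-- Minkowski's integral inequality for averages. -/
lemma N2_avg_le {k : ℝ → ℝ} (hk : Nice k) {V : (ℝ × ℝ) × ℝ → ℝ} (hV : ∀ t, Nice fun x => V (x, t))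
    (hkV : Nice (fun p => k p.2 * V p)) {Z : ℝ} (hZ : ∀ t, k t ≠ 0 → N2 (fun x => V (x, t)) ≤ Z) :
    N2 (fun x => ∫ t, k t * V (x, t)) ≤ (∫ t, |k t|) ^ 2 * Z := by
  set W := fun x => ∫ t, k t * V (x, t) with hW
  have hWn : Nice W := hkV.integral_prod_right
  by_cases hk0 : ∀ t, k t = 0
  · simp [hW, hk0, N2]
  push Not at hk0
  obtain ⟨t₀, ht₀⟩ := hk0
  have hZ0 : 0 ≤ Z := (N2_nonneg _).trans (hZ t₀ ht₀)
  have h1 : N2 W = ∫ t, ∫ x, k t * V (x, t) * W x := by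
    rw [← integral_avg_mul hkV hWn]; simp only [N2, pow_two]; rfl
  have h2 : N2 W ≤ (∫ t, |k t|) * √Z * √(N2 W) := by
    calc N2 W ≤ ∫ t, |k t| * (√Z * √(N2 W)) := by
          refine h1.trans_le ?_
          have hi : Integrable (fun p : (ℝ × ℝ) × ℝ => k p.2 * V p * W p.1) :=
            (hkV.mul_bdd (by have := hWn.meas; fun_prop)
              (hWn.bdd.imp fun M hM p => hM _)).integrable
          refine integral_mono hi.integral_prod_right (hk.abs.integrable.mul_const _) fun t => ?_
          change ∫ x, k t * V (x, t) * W x ≤ |k t| * (√Z * √(N2 W))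
          by_cases ht : k t = 0
          · simp [ht]
          · have h3 := abs_integral_mul_le (hV t) hWn
            have h4 : √(N2 fun x => V (x, t)) ≤ √Z := Real.sqrt_le_sqrt (hZ t ht)
            simp only [mul_assoc, integral_const_mul]
            calc k t * ∫ x, V (x, t) * W x ≤ |k t| * |∫ x, V (x, t) * W x| := by
                  rw [← abs_mul]; exact le_abs_self _
              _ ≤ |k t| * (√Z * √(N2 W)) := by
                  gcongr; exact h3.trans (by gcongr)
      _ = _ := by rw [integral_mul_const, mul_assoc]
  have := le_sq_of_le_mul_sqrt (N2_nonneg W) h2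
  rwa [mul_pow, Real.sq_sqrt hZ0] at this

lemma N2_Top_le {k : ℝ → ℝ} (hk : Nice k) (e : ℝ) (hf : Nice f) :
    N2 (Top k e f) ≤ (∫ t, |k t|) ^ 2 * N2 f :=
  N2_avg_le hk (V := fun p => f (p.1 - sh e p.2)) (fun t => hf.comp_sub_right (sh e t))
    (nice_Top_integrand hk e hf) fun t _ => (N2_comp_sub f (sh e t)).le

lemma Top_add {k : ℝ → ℝ} (hk : Nice k) (e : ℝ) (hf : Nice f) (hg : Nice g) (x : ℝ × ℝ) :
    Top k e (fun x => f x + g x) x = Top k e f x + Top k e g x := by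
  have h : ∀ {f : ℝ × ℝ → ℝ}, Nice f → Integrable (fun t => k t * f (x - sh e t)) := by
    intro f hf
    have hfm := hf.meas
    exact (hk.mul_bdd (by fun_prop) (hf.bdd.imp fun M hM t => hM _)).integrable
  unfold Top
  rw [← integral_add (h hf) (h hg)]
  congr 1; ext t; ring

lemma Top_const_mul (k : ℝ → ℝ) (e c : ℝ) (f : ℝ × ℝ → ℝ) (x : ℝ × ℝ) :
    Top k e (fun x => c * f x) x = c * Top k e f x := by
  unfold Top
  rw [← integral_const_mul]
  congr 1; ext t; ring

lemma Top_sub {k : ℝ → ℝ} (hk : Nice k) (e : ℝ) (hf : Nice f) (hg : Nice g) (x : ℝ × ℝ) :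
    Top k e (fun x => f x - g x) x = Top k e f x - Top k e g x := by
  have := Top_add hk e hf (hg.const_mul (-1)) x
  rw [Top_const_mul] at this
  simpa [sub_eq_add_neg] using this

lemma Top_sum {ι : Type*} (s : Finset ι) {k : ℝ → ℝ} (hk : Nice k) (e : ℝ) {F : ι → ℝ × ℝ → ℝ}
    (hF : ∀ i ∈ s, Nice (F i)) (x : ℝ × ℝ) :
    Top k e (fun x => ∑ i ∈ s, F i x) x = ∑ i ∈ s, Top k e (F i) x := by
  classical
  induction s using Finset.induction_on with
  | empty => simp [Top]
  | insert a s ha ih =>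
    simp only [Finset.sum_insert ha]
    rw [Top_add hk e (hF a (Finset.mem_insert_self a s))
      (nice_sum s fun i hi => hF i (Finset.mem_insert_of_mem hi)),
      ih fun i hi => hF i (Finset.mem_insert_of_mem hi)]

lemma abs_Top_le (k : ℝ → ℝ) (e : ℝ) (f : ℝ × ℝ → ℝ) (x : ℝ × ℝ) :
    |Top k e f x| ≤ Top (fun t => |k t|) e (fun x => |f x|) x := by
  unfold Top
  refine (abs_integral_le_integral_abs).trans (le_of_eq ?_)
  simp only [abs_mul]

end

section

/-! ### Conditional expectations on dyadic cubes -/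

variable {f g : ℝ × ℝ → ℝ}

/-- The average of `f` over the dyadic cube of scale `k` containing `x`. -/
def EE (k : ℤ) (f : ℝ × ℝ → ℝ) (x : ℝ × ℝ) : ℝ := (8 ^ k)⁻¹ * ∫ y in cube k (idx k x), f y

/-- The complementary projection `f - EE k f`. -/
def DD (k : ℤ) (f : ℝ × ℝ → ℝ) (x : ℝ × ℝ) : ℝ := f x - EE k f x

lemma volume_real_cube (k : ℤ) (n : ℤ × ℤ) : volume.real (cube k n) = 8 ^ k := by
  rw [Measure.real, volume_cube, ENNReal.toReal_ofReal (by positivity)]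

lemma volume_real_tri (k : ℤ) (n : ℤ × ℤ) : volume.real (tri k n) = 9 * 8 ^ k := by
  rw [Measure.real, volume_tri, ENNReal.toReal_mul, ENNReal.toReal_ofReal (by positivity)]; simp

lemma volume_cube_ne_top (k : ℤ) (n : ℤ × ℤ) : volume (cube k n) ≠ ⊤ := by
  rw [volume_cube]; exact ENNReal.ofReal_ne_top

lemma volume_tri_ne_top (k : ℤ) (n : ℤ × ℤ) : volume (tri k n) ≠ ⊤ := by
  rw [volume_tri]; exact ENNReal.mul_ne_top (by simp) ENNReal.ofReal_ne_top

lemma EE_of_idx_eq {k : ℤ} (f : ℝ × ℝ → ℝ) {x y : ℝ × ℝ} (h : idx k x = idx k y) :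
    EE k f x = EE k f y := by simp only [EE, h]

lemma EE_of_mem {k : ℤ} (f : ℝ × ℝ → ℝ) {n : ℤ × ℤ} {x : ℝ × ℝ} (h : x ∈ cube k n) :
    EE k f x = (8 ^ k)⁻¹ * ∫ y in cube k n, f y := by rw [EE, mem_cube.mp h]

lemma measurable_EE (k : ℤ) (f : ℝ × ℝ → ℝ) : Measurable (EE k f) :=
  (Measurable.of_discrete (f := fun n : ℤ × ℤ => (8 ^ k : ℝ)⁻¹ * ∫ y in cube k n, f y)).comp
    (measurable_idx k)

lemma abs_EE_le_of_bdd {k : ℤ} {x : ℝ × ℝ} {M : ℝ} (h : ∀ y ∈ cube k (idx k x), |f y| ≤ M) :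
    |EE k f x| ≤ M := by
  have h1 : ‖∫ y in cube k (idx k x), f y‖ ≤ M * volume.real (cube k (idx k x)) :=
    norm_setIntegral_le_of_norm_le_const (volume_cube_ne_top k _).lt_top h
  rw [volume_real_cube, Real.norm_eq_abs] at h1
  rw [EE, abs_mul, abs_of_pos (by positivity)]
  have h8 : (0 : ℝ) < 8 ^ k := by positivity
  rw [inv_mul_le_iff₀ h8]; linarith

lemma nice_EE (k : ℤ) (hf : Nice f) : Nice (EE k f) := by
  refine ⟨measurable_EE k f, hf.bdd.imp fun M hM x => abs_EE_le_of_bdd fun y _ => hM y, ?_⟩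
  obtain ⟨R, hR⟩ := hf.supp
  refine ⟨R + 2 ^ k + 4 ^ k, fun x hx => ?_⟩
  have : |EE k f x| ≤ 0 := by
    refine abs_EE_le_of_bdd fun y hy => ?_
    obtain ⟨h1, h2⟩ := close_of_idx_eq (mem_cube.mp hy)
    rw [hR y, abs_zero]
    have h3 : ‖y - x‖ ≤ 2 ^ k + 4 ^ k := by
      have : (0 : ℝ) < 2 ^ k := by positivity
      have : (0 : ℝ) < 4 ^ k := by positivity
      rw [Prod.norm_def, max_le_iff, Real.norm_eq_abs, Real.norm_eq_abs, Prod.fst_sub, Prod.snd_sub]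
      constructor <;> linarith
    have h4 := norm_sub_norm_le x y
    rw [norm_sub_rev] at h4
    linarith
  exact abs_eq_zero.mp (le_antisymm this (abs_nonneg _))

lemma nice_DD (k : ℤ) (hf : Nice f) : Nice (DD k f) := hf.sub (nice_EE k hf)

lemma setIntegral_EE (k : ℤ) (f : ℝ × ℝ → ℝ) (n : ℤ × ℤ) :
    ∫ x in cube k n, EE k f x = ∫ x in cube k n, f x := by
  rw [setIntegral_congr_fun (g := fun _ => (8 ^ k)⁻¹ * ∫ y in cube k n, f y) (measurableSet_cube k n)
    fun x hx => EE_of_mem f hx, setIntegral_const, volume_real_cube, smul_eq_mul]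
  have h8 : (0 : ℝ) < 8 ^ k := by positivity
  field_simp

lemma setIntegral_eq_of_cube {k : ℤ} {S : Set (ℝ × ℝ)} (hS : DMeas k S)
    {φ ψ : ℝ × ℝ → ℝ} (hφ : Integrable φ) (hψ : Integrable ψ)
    (h : ∀ n, cube k n ⊆ S → ∫ x in cube k n, φ x = ∫ x in cube k n, ψ x) :
    ∫ x in S, φ x = ∫ x in S, ψ x := by
  have := abs_setIntegral_le_of_cube (φ := fun x => φ x - ψ x) (ψ := fun _ => 0) hS (hφ.sub hψ)
    (integrable_zero _ _ _) (fun n hn => by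
      rw [integral_sub hφ.integrableOn hψ.integrableOn, h n hn, sub_self]; simp)
  rw [integral_sub hφ.integrableOn hψ.integrableOn] at this
  simp only [integral_zero] at this
  exact sub_eq_zero.mp (abs_eq_zero.mp (le_antisymm this (abs_nonneg _)))

lemma dMeas_univ (k : ℤ) : DMeas k univ := fun _ _ _ _ => mem_univ _

lemma integral_eq_of_cube (k : ℤ) {φ ψ : ℝ × ℝ → ℝ} (hφ : Integrable φ) (hψ : Integrable ψ)
    (h : ∀ n, ∫ x in cube k n, φ x = ∫ x in cube k n, ψ x) :
    ∫ x, φ x = ∫ x, ψ x := by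
  simpa using setIntegral_eq_of_cube (dMeas_univ k) hφ hψ fun n _ => h n

lemma EE_comp_of_le {k l : ℤ} (h : k ≤ l) (f : ℝ × ℝ → ℝ) : EE k (EE l f) = EE l f := by
  ext x
  rw [EE, setIntegral_congr_fun (g := fun _ => EE l f x) (measurableSet_cube k _) fun y hy => ?_,
    setIntegral_const, volume_real_cube, smul_eq_mul, inv_mul_cancel_left₀ (by positivity)]
  exact EE_of_idx_eq f (idx_eq_mono h (mem_cube.mp hy))

lemma EE_comp_of_ge {k l : ℤ} (h : k ≤ l) (hf : Nice f) : EE l (EE k f) = EE l f := by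
  ext x
  rw [EE, EE, setIntegral_eq_of_cube (dMeas_cube h _) (nice_EE k hf).integrable hf.integrable
    fun n _ => setIntegral_EE k f n]

lemma EE_add (k : ℤ) (hf : Nice f) (hg : Nice g) (x : ℝ × ℝ) :
    EE k (fun x => f x + g x) x = EE k f x + EE k g x := by
  simp only [EE]
  rw [integral_add hf.integrable.integrableOn hg.integrable.integrableOn, mul_add]

lemma EE_sub (k : ℤ) (hf : Nice f) (hg : Nice g) (x : ℝ × ℝ) :
    EE k (fun x => f x - g x) x = EE k f x - EE k g x := by
  simp only [EE]
  rw [integral_sub hf.integrable.integrableOn hg.integrable.integrableOn, mul_sub]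

lemma DD_add (k : ℤ) (hf : Nice f) (hg : Nice g) (x : ℝ × ℝ) :
    DD k (fun x => f x + g x) x = DD k f x + DD k g x := by
  simp only [DD, EE_add k hf hg]; ring

lemma abs_EE_le (k : ℤ) (f : ℝ × ℝ → ℝ) (x : ℝ × ℝ) :
    |EE k f x| ≤ EE k (fun x => |f x|) x := by
  rw [EE, abs_mul, abs_of_pos (a := ((8 : ℝ) ^ k)⁻¹) (by positivity), EE]
  gcongr
  exact abs_integral_le_integral_abs

lemma EE_indicator {k : ℤ} {S : Set (ℝ × ℝ)} (hS : DMeas k S) (f : ℝ × ℝ → ℝ) :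
    EE k (S.indicator f) = S.indicator (EE k f) := by
  ext x
  by_cases hx : x ∈ S
  · rw [indicator_of_mem hx, EE, EE]
    congr 1
    refine setIntegral_congr_fun (measurableSet_cube k _) fun y hy => ?_
    exact indicator_of_mem (hS x y (mem_cube.mp hy).symm hx) f
  · rw [indicator_of_notMem hx, EE, setIntegral_congr_fun (g := fun _ => 0)
      (measurableSet_cube k _) fun y hy => ?_]
    · simp
    · exact indicator_of_notMem (fun hy' => hx (hS y x (mem_cube.mp hy) hy')) f

lemma DD_indicator {k : ℤ} {S : Set (ℝ × ℝ)} (hS : DMeas k S) (f : ℝ × ℝ → ℝ) :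
    DD k (S.indicator f) = S.indicator (DD k f) := by
  ext x
  simp only [DD, EE_indicator hS]
  by_cases hx : x ∈ S <;> simp [hx, DD]

lemma integral_EE_mul (k : ℤ) (hf : Nice f) (hg : Nice g) :
    ∫ x, EE k f x * g x = ∫ x, EE k f x * EE k g x := by
  refine integral_eq_of_cube k ((nice_EE k hf).mul hg).integrable
    ((nice_EE k hf).mul (nice_EE k hg)).integrable fun n => ?_
  rw [setIntegral_congr_fun (g := fun x => ((8 ^ k)⁻¹ * ∫ y in cube k n, f y) * g x)
      (measurableSet_cube k n) fun x hx => by simp only [EE_of_mem f hx],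
    setIntegral_congr_fun (f := fun x => EE k f x * EE k g x)
      (g := fun x => ((8 ^ k)⁻¹ * ∫ y in cube k n, f y) * EE k g x)
      (measurableSet_cube k n) fun x hx => by simp only [EE_of_mem f hx],
    integral_const_mul, integral_const_mul, setIntegral_EE]

lemma EE_adjoint (k : ℤ) (hf : Nice f) (hg : Nice g) :
    ∫ x, EE k f x * g x = ∫ x, f x * EE k g x := by
  rw [integral_EE_mul k hf hg]
  simp_rw [mul_comm (f _), mul_comm (EE k f _)]
  rw [integral_EE_mul k hg hf]

lemma integral_EE (k : ℤ) (hf : Nice f) : ∫ x, EE k f x = ∫ x, f x :=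
  integral_eq_of_cube k (nice_EE k hf).integrable hf.integrable fun n => setIntegral_EE k f n

lemma DD_adjoint (k : ℤ) (hf : Nice f) (hg : Nice g) :
    ∫ x, DD k f x * g x = ∫ x, f x * DD k g x := by
  simp only [DD, sub_mul, mul_sub]
  rw [integral_sub (hf.mul hg).integrable ((nice_EE k hf).mul hg).integrable,
    integral_sub (hf.mul hg).integrable (hf.mul (nice_EE k hg)).integrable, EE_adjoint k hf hg]

lemma N2_EE (k : ℤ) (hf : Nice f) : N2 (EE k f) = ∫ x, EE k f x * f x := by
  rw [integral_EE_mul k hf hf]; simp only [N2, pow_two]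

lemma N2_DD (k : ℤ) (hf : Nice f) : N2 (DD k f) = N2 f - N2 (EE k f) := by
  have h1 := N2_EE k hf
  have h2 := N2_add hf (nice_EE k hf).neg
  have h3 : N2 (fun x => -EE k f x) = N2 (EE k f) := by simp [N2]
  have h4 : ∫ x, f x * -EE k f x = - N2 (EE k f) := by
    rw [h1, ← integral_neg]; congr 1; ext x; ring
  rw [h3, h4] at h2
  have h5 : N2 (DD k f) = N2 (fun x => f x + -EE k f x) := by
    congr 1
  rw [h5, h2]; ring

lemma N2_EE_le (k : ℤ) (hf : Nice f) : N2 (EE k f) ≤ N2 f := by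
  linarith [N2_DD k hf, N2_nonneg (DD k f)]

lemma N2_DD_le (k : ℤ) (hf : Nice f) : N2 (DD k f) ≤ N2 f := by
  linarith [N2_DD k hf, N2_nonneg (EE k f)]

/-- Jensen's inequality for dyadic averages. -/
lemma abs_EE_rpow_le (k : ℤ) (hf : Nice f) {r : ℝ} (hr : 1 ≤ r) (x : ℝ × ℝ) :
    |EE k f x| ^ r ≤ EE k (fun x => |f x| ^ r) x := by
  have hr0 : 0 < r := by linarith
  have h8 : (0 : ℝ) < 8 ^ k := by positivity
  have hav : ∀ h : ℝ × ℝ → ℝ, EE k h x = ⨍ y in cube k (idx k x), h y := by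
    intro h
    rw [setAverage_eq, volume_real_cube, smul_eq_mul, EE]
  refine (Real.rpow_le_rpow (abs_nonneg _) (abs_EE_le k f x) hr0.le).trans ?_
  rw [hav, hav]
  exact (convexOn_rpow hr).map_set_average_le
    (Real.continuous_rpow_const hr0.le).continuousOn isClosed_Ici
    (by rw [volume_cube]; exact eight_pos k) (volume_cube_ne_top k _)
    (ae_of_all _ fun y => abs_nonneg (f y)) hf.abs.integrable.integrableOn
    (hf.abs_rpow hr0).integrable.integrableOn

lemma integral_abs_EE_rpow_le (k : ℤ) (hf : Nice f) {r : ℝ} (hr : 1 ≤ r) :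
    ∫ x, |EE k f x| ^ r ≤ ∫ x, |f x| ^ r := by
  have hr0 : 0 < r := by linarith
  rw [← integral_EE k (hf.abs_rpow hr0)]
  exact integral_mono ((nice_EE k hf).abs_rpow hr0).integrable
    (nice_EE k (hf.abs_rpow hr0)).integrable (abs_EE_rpow_le k hf hr)

end

/-! ### Affine changes of variables -/

lemma lintegral_comp_affine {h : ℝ → ENNReal} (hh : Measurable h) {a : ℝ} (ha : a ≠ 0) (c : ℝ) :
    ∫⁻ v, h (a * v + c) = ENNReal.ofReal |a⁻¹| * ∫⁻ v, h v := by
  have h1 : ∫⁻ v, h (a * v + c) = ∫⁻ v, h (v + c) ∂(Measure.map (fun x => a * x) volume) := by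
    rw [lintegral_map (by fun_prop) (by fun_prop)]
  rw [h1, Real.map_volume_mul_left ha, lintegral_smul_measure, lintegral_add_right_eq_self h c,
    smul_eq_mul]

/-- Recovers `(t, s)` from `(t - s, t² - s²)`. -/
def diffInv (z : ℝ × ℝ) : ℝ × ℝ := ((z.2 / z.1 + z.1) / 2, (z.2 / z.1 - z.1) / 2)

@[fun_prop]
lemma measurable_diffInv : Measurable diffInv := by unfold diffInv; fun_prop

lemma diffInv_sub (z : ℝ × ℝ) : (diffInv z).1 - (diffInv z).2 = z.1 := by
  simp only [diffInv]; ring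

lemma diffInv_sq_sub {z : ℝ × ℝ} (hz : z.1 ≠ 0) :
    (diffInv z).1 ^ 2 - (diffInv z).2 ^ 2 = z.2 := by
  simp only [diffInv]; field_simp; ring

lemma lintegral_diffInv {h : ℝ × ℝ → ENNReal} (hh : Measurable h) :
    ∫⁻ z, ENNReal.ofReal (1 / (2 * |z.1|)) * h (diffInv z) = ∫⁻ p, h p := by
  rw [Measure.volume_eq_prod, lintegral_prod _ (by fun_prop)]
  have h0 : ∀ᵐ u : ℝ, u ≠ 0 := Measure.ae_ne volume 0
  have h1 : ∀ᵐ u : ℝ, ∫⁻ v, ENNReal.ofReal (1 / (2 * |u|)) * h (diffInv (u, v)) =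
      ∫⁻ s, h (s + u, s) := by
    filter_upwards [h0] with u hu
    rw [lintegral_const_mul _ (by fun_prop)]
    have := lintegral_comp_affine (h := fun s => h (s + u, s)) (by fun_prop)
      (a := (2 * u)⁻¹) (by simp [hu]) (-u / 2)
    have h2 : ∀ v, h (diffInv (u, v)) = h ((2 * u)⁻¹ * v + -u / 2 + u, (2 * u)⁻¹ * v + -u / 2) := by
      intro v
      simp only [diffInv]
      congr 2 <;> field_simp <;> ring
    simp only [h2]
    rw [this, ← mul_assoc, ← ENNReal.ofReal_mul (by positivity)]
    have h3 : 1 / (2 * |u|) * |(2 * u)⁻¹⁻¹| = 1 := by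
      rw [inv_inv, abs_mul, abs_two]
      have := abs_pos.mpr hu
      field_simp
    rw [h3]; simp
  rw [lintegral_congr_ae h1, lintegral_lintegral_swap (by fun_prop), lintegral_prod_symm _ (by fun_prop)]
  congr 1; ext s
  have := lintegral_add_left_eq_self (fun t => h (t, s)) s (μ := volume)
  exact this

lemma map_diffInv : Measure.map diffInv
    (volume.withDensity fun z : ℝ × ℝ => ENNReal.ofReal (1 / (2 * |z.1|))) = volume := by
  ext S hS
  rw [← lintegral_indicator_one hS, lintegral_map (measurable_one.indicator hS) (by fun_prop),
    lintegral_withDensity_eq_lintegral_mul _ (by fun_prop)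
      (g := fun a => S.indicator 1 (diffInv a)) ((measurable_one.indicator hS).comp measurable_diffInv),
    ← lintegral_indicator_one hS, ← lintegral_diffInv (measurable_one.indicator hS)]
  rfl

lemma integral_diffInv {F : ℝ × ℝ → ℝ} (hF : Measurable F) :
    ∫ p, F p = ∫ z, 1 / (2 * |z.1|) * F (diffInv z) := by
  conv_lhs => rw [← map_diffInv]
  rw [integral_map (by fun_prop) (by fun_prop), integral_withDensity_eq_integral_toReal_smul
    (by fun_prop) (ae_of_all _ fun z => ENNReal.ofReal_lt_top)]
  congr 1; ext z
  rw [ENNReal.toReal_ofReal (by positivity), smul_eq_mul]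

/-- Parabolic dilation. -/
def dil (a : ℝ) (x : ℝ × ℝ) : ℝ × ℝ := (a * x.1, a ^ 2 * x.2)

@[fun_prop]
lemma measurable_dil (a : ℝ) : Measurable (dil a) := by unfold dil; fun_prop

lemma lintegral_dil {h : ℝ × ℝ → ENNReal} (hh : Measurable h) {a : ℝ} (ha : 0 < a) :
    ∫⁻ x, h (dil a x) = ENNReal.ofReal ((a ^ 3)⁻¹) * ∫⁻ x, h x := by
  rw [Measure.volume_eq_prod, lintegral_prod _ (by fun_prop), lintegral_prod _ (by fun_prop)]
  have h1 : ∀ u : ℝ, ∫⁻ v, h (dil a (u, v)) =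
      ENNReal.ofReal |(a ^ 2)⁻¹| * ∫⁻ v, h (a * u, v) := by
    intro u
    have := lintegral_comp_affine (h := fun v => h (a * u, v)) (by fun_prop)
      (a := a ^ 2) (by positivity) 0
    simpa [dil] using this
  simp only [h1]
  rw [lintegral_const_mul _ (by fun_prop)]
  have h2 := lintegral_comp_affine (h := fun u => ∫⁻ v, h (u, v)) (by fun_prop) ha.ne' 0
  simp only [add_zero] at h2
  rw [h2, ← mul_assoc, ← ENNReal.ofReal_mul (by positivity)]
  congr 2
  rw [abs_of_pos (by positivity), abs_of_pos (by positivity)]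
  field_simp

lemma map_dil {a : ℝ} (ha : 0 < a) :
    Measure.map (dil a) volume = ENNReal.ofReal ((a ^ 3)⁻¹) • volume := by
  ext S hS
  rw [← lintegral_indicator_one hS, lintegral_map (measurable_one.indicator hS) (by fun_prop),
    lintegral_dil (measurable_one.indicator hS) ha, lintegral_indicator_one hS]
  rfl

lemma integral_dil {F : ℝ × ℝ → ℝ} (hF : Measurable F) {a : ℝ} (ha : 0 < a) :
    ∫ x, F (dil a x) = (a ^ 3)⁻¹ * ∫ x, F x := by
  rw [← integral_map (φ := dil a) (by fun_prop) (by fun_prop), map_dil ha, integral_smul_measure,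
    ENNReal.toReal_ofReal (by positivity), smul_eq_mul]

lemma dil_sub (a : ℝ) (x y : ℝ × ℝ) : dil a (x - y) = dil a x - dil a y := by
  simp only [dil, Prod.fst_sub, Prod.snd_sub, Prod.mk_sub_mk]; ext <;> ring

lemma dil_sh (a e t : ℝ) : dil a (sh e t) = sh e (a * t) := by
  simp only [dil, sh]; ext <;> ring

lemma dil_dil_inv {a : ℝ} (ha : a ≠ 0) (x : ℝ × ℝ) : dil a (dil a⁻¹ x) = x := by
  simp only [dil]; ext <;> simp <;> field_simp

lemma Nice.comp_dil {f : ℝ × ℝ → ℝ} (hf : Nice f) {a : ℝ} (ha : 0 < a) :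
    Nice (fun x => f (dil a x)) := by
  refine ⟨hf.meas.comp (measurable_dil a), hf.bdd.imp fun M hM x => hM _, ?_⟩
  obtain ⟨R, hR0, hR⟩ := hf.exists_pos_supp
  refine ⟨R / a + R / a ^ 2, fun x hx => hR _ ?_⟩
  rw [Prod.norm_def, lt_max_iff] at hx ⊢
  simp only [dil, Real.norm_eq_abs, abs_mul, abs_of_pos ha, abs_of_pos (pow_pos ha 2)] at hx ⊢
  have h1 : 0 < R / a := by positivity
  have h2 : 0 < R / a ^ 2 := by positivity
  rcases hx with hx | hx
  · left
    have : R / a < |x.1| := by linarith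
    rw [div_lt_iff₀ ha] at this; linarith
  · right
    have : R / a ^ 2 < |x.2| := by linarith
    rw [div_lt_iff₀ (by positivity)] at this; linarith

lemma N2_dil {f : ℝ × ℝ → ℝ} (hf : Measurable f) {a : ℝ} (ha : 0 < a) :
    N2 (fun x => f (dil a x)) = (a ^ 3)⁻¹ * N2 f := by
  unfold N2; exact integral_dil (F := fun x => f x ^ 2) (by fun_prop) ha

/-! ### Truncated kernels -/

/-- The kernel `1/t` restricted to `2^a ≤ |t| < 2^b`. -/
def kap (a b : ℤ) (t : ℝ) : ℝ := if (2 : ℝ) ^ a ≤ |t| ∧ |t| < 2 ^ b then 1 / t else 0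

@[fun_prop]
lemma measurable_kap (a b : ℤ) : Measurable (kap a b) := by
  unfold kap
  refine Measurable.ite ?_ (by fun_prop) (by fun_prop)
  exact (measurableSet_le measurable_const measurable_norm).inter
    (measurableSet_lt measurable_norm measurable_const)

lemma abs_kap_le (a b : ℤ) (t : ℝ) : |kap a b t| ≤ 2 ^ (-a) := by
  unfold kap
  split_ifs with h
  · rw [abs_div, abs_one, zpow_neg, one_div]
    exact inv_anti₀ (by positivity) h.1
  · simp; positivity

lemma kap_eq_zero {a b : ℤ} {t : ℝ} (h : |t| < 2 ^ a ∨ 2 ^ b ≤ |t|) : kap a b t = 0 := by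
  unfold kap
  rw [if_neg]
  rintro ⟨h1, h2⟩
  rcases h with h | h <;> linarith

lemma abs_lt_of_kap_ne_zero {a b : ℤ} {t : ℝ} (h : kap a b t ≠ 0) : |t| < 2 ^ b := by
  by_contra h'
  exact h (kap_eq_zero (Or.inr (not_lt.mp h')))

lemma nice_kap (a b : ℤ) : Nice (kap a b) :=
  ⟨measurable_kap a b, ⟨_, abs_kap_le a b⟩, ⟨2 ^ b, fun _ ht => kap_eq_zero (Or.inr ht.le)⟩⟩

lemma kap_neg (a b : ℤ) (t : ℝ) : kap a b (-t) = -kap a b t := by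
  unfold kap; rw [abs_neg]; split_ifs <;> simp [div_neg]

lemma kap_add {a b c : ℤ} (h1 : a ≤ b) (h2 : b ≤ c) (t : ℝ) :
    kap a c t = kap a b t + kap b c t := by
  have h3 : (2 : ℝ) ^ a ≤ 2 ^ b := zpow_le_zpow_right₀ (by norm_num) h1
  have h4 : (2 : ℝ) ^ b ≤ 2 ^ c := zpow_le_zpow_right₀ (by norm_num) h2
  unfold kap
  by_cases hb : |t| < 2 ^ b
  · rw [if_neg (c := (2 : ℝ) ^ b ≤ |t| ∧ |t| < 2 ^ c) (by rintro ⟨h, -⟩; linarith), add_zero]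
    simp [hb, hb.trans_le h4]
  · rw [if_neg (c := (2 : ℝ) ^ a ≤ |t| ∧ |t| < 2 ^ b) (by rintro ⟨-, h⟩; exact hb h), zero_add]
    push Not at hb
    simp [hb, h3.trans hb]

lemma kap_self (a : ℤ) (t : ℝ) : kap a a t = 0 := by
  unfold kap; rw [if_neg]; rintro ⟨h1, h2⟩; linarith

lemma kap_scale (j : ℤ) (t : ℝ) : (2 : ℝ) ^ j * kap j (j + 1) (2 ^ j * t) = kap 0 1 t := by
  have hp : (0 : ℝ) < 2 ^ j := by positivity
  have h1 : (2 : ℝ) ^ j ≤ |2 ^ j * t| ↔ (2 : ℝ) ^ (0 : ℤ) ≤ |t| := by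
    rw [abs_mul, abs_of_pos hp, zpow_zero]; exact le_mul_iff_one_le_right hp
  have h2 : |2 ^ j * t| < (2 : ℝ) ^ (j + 1) ↔ |t| < (2 : ℝ) ^ (1 : ℤ) := by
    rw [abs_mul, abs_of_pos hp, zpow_add₀ (by norm_num)]
    exact mul_lt_mul_iff_right₀ hp
  unfold kap
  simp only [h1, h2]
  split_ifs with h
  · by_cases ht : t = 0
    · simp [ht]
    · field_simp
  · simp

lemma integral_abs_kap_zero_le : ∫ t, |kap 0 1 t| ≤ 4 := by
  have h : ∀ t, |kap 0 1 t| ≤ (Icc (-2 : ℝ) 2).indicator (fun _ => (1 : ℝ)) t := by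
    intro t
    by_cases ht : t ∈ Icc (-2 : ℝ) 2
    · rw [indicator_of_mem ht]; simpa using abs_kap_le 0 1 t
    · rw [indicator_of_notMem ht, kap_eq_zero, abs_zero]
      right
      by_contra h'
      push Not at h'
      rw [zpow_one, abs_lt] at h'
      exact ht ⟨h'.1.le, h'.2.le⟩
  refine (integral_mono (nice_kap 0 1).abs.integrable ?_ h).trans ?_
  · exact (integrable_indicator_iff measurableSet_Icc).mpr (by simp)
  · rw [integral_indicator measurableSet_Icc]; simp; norm_num

lemma integral_abs_kap_le (j : ℤ) : ∫ t, |kap j (j + 1) t| ≤ 4 := by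
  have hp : (0 : ℝ) < 2 ^ j := by positivity
  have h := Measure.integral_comp_mul_left (fun t => |kap j (j + 1) t|) ((2 : ℝ) ^ j)
  rw [abs_of_pos (by positivity), smul_eq_mul] at h
  refine le_trans (le_of_eq ?_) integral_abs_kap_zero_le
  have h2 : ∀ t, |kap 0 1 t| = 2 ^ j * |kap j (j + 1) (2 ^ j * t)| := by
    intro t; rw [← kap_scale j t, abs_mul, abs_of_pos hp]
  simp only [h2]
  rw [integral_const_mul, h]; field_simp

/-- The single-scale operator. -/
def TT (j : ℤ) (e : ℝ) (f : ℝ × ℝ → ℝ) : ℝ × ℝ → ℝ := Top (kap j (j + 1)) e f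

lemma nice_TT (j : ℤ) (e : ℝ) {f : ℝ × ℝ → ℝ} (hf : Nice f) : Nice (TT j e f) :=
  nice_Top (nice_kap _ _) e hf

lemma N2_TT_le (j : ℤ) (e : ℝ) {f : ℝ × ℝ → ℝ} (hf : Nice f) : N2 (TT j e f) ≤ 16 * N2 f := by
  refine (N2_Top_le (nice_kap _ _) e hf).trans ?_
  have h1 := integral_abs_kap_le j
  have h2 : 0 ≤ ∫ t, |kap j (j + 1) t| := integral_nonneg fun _ => abs_nonneg _
  have := N2_nonneg f
  gcongr
  nlinarith

lemma TT_dil (j : ℤ) (e : ℝ) (f : ℝ × ℝ → ℝ) (x : ℝ × ℝ) :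
    TT j e f (dil (2 ^ j) x) = TT 0 e (fun y => f (dil (2 ^ j) y)) x := by
  have hp : (0 : ℝ) < 2 ^ j := by positivity
  unfold TT Top
  have h := Measure.integral_comp_mul_left
    (fun t => kap j (j + 1) t * f (dil (2 ^ j) x - sh e t)) ((2 : ℝ) ^ j)
  rw [abs_of_pos (by positivity), smul_eq_mul] at h
  have h2 : ∀ t, kap 0 (0 + 1) t * f (dil (2 ^ j) (x - sh e t)) =
      2 ^ j * (kap j (j + 1) (2 ^ j * t) * f (dil (2 ^ j) x - sh e (2 ^ j * t))) := by
    intro t; rw [zero_add, ← kap_scale j t, dil_sub, dil_sh]; ring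
  simp only [h2]
  rw [integral_const_mul, h]; field_simp

/-! ### Smoothing of a single-scale operator -/

/-- The density of the autocorrelation of the unit-scale kernel. -/
def Phi (z : ℝ × ℝ) : ℝ := 1 / (2 * |z.1|) * (kap 0 1 (diffInv z).1 * kap 0 1 (diffInv z).2)

@[fun_prop]
lemma measurable_Phi : Measurable Phi := by unfold Phi; fun_prop

lemma abs_kap_zero_le (t : ℝ) : |kap 0 1 t| ≤ 1 := by simpa using abs_kap_le 0 1 t

lemma abs_lt_of_kap_zero_ne {t : ℝ} (h : kap 0 1 t ≠ 0) : |t| < 2 := by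
  simpa using abs_lt_of_kap_ne_zero h

/-- The points within `3d` of the discontinuities of the unit-scale kernel. -/
def edgeSet (d : ℝ) : Set ℝ := {t | |(|t| - 1)| ≤ 3 * d ∨ |(|t| - 2)| ≤ 3 * d}

lemma measurableSet_edgeSet (d : ℝ) : MeasurableSet (edgeSet d) := by
  have h1 : Measurable fun t : ℝ => |(|t| - 1)| := (continuous_abs.sub continuous_const).abs.measurable
  have h2 : Measurable fun t : ℝ => |(|t| - 2)| := (continuous_abs.sub continuous_const).abs.measurable
  exact (measurableSet_le h1 measurable_const).union (measurableSet_le h2 measurable_const)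

lemma volume_edgeSet_le {d : ℝ} (hd : 0 ≤ d) : volume (edgeSet d) ≤ ENNReal.ofReal (24 * d) := by
  have hsub : edgeSet d ⊆ (Icc (1 - 3 * d) (1 + 3 * d) ∪ Icc (-1 - 3 * d) (-1 + 3 * d)) ∪
      (Icc (2 - 3 * d) (2 + 3 * d) ∪ Icc (-2 - 3 * d) (-2 + 3 * d)) := by
    rintro t (h | h)
    · left
      rw [abs_le] at h
      rcases abs_cases t with ⟨h1, -⟩ | ⟨h1, -⟩
      · left; constructor <;> linarith
      · right; constructor <;> linarith
    · right
      rw [abs_le] at h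
      rcases abs_cases t with ⟨h1, -⟩ | ⟨h1, -⟩
      · left; constructor <;> linarith
      · right; constructor <;> linarith
  refine (measure_mono hsub).trans ?_
  refine (measure_union_le _ _).trans ((add_le_add (measure_union_le _ _)
    (measure_union_le _ _)).trans (le_of_eq ?_))
  simp only [Real.volume_Icc]
  rw [← ENNReal.ofReal_add (by linarith) (by linarith), ← ENNReal.ofReal_add (by linarith) (by linarith),
    ← ENNReal.ofReal_add (by linarith) (by linarith)]
  congr 1; ring

lemma abs_kap_sub_le {d t p : ℝ} (hd : 0 ≤ d) (h : |p - t| ≤ 3 * d) :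
    |kap 0 1 t - kap 0 1 p| ≤ 3 * d + (edgeSet d).indicator 1 t := by
  have hi : 0 ≤ (edgeSet d).indicator (1 : ℝ → ℝ) t := indicator_nonneg (by simp) t
  have hpt : |(|p| - |t|)| ≤ 3 * d := (abs_abs_sub_abs_le _ _).trans h
  rw [abs_le] at hpt
  by_cases h1 : (2 : ℝ) ^ (0 : ℤ) ≤ |t| ∧ |t| < 2 ^ (1 : ℤ)
  · by_cases h2 : (2 : ℝ) ^ (0 : ℤ) ≤ |p| ∧ |p| < 2 ^ (1 : ℤ)
    · have e1 : kap 0 1 t = 1 / t := if_pos h1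
      have e2 : kap 0 1 p = 1 / p := if_pos h2
      rw [zpow_zero] at h1 h2
      have ht : t ≠ 0 := by rintro rfl; simp at h1; linarith
      have hp : p ≠ 0 := by rintro rfl; simp at h2; linarith
      have : |kap 0 1 t - kap 0 1 p| ≤ |p - t| := by
        rw [e1, e2, div_sub_div _ _ ht hp, abs_div, one_mul, mul_one]
        refine div_le_self (abs_nonneg _) ?_
        rw [abs_mul]
        nlinarith [h1.1, h2.1]
      linarith
    · have e2 : kap 0 1 p = 0 := if_neg h2
      have hmem : t ∈ edgeSet d := by
        rw [zpow_zero, zpow_one] at h1 h2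
        rcases lt_or_ge |p| 1 with hp | hp
        · left; rw [abs_le]; constructor <;> linarith
        · right
          have : 2 ≤ |p| := by by_contra h'; exact h2 ⟨hp, not_le.mp h'⟩
          rw [abs_le]; constructor <;> linarith
      rw [e2, sub_zero, indicator_of_mem hmem]
      have := abs_kap_zero_le t
      simp only [Pi.one_apply]; linarith
  · have e1 : kap 0 1 t = 0 := if_neg h1
    by_cases h2 : (2 : ℝ) ^ (0 : ℤ) ≤ |p| ∧ |p| < 2 ^ (1 : ℤ)
    · have hmem : t ∈ edgeSet d := by
        rw [zpow_zero, zpow_one] at h1 h2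
        rcases lt_or_ge |t| 1 with hp | hp
        · left; rw [abs_le]; constructor <;> linarith
        · right
          have : 2 ≤ |t| := by by_contra h'; exact h1 ⟨hp, not_le.mp h'⟩
          rw [abs_le]; constructor <;> linarith
      rw [e1, zero_sub, abs_neg, indicator_of_mem hmem]
      have := abs_kap_zero_le p
      simp only [Pi.one_apply]; linarith
    · have e2 : kap 0 1 p = 0 := if_neg h2
      rw [e1, e2]; simp; linarith

lemma diffInv_close {d : ℝ} (hd : 0 < d) (hd1 : d ≤ 1) {z w : ℝ × ℝ} (hw1 : |w.1| ≤ d ^ 2)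
    (hw2 : |w.2| ≤ d ^ 2) (hz : 2 * d < |z.1|)
    (hne : |z.2 / z.1| ≤ 4 ∨ |(z - w).2 / (z - w).1| ≤ 4) :
    |(diffInv (z - w)).1 - (diffInv z).1| ≤ 3 * d ∧ |(diffInv (z - w)).2 - (diffInv z).2| ≤ 3 * d := by
  have hz0 : z.1 ≠ 0 := by intro h; rw [h, abs_zero] at hz; linarith
  have hdd : d ^ 2 ≤ d := by nlinarith
  have hu' : d ≤ |z.1 - w.1| := by
    have := abs_sub_abs_le_abs_sub z.1 w.1; linarith
  have hz0' : z.1 - w.1 ≠ 0 := by intro h; rw [h, abs_zero] at hu'; linarith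
  simp only [Prod.fst_sub, Prod.snd_sub] at hne
  have key : |(z.2 - w.2) / (z.1 - w.1) - z.2 / z.1| ≤ 5 * d := by
    rcases hne with h | h
    · have : (z.2 - w.2) / (z.1 - w.1) - z.2 / z.1 = (z.2 / z.1 * w.1 - w.2) / (z.1 - w.1) := by
        field_simp; ring
      rw [this, abs_div, div_le_iff₀ (by positivity)]
      calc |z.2 / z.1 * w.1 - w.2| ≤ |z.2 / z.1| * |w.1| + |w.2| := by
            rw [← abs_mul]; exact abs_sub _ _
        _ ≤ 4 * d ^ 2 + d ^ 2 := by gcongr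
        _ ≤ 5 * d * |z.1 - w.1| := by nlinarith
    · have : (z.2 - w.2) / (z.1 - w.1) - z.2 / z.1 =
          ((z.2 - w.2) / (z.1 - w.1) * w.1 - w.2) / z.1 := by
        field_simp; ring
      rw [this, abs_div, div_le_iff₀ (by positivity)]
      calc |(z.2 - w.2) / (z.1 - w.1) * w.1 - w.2|
          ≤ |(z.2 - w.2) / (z.1 - w.1)| * |w.1| + |w.2| := by
            rw [← abs_mul]; exact abs_sub _ _
        _ ≤ 4 * d ^ 2 + d ^ 2 := by gcongr
        _ ≤ 5 * d * |z.1| := by nlinarith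
  simp only [diffInv, Prod.fst_sub, Prod.snd_sub]
  rw [abs_le] at key hw1
  constructor <;> rw [abs_le] <;> constructor <;> linarith

/-- Majorant of the difference of autocorrelations away from the singularity. -/
def farMaj (d : ℝ) (p : ℝ × ℝ) : ℝ :=
  (Icc (-5 : ℝ) 5 ×ˢ Icc (-5 : ℝ) 5).indicator (fun _ => 7 * d) p +
    ((edgeSet d ×ˢ Icc (-5 : ℝ) 5).indicator (fun _ => 1) p +
    (Icc (-5 : ℝ) 5 ×ˢ edgeSet d).indicator (fun _ => 1) p)

/-- Majorant of the autocorrelation near the singularity. -/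
def nearMaj (d : ℝ) (p : ℝ × ℝ) : ℝ :=
  {p : ℝ × ℝ | |p.1 - p.2| ≤ 3 * d ∧ |p.2| ≤ 2}.indicator (fun _ => 1) p

lemma measurableSet_nearMaj (d : ℝ) :
    MeasurableSet {p : ℝ × ℝ | |p.1 - p.2| ≤ 3 * d ∧ |p.2| ≤ 2} := by
  have h1 : Measurable fun p : ℝ × ℝ => |p.1 - p.2| := (continuous_fst.sub continuous_snd).abs.measurable
  have h2 : Measurable fun p : ℝ × ℝ => |p.2| := continuous_snd.abs.measurable
  exact (measurableSet_le h1 measurable_const).inter (measurableSet_le h2 measurable_const)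

@[fun_prop]
lemma measurable_nearMaj (d : ℝ) : Measurable (nearMaj d) :=
  measurable_const.indicator (measurableSet_nearMaj d)

@[fun_prop]
lemma measurable_farMaj (d : ℝ) : Measurable (farMaj d) :=
  (measurable_const.indicator (measurableSet_Icc.prod measurableSet_Icc)).add
    ((measurable_const.indicator ((measurableSet_edgeSet d).prod measurableSet_Icc)).add
    (measurable_const.indicator (measurableSet_Icc.prod (measurableSet_edgeSet d))))

lemma nearMaj_nonneg (d : ℝ) (p : ℝ × ℝ) : 0 ≤ nearMaj d p := indicator_nonneg (by simp) p

lemma farMaj_nonneg {d : ℝ} (hd : 0 ≤ d) (p : ℝ × ℝ) : 0 ≤ farMaj d p :=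
  add_nonneg (indicator_nonneg (fun _ _ => by positivity) p)
    (add_nonneg (indicator_nonneg (by simp) p) (indicator_nonneg (by simp) p))

lemma abs_Phi_sub_le {d : ℝ} (hd : 0 < d) (hd1 : d ≤ 1) {w : ℝ × ℝ} (hw1 : |w.1| ≤ d ^ 2)
    (hw2 : |w.2| ≤ d ^ 2) (z : ℝ × ℝ) :
    |Phi z - Phi (z - w)| ≤ 1 / (2 * |z.1|) * nearMaj d (diffInv z) +
      1 / (2 * |(z - w).1|) * nearMaj d (diffInv (z - w)) +
      1 / (2 * |z.1|) * farMaj d (diffInv z) := by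
  have hnn : ∀ z : ℝ × ℝ, 0 ≤ 1 / (2 * |z.1|) := fun z => by positivity
  have hdd : d ^ 2 ≤ d := by nlinarith
  have hkk : ∀ t s : ℝ, |kap 0 1 t * kap 0 1 s| ≤ 1 := fun t s => by
    rw [abs_mul]
    exact mul_le_one₀ (abs_kap_zero_le t) (abs_nonneg _) (abs_kap_zero_le s)
  rcases le_or_gt |z.1| (2 * d) with hz | hz
  · have hz' : |(z - w).1| ≤ 3 * d := by
      rw [Prod.fst_sub]; have := abs_sub z.1 w.1; linarith
    have key : ∀ z : ℝ × ℝ, |z.1| ≤ 3 * d →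
        |Phi z| ≤ 1 / (2 * |z.1|) * nearMaj d (diffInv z) := by
      intro z hz
      rw [Phi, abs_mul, abs_of_nonneg (hnn z)]
      refine mul_le_mul_of_nonneg_left ?_ (hnn z)
      by_cases hk : kap 0 1 (diffInv z).2 = 0
      · rw [hk, mul_zero, abs_zero]; exact nearMaj_nonneg _ _
      · rw [nearMaj, indicator_of_mem]
        · exact hkk _ _
        · refine ⟨?_, (abs_lt_of_kap_zero_ne hk).le⟩
          rw [diffInv_sub]; exact hz
    have h1 := key z (by linarith)
    have h2 := key (z - w) hz'
    have h3 := mul_nonneg (hnn z) (farMaj_nonneg hd.le (diffInv z))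
    have h4 := abs_sub (Phi z) (Phi (z - w))
    linarith
  · have hz0 : 0 < |z.1| := by linarith
    have hu' : d ≤ |(z - w).1| := by
      rw [Prod.fst_sub]
      have := abs_sub_abs_le_abs_sub z.1 w.1; linarith
    have hu'0 : 0 < |(z - w).1| := by linarith
    suffices h : |Phi z - Phi (z - w)| ≤ 1 / (2 * |z.1|) * farMaj d (diffInv z) by
      have h1 := mul_nonneg (hnn z) (nearMaj_nonneg d (diffInv z))
      have h2 := mul_nonneg (hnn (z - w)) (nearMaj_nonneg d (diffInv (z - w)))
      linarith
    set t := (diffInv z).1 with ht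
    set s := (diffInv z).2 with hs
    set t' := (diffInv (z - w)).1 with ht'
    set s' := (diffInv (z - w)).2 with hs'
    by_cases hall : kap 0 1 t * kap 0 1 s = 0 ∧ kap 0 1 t' * kap 0 1 s' = 0
    · rw [Phi, Phi, ← ht, ← hs, ← ht', ← hs', hall.1, hall.2]
      simp only [mul_zero, sub_zero, abs_zero]
      exact mul_nonneg (hnn z) (farMaj_nonneg hd.le _)
    have hts : ∀ z : ℝ × ℝ, z.2 / z.1 = (diffInv z).1 + (diffInv z).2 := fun z => by
      simp only [diffInv]; ring
    have hbd : (|t| < 2 ∧ |s| < 2) ∨ (|t'| < 2 ∧ |s'| < 2) := by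
      by_contra hcon
      apply hall
      constructor
      · by_contra h0
        exact hcon (Or.inl ⟨abs_lt_of_kap_zero_ne (left_ne_zero_of_mul h0),
          abs_lt_of_kap_zero_ne (right_ne_zero_of_mul h0)⟩)
      · by_contra h0
        exact hcon (Or.inr ⟨abs_lt_of_kap_zero_ne (left_ne_zero_of_mul h0),
          abs_lt_of_kap_zero_ne (right_ne_zero_of_mul h0)⟩)
    have hclose := diffInv_close hd hd1 hw1 hw2 hz (hbd.imp
      (fun h => by
        rw [hts z]
        have := abs_add_le t s; linarith [h.1, h.2])
      (fun h => by
        rw [hts (z - w)]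
        have := abs_add_le t' s'; linarith [h.1, h.2]))
    rw [← ht, ← hs, ← ht', ← hs'] at hclose
    have ht5 : t ∈ Icc (-5 : ℝ) 5 := by
      have h1 := hclose.1
      rw [abs_le] at h1
      rcases hbd with h | h
      · have := abs_lt.mp h.1; constructor <;> linarith
      · have := abs_lt.mp h.1; constructor <;> linarith
    have hs5 : s ∈ Icc (-5 : ℝ) 5 := by
      have h1 := hclose.2
      rw [abs_le] at h1
      rcases hbd with h | h
      · have := abs_lt.mp h.2; constructor <;> linarith
      · have := abs_lt.mp h.2; constructor <;> linarith
    have hk1 := abs_kap_sub_le hd.le hclose.1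
    have hk2 := abs_kap_sub_le hd.le hclose.2
    have hfar : farMaj d (diffInv z) = 7 * d + ((edgeSet d).indicator 1 t + (edgeSet d).indicator 1 s) := by
      have hz : diffInv z = (t, s) := rfl
      rw [farMaj, hz, indicator_of_mem (by exact ⟨ht5, hs5⟩)]
      congr 2
      · by_cases h : t ∈ edgeSet d
        · rw [indicator_of_mem h, indicator_of_mem (by exact ⟨h, hs5⟩)]; rfl
        · rw [indicator_of_notMem h, indicator_of_notMem (by exact fun h' => h h'.1)]
      · by_cases h : s ∈ edgeSet d
        · rw [indicator_of_mem h, indicator_of_mem (by exact ⟨ht5, h⟩)]; rfl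
        · rw [indicator_of_notMem h, indicator_of_notMem (by exact fun h' => h h'.2)]
    have hsplit : Phi z - Phi (z - w) = 1 / (2 * |z.1|) *
        ((kap 0 1 t - kap 0 1 t') * kap 0 1 s + kap 0 1 t' * (kap 0 1 s - kap 0 1 s') +
          kap 0 1 t' * kap 0 1 s' * ((|(z - w).1| - |z.1|) / |(z - w).1|)) := by
      rw [Phi, Phi, ← ht, ← hs, ← ht', ← hs']
      field_simp
      ring
    rw [hsplit, abs_mul, abs_of_nonneg (hnn z), hfar]
    refine mul_le_mul_of_nonneg_left ?_ (hnn z)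
    have b1 : |(kap 0 1 t - kap 0 1 t') * kap 0 1 s| ≤ 3 * d + (edgeSet d).indicator 1 t := by
      rw [abs_mul]
      exact (mul_le_of_le_one_right (abs_nonneg _) (abs_kap_zero_le s)).trans hk1
    have b2 : |kap 0 1 t' * (kap 0 1 s - kap 0 1 s')| ≤ 3 * d + (edgeSet d).indicator 1 s := by
      rw [abs_mul]
      exact (mul_le_of_le_one_left (abs_nonneg _) (abs_kap_zero_le t')).trans hk2
    have b3 : |kap 0 1 t' * kap 0 1 s' * ((|(z - w).1| - |z.1|) / |(z - w).1|)| ≤ d := by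
      rw [abs_mul]
      refine (mul_le_of_le_one_left (abs_nonneg _) (hkk _ _)).trans ?_
      rw [abs_div, abs_abs, div_le_iff₀ hu'0]
      refine (abs_abs_sub_abs_le _ _).trans ?_
      have : (z - w).1 - z.1 = -w.1 := by rw [Prod.fst_sub]; ring
      rw [this, abs_neg]
      nlinarith
    have h1 := abs_add_le ((kap 0 1 t - kap 0 1 t') * kap 0 1 s + kap 0 1 t' * (kap 0 1 s - kap 0 1 s'))
      (kap 0 1 t' * kap 0 1 s' * ((|(z - w).1| - |z.1|) / |(z - w).1|))
    have h2 := abs_add_le ((kap 0 1 t - kap 0 1 t') * kap 0 1 s)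
      (kap 0 1 t' * (kap 0 1 s - kap 0 1 s'))
    linarith

lemma lintegral_nearMaj_le (d : ℝ) :
    ∫⁻ p, ENNReal.ofReal (nearMaj d p) ≤ ENNReal.ofReal (24 * d) := by
  rw [Measure.volume_eq_prod, lintegral_prod_symm _ (by fun_prop)]
  have h : ∀ s t, ENNReal.ofReal (nearMaj d (t, s)) ≤
      (Icc (-2 : ℝ) 2).indicator 1 s * (Icc (s - 3 * d) (s + 3 * d)).indicator 1 t := by
    intro s t
    by_cases hm : |t - s| ≤ 3 * d ∧ |s| ≤ 2
    · have h1 := abs_le.mp hm.1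
      have h2 := abs_le.mp hm.2
      rw [nearMaj, indicator_of_mem (by exact hm), indicator_of_mem (by exact h2),
        indicator_of_mem (by constructor <;> linarith)]
      simp
    · rw [nearMaj, indicator_of_notMem (by exact hm)]; simp
  refine (lintegral_mono fun s => lintegral_mono fun t => h s t).trans ?_
  have h2 : ∀ s : ℝ, ∫⁻ t, (Icc (-2 : ℝ) 2).indicator 1 s *
      (Icc (s - 3 * d) (s + 3 * d)).indicator (1 : ℝ → ENNReal) t =
      (Icc (-2 : ℝ) 2).indicator 1 s * ENNReal.ofReal (6 * d) := by
    intro s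
    rw [lintegral_const_mul _ (measurable_one.indicator measurableSet_Icc),
      lintegral_indicator_one measurableSet_Icc, Real.volume_Icc]
    congr 2; ring
  simp only [h2]
  rw [lintegral_mul_const _ (measurable_one.indicator measurableSet_Icc),
    lintegral_indicator_one measurableSet_Icc, Real.volume_Icc, ← ENNReal.ofReal_mul (by norm_num)]
  apply le_of_eq; congr 1; ring

lemma lintegral_farMaj_le {d : ℝ} (hd : 0 ≤ d) :
    ∫⁻ p, ENNReal.ofReal (farMaj d p) ≤ ENNReal.ofReal (1180 * d) := by
  have hind : ∀ (S : Set (ℝ × ℝ)) (c : ℝ) (p : ℝ × ℝ), ENNReal.ofReal (S.indicator (fun _ => c) p) =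
      S.indicator (fun _ => ENNReal.ofReal c) p := by
    intro S c p; by_cases h : p ∈ S <;> simp [h]
  have h1 : ∀ p, ENNReal.ofReal (farMaj d p) =
      (Icc (-5 : ℝ) 5 ×ˢ Icc (-5 : ℝ) 5).indicator (fun _ => ENNReal.ofReal (7 * d)) p +
    ((edgeSet d ×ˢ Icc (-5 : ℝ) 5).indicator (fun _ => ENNReal.ofReal 1) p +
    (Icc (-5 : ℝ) 5 ×ˢ edgeSet d).indicator (fun _ => ENNReal.ofReal 1) p) := by
    intro p
    rw [farMaj, ENNReal.ofReal_add (indicator_nonneg (fun _ _ => by positivity) p)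
      (add_nonneg (indicator_nonneg (by simp) p) (indicator_nonneg (by simp) p)),
      ENNReal.ofReal_add (indicator_nonneg (by simp) p) (indicator_nonneg (by simp) p),
      hind, hind, hind]
  have hm1 : MeasurableSet (Icc (-5 : ℝ) 5 ×ˢ Icc (-5 : ℝ) 5) := measurableSet_Icc.prod measurableSet_Icc
  have hm2 := (measurableSet_edgeSet d).prod (measurableSet_Icc (a := (-5 : ℝ)) (b := 5))
  have hm3 := (measurableSet_Icc (a := (-5 : ℝ)) (b := 5)).prod (measurableSet_edgeSet d)
  simp only [h1]
  rw [lintegral_add_left (measurable_const.indicator hm1),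
    lintegral_add_left (measurable_const.indicator hm2), lintegral_indicator_const hm1,
    lintegral_indicator_const hm2, lintegral_indicator_const hm3, Measure.volume_eq_prod,
    Measure.prod_prod, Measure.prod_prod, Measure.prod_prod, Real.volume_Icc]
  have he := volume_edgeSet_le hd
  calc _ ≤ ENNReal.ofReal (7 * d) * (ENNReal.ofReal (5 - -5) * ENNReal.ofReal (5 - -5)) +
        (ENNReal.ofReal 1 * (ENNReal.ofReal (24 * d) * ENNReal.ofReal (5 - -5)) +
        ENNReal.ofReal 1 * (ENNReal.ofReal (5 - -5) * ENNReal.ofReal (24 * d))) := by gcongr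
    _ = _ := by
      simp only [← ENNReal.ofReal_mul (show (0 : ℝ) ≤ 5 - -5 by norm_num),
        ← ENNReal.ofReal_mul (show (0 : ℝ) ≤ 24 * d by positivity),
        ← ENNReal.ofReal_mul (show (0 : ℝ) ≤ 7 * d by positivity),
        ← ENNReal.ofReal_mul (show (0 : ℝ) ≤ 1 by norm_num)]
      rw [← ENNReal.ofReal_add (by positivity) (by positivity),
        ← ENNReal.ofReal_add (by positivity) (by positivity)]
      congr 1; ring

lemma lintegral_Phi_sub_le {d : ℝ} (hd : 0 < d) (hd1 : d ≤ 1) {w : ℝ × ℝ} (hw1 : |w.1| ≤ d ^ 2)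
    (hw2 : |w.2| ≤ d ^ 2) :
    ∫⁻ z, ENNReal.ofReal |Phi z - Phi (z - w)| ≤ ENNReal.ofReal (1300 * d) := by
  have hnn : ∀ z : ℝ × ℝ, 0 ≤ 1 / (2 * |z.1|) := fun z => by positivity
  have h1 : ∀ z, ENNReal.ofReal |Phi z - Phi (z - w)| ≤
      ENNReal.ofReal (1 / (2 * |z.1|)) * ENNReal.ofReal (nearMaj d (diffInv z)) +
      ENNReal.ofReal (1 / (2 * |(z - w).1|)) * ENNReal.ofReal (nearMaj d (diffInv (z - w))) +
      ENNReal.ofReal (1 / (2 * |z.1|)) * ENNReal.ofReal (farMaj d (diffInv z)) := by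
    intro z
    rw [← ENNReal.ofReal_mul (hnn _), ← ENNReal.ofReal_mul (hnn _), ← ENNReal.ofReal_mul (hnn _),
      ← ENNReal.ofReal_add (mul_nonneg (hnn _) (nearMaj_nonneg _ _))
        (mul_nonneg (hnn _) (nearMaj_nonneg _ _)),
      ← ENNReal.ofReal_add (add_nonneg (mul_nonneg (hnn _) (nearMaj_nonneg _ _))
        (mul_nonneg (hnn _) (nearMaj_nonneg _ _))) (mul_nonneg (hnn _) (farMaj_nonneg hd.le _))]
    exact ENNReal.ofReal_le_ofReal (abs_Phi_sub_le hd hd1 hw1 hw2 z)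
  have hshift := lintegral_sub_right_eq_self (μ := (volume : Measure (ℝ × ℝ)))
    (fun z => ENNReal.ofReal (1 / (2 * |z.1|)) * ENNReal.ofReal (nearMaj d (diffInv z))) w
  have hN := lintegral_diffInv (h := fun p => ENNReal.ofReal (nearMaj d p)) (by fun_prop)
  have hF := lintegral_diffInv (h := fun p => ENNReal.ofReal (farMaj d p)) (by fun_prop)
  refine (lintegral_mono h1).trans ?_
  rw [lintegral_add_left (by fun_prop), lintegral_add_left (by fun_prop), hshift, hN, hF]
  calc _ ≤ ENNReal.ofReal (24 * d) + ENNReal.ofReal (24 * d) + ENNReal.ofReal (1180 * d) := by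
        gcongr
        · exact lintegral_nearMaj_le d
        · exact lintegral_nearMaj_le d
        · exact lintegral_farMaj_le hd.le
    _ ≤ _ := by
        rw [← ENNReal.ofReal_add (by positivity) (by positivity),
          ← ENNReal.ofReal_add (by positivity) (by positivity)]
        apply ENNReal.ofReal_le_ofReal; linarith

/-- Autocorrelation. -/
def corr (u : ℝ × ℝ → ℝ) (y : ℝ × ℝ) : ℝ := ∫ x, u (x - y) * u x

lemma measurable_corr {u : ℝ × ℝ → ℝ} (hu : Nice u) : Measurable (corr u) := by
  have h := hu.meas
  have h2 : Measurable (fun p : (ℝ × ℝ) × (ℝ × ℝ) => u (p.2 - p.1) * u p.2) := by fun_prop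
  exact (h2.stronglyMeasurable.integral_prod_right (ν := volume)).measurable

lemma abs_corr_le {u : ℝ × ℝ → ℝ} (hu : Nice u) (y : ℝ × ℝ) : |corr u y| ≤ N2 u := by
  refine (abs_integral_mul_le (hu.comp_sub_right y) hu).trans ?_
  rw [N2_comp_sub, Real.mul_self_sqrt (N2_nonneg u)]

lemma Top_comp_sub (k : ℝ → ℝ) (e : ℝ) (u : ℝ × ℝ → ℝ) (w x : ℝ × ℝ) :
    Top k e (fun y => u (y - w)) x = Top k e u (x - w) := by
  unfold Top; congr 1; ext t; rw [sub_right_comm]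

lemma Nice.prod_mul {X Y : Type*} [NormedAddCommGroup X] [NormedAddCommGroup Y] [MeasurableSpace X]
    [MeasurableSpace Y] {f : X → ℝ} {g : Y → ℝ} (hf : Nice f) (hg : Nice g) :
    Nice (fun p : X × Y => f p.1 * g p.2) := by
  obtain ⟨M, hM0, hM⟩ := hf.exists_pos_bdd
  obtain ⟨R, hR0, hR⟩ := hf.exists_pos_supp
  obtain ⟨M', hM0', hM'⟩ := hg.exists_pos_bdd
  obtain ⟨R', hR0', hR'⟩ := hg.exists_pos_supp
  have h1 := hf.meas
  have h2 := hg.meas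
  refine ⟨by fun_prop, ⟨M * M', fun p => ?_⟩, ⟨R + R', fun p hp => ?_⟩⟩
  · rw [abs_mul]
    exact mul_le_mul (hM _) (hM' _) (abs_nonneg _) hM0.le
  · rw [Prod.norm_def, lt_max_iff] at hp
    rcases hp with hp | hp
    · rw [hR _ (by linarith), zero_mul]
    · rw [hR' _ (by linarith), mul_zero]

lemma integral_TT_mul_TT {u : ℝ × ℝ → ℝ} (hu : Nice u) (e : ℝ) (w : ℝ × ℝ) :
    ∫ x, TT 0 e u (x - w) * TT 0 e u x = ∫ z, Phi z * corr u (w + e • z) := by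
  set k := kap 0 1 with hk
  have hkn : Nice k := nice_kap 0 1
  have hv : Nice (TT 0 e u) := nice_TT 0 e hu
  have hcm := measurable_corr hu
  have h1 : ∀ x, TT 0 e u (x - w) = ∫ t, k t * u (x - sh e t - w) := by
    intro x
    have := Top_comp_sub k e u w x
    exact this.symm
  simp only [h1]
  have hF := nice_Top_integrand hkn e (hu.comp_sub_right w)
  rw [integral_avg_mul hF hv]
  have h2 : ∀ t, ∫ x, k t * u (x - sh e t - w) * TT 0 e u x =
      ∫ s, k t * k s * corr u (w + (sh e t - sh e s)) := by
    intro t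
    have h3 : ∀ x, k t * u (x - sh e t - w) * TT 0 e u x =
        k t * ((∫ s, k s * u (x - sh e s)) * u (x - sh e t - w)) := by
      intro x
      have : TT 0 e u x = ∫ s, k s * u (x - sh e s) := rfl
      rw [this]; ring
    simp only [h3]
    have hu' : Nice (fun x => u (x - sh e t - w)) :=
      (hu.comp_sub_right w).comp_sub_right (sh e t)
    rw [integral_const_mul, integral_avg_mul (nice_Top_integrand hkn e hu) hu', ← integral_const_mul]
    congr 1; ext s
    simp only [mul_assoc]
    rw [integral_const_mul]
    congr 2
    unfold corr
    rw [← integral_sub_right_eq_self (fun x => u (x - (w + (sh e t - sh e s))) * u x) (sh e s)]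
    congr 1; ext x
    rw [mul_comm]
    congr 2
    abel
  simp only [h2]
  have hi : Nice (fun p : ℝ × ℝ => k p.1 * k p.2 * corr u (w + (sh e p.1 - sh e p.2))) :=
    (hkn.prod_mul hkn).mul_bdd (by fun_prop) ⟨_, fun p => abs_corr_le hu _⟩
  rw [← integral_prod _ hi.integrable, ← Measure.volume_eq_prod, integral_diffInv hi.meas]
  refine integral_congr_ae ?_
  have h0 : ∀ᵐ z : ℝ × ℝ, z.1 ≠ 0 := by
    rw [Measure.volume_eq_prod]
    exact Measure.quasiMeasurePreserving_fst.ae (Measure.ae_ne volume (0 : ℝ))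
  filter_upwards [h0] with z hz
  rw [Phi, mul_assoc]
  have : w + (sh e (diffInv z).1 - sh e (diffInv z).2) = w + e • z := by
    congr 1
    ext
    · simp only [sh, Prod.fst_sub, Prod.smul_fst, smul_eq_mul]
      rw [← mul_sub, diffInv_sub]
    · simp only [sh, Prod.snd_sub, Prod.smul_snd, smul_eq_mul]
      rw [← mul_sub, diffInv_sq_sub hz]
  rw [this]; ring

lemma integrable_Phi : Integrable Phi := by
  refine ⟨by fun_prop, ?_⟩
  rw [hasFiniteIntegral_iff_norm]
  have h := (nice_kap 0 1).prod_mul (nice_kap 0 1)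
  have h1 : ∀ z, ENNReal.ofReal ‖Phi z‖ = ENNReal.ofReal (1 / (2 * |z.1|)) *
      ENNReal.ofReal |kap 0 1 (diffInv z).1 * kap 0 1 (diffInv z).2| := by
    intro z
    rw [Phi, Real.norm_eq_abs, abs_mul, abs_of_nonneg (a := 1 / (2 * |z.1|)) (by positivity),
      ENNReal.ofReal_mul (by positivity)]
  simp only [h1]
  rw [lintegral_diffInv (h := fun p => ENNReal.ofReal |kap 0 1 p.1 * kap 0 1 p.2|)
    (by have := h.meas; exact (this.abs).ennreal_ofReal)]
  have := (h.integrable (μ := volume)).2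
  rw [hasFiniteIntegral_iff_norm] at this
  exact this

lemma N2_sub_comp (v : ℝ × ℝ → ℝ) (hv : Nice v) (w : ℝ × ℝ) :
    N2 (fun x => v (x - w) - v x) = 2 * N2 v - 2 * ∫ x, v (x - w) * v x := by
  have h := N2_add (hv.comp_sub_right w) hv.neg
  rw [N2_comp_sub] at h
  have h2 : N2 (fun x => -v x) = N2 v := by simp [N2]
  rw [h2] at h
  simp only [← sub_eq_add_neg, mul_neg, integral_neg] at h
  rw [h]; ring

lemma N2_shift_TT_zero {u : ℝ × ℝ → ℝ} (hu : Nice u) {e : ℝ} (he : e * e = 1) {d : ℝ} (hd : 0 < d)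
    (hd1 : d ≤ 1) {w : ℝ × ℝ} (hw1 : |w.1| ≤ d ^ 2) (hw2 : |w.2| ≤ d ^ 2) :
    N2 (fun x => TT 0 e u (x - w) - TT 0 e u x) ≤ 2600 * d * N2 u := by
  have hv : Nice (TT 0 e u) := nice_TT 0 e hu
  have hcm := measurable_corr hu
  have heabs : |e| = 1 := by
    have : |e| * |e| = 1 := by rw [← abs_mul, he, abs_one]
    nlinarith [abs_nonneg e]
  rw [N2_sub_comp _ hv]
  have h0 : N2 (TT 0 e u) = ∫ z, Phi z * corr u (e • z) := by
    have := integral_TT_mul_TT hu e 0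
    simp only [sub_zero, zero_add] at this
    rw [← this]; unfold N2; congr 1; ext x; ring
  have h1 : ∫ x, TT 0 e u (x - w) * TT 0 e u x = ∫ z, Phi (z - e • w) * corr u (e • z) := by
    rw [integral_TT_mul_TT hu e w, ← integral_sub_right_eq_self _ (e • w)]
    congr 1; ext z
    rw [smul_sub, smul_smul, he, one_smul]
    congr 2; abel
  have hcm2 : Measurable fun z : ℝ × ℝ => corr u (e • z) := by fun_prop
  have hInt : ∀ {F : ℝ × ℝ → ℝ}, Integrable F → Integrable fun z => F z * corr u (e • z) := by
    intro F hF
    have := hF.bdd_mul (f := fun z => corr u (e • z)) (c := N2 u) hcm2.aestronglyMeasurable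
      (ae_of_all _ fun z => abs_corr_le hu _)
    simpa [mul_comm] using this
  have hi1 : Integrable fun z => Phi (z - e • w) := integrable_Phi.comp_sub_right _
  rw [h0, h1, ← mul_sub, ← integral_sub (hInt integrable_Phi) (hInt hi1)]
  have hdiff : Integrable fun z => Phi z - Phi (z - e • w) := integrable_Phi.sub hi1
  have h2 : ∫ z, (Phi z * corr u (e • z) - Phi (z - e • w) * corr u (e • z)) ≤
      ∫ z, |Phi z - Phi (z - e • w)| * N2 u := by
    refine integral_mono ((hInt integrable_Phi).sub (hInt hi1)) (hdiff.abs.mul_const _) fun z => ?_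
    dsimp only
    rw [← sub_mul]
    refine (le_abs_self _).trans ?_
    rw [abs_mul]
    gcongr
    exact abs_corr_le hu _
  have h3 : ∫ z, |Phi z - Phi (z - e • w)| ≤ 1300 * d := by
    rw [integral_eq_lintegral_of_nonneg_ae (ae_of_all _ fun _ => abs_nonneg _)
      hdiff.abs.aestronglyMeasurable]
    refine ENNReal.toReal_le_of_le_ofReal (by positivity) ?_
    refine lintegral_Phi_sub_le hd hd1 ?_ ?_
    · simpa [abs_mul, heabs] using hw1
    · simpa [abs_mul, heabs] using hw2
  rw [integral_mul_const] at h2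
  have := mul_le_mul_of_nonneg_right h3 (N2_nonneg u)
  linarith

/-- Smoothing estimate at all scales. -/
lemma N2_shift_TT {u : ℝ × ℝ → ℝ} (hu : Nice u) {e : ℝ} (he : e * e = 1) (j : ℤ) {d : ℝ} (hd : 0 < d)
    (hd1 : d ≤ 1) {w : ℝ × ℝ} (hw1 : |w.1| ≤ d ^ 2 * 2 ^ j) (hw2 : |w.2| ≤ d ^ 2 * 4 ^ j) :
    N2 (fun x => TT j e u (x - w) - TT j e u x) ≤ 2600 * d * N2 u := by
  have hp : (0 : ℝ) < 2 ^ j := by positivity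
  have h4 : (4 : ℝ) ^ j = (2 ^ j) ^ 2 := by rw [← zpow_natCast, ← zpow_mul, mul_comm, zpow_mul]; norm_num
  have hv := nice_TT j e hu
  have h1 := N2_shift_TT_zero (hu.comp_dil hp) he hd hd1 (w := dil (2 ^ j)⁻¹ w)
    (by simp only [dil, abs_mul, abs_inv, abs_of_pos hp]
        rwa [inv_mul_le_iff₀ hp, mul_comm])
    (by simp only [dil, abs_mul, abs_inv, abs_pow, abs_of_pos hp]
        rw [inv_pow, ← h4]
        rwa [inv_mul_le_iff₀ (by positivity), mul_comm])
  have hm : Measurable (fun x => TT j e u (x - w) - TT j e u x) := by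
    have := hv.meas; fun_prop
  have h2 := N2_dil hm hp
  have h3 : ∀ x, TT j e u (dil (2 ^ j) x - w) - TT j e u (dil (2 ^ j) x) =
      TT 0 e (fun y => u (dil (2 ^ j) y)) (x - dil (2 ^ j)⁻¹ w) -
      TT 0 e (fun y => u (dil (2 ^ j) y)) x := by
    intro x
    rw [← TT_dil, ← TT_dil, dil_sub, dil_dil_inv hp.ne']
  simp only [h3] at h2
  rw [h2, N2_dil hu.meas hp] at h1
  have hq : (0 : ℝ) < ((2 ^ j) ^ 3)⁻¹ := by positivity
  rw [mul_left_comm] at h1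
  exact le_of_mul_le_mul_left h1 hq

section

variable {f g u v : ℝ × ℝ → ℝ}

/-! ### Single-scale `L²` estimates -/

lemma sq_EE_le (k : ℤ) (hf : Nice f) (x : ℝ × ℝ) : EE k f x ^ 2 ≤ EE k (fun y => f y ^ 2) x := by
  have := abs_EE_rpow_le k hf (r := 2) (by norm_num) x
  simpa using this

/-- The window of translations occurring inside a cube of scale `k`. -/
def win (k : ℤ) : Set (ℝ × ℝ) := Ioo (-2 ^ k) (2 ^ k) ×ˢ Ioo (-4 ^ k) (4 ^ k)

lemma measurableSet_win (k : ℤ) : MeasurableSet (win k) := measurableSet_Ioo.prod measurableSet_Ioo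

lemma volume_real_win (k : ℤ) : volume.real (win k) = 4 * 8 ^ k := by
  rw [win, Measure.real, Measure.volume_eq_prod, Measure.prod_prod, Real.volume_Ioo, Real.volume_Ioo,
    ENNReal.toReal_mul, ENNReal.toReal_ofReal, ENNReal.toReal_ofReal]
  · have : (8 : ℝ) ^ k = 2 ^ k * 4 ^ k := by rw [← mul_zpow]; norm_num
    rw [this]; ring
  · have : (0 : ℝ) < 4 ^ k := by positivity
    linarith
  · have : (0 : ℝ) < 2 ^ k := by positivity
    linarith

lemma win_ne_top (k : ℤ) : volume (win k) ≠ ⊤ := by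
  rw [win, Measure.volume_eq_prod, Measure.prod_prod, Real.volume_Ioo, Real.volume_Ioo]
  exact ENNReal.mul_ne_top ENNReal.ofReal_ne_top ENNReal.ofReal_ne_top

lemma nice_win_diff (hv : Nice v) (k : ℤ) :
    Nice (fun p : (ℝ × ℝ) × (ℝ × ℝ) =>
      (win k).indicator (fun _ => (1 : ℝ)) p.2 * (v (p.1 - p.2) - v p.1) ^ 2) := by
  obtain ⟨M, hM0, hM⟩ := hv.exists_pos_bdd
  obtain ⟨R, hR0, hR⟩ := hv.exists_pos_supp
  have hm := hv.meas
  have hi : Measurable ((win k).indicator (fun _ => (1 : ℝ))) :=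
    measurable_const.indicator (measurableSet_win k)
  have hi1 : ∀ w, |(win k).indicator (fun _ => (1 : ℝ)) w| ≤ 1 := by
    intro w; by_cases h : w ∈ win k <;> simp [h]
  have h2 : (0 : ℝ) < 2 ^ k := by positivity
  have h4 : (0 : ℝ) < 4 ^ k := by positivity
  refine ⟨by fun_prop, ⟨(2 * M) ^ 2, fun p => ?_⟩, ⟨R + 2 ^ k + 4 ^ k, fun p hp => ?_⟩⟩
  · rw [abs_mul, abs_pow]
    refine (mul_le_of_le_one_left (by positivity) (hi1 _)).trans ?_
    gcongr
    have := abs_sub (v (p.1 - p.2)) (v p.1)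
    linarith [hM (p.1 - p.2), hM p.1]
  · by_cases hw : p.2 ∈ win k
    · have hn : ‖p.2‖ ≤ 2 ^ k + 4 ^ k := by
        rw [Prod.norm_def, max_le_iff, Real.norm_eq_abs, Real.norm_eq_abs, abs_le, abs_le]
        have h5 := hw.1
        have h6 := hw.2
        refine ⟨⟨?_, ?_⟩, ?_, ?_⟩ <;> linarith [h5.1, h5.2, h6.1, h6.2]
      rw [Prod.norm_def, lt_max_iff] at hp
      have hp1 : R + 2 ^ k + 4 ^ k < ‖p.1‖ := by
        rcases hp with hp | hp
        · exact hp
        · linarith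
      have := norm_sub_norm_le p.1 p.2
      rw [hR p.1 (by linarith), hR (p.1 - p.2) (by linarith)]; simp
    · simp [hw]

lemma N2_DD_le_of_shift (hv : Nice v) (k : ℤ) {Z : ℝ}
    (hZ : ∀ w : ℝ × ℝ, |w.1| ≤ 2 ^ k → |w.2| ≤ 4 ^ k → N2 (fun x => v (x - w) - v x) ≤ Z) :
    N2 (DD k v) ≤ 4 * Z := by
  have h8 : (0 : ℝ) < 8 ^ k := by positivity
  have hF := nice_win_diff hv k
  set F := fun p : (ℝ × ℝ) × (ℝ × ℝ) =>
      (win k).indicator (fun _ => (1 : ℝ)) p.2 * (v (p.1 - p.2) - v p.1) ^ 2 with hFdef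
  have hpt : ∀ x, DD k v x ^ 2 ≤ (8 ^ k)⁻¹ * ∫ w, F (x, w) := by
    intro x
    have hg : Nice ((cube k (idx k x)).indicator (fun y => v x - v y)) := by
      obtain ⟨M, hM0, hM⟩ := hv.exists_pos_bdd
      have h1 : Nice ((cube k (idx k x)).indicator (fun _ => (1 : ℝ))) := by
        refine ⟨measurable_const.indicator (measurableSet_cube k _), ⟨1, fun y => ?_⟩,
          ⟨‖x‖ + 2 ^ k + 4 ^ k, fun y hy => ?_⟩⟩
        · by_cases h : y ∈ cube k (idx k x) <;> simp [h]
        · rw [indicator_of_notMem]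
          intro h
          have hc := close_of_idx_eq (mem_cube.mp h)
          have := norm_sub_norm_le y x
          have h2 : ‖y - x‖ ≤ 2 ^ k + 4 ^ k := by
            rw [Prod.norm_def, max_le_iff]
            have h2 : (0 : ℝ) < 2 ^ k := by positivity
            have h4 : (0 : ℝ) < 4 ^ k := by positivity
            simp only [Prod.fst_sub, Prod.snd_sub, Real.norm_eq_abs]
            constructor <;> linarith [hc.1, hc.2]
          linarith
      have h2 := h1.mul_bdd (g := fun y => v x - v y) (by have := hv.meas; fun_prop)
        ⟨2 * M, fun y => by have := abs_sub (v x) (v y); linarith [hM x, hM y]⟩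
      have h3 : (cube k (idx k x)).indicator (fun y => v x - v y) =
          fun y => (cube k (idx k x)).indicator (fun _ => (1 : ℝ)) y * (v x - v y) := by
        ext y
        by_cases h : y ∈ cube k (idx k x) <;> simp [h]
      rw [h3]; exact h2
    have h1 : DD k v x = EE k ((cube k (idx k x)).indicator (fun y => v x - v y)) x := by
      rw [EE, setIntegral_indicator (measurableSet_cube k _), inter_self, integral_sub
        (by rw [integrable_const_iff]; right; exact ⟨by simpa using (volume_cube_ne_top k _).lt_top⟩)
        (hv.integrable (μ := volume)).integrableOn, setIntegral_const, volume_real_cube, DD, EE,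
        smul_eq_mul]
      field_simp
    rw [h1]
    refine (sq_EE_le k hg x).trans ?_
    rw [EE]
    refine mul_le_mul_of_nonneg_left ?_ (by positivity)
    have h3 : ∫ w, F (x, w) = ∫ y, F (x, x - y) :=
      (integral_sub_left_eq_self (fun w => F (x, w)) volume x).symm
    rw [h3, ← integral_indicator (measurableSet_cube k _)]
    have hFx : Nice (fun w => F (x, w)) := by
      refine ⟨hF.meas.comp (by fun_prop), hF.bdd.imp fun M hM w => hM _, ?_⟩
      obtain ⟨R, hR⟩ := hF.supp
      refine ⟨R, fun w hw => hR _ ?_⟩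
      rw [Prod.norm_def, lt_max_iff]; right; exact hw
    refine integral_mono ((hg.sq.indicator (measurableSet_cube k _)).integrable) ?_ fun y => ?_
    · exact (integrable_comp_sub_left (fun w => F (x, w)) x).mpr hFx.integrable
    · by_cases h : y ∈ cube k (idx k x)
      · have hc := close_of_idx_eq (mem_cube.mp h)
        have hw : x - y ∈ win k := by
          constructor
          · rw [mem_Ioo, ← abs_lt, Prod.fst_sub, abs_sub_comm]; exact hc.1
          · rw [mem_Ioo, ← abs_lt, Prod.snd_sub, abs_sub_comm]; exact hc.2
        simp only [indicator_of_mem h, hFdef, indicator_of_mem hw, sub_sub_cancel, one_mul]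
        apply le_of_eq; ring
      · rw [indicator_of_notMem h]
        simp only [hFdef]
        exact mul_nonneg (indicator_nonneg (by simp) _) (sq_nonneg _)
  have h2 : N2 (DD k v) ≤ ∫ x, (8 ^ k)⁻¹ * ∫ w, F (x, w) :=
    integral_mono (nice_DD k hv).sq.integrable (hF.integral_prod_right.const_mul _).integrable hpt
  rw [integral_const_mul, integral_integral_swap (by exact hF.integrable)] at h2
  have h3 : ∀ w, ∫ x, F (x, w) ≤ (win k).indicator (fun _ => Z) w := by
    intro w
    simp only [hFdef]
    rw [integral_const_mul]
    by_cases hw : w ∈ win k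
    · rw [indicator_of_mem hw, indicator_of_mem hw, one_mul]
      exact hZ w (abs_lt.mpr hw.1).le (abs_lt.mpr hw.2).le
    · simp [hw]
  have h4 : ∫ w, ∫ x, F (x, w) ≤ Z * (4 * 8 ^ k) := by
    refine (integral_mono hF.integrable.integral_prod_right ?_ h3).trans ?_
    · rw [integrable_indicator_iff (measurableSet_win k), integrableOn_const_iff]
      right; exact (win_ne_top k).lt_top
    · rw [integral_indicator (measurableSet_win k), setIntegral_const, volume_real_win, smul_eq_mul]
      apply le_of_eq; ring
  refine h2.trans ((mul_le_mul_of_nonneg_left h4 (by positivity)).trans (le_of_eq ?_))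
  field_simp

lemma integral_kap (a b : ℤ) : ∫ t, kap a b t = 0 := by
  have h := integral_neg_eq_self (kap a b) volume
  simp only [kap_neg, integral_neg] at h
  linarith

lemma N2_TT_le_of_shift (hv : Nice v) (i : ℤ) {e : ℝ} (he : |e| = 1) {Z : ℝ}
    (hZ : ∀ w : ℝ × ℝ, |w.1| ≤ 2 ^ (i + 1) → |w.2| ≤ 4 ^ (i + 1) →
      N2 (fun x => v (x - w) - v x) ≤ Z) :
    N2 (TT i e v) ≤ 16 * Z := by
  have hk := nice_kap i (i + 1)
  have hkm := hk.meas
  have hv1 : Nice (fun p : (ℝ × ℝ) × ℝ => kap i (i + 1) p.2 * (v (p.1 - sh e p.2) - v p.1)) := by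
    have h := (nice_Top_integrand hk e hv).sub (hv.prod_mul hk)
    have h3 : (fun p : (ℝ × ℝ) × ℝ => kap i (i + 1) p.2 * (v (p.1 - sh e p.2) - v p.1)) =
        fun p => kap i (i + 1) p.2 * v (p.1 - sh e p.2) - v p.1 * kap i (i + 1) p.2 := by
      ext p; ring
    rw [h3]; exact h
  have h1 : ∀ x, TT i e v x = ∫ t, kap i (i + 1) t * (v (x - sh e t) - v x) := by
    intro x
    have hm := hv.meas
    have hi : Integrable fun t => kap i (i + 1) t * v (x - sh e t) :=
      (hk.mul_bdd (g := fun t => v (x - sh e t)) (by fun_prop) (hv.bdd.imp fun M hM t => hM _)).integrable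
    simp only [mul_sub]
    rw [integral_sub hi (hk.integrable.mul_const _), integral_mul_const, integral_kap, zero_mul,
      sub_zero]
    rfl
  have h2 : N2 (TT i e v) = N2 (fun x => ∫ t, kap i (i + 1) t * (v (x - sh e t) - v x)) := by
    unfold N2; simp only [h1]
  rw [h2]
  have hZ0 : 0 ≤ Z := (N2_nonneg _).trans (hZ 0 (by simp; positivity) (by simp; positivity))
  refine (N2_avg_le hk (V := fun p => v (p.1 - sh e p.2) - v p.1)
    (fun t => (hv.comp_sub_right (sh e t)).sub hv) hv1 (Z := Z) fun t ht => ?_).trans ?_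
  · have htl := abs_lt_of_kap_ne_zero ht
    refine hZ (sh e t) ?_ ?_
    · simp only [sh, abs_mul, he, one_mul]; exact htl.le
    · simp only [sh, abs_mul, he, one_mul, abs_pow]
      have h4 : (4 : ℝ) ^ (i + 1) = (2 ^ (i + 1)) ^ 2 := by
        rw [← zpow_natCast, ← zpow_mul, mul_comm, zpow_mul]; norm_num
      rw [h4]
      gcongr
  · have h1 := integral_abs_kap_le i
    have h2 : 0 ≤ ∫ t, |kap i (i + 1) t| := integral_nonneg fun _ => abs_nonneg _
    gcongr
    nlinarith

lemma abs_eq_one_of_sq {e : ℝ} (he : e * e = 1) : |e| = 1 := by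
  have : |e| * |e| = 1 := by rw [← abs_mul, he, abs_one]
  nlinarith [abs_nonneg e]

lemma N2_shift_TT_nat (hu : Nice u) {e : ℝ} (he : e * e = 1) (k : ℤ) (n : ℕ) {w : ℝ × ℝ}
    (hw1 : |w.1| ≤ 2 ^ k) (hw2 : |w.2| ≤ 4 ^ k) :
    N2 (fun x => TT (k + n) e u (x - w) - TT (k + n) e u x) ≤ 2600 * (3 / 4) ^ n * N2 u := by
  have h1 : (1 : ℝ) ≤ ((3 / 4) ^ n) ^ 2 * 2 ^ n := by
    rw [← pow_mul, mul_comm n 2, pow_mul, ← mul_pow]; exact one_le_pow₀ (by norm_num)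
  have h2 : (1 : ℝ) ≤ ((3 / 4) ^ n) ^ 2 * 4 ^ n := by
    rw [← pow_mul, mul_comm n 2, pow_mul, ← mul_pow]; exact one_le_pow₀ (by norm_num)
  refine N2_shift_TT hu he (k + n) (by positivity) (pow_le_one₀ (by norm_num) (by norm_num)) ?_ ?_
  · rw [zpow_add₀ (by norm_num), zpow_natCast]
    have : (0 : ℝ) < 2 ^ k := by positivity
    nlinarith
  · rw [zpow_add₀ (by norm_num), zpow_natCast]
    have : (0 : ℝ) < 4 ^ k := by positivity
    nlinarith

lemma N2_DD_TT_le (hu : Nice u) {e : ℝ} (he : e * e = 1) (k : ℤ) (n : ℕ) :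
    N2 (DD k (TT (k + n) e u)) ≤ 10400 * (3 / 4) ^ n * N2 u := by
  have := N2_DD_le_of_shift (nice_TT (k + n) e hu) k (Z := 2600 * (3 / 4) ^ n * N2 u)
    fun w h1 h2 => N2_shift_TT_nat hu he k n h1 h2
  linarith

lemma N2_TT_DD_le (hu : Nice u) {e : ℝ} (he : e * e = 1) (k : ℤ) (n : ℕ) :
    N2 (TT (k + n) e (DD k u)) ≤ 10400 * (3 / 4) ^ n * N2 u := by
  set h := TT (k + n) e (DD k u) with hh
  have hn : Nice h := nice_TT _ _ (nice_DD k hu)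
  have h1 : N2 h = ∫ x, u x * DD k (TT (k + n) (-e) h) x := by
    rw [← DD_adjoint k hu (nice_TT _ _ hn)]
    unfold TT
    rw [← Top_adjoint (nice_kap _ _) e (nice_DD k hu) hn]
    unfold N2
    congr 1; ext x; rw [pow_two]; rfl
  have h2 := (le_abs_self _).trans (abs_integral_mul_le hu (nice_DD k (nice_TT (k + n) (-e) hn)))
  rw [← h1] at h2
  have h3 := N2_DD_TT_le hn (e := -e) (by rw [neg_mul_neg]; exact he) k n
  have h4 : N2 h ≤ √(10400 * (3 / 4) ^ n * N2 u) * √(N2 h) := by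
    refine h2.trans ?_
    rw [← Real.sqrt_mul (N2_nonneg u), ← Real.sqrt_mul (by have := N2_nonneg u; positivity)]
    apply Real.sqrt_le_sqrt
    have := mul_le_mul_of_nonneg_left h3 (N2_nonneg u)
    linarith
  have h5 := le_sq_of_le_mul_sqrt (N2_nonneg h) h4
  rwa [Real.sq_sqrt (by have := N2_nonneg u; positivity)] at h5

lemma N2_TT_TT_le (hv : Nice v) {e e' : ℝ} (he : e * e = 1) (he' : e' * e' = 1) (i : ℤ) (n : ℕ) :
    N2 (TT i e' (TT (i + n) e v)) ≤ 60000 * (3 / 4) ^ n * N2 v := by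
  have hN := N2_nonneg v
  rcases n with _ | n
  · have h1 := N2_TT_le i e' (nice_TT (i + (0 : ℕ)) e hv)
    have h2 := N2_TT_le (i + (0 : ℕ)) e hv
    simp only [pow_zero] at *
    linarith
  · have h := N2_TT_le_of_shift (nice_TT (i + (n + 1 : ℕ)) e hv) i (abs_eq_one_of_sq he')
      (Z := 2600 * (3 / 4) ^ n * N2 v) fun w h1 h2 => by
        have := N2_shift_TT_nat hv he (i + 1) n h1 h2
        rwa [show i + 1 + (n : ℤ) = i + (n + 1 : ℕ) by push_cast; ring] at this
    refine h.trans ?_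
    rw [pow_succ]
    have : (0 : ℝ) ≤ (3 / 4) ^ n * N2 v := by positivity
    nlinarith

/-! ### Averages are almost translation invariant at small scales -/

lemma volume_edge_cube_le (k : ℤ) (n : ℤ × ℤ) (w : ℝ × ℝ) :
    volume.real ({x | idx k (x - w) ≠ idx k x} ∩ cube k n) ≤
      2 * (|w.1| / 2 ^ k + |w.2| / 4 ^ k) * 8 ^ k := by
  have h2 : (0 : ℝ) < 2 ^ k := by positivity
  have h4 : (0 : ℝ) < 4 ^ k := by positivity
  set a : ℝ := n.1 * 2 ^ k with ha
  set c : ℝ := n.2 * 4 ^ k with hc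
  set I := Ico a (a + 2 ^ k)
  set J := Ico c (c + 4 ^ k)
  set A := Ico a (a + |w.1|) ∪ Ico (a + 2 ^ k - |w.1|) (a + 2 ^ k)
  set A' := Ico c (c + |w.2|) ∪ Ico (c + 4 ^ k - |w.2|) (c + 4 ^ k)
  have hcube : cube k n = I ×ˢ J := by
    rw [cube_eq_prod]; simp only [I, J, add_mul, one_mul, ha, hc]
  have hsub : {x | idx k (x - w) ≠ idx k x} ∩ cube k n ⊆ A ×ˢ J ∪ I ×ˢ A' := by
    rintro x ⟨hx1, hx2⟩
    have hx3 : x - w ∉ cube k n := by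
      intro h
      apply hx1
      rw [mem_cube.mp h, mem_cube.mp hx2]
    rw [hcube] at hx2 hx3
    by_cases hA : x.1 ∈ A
    · left; exact ⟨hA, hx2.2⟩
    · right
      refine ⟨hx2.1, ?_⟩
      by_contra hA'
      apply hx3
      have e1 := le_abs_self w.1
      have e2 := neg_abs_le w.1
      have e3 := le_abs_self w.2
      have e4 := neg_abs_le w.2
      simp only [A, A', mem_union, mem_Ico, not_or, not_and, not_lt] at hA hA'
      have i1 := hx2.1
      have i2 := hx2.2
      simp only [I, J, mem_Ico] at i1 i2
      have l1 := hA.1 i1.1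
      have l2 := hA'.1 i2.1
      have l3 : x.1 < a + 2 ^ k - |w.1| := by
        by_contra h; linarith [hA.2 (not_lt.mp h)]
      have l4 : x.2 < c + 4 ^ k - |w.2| := by
        by_contra h; linarith [hA'.2 (not_lt.mp h)]
      refine ⟨⟨?_, ?_⟩, ?_, ?_⟩ <;> simp only [Prod.fst_sub, Prod.snd_sub] <;> linarith
  have hA : volume A ≤ ENNReal.ofReal (2 * |w.1|) := by
    refine (measure_union_le _ _).trans (le_of_eq ?_)
    rw [Real.volume_Ico, Real.volume_Ico, ← ENNReal.ofReal_add (by simp) (by simp)]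
    congr 1; ring
  have hA' : volume A' ≤ ENNReal.ofReal (2 * |w.2|) := by
    refine (measure_union_le _ _).trans (le_of_eq ?_)
    rw [Real.volume_Ico, Real.volume_Ico, ← ENNReal.ofReal_add (by simp) (by simp)]
    congr 1; ring
  refine ENNReal.toReal_le_of_le_ofReal (by positivity) ?_
  refine (measure_mono hsub).trans ((measure_union_le _ _).trans ?_)
  rw [Measure.volume_eq_prod, Measure.prod_prod, Measure.prod_prod, Real.volume_Ico, Real.volume_Ico]
  calc _ ≤ ENNReal.ofReal (2 * |w.1|) * ENNReal.ofReal (c + 4 ^ k - c) +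
        ENNReal.ofReal (a + 2 ^ k - a) * ENNReal.ofReal (2 * |w.2|) := by gcongr
    _ = _ := by
      rw [← ENNReal.ofReal_mul (by positivity), ← ENNReal.ofReal_mul (by simp; positivity),
        ← ENNReal.ofReal_add (by simp; positivity) (by simp; positivity)]
      congr 1
      have : (8 : ℝ) ^ k = 2 ^ k * 4 ^ k := by rw [← mul_zpow]; norm_num
      rw [this]; field_simp; ring

lemma integral_edge_EE_le (hf : Nice f) (k : ℤ) (w : ℝ × ℝ) :
    ∫ x, {x | idx k (x - w) ≠ idx k x}.indicator (fun x => EE k f x ^ 2) x ≤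
      2 * (|w.1| / 2 ^ k + |w.2| / 4 ^ k) * N2 f := by
  set B := {x | idx k (x - w) ≠ idx k x}
  have hB : MeasurableSet B :=
    (measurableSet_eq_fun ((measurable_idx k).comp (measurable_sub_const w)) (measurable_idx k)).compl
  have hE := (nice_EE k hf).sq
  set ρ := 2 * (|w.1| / 2 ^ k + |w.2| / 4 ^ k)
  have hρ : 0 ≤ ρ := by positivity
  have h := abs_setIntegral_le_of_cube (dMeas_univ k) (hE.indicator hB).integrable
    (hE.const_mul ρ).integrable fun n _ => ?_
  · simp only [setIntegral_univ] at h
    refine (le_abs_self _).trans (h.trans ?_)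
    rw [integral_const_mul]
    exact mul_le_mul_of_nonneg_left (N2_EE_le k hf) hρ
  · set c := ((8 : ℝ) ^ k)⁻¹ * ∫ y in cube k n, f y
    have h1 : ∫ x in cube k n, B.indicator (fun x => EE k f x ^ 2) x =
        c ^ 2 * volume.real (B ∩ cube k n) := by
      rw [setIntegral_indicator hB, inter_comm, setIntegral_congr_fun (g := fun _ => c ^ 2)
        (hB.inter (measurableSet_cube k n)) fun x hx => by simp only [EE_of_mem f hx.2]; rfl,
        setIntegral_const, smul_eq_mul, mul_comm]
    have h2 : ∫ x in cube k n, ρ * EE k f x ^ 2 = ρ * c ^ 2 * 8 ^ k := by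
      rw [setIntegral_congr_fun (g := fun _ => ρ * c ^ 2)
        (measurableSet_cube k n) fun x hx => by simp only [EE_of_mem f hx]; rfl,
        setIntegral_const, smul_eq_mul, mul_comm, volume_real_cube]
    rw [h1, h2, abs_of_nonneg (by positivity)]
    have := mul_le_mul_of_nonneg_left (volume_edge_cube_le k n w) (sq_nonneg c)
    calc _ ≤ _ := this
      _ = _ := by ring

lemma N2_shift_EE (hf : Nice f) (k : ℤ) (w : ℝ × ℝ) :
    N2 (fun x => EE k f (x - w) - EE k f x) ≤ 8 * (|w.1| / 2 ^ k + |w.2| / 4 ^ k) * N2 f := by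
  have hE := (nice_EE k hf).sq
  have hm : ∀ w : ℝ × ℝ, MeasurableSet {x | idx k (x - w) ≠ idx k x} := fun w =>
    (measurableSet_eq_fun ((measurable_idx k).comp (measurable_sub_const w)) (measurable_idx k)).compl
  have h1 := integral_edge_EE_le hf k w
  have h2 := integral_edge_EE_le hf k (-w)
  rw [← integral_sub_right_eq_self _ w] at h2
  simp only [Prod.fst_neg, Prod.snd_neg, abs_neg] at h2
  have n1 := hE.indicator (hm w)
  have n2 := (hE.indicator (hm (-w))).comp_sub_right w
  have h3 : N2 (fun x => EE k f (x - w) - EE k f x) ≤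
      ∫ x, (2 * {x | idx k (x - w) ≠ idx k x}.indicator (fun x => EE k f x ^ 2) x +
        2 * {x | idx k (x - -w) ≠ idx k x}.indicator (fun x => EE k f x ^ 2) (x - w)) := by
    refine integral_mono (((nice_EE k hf).comp_sub_right w).sub (nice_EE k hf)).sq.integrable
      ((n1.const_mul 2).add (n2.const_mul 2)).integrable fun x => ?_
    dsimp only
    by_cases hx : idx k (x - w) = idx k x
    · rw [EE_of_idx_eq f hx, sub_self]
      have : ∀ S : Set (ℝ × ℝ), ∀ y, 0 ≤ S.indicator (fun x => EE k f x ^ 2) y := fun S y =>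
        indicator_nonneg (fun _ _ => sq_nonneg _) y
      have e1 := this {x | idx k (x - w) ≠ idx k x} x
      have e2 := this {x | idx k (x - -w) ≠ idx k x} (x - w)
      simp only [ne_eq, OfNat.ofNat_ne_zero, not_false_eq_true, zero_pow]
      positivity
    · rw [indicator_of_mem (by exact hx), indicator_of_mem]
      · nlinarith [sq_nonneg (EE k f (x - w) + EE k f x)]
      · rw [mem_ofPred_eq, sub_neg_eq_add, sub_add_cancel]
        exact fun h => hx h.symm
  rw [integral_add (n1.const_mul 2).integrable (n2.const_mul 2).integrable, integral_const_mul,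
    integral_const_mul] at h3
  linarith

lemma N2_TT_EE_le (hf : Nice f) {e : ℝ} (he : e * e = 1) (j : ℤ) (n : ℕ) :
    N2 (TT j e (EE (j + n) f)) ≤ 10400 * (3 / 4) ^ n * N2 f := by
  have hN := N2_nonneg f
  have h := N2_TT_le_of_shift (nice_EE (j + n) hf) j (abs_eq_one_of_sq he)
    (Z := 48 * (3 / 4) ^ n * N2 f) fun w h1 h2 => by
      refine (N2_shift_EE hf (j + n) w).trans ?_
      refine mul_le_mul_of_nonneg_right ?_ hN
      have e1 : |w.1| / 2 ^ (j + n) ≤ 2 * (3 / 4) ^ n := by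
        rw [div_le_iff₀ (by positivity)]
        refine h1.trans ?_
        rw [zpow_add₀ (by norm_num), zpow_add₀ (by norm_num), zpow_one, zpow_natCast]
        have : (1 : ℝ) ≤ (3 / 4) ^ n * 2 ^ n := by rw [← mul_pow]; exact one_le_pow₀ (by norm_num)
        have h2 : (0 : ℝ) < 2 ^ j := by positivity
        nlinarith
      have e2 : |w.2| / 4 ^ (j + n) ≤ 4 * (3 / 4) ^ n := by
        rw [div_le_iff₀ (by positivity)]
        refine h2.trans ?_
        rw [zpow_add₀ (by norm_num), zpow_add₀ (by norm_num), zpow_one, zpow_natCast]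
        have : (1 : ℝ) ≤ (3 / 4) ^ n * 4 ^ n := by rw [← mul_pow]; exact one_le_pow₀ (by norm_num)
        have h2 : (0 : ℝ) < 4 ^ j := by positivity
        nlinarith
      linarith
  refine h.trans ?_
  have : (0 : ℝ) ≤ (3 / 4) ^ n * N2 f := by positivity
  nlinarith

end

section

variable {f g u v : ℝ × ℝ → ℝ}

/-! ### Almost orthogonality and the uniform `L²` bound -/

lemma sqrt_three_quarters_pow_le (n : ℕ) : √((3 / 4 : ℝ) ^ n) ≤ (7 / 8) ^ n := by
  apply Real.sqrt_le_iff.mpr ⟨by positivity, ?_⟩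
  rw [← pow_mul, mul_comm, pow_mul]
  exact pow_le_pow_left₀ (by norm_num) (by norm_num) n

lemma sqrt_seven_eighths_pow_le (n : ℕ) : √((7 / 8 : ℝ) ^ n) ≤ (15 / 16) ^ n := by
  apply Real.sqrt_le_iff.mpr ⟨by positivity, ?_⟩
  rw [← pow_mul, mul_comm, pow_mul]
  exact pow_le_pow_left₀ (by norm_num) (by norm_num) n

lemma sum_pow_le_of_injOn {ι : Type*} {q : ℝ} (h0 : 0 ≤ q) (h1 : q < 1) (s : Finset ι) (φ : ι → ℕ)
    (hφ : InjOn φ s) : ∑ j ∈ s, q ^ φ j ≤ (1 - q)⁻¹ := by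
  classical
  rw [← Finset.sum_image (f := fun n => q ^ n) hφ, ← tsum_geometric_of_lt_one h0 h1]
  exact (summable_geometric_of_lt_one h0 h1).sum_le_tsum _ fun _ _ => by positivity

lemma sum_pow_natAbs_le {q : ℝ} (h0 : 0 ≤ q) (h1 : q < 1) (s : Finset ℤ) (i : ℤ) :
    ∑ j ∈ s, q ^ (j - i).natAbs ≤ 2 * (1 - q)⁻¹ := by
  rw [← Finset.sum_filter_add_sum_filter_not s (fun j => i ≤ j), two_mul]
  refine add_le_add (sum_pow_le_of_injOn h0 h1 _ _ ?_) (sum_pow_le_of_injOn h0 h1 _ _ ?_)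
  · intro a ha b hb h
    simp only [Finset.coe_filter, mem_ofPred_eq] at ha hb
    simp only at h
    omega
  · intro a ha b hb h
    simp only [Finset.coe_filter, mem_ofPred_eq, not_le] at ha hb
    simp only at h
    omega

lemma sqrt_N2_sum_le {ι : Type*} (s : Finset ι) {F : ι → ℝ × ℝ → ℝ} (h : ∀ i ∈ s, Nice (F i)) :
    √(N2 (fun x => ∑ i ∈ s, F i x)) ≤ ∑ i ∈ s, √(N2 (F i)) := by
  classical
  induction s using Finset.induction_on with
  | empty => simp [N2]
  | insert a s ha ih =>
    simp only [Finset.sum_insert ha]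
    refine (sqrt_N2_add_le (h a (Finset.mem_insert_self _ _))
      (nice_sum s fun i hi => h i (Finset.mem_insert_of_mem hi))).trans ?_
    exact add_le_add le_rfl (ih fun i hi => h i (Finset.mem_insert_of_mem hi))

lemma N2_sum {ι : Type*} (s : Finset ι) {F : ι → ℝ × ℝ → ℝ} (h : ∀ i ∈ s, Nice (F i)) :
    N2 (fun x => ∑ i ∈ s, F i x) = ∑ i ∈ s, ∑ j ∈ s, ∫ x, F i x * F j x := by
  unfold N2
  have h1 : ∀ x, (∑ i ∈ s, F i x) ^ 2 = ∑ i ∈ s, ∑ j ∈ s, F i x * F j x := by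
    intro x; rw [sq, Finset.sum_mul_sum]
  simp only [h1]
  rw [integral_finsetSum s fun i hi =>
    (nice_sum s fun j hj => (h i hi).mul (h j hj)).integrable]
  refine Finset.sum_congr rfl fun i hi => ?_
  exact integral_finsetSum s fun j hj => ((h i hi).mul (h j hj)).integrable

lemma abs_integral_TT_mul_TT_le_aux (hu : Nice u) (hv : Nice v) {e : ℝ} (he : e * e = 1) (i : ℤ)
    (n : ℕ) : |∫ x, TT i e u x * TT (i + n) e v x| ≤ 245 * (7 / 8) ^ n * (√(N2 u) * √(N2 v)) := by
  have h1 : ∫ x, TT i e u x * TT (i + n) e v x = ∫ x, u x * TT i (-e) (TT (i + n) e v) x :=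
    Top_adjoint (nice_kap _ _) e hu (nice_TT _ e hv)
  rw [h1]
  refine (abs_integral_mul_le hu (nice_TT i (-e) (nice_TT _ e hv))).trans ?_
  have h2 : √(N2 (TT i (-e) (TT (i + n) e v))) ≤ 245 * (7 / 8) ^ n * √(N2 v) := by
    refine (Real.sqrt_le_sqrt (N2_TT_TT_le hv he (by linarith) i n)).trans ?_
    rw [Real.sqrt_mul (by positivity), Real.sqrt_mul (by positivity)]
    gcongr
    · rw [Real.sqrt_le_left (by norm_num)]; norm_num
    · exact sqrt_three_quarters_pow_le n
  calc √(N2 u) * √(N2 (TT i (-e) (TT (i + n) e v)))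
      ≤ √(N2 u) * (245 * (7 / 8) ^ n * √(N2 v)) := by gcongr
    _ = _ := by ring

lemma abs_integral_TT_mul_TT_le (hu : Nice u) (hv : Nice v) {e : ℝ} (he : e * e = 1) (i j : ℤ) :
    |∫ x, TT i e u x * TT j e v x| ≤ 245 * (7 / 8) ^ (j - i).natAbs * (√(N2 u) * √(N2 v)) := by
  rcases le_total i j with h | h
  · have h1 := abs_integral_TT_mul_TT_le_aux hu hv he i (j - i).natAbs
    rwa [show i + ((j - i).natAbs : ℤ) = j by omega] at h1
  · have h1 := abs_integral_TT_mul_TT_le_aux hv hu he j (j - i).natAbs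
    rw [show j + ((j - i).natAbs : ℤ) = i by omega] at h1
    simp only [mul_comm (TT i e u _)]
    rwa [mul_comm (√(N2 u))]

/-- Almost orthogonality. -/
lemma N2_sum_TT_le (s : Finset ℤ) {w : ℤ → ℝ × ℝ → ℝ} {a : ℤ → ℝ} {e ρ : ℝ} (he : e * e = 1)
    (hρ : 0 ≤ ρ) (hw : ∀ j ∈ s, Nice (w j)) (h1 : ∀ j ∈ s, N2 (w j) ≤ a j)
    (h2 : ∀ j ∈ s, N2 (TT j e (w j)) ≤ ρ ^ 2 * a j) :
    N2 (fun x => ∑ j ∈ s, TT j e (w j) x) ≤ 512 * ρ * ∑ j ∈ s, a j := by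
  have ha : ∀ j ∈ s, 0 ≤ a j := fun j hj => (N2_nonneg _).trans (h1 j hj)
  rw [N2_sum s fun j hj => nice_TT j e (hw j hj)]
  have key : ∀ i ∈ s, ∀ j ∈ s, ∫ x, TT i e (w i) x * TT j e (w j) x ≤
      8 * ρ * ((15 / 16) ^ (j - i).natAbs * a i + (15 / 16) ^ (i - j).natAbs * a j) := by
    intro i hi j hj
    set n := (j - i).natAbs with hn
    have hn' : (i - j).natAbs = n := by omega
    rw [hn']
    have hp1 : |∫ x, TT i e (w i) x * TT j e (w j) x| ≤ 245 * (7 / 8) ^ n * (√(a i) * √(a j)) := by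
      refine (abs_integral_TT_mul_TT_le (hw i hi) (hw j hj) he i j).trans ?_
      gcongr
      · exact h1 i hi
      · exact h1 j hj
    have hp2 : |∫ x, TT i e (w i) x * TT j e (w j) x| ≤ ρ ^ 2 * (√(a i) * √(a j)) := by
      refine (abs_integral_mul_le (nice_TT i e (hw i hi)) (nice_TT j e (hw j hj))).trans ?_
      have hs : ∀ k ∈ s, √(N2 (TT k e (w k))) ≤ ρ * √(a k) := by
        intro k hk
        refine (Real.sqrt_le_sqrt (h2 k hk)).trans ?_
        rw [Real.sqrt_mul (by positivity), Real.sqrt_sq hρ]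
      calc _ ≤ (ρ * √(a i)) * (ρ * √(a j)) := by
            gcongr
            · exact hs i hi
            · exact hs j hj
        _ = _ := by ring
    set X := |∫ x, TT i e (w i) x * TT j e (w j) x|
    set Y := √(a i) * √(a j)
    have hY : 0 ≤ Y := by positivity
    have hX : X ≤ 16 * ρ * (15 / 16) ^ n * Y := by
      have h3 : X ^ 2 ≤ (16 * ρ * (15 / 16) ^ n * Y) ^ 2 := by
        have h4 : X ^ 2 ≤ (245 * (7 / 8) ^ n * Y) * (ρ ^ 2 * Y) := by
          rw [sq]; exact mul_le_mul hp1 hp2 (abs_nonneg _) (by positivity)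
        refine h4.trans ?_
        have h5 : ((7 : ℝ) / 8) ^ n ≤ ((15 / 16) ^ n) ^ 2 := by
          rw [← pow_mul, mul_comm n 2, pow_mul]
          exact pow_le_pow_left₀ (by norm_num) (by norm_num) n
        calc _ = 245 * (7 / 8) ^ n * (ρ ^ 2 * Y ^ 2) := by ring
          _ ≤ 256 * ((15 / 16) ^ n) ^ 2 * (ρ ^ 2 * Y ^ 2) := by gcongr; norm_num
          _ = _ := by ring
      exact abs_le_of_sq_le_sq' h3 (by positivity) |>.2
    have hYa : Y ≤ (a i + a j) / 2 := by
      have := sq_nonneg (√(a i) - √(a j))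
      nlinarith [Real.sq_sqrt (ha i hi), Real.sq_sqrt (ha j hj)]
    calc _ ≤ X := le_abs_self _
      _ ≤ 16 * ρ * (15 / 16) ^ n * ((a i + a j) / 2) := hX.trans (by gcongr)
      _ = _ := by ring
  refine (Finset.sum_le_sum fun i hi => Finset.sum_le_sum fun j hj => key i hi j hj).trans ?_
  simp only [← Finset.mul_sum, Finset.sum_add_distrib]
  have hA : ∑ i ∈ s, ∑ j ∈ s, (15 / 16 : ℝ) ^ (j - i).natAbs * a i ≤ 32 * ∑ i ∈ s, a i := by
    rw [Finset.mul_sum]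
    refine Finset.sum_le_sum fun i hi => ?_
    rw [← Finset.sum_mul]
    have := sum_pow_natAbs_le (q := 15 / 16) (by norm_num) (by norm_num) s i
    norm_num at this
    exact mul_le_mul_of_nonneg_right this (ha i hi)
  have hB : ∑ i ∈ s, ∑ j ∈ s, (15 / 16 : ℝ) ^ (i - j).natAbs * a j ≤ 32 * ∑ i ∈ s, a i := by
    rw [Finset.sum_comm]; exact hA
  calc _ ≤ 8 * ρ * (32 * ∑ i ∈ s, a i + 32 * ∑ i ∈ s, a i) := by gcongr
    _ = _ := by ring

/-- The martingale difference of scale `k`. -/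
def PP (k : ℤ) (f : ℝ × ℝ → ℝ) (x : ℝ × ℝ) : ℝ := EE k f x - EE (k + 1) f x

lemma nice_PP (k : ℤ) (hf : Nice f) : Nice (PP k f) := (nice_EE k hf).sub (nice_EE (k + 1) hf)

lemma PP_eq_DD_EE (k : ℤ) (hf : Nice f) : PP k f = DD (k + 1) (EE k f) := by
  ext x; rw [PP, DD, EE_comp_of_ge (by omega) hf]

lemma EE_PP (k : ℤ) (hf : Nice f) : EE k (PP k f) = PP k f := by
  ext x
  have h := EE_sub k (nice_EE k hf) (nice_EE (k + 1) hf) x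
  rw [EE_comp_of_le le_rfl, EE_comp_of_le (by omega)] at h
  exact h

lemma DD_PP (k : ℤ) (hf : Nice f) : DD (k + 1) (PP k f) = PP k f := by
  ext x
  have h := EE_sub (k + 1) (nice_EE k hf) (nice_EE (k + 1) hf) x
  rw [EE_comp_of_ge (by omega) hf, EE_comp_of_le le_rfl, sub_self] at h
  have h' : EE (k + 1) (PP k f) x = 0 := h
  rw [DD, h', sub_zero]

lemma N2_PP (k : ℤ) (hf : Nice f) : N2 (PP k f) = N2 (EE k f) - N2 (EE (k + 1) f) := by
  rw [PP_eq_DD_EE k hf, N2_DD _ (nice_EE k hf), EE_comp_of_ge (by omega) hf]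

lemma N2_PP_le (k : ℤ) (hf : Nice f) : N2 (PP k f) ≤ N2 f := by
  rw [N2_PP k hf]; linarith [N2_EE_le k hf, N2_nonneg (EE (k + 1) f)]

lemma sum_Ico_int_telescope (φ : ℤ → ℝ) (a : ℤ) (n : ℕ) :
    ∑ k ∈ Finset.Ico a (a + n), (φ k - φ (k + 1)) = φ a - φ (a + n) := by
  induction n with
  | zero => simp
  | succ n ih =>
    have h : Finset.Ico a (a + (n + 1 : ℕ)) = insert (a + n) (Finset.Ico a (a + n)) := by
      ext k; simp only [Finset.mem_insert, Finset.mem_Ico]; omega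
    rw [h, Finset.sum_insert (by simp), ih]
    push_cast
    rw [← add_assoc]; ring

lemma sum_N2_PP_le (hf : Nice f) {a b : ℤ} (hab : a ≤ b) :
    ∑ k ∈ Finset.Ico a b, N2 (PP k f) ≤ N2 f := by
  simp only [N2_PP _ hf]
  obtain ⟨n, rfl⟩ := Int.le.dest hab
  rw [sum_Ico_int_telescope (fun k => N2 (EE k f))]
  linarith [N2_EE_le a hf, N2_nonneg (EE (a + n) f)]

lemma sum_PP {a b : ℤ} (hab : a ≤ b) (f : ℝ × ℝ → ℝ) (x : ℝ × ℝ) :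
    ∑ k ∈ Finset.Ico a b, PP k f x = EE a f x - EE b f x := by
  obtain ⟨n, rfl⟩ := Int.le.dest hab
  exact sum_Ico_int_telescope (fun k => EE k f x) a n

lemma N2_TT_PP_le (hf : Nice f) {e : ℝ} (he : e * e = 1) (j k : ℤ) :
    N2 (TT j e (PP k f)) ≤ 14400 * (3 / 4) ^ (k - j).natAbs * N2 (PP k f) := by
  have h0 := N2_nonneg (PP k f)
  rcases le_or_gt j k with h | h
  · have h1 := N2_TT_EE_le (nice_PP k hf) he j (k - j).natAbs
    rw [show j + ((k - j).natAbs : ℤ) = k by omega, EE_PP k hf] at h1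
    refine h1.trans ?_
    gcongr; norm_num
  · obtain ⟨n, hn⟩ : ∃ n, (k - j).natAbs = n + 1 := ⟨(k - j).natAbs - 1, by omega⟩
    have h1 := N2_TT_DD_le (nice_PP k hf) he (k + 1) n
    rw [show k + 1 + (n : ℤ) = j by omega, DD_PP k hf] at h1
    refine h1.trans ?_
    rw [hn, pow_succ]
    have : 0 ≤ (3 / 4 : ℝ) ^ n * N2 (PP k f) := by positivity
    linarith

lemma Top_kap_eq_sum (hf : Nice f) {a b : ℤ} (hab : a ≤ b) (e : ℝ) (x : ℝ × ℝ) :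
    Top (kap a b) e f x = ∑ j ∈ Finset.Ico a b, TT j e f x := by
  obtain ⟨n, rfl⟩ := Int.le.dest hab
  induction n with
  | zero => simp [Top, kap_self]
  | succ n ih =>
    have h : Finset.Ico a (a + (n + 1 : ℕ)) = insert (a + n) (Finset.Ico a (a + n)) := by
      ext k; simp only [Finset.mem_insert, Finset.mem_Ico]; omega
    rw [h, Finset.sum_insert (by simp), ← ih (by omega)]
    unfold TT Top
    have hm := hf.meas
    have hi : ∀ c d : ℤ, Integrable fun t => kap c d t * f (x - sh e t) := fun c d =>
      ((nice_kap c d).mul_bdd (g := fun t => f (x - sh e t)) (by fun_prop)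
        (hf.bdd.imp fun M hM t => hM _)).integrable
    rw [← integral_add (hi _ _) (hi _ _)]
    congr 1; ext t
    rw [kap_add (b := a + n) (by omega) (by push_cast; omega)]
    push_cast
    rw [← add_assoc]; ring

lemma sqrt_N2_le {Z c : ℝ} (hc : 0 ≤ c) (n : ℕ) (h : N2 u ≤ c ^ 2 * (3 / 4) ^ n * Z) :
    √(N2 u) ≤ c * (7 / 8) ^ n * √Z := by
  refine (Real.sqrt_le_sqrt h).trans ?_
  rw [Real.sqrt_mul (by positivity), Real.sqrt_mul (by positivity), Real.sqrt_sq hc]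
  gcongr
  exact sqrt_three_quarters_pow_le n

lemma sqrt_N2_sum_TT_DD_le (hf : Nice f) {a b : ℤ} {e : ℝ} (he : e * e = 1) :
    √(N2 (fun x => ∑ j ∈ Finset.Ico a b, TT j e (DD a f) x)) ≤ 960 * √(N2 f) := by
  refine (sqrt_N2_sum_le _ fun j _ => nice_TT j e (nice_DD a hf)).trans ?_
  have h1 : ∀ j ∈ Finset.Ico a b, √(N2 (TT j e (DD a f))) ≤ 120 * √(N2 f) * (7 / 8) ^ (j - a).natAbs := by
    intro j hj
    rw [Finset.mem_Ico] at hj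
    have h := N2_TT_DD_le hf he a (j - a).natAbs
    rw [show a + ((j - a).natAbs : ℤ) = j by omega] at h
    refine (sqrt_N2_le (c := 120) (by norm_num) (j - a).natAbs (h.trans ?_)).trans (by linarith)
    have := N2_nonneg f
    gcongr; norm_num
  refine (Finset.sum_le_sum h1).trans ?_
  rw [← Finset.mul_sum]
  have h2 := sum_pow_le_of_injOn (q := 7 / 8) (by norm_num) (by norm_num) (Finset.Ico a b)
    (fun j => (j - a).natAbs) (fun i hi j hj h => by
      simp only [Finset.coe_Ico, mem_Ico] at hi hj; simp only at h; omega)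
  norm_num at h2
  nlinarith [Real.sqrt_nonneg (N2 f)]

lemma sqrt_N2_sum_TT_EE_le (hf : Nice f) {a b : ℤ} {e : ℝ} (he : e * e = 1) :
    √(N2 (fun x => ∑ j ∈ Finset.Ico a b, TT j e (EE b f) x)) ≤ 960 * √(N2 f) := by
  refine (sqrt_N2_sum_le _ fun j _ => nice_TT j e (nice_EE b hf)).trans ?_
  have h1 : ∀ j ∈ Finset.Ico a b, √(N2 (TT j e (EE b f))) ≤ 120 * √(N2 f) * (7 / 8) ^ (b - j).natAbs := by
    intro j hj
    rw [Finset.mem_Ico] at hj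
    have h := N2_TT_EE_le hf he j (b - j).natAbs
    rw [show j + ((b - j).natAbs : ℤ) = b by omega] at h
    refine (sqrt_N2_le (c := 120) (by norm_num) (b - j).natAbs (h.trans ?_)).trans (by linarith)
    have := N2_nonneg f
    gcongr; norm_num
  refine (Finset.sum_le_sum h1).trans ?_
  rw [← Finset.mul_sum]
  have h2 := sum_pow_le_of_injOn (q := 7 / 8) (by norm_num) (by norm_num) (Finset.Ico a b)
    (fun j => (b - j).natAbs) (fun i hi j hj h => by
      simp only [Finset.coe_Ico, mem_Ico] at hi hj; simp only at h; omega)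
  norm_num at h2
  nlinarith [Real.sqrt_nonneg (N2 f)]

lemma sum_diag (s : Finset ℤ) {a b : ℤ} (hs : s = Finset.Ico a b) (φ : ℤ → ℤ → ℝ) :
    ∑ j ∈ s, ∑ k ∈ s, φ j k =
      ∑ d ∈ Finset.Ioo (a - b) (b - a), ∑ j ∈ s, if j + d ∈ s then φ j (j + d) else 0 := by
  rw [Finset.sum_comm (s := Finset.Ioo _ _)]
  refine Finset.sum_congr rfl fun j hj => ?_
  rw [← Finset.sum_filter]
  refine Finset.sum_nbij' (fun k => k - j) (fun d => j + d) ?_ ?_ ?_ ?_ ?_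
  all_goals
    subst hs
    intro k hk
    simp only [Finset.mem_Ico, Finset.mem_filter, Finset.mem_Ioo] at *
  · omega
  · omega
  · omega
  · omega
  · congr 1; omega

lemma sqrt_N2_sum_TT_PP_le (hf : Nice f) {a b : ℤ} (hab : a ≤ b) {e : ℝ} (he : e * e = 1) :
    √(N2 (fun x => ∑ j ∈ Finset.Ico a b, ∑ k ∈ Finset.Ico a b, TT j e (PP k f) x)) ≤
      8000 * √(N2 f) := by
  set s := Finset.Ico a b with hs
  simp only [sum_diag s hs fun j k => TT j e (PP k f) _]
  set w : ℤ → ℤ → ℝ × ℝ → ℝ := fun d j => if j + d ∈ s then PP (j + d) f else fun _ => 0 with hwdef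
  have hT0 : ∀ j, TT j e (fun _ => 0) = fun _ => 0 := by intro j; ext x; simp [TT, Top]
  have hTw : ∀ d j x, (if j + d ∈ s then TT j e (PP (j + d) f) x else 0) = TT j e (w d j) x := by
    intro d j x
    by_cases h : j + d ∈ s
    · simp [hwdef, h]
    · simp [hwdef, h, hT0]
  simp only [hTw]
  have hw : ∀ d j, Nice (w d j) := by
    intro d j
    simp only [hwdef]
    split_ifs
    · exact nice_PP _ hf
    · exact nice_zero
  refine (sqrt_N2_sum_le _ fun d _ => nice_sum s fun j _ => nice_TT j e (hw d j)).trans ?_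
  have h1 : ∀ d ∈ Finset.Ioo (a - b) (b - a), √(N2 (fun x => ∑ j ∈ s, TT j e (w d j) x)) ≤
      250 * √(N2 f) * (15 / 16) ^ (d - 0).natAbs := by
    intro d _
    have hρ : (120 * (7 / 8 : ℝ) ^ d.natAbs) ^ 2 ≥ 14400 * (3 / 4) ^ d.natAbs := by
      rw [mul_pow, ← pow_mul, mul_comm d.natAbs 2, pow_mul]
      norm_num
      exact pow_le_pow_left₀ (by norm_num) (by norm_num) _
    have h := N2_sum_TT_le s (w := w d) (a := fun j => N2 (w d j)) (ρ := 120 * (7 / 8) ^ d.natAbs) he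
      (by positivity) (fun j _ => hw d j) (fun _ _ => le_rfl) (fun j _ => by
        simp only [hwdef]
        by_cases h : j + d ∈ s
        · simp only [h, if_true]
          have h2 := N2_TT_PP_le hf he j (j + d)
          rw [add_sub_cancel_left] at h2
          exact h2.trans (mul_le_mul_of_nonneg_right hρ (N2_nonneg _))
        · simp [h, hT0, N2])
    have hsum : ∑ j ∈ s, N2 (w d j) ≤ N2 f := by
      have h3 : ∑ j ∈ s, N2 (w d j) = ∑ j ∈ s with j + d ∈ s, N2 (PP (j + d) f) := by
        rw [Finset.sum_filter]
        refine Finset.sum_congr rfl fun j _ => ?_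
        by_cases h : j + d ∈ s
        · simp [hwdef, h]
        · simp [hwdef, h, N2]
      rw [h3]
      refine le_trans ?_ (sum_N2_PP_le hf hab)
      rw [← Finset.sum_image (f := fun k => N2 (PP k f)) (g := fun j => j + d)
        (fun i _ j _ h => by simpa using h)]
      refine Finset.sum_le_sum_of_subset_of_nonneg ?_ fun _ _ _ => N2_nonneg _
      intro k hk
      simp only [Finset.mem_image, Finset.mem_filter] at hk
      obtain ⟨j, ⟨_, h⟩, rfl⟩ := hk
      exact h
    have h4 : N2 (fun x => ∑ j ∈ s, TT j e (w d j) x) ≤ 62500 * (7 / 8) ^ d.natAbs * N2 f := by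
      refine h.trans ?_
      have : 0 ≤ (7 / 8 : ℝ) ^ d.natAbs := by positivity
      calc 512 * (120 * (7 / 8 : ℝ) ^ d.natAbs) * ∑ j ∈ s, N2 (w d j)
          ≤ 512 * (120 * (7 / 8 : ℝ) ^ d.natAbs) * N2 f := by gcongr
        _ ≤ _ := by nlinarith [mul_nonneg this (N2_nonneg f)]
    refine (Real.sqrt_le_sqrt h4).trans ?_
    rw [Real.sqrt_mul (by positivity), Real.sqrt_mul (by positivity), sub_zero]
    have h5 : √(62500 : ℝ) = 250 := by
      rw [show (62500 : ℝ) = 250 ^ 2 by norm_num, Real.sqrt_sq (by norm_num)]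
    rw [h5]
    have := sqrt_seven_eighths_pow_le d.natAbs
    have h6 : 250 * √((7 / 8 : ℝ) ^ d.natAbs) * √(N2 f) ≤ 250 * (15 / 16) ^ d.natAbs * √(N2 f) := by
      gcongr
    linarith
  refine (Finset.sum_le_sum h1).trans ?_
  rw [← Finset.mul_sum]
  have h2 := sum_pow_natAbs_le (q := 15 / 16) (by norm_num) (by norm_num) (Finset.Ioo (a - b) (b - a)) 0
  norm_num at h2
  simp only [sub_zero]
  nlinarith [Real.sqrt_nonneg (N2 f)]

/-- The truncated parabolic Hilbert transforms are bounded on `L²`, uniformly in the truncation. -/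
lemma sqrt_N2_Top_kap_le (hf : Nice f) {a b : ℤ} (hab : a ≤ b) {e : ℝ} (he : e * e = 1) :
    √(N2 (Top (kap a b) e f)) ≤ 10000 * √(N2 f) := by
  set s := Finset.Ico a b with hs
  have h1 : Top (kap a b) e f = fun x => ((∑ j ∈ s, TT j e (DD a f) x) +
      (∑ j ∈ s, TT j e (EE b f) x)) + ∑ j ∈ s, ∑ k ∈ s, TT j e (PP k f) x := by
    ext x
    rw [Top_kap_eq_sum hf hab, ← Finset.sum_add_distrib, ← Finset.sum_add_distrib]
    refine Finset.sum_congr rfl fun j _ => ?_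
    have hk := nice_kap j (j + 1)
    unfold TT
    rw [← Top_sum s hk e (fun k _ => nice_PP k hf), ← Top_add hk e (nice_DD a hf) (nice_EE b hf),
      ← Top_add hk e ((nice_DD a hf).add (nice_EE b hf)) (nice_sum s fun k _ => nice_PP k hf)]
    congr 1
    ext y
    rw [sum_PP hab, DD]; ring
  have n1 := nice_sum s fun j _ => nice_TT j e (nice_DD a hf)
  have n2 := nice_sum s fun j _ => nice_TT j e (nice_EE b hf)
  have n3 := nice_sum s fun j _ => nice_sum s fun k _ => nice_TT j e (nice_PP k hf)
  rw [h1]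
  refine (sqrt_N2_add_le (n1.add n2) n3).trans ?_
  have := sqrt_N2_add_le n1 n2
  have := sqrt_N2_sum_TT_DD_le hf (a := a) (b := b) he
  have := sqrt_N2_sum_TT_EE_le hf (a := a) (b := b) he
  have := sqrt_N2_sum_TT_PP_le hf hab he
  nlinarith [Real.sqrt_nonneg (N2 f)]

end

section

variable {f g u v : ℝ × ℝ → ℝ}

/-! ### Single-scale estimates below the duality line -/

lemma abs_Top_le_of_bdd {k : ℝ → ℝ} (hk : Nice k) (e : ℝ) (hf : Nice f) {M : ℝ} (hM : ∀ x, |f x| ≤ M)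
    (x : ℝ × ℝ) : |Top k e f x| ≤ (∫ t, |k t|) * M := by
  refine (abs_Top_le k e f x).trans ?_
  have hm := hf.meas
  unfold Top
  rw [← integral_mul_const]
  refine integral_mono ?_ (hk.abs.integrable.mul_const _) fun t =>
    mul_le_mul_of_nonneg_left (hM _) (abs_nonneg _)
  exact (hk.abs.mul_bdd (g := fun t => |f (x - sh e t)|) (by fun_prop)
    (hf.bdd.imp fun M hM t => by rw [abs_abs]; exact hM _)).integrable

lemma integral_abs_Top_le {k : ℝ → ℝ} (hk : Nice k) (e : ℝ) (hf : Nice f) :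
    ∫ x, |Top k e f x| ≤ (∫ t, |k t|) * ∫ x, |f x| := by
  have h1 : ∫ x, |Top k e f x| ≤ ∫ x, Top (fun t => |k t|) e (fun x => |f x|) x :=
    integral_mono (nice_Top hk e hf).abs.integrable (nice_Top hk.abs e hf.abs).integrable
      fun x => abs_Top_le k e f x
  refine h1.trans (le_of_eq ?_)
  unfold Top
  rw [integral_integral_swap (nice_Top_integrand hk.abs e hf.abs).integrable]
  simp only [integral_const_mul]
  simp only [integral_sub_right_eq_self (fun x => |f x|)]
  rw [integral_mul_const]

lemma abs_TT_le_of_bdd (j : ℤ) (e : ℝ) (hf : Nice f) {M : ℝ} (hM : ∀ x, |f x| ≤ M)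
    (x : ℝ × ℝ) : |TT j e f x| ≤ 4 * M := by
  have h0 : 0 ≤ M := (abs_nonneg _).trans (hM 0)
  exact (abs_Top_le_of_bdd (nice_kap _ _) e hf hM x).trans
    (mul_le_mul_of_nonneg_right (integral_abs_kap_le j) h0)

lemma integral_abs_TT_le (j : ℤ) (e : ℝ) (hf : Nice f) : ∫ x, |TT j e f x| ≤ 4 * ∫ x, |f x| :=
  (integral_abs_Top_le (nice_kap _ _) e hf).trans
    (mul_le_mul_of_nonneg_right (integral_abs_kap_le j) (integral_nonneg fun _ => abs_nonneg _))

lemma integral_abs_EE_le (k : ℤ) (hf : Nice f) : ∫ x, |EE k f x| ≤ ∫ x, |f x| := by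
  simpa using integral_abs_EE_rpow_le k hf le_rfl

lemma integral_abs_PP_le (k : ℤ) (hf : Nice f) : ∫ x, |PP k f x| ≤ 2 * ∫ x, |f x| := by
  have h1 : ∫ x, |PP k f x| ≤ ∫ x, (|EE k f x| + |EE (k + 1) f x|) :=
    integral_mono (nice_PP k hf).abs.integrable
      ((nice_EE k hf).abs.add (nice_EE (k + 1) hf).abs).integrable fun x => abs_sub _ _
  rw [integral_add (nice_EE k hf).abs.integrable (nice_EE (k + 1) hf).abs.integrable] at h1
  linarith [integral_abs_EE_le k hf, integral_abs_EE_le (k + 1) hf]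

lemma abs_EE_le_integral (k : ℤ) (hf : Nice f) (x : ℝ × ℝ) :
    |EE k f x| ≤ (8 ^ k)⁻¹ * ∫ y, |f y| := by
  refine (abs_EE_le k f x).trans ?_
  rw [EE]
  refine mul_le_mul_of_nonneg_left ?_ (by positivity)
  exact setIntegral_le_integral hf.abs.integrable (.of_forall fun _ => abs_nonneg _)

lemma abs_PP_le_integral (k : ℤ) (hf : Nice f) (x : ℝ × ℝ) :
    |PP k f x| ≤ 2 * ((8 ^ k)⁻¹ * ∫ y, |f y|) := by
  have h0 : 0 ≤ ∫ y, |f y| := integral_nonneg fun _ => abs_nonneg _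
  have h1 := abs_EE_le_integral k hf x
  have h2 := abs_EE_le_integral (k + 1) hf x
  have h3 : ((8 : ℝ) ^ (k + 1))⁻¹ * ∫ y, |f y| ≤ (8 ^ k)⁻¹ * ∫ y, |f y| := by
    gcongr
    · norm_num
    · omega
  have := abs_sub (EE k f x) (EE (k + 1) f x)
  rw [PP]; linarith

lemma abs_PP_le_of_bdd (k : ℤ) {M : ℝ} (hM : ∀ x, |f x| ≤ M) (x : ℝ × ℝ) : |PP k f x| ≤ 2 * M := by
  have h1 : |EE k f x| ≤ M := abs_EE_le_of_bdd fun y _ => hM y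
  have h2 : |EE (k + 1) f x| ≤ M := abs_EE_le_of_bdd fun y _ => hM y
  have := abs_sub (EE k f x) (EE (k + 1) f x)
  rw [PP]; linarith

lemma abs_integral_mul_le_of_bdd (hf : Nice f) (hg : Nice g) {M : ℝ} (hM : ∀ x, |g x| ≤ M) :
    |∫ x, f x * g x| ≤ (∫ x, |f x|) * M := by
  refine abs_integral_le_integral_abs.trans ?_
  rw [← integral_mul_const]
  refine integral_mono (hf.mul hg).abs.integrable (hf.abs.integrable.mul_const _) fun x => ?_
  simp only [abs_mul]
  exact mul_le_mul_of_nonneg_left (hM x) (abs_nonneg _)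

/-- The pairing of one piece of the operator with martingale differences. -/
def pairing (j k l : ℤ) (e : ℝ) (u v : ℝ × ℝ → ℝ) : ℝ := ∫ x, TT j e (PP k u) x * PP l v x

lemma abs_pairing_le_L2 (hu : Nice u) (hv : Nice v) {e : ℝ} (he : e * e = 1) (j k l : ℤ) :
    |pairing j k l e u v| ≤
      120 * (15 / 16) ^ ((k - j).natAbs + (l - j).natAbs) * (√(N2 u) * √(N2 v)) := by
  have nu := nice_PP k hu
  have nv := nice_PP l hv
  have hb : ∀ (e : ℝ), e * e = 1 → ∀ (k : ℤ) {u}, Nice u →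
      √(N2 (TT j e (PP k u))) ≤ 120 * (7 / 8) ^ (k - j).natAbs * √(N2 u) := by
    intro e he k u hu
    refine sqrt_N2_le (by norm_num) _ ((N2_TT_PP_le hu he j k).trans ?_)
    norm_num
    exact N2_PP_le k hu
  have h1 : |pairing j k l e u v| ≤ 120 * (7 / 8) ^ (k - j).natAbs * (√(N2 u) * √(N2 v)) := by
    refine (abs_integral_mul_le (nice_TT j e nu) nv).trans ?_
    rw [← mul_assoc]
    gcongr
    · exact hb e he k hu
    · exact N2_PP_le l hv
  have h2 : |pairing j k l e u v| ≤ 120 * (7 / 8) ^ (l - j).natAbs * (√(N2 u) * √(N2 v)) := by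
    have h3 : pairing j k l e u v = ∫ x, PP k u x * TT j (-e) (PP l v) x :=
      Top_adjoint (nice_kap _ _) e nu nv
    rw [h3]
    refine (abs_integral_mul_le nu (nice_TT j (-e) nv)).trans ?_
    have := hb (-e) (by linarith) l hv
    calc _ ≤ √(N2 u) * (120 * (7 / 8) ^ (l - j).natAbs * √(N2 v)) := by
          gcongr
          exact N2_PP_le k hu
      _ = _ := by ring
  set X := |pairing j k l e u v|
  set Y := √(N2 u) * √(N2 v)
  set a := (k - j).natAbs
  set b := (l - j).natAbs
  refine abs_le_of_sq_le_sq' ?_ (by positivity) |>.2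
  have h4 : X ^ 2 ≤ (120 * (7 / 8) ^ a * Y) * (120 * (7 / 8) ^ b * Y) := by
    rw [sq]; exact mul_le_mul h1 h2 (abs_nonneg _) (by positivity)
  refine h4.trans ?_
  have h5 : ((7 : ℝ) / 8) ^ (a + b) ≤ ((15 / 16) ^ (a + b)) ^ 2 := by
    rw [← pow_mul, mul_comm (a + b) 2, pow_mul]
    exact pow_le_pow_left₀ (by norm_num) (by norm_num) _
  calc _ = 14400 * (7 / 8) ^ (a + b) * Y ^ 2 := by ring
    _ ≤ 14400 * ((15 / 16) ^ (a + b)) ^ 2 * Y ^ 2 := by gcongr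
    _ = _ := by ring

lemma abs_pairing_le_L1 (hu : Nice u) (hv : Nice v) (e : ℝ) (j k l : ℤ) {M : ℝ}
    (hM : ∀ x, |v x| ≤ M) : |pairing j k l e u v| ≤ 16 * ((∫ x, |u x|) * M) := by
  have h0 : 0 ≤ M := (abs_nonneg _).trans (hM 0)
  refine (abs_integral_mul_le_of_bdd (nice_TT j e (nice_PP k hu)) (nice_PP l hv)
    (abs_PP_le_of_bdd l hM)).trans ?_
  have h1 := integral_abs_TT_le j e (nice_PP k hu)
  have h2 := integral_abs_PP_le k hu
  nlinarith

lemma abs_pairing_le_kernel (hu : Nice u) (hv : Nice v) (e : ℝ) (j k l : ℤ) :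
    |pairing j k l e u v| ≤ 16 * ((8 ^ k)⁻¹ * (∫ x, |u x|) * ∫ x, |v x|) := by
  have n1 := nice_TT j e (nice_PP k hu)
  have h1 := abs_TT_le_of_bdd j e (nice_PP k hu) (abs_PP_le_integral k hu)
  have h2 := abs_integral_mul_le_of_bdd (nice_PP l hv) n1 h1
  have h3 := integral_abs_PP_le l hv
  unfold pairing
  simp only [mul_comm (TT j e _ _)]
  refine h2.trans ?_
  have h0 : 0 ≤ (8 ^ k : ℝ)⁻¹ * ∫ x, |u x| :=
    mul_nonneg (by positivity) (integral_nonneg fun _ => abs_nonneg _)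
  nlinarith

lemma N2_le_of_bdd (hu : Nice u) {K : ℝ} (hK : ∀ x, |u x| ≤ K) {U : Set (ℝ × ℝ)}
    (hfin : volume U ≠ ⊤) (hsupp : ∀ x ∉ U, u x = 0) :
    N2 u ≤ K ^ 2 * volume.real U := by
  have h1 : N2 u = ∫ x in U, u x ^ 2 :=
    (setIntegral_eq_integral_of_forall_compl_eq_zero fun x hx => by simp [hsupp x hx]).symm
  rw [h1, mul_comm, ← smul_eq_mul, ← setIntegral_const]
  refine setIntegral_mono (hu.sq.integrable (μ := volume)).integrableOn
    (integrableOn_const hfin) fun x => ?_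
  exact sq_le_sq' (by linarith [neg_abs_le (u x), hK x]) ((le_abs_self _).trans (hK x))

lemma integral_abs_le_of_bdd (hu : Nice u) {K : ℝ} (hK : ∀ x, |u x| ≤ K) {U : Set (ℝ × ℝ)}
    (hfin : volume U ≠ ⊤) (hsupp : ∀ x ∉ U, u x = 0) :
    ∫ x, |u x| ≤ K * volume.real U := by
  have h1 : ∫ x, |u x| = ∫ x in U, |u x| :=
    (setIntegral_eq_integral_of_forall_compl_eq_zero fun x hx => by simp [hsupp x hx]).symm
  rw [h1, mul_comm, ← smul_eq_mul, ← setIntegral_const]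
  exact setIntegral_mono (hu.abs.integrable (μ := volume)).integrableOn
    (integrableOn_const hfin) hK

/-- Exponents for the interpolation of the three single-scale estimates. -/
structure Expo where
  (θ₁ θ₂ θ₃ : ℝ)
  h₁ : 0 ≤ θ₁
  h₂ : 0 ≤ θ₂
  h₃ : 0 ≤ θ₃
  sum : θ₁ + θ₂ + θ₃ = 1

namespace Expo
variable (E : Expo)

/-- The resulting exponent of the first function. -/
def al : ℝ := E.θ₁ / 2 + E.θ₂ + E.θ₃
/-- The resulting exponent of the second function. -/
def be : ℝ := E.θ₁ / 2 + E.θ₃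
/-- The resulting decay rate. -/
def q : ℝ := (15 / 16) ^ E.θ₁ * 8 ^ E.θ₃

lemma q_pos : 0 < E.q := by unfold q; positivity

end Expo

/-- Restricted-type interpolated estimate. -/
lemma abs_pairing_le_restricted (E : Expo) (hu : Nice u) (hv : Nice v) {e : ℝ} (he : e * e = 1)
    {j k l : ℤ} (hk : k ≤ j) {K L : ℝ} (hK : ∀ x, |u x| ≤ K) (hL : ∀ x, |v x| ≤ L)
    {U V : Set (ℝ × ℝ)} (hUf : volume U ≠ ⊤)
    (hVf : volume V ≠ ⊤) (hus : ∀ x ∉ U, u x = 0) (hvs : ∀ x ∉ V, v x = 0) {a b : ℝ}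
    (ha : volume.real U ≤ a * 8 ^ j) (hb : volume.real V ≤ b * 8 ^ j) :
    |pairing j k l e u v| ≤
      120 * (K * L) * E.q ^ ((k - j).natAbs + (l - j).natAbs) * (a ^ E.al * b ^ E.be) * 8 ^ j := by
  have hK0 : 0 ≤ K := (abs_nonneg _).trans (hK 0)
  have hL0 : 0 ≤ L := (abs_nonneg _).trans (hL 0)
  have hj : (0 : ℝ) < 8 ^ j := by positivity
  have ha0 : 0 ≤ a := by
    by_contra h
    have := measureReal_nonneg (μ := volume) (s := U)
    nlinarith [mul_pos (neg_pos.mpr (not_le.mp h)) hj]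
  have hb0 : 0 ≤ b := by
    by_contra h
    have := measureReal_nonneg (μ := volume) (s := V)
    nlinarith [mul_pos (neg_pos.mpr (not_le.mp h)) hj]
  set n := (k - j).natAbs + (l - j).natAbs with hn
  set X := |pairing j k l e u v|
  set D := 120 * (K * L) * 8 ^ j with hD
  have hD0 : 0 ≤ D := by positivity
  have hu2 : √(N2 u) ≤ K * √(a * 8 ^ j) := by
    refine (Real.sqrt_le_sqrt ((N2_le_of_bdd hu hK hUf hus).trans
      (mul_le_mul_of_nonneg_left ha (by positivity)))).trans ?_
    rw [Real.sqrt_mul (by positivity), Real.sqrt_sq hK0]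
  have hv2 : √(N2 v) ≤ L * √(b * 8 ^ j) := by
    refine (Real.sqrt_le_sqrt ((N2_le_of_bdd hv hL hVf hvs).trans
      (mul_le_mul_of_nonneg_left hb (by positivity)))).trans ?_
    rw [Real.sqrt_mul (by positivity), Real.sqrt_sq hL0]
  have hu1 : ∫ x, |u x| ≤ K * (a * 8 ^ j) := (integral_abs_le_of_bdd hu hK hUf hus).trans
    (mul_le_mul_of_nonneg_left ha hK0)
  have hv1 : ∫ x, |v x| ≤ L * (b * 8 ^ j) := (integral_abs_le_of_bdd hv hL hVf hvs).trans
    (mul_le_mul_of_nonneg_left hb hL0)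
  have hu10 : 0 ≤ ∫ x, |u x| := integral_nonneg fun _ => abs_nonneg _
  have hv10 : 0 ≤ ∫ x, |v x| := integral_nonneg fun _ => abs_nonneg _
  have b1 : X ≤ D * ((15 / 16) ^ n * (√a * √b)) := by
    refine (abs_pairing_le_L2 hu hv he j k l).trans ?_
    calc _ ≤ 120 * (15 / 16) ^ n * ((K * √(a * 8 ^ j)) * (L * √(b * 8 ^ j))) := by gcongr
      _ = 120 * (K * L) * (√(8 ^ j) * √(8 ^ j)) * ((15 / 16) ^ n * (√a * √b)) := by
        rw [Real.sqrt_mul ha0, Real.sqrt_mul hb0]; ring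
      _ = _ := by rw [Real.mul_self_sqrt hj.le]
  have b2 : X ≤ D * a := by
    refine (abs_pairing_le_L1 hu hv e j k l hL).trans ?_
    calc _ ≤ 16 * ((K * (a * 8 ^ j)) * L) := by gcongr
      _ ≤ 120 * ((K * (a * 8 ^ j)) * L) := by gcongr; norm_num
      _ = _ := by rw [hD]; ring
  have b3 : X ≤ D * (8 ^ n * (a * b)) := by
    refine (abs_pairing_le_kernel hu hv e j k l).trans ?_
    have h8 : (8 ^ k : ℝ)⁻¹ * 8 ^ j ≤ 8 ^ n := by
      rw [← zpow_neg, ← zpow_add₀ (by norm_num), ← zpow_natCast]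
      exact zpow_le_zpow_right₀ (by norm_num) (by omega)
    calc _ ≤ 16 * ((8 ^ k)⁻¹ * (K * (a * 8 ^ j)) * (L * (b * 8 ^ j))) := by gcongr
      _ = 16 * (K * L) * 8 ^ j * (((8 ^ k)⁻¹ * 8 ^ j) * (a * b)) := by ring
      _ ≤ 120 * (K * L) * 8 ^ j * (8 ^ n * (a * b)) := by gcongr; norm_num
  have hX0 : 0 ≤ X := abs_nonneg _
  rcases hX0.eq_or_lt with h0 | hXp
  · rw [← h0]
    have := E.q_pos
    positivity
  have hDp : 0 < D := by
    rcases hD0.eq_or_lt with h | h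
    · rw [← h, zero_mul] at b2; linarith
    · exact h
  have hap : 0 < a := by
    rcases ha0.eq_or_lt with h | h
    · rw [← h, mul_zero] at b2; linarith
    · exact h
  have hbp : 0 < b := by
    rcases hb0.eq_or_lt with h | h
    · rw [← h, mul_zero, mul_zero, mul_zero] at b3; linarith
    · exact h
  clear_value D
  have e1 : X = X ^ E.θ₁ * X ^ E.θ₂ * X ^ E.θ₃ := by
    rw [← Real.rpow_add hXp, ← Real.rpow_add hXp, E.sum, Real.rpow_one]
  have e2 : D = D ^ E.θ₁ * D ^ E.θ₂ * D ^ E.θ₃ := by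
    rw [← Real.rpow_add hDp, ← Real.rpow_add hDp, E.sum, Real.rpow_one]
  have h1 := E.h₁
  have h2 := E.h₂
  have h3 := E.h₃
  have ea : a ^ E.al = √a ^ E.θ₁ * a ^ E.θ₂ * a ^ E.θ₃ := by
    rw [Expo.al, Real.rpow_add hap, Real.rpow_add hap, Real.sqrt_eq_rpow, ← Real.rpow_mul ha0]
    ring_nf
  have eb : b ^ E.be = √b ^ E.θ₁ * b ^ E.θ₃ := by
    rw [Expo.be, Real.rpow_add hbp, Real.sqrt_eq_rpow, ← Real.rpow_mul hb0]
    ring_nf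
  have eq : E.q ^ n = ((15 / 16 : ℝ) ^ n) ^ E.θ₁ * ((8 : ℝ) ^ n) ^ E.θ₃ := by
    rw [Expo.q, mul_pow, ← Real.rpow_natCast, ← Real.rpow_natCast, ← Real.rpow_natCast,
      ← Real.rpow_natCast, ← Real.rpow_mul (by norm_num), ← Real.rpow_mul (by norm_num),
      ← Real.rpow_mul (by norm_num), ← Real.rpow_mul (by norm_num), mul_comm E.θ₁, mul_comm E.θ₃]
  calc X = X ^ E.θ₁ * X ^ E.θ₂ * X ^ E.θ₃ := e1
    _ ≤ (D * ((15 / 16) ^ n * (√a * √b))) ^ E.θ₁ * (D * a) ^ E.θ₂ * (D * (8 ^ n * (a * b))) ^ E.θ₃ := by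
      gcongr
    _ = D * E.q ^ n * (a ^ E.al * b ^ E.be) := by
      rw [Real.mul_rpow hD0 (by positivity), Real.mul_rpow hD0 (by positivity),
        Real.mul_rpow hD0 (by positivity), Real.mul_rpow (by positivity) (by positivity),
        Real.mul_rpow (by positivity) (by positivity), Real.mul_rpow (by positivity) (by positivity),
        Real.mul_rpow (by positivity) (by positivity), ea, eb, eq]
      nth_rw 4 [e2]
      ring
    _ = _ := by rw [hD]; ring

/-- The dyadic level sets of `|u|`, the bottom one collecting all small values. -/
def lev (u : ℝ × ℝ → ℝ) (m : ℕ) : Set (ℝ × ℝ) :=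
  {x | u x ≠ 0 ∧ (m = 0 ∨ 2 ^ m ≤ |u x|) ∧ |u x| < 2 ^ (m + 1)}

lemma measurableSet_lev (hu : Measurable u) (m : ℕ) : MeasurableSet (lev u m) := by
  refine (measurableSet_eq_fun hu measurable_const).compl.inter (MeasurableSet.inter ?_ ?_)
  · exact (MeasurableSet.const _).union (measurableSet_le measurable_const hu.abs)
  · exact measurableSet_lt hu.abs measurable_const

lemma sum_lev_indicator (u : ℝ × ℝ → ℝ) (M : ℕ) (x : ℝ × ℝ) :
    ∑ m ∈ Finset.range (M + 1), (lev u m).indicator u x = if |u x| < 2 ^ (M + 1) then u x else 0 := by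
  induction M with
  | zero =>
    simp only [zero_add, Finset.range_one, Finset.sum_singleton, indicator, lev, mem_ofPred_eq]
    by_cases h : u x = 0 <;> simp [h]
  | succ M ih =>
    rw [Finset.sum_range_succ, ih]
    have h1 : (2 : ℝ) ^ (M + 1) < 2 ^ (M + 1 + 1) := pow_lt_pow_right₀ (by norm_num) (by omega)
    have hp : (0 : ℝ) < 2 ^ (M + 1) := by positivity
    by_cases h2 : |u x| < 2 ^ (M + 1)
    · have hx : x ∉ lev u (M + 1) := by
        rintro ⟨_, h3 | h3, _⟩
        · omega
        · linarith
      rw [if_pos h2, if_pos (h2.trans h1), indicator_of_notMem hx, add_zero]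
    · have h4 : u x ≠ 0 := by
        intro h; rw [h, abs_zero] at h2; exact h2 hp
      by_cases h5 : |u x| < 2 ^ (M + 1 + 1)
      · have hx : x ∈ lev u (M + 1) := ⟨h4, Or.inr (not_lt.mp h2), h5⟩
        rw [if_neg h2, indicator_of_mem hx, if_pos h5, zero_add]
      · have hx : x ∉ lev u (M + 1) := fun h => h5 h.2.2
        rw [if_neg h2, indicator_of_notMem hx, if_neg h5, add_zero]

lemma exists_sum_lev (hu : Nice u) :
    ∃ M : ℕ, u = fun x => ∑ m ∈ Finset.range M, (lev u m).indicator u x := by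
  obtain ⟨K, hK0, hK⟩ := hu.exists_pos_bdd
  obtain ⟨M, hM⟩ := pow_unbounded_of_one_lt K (by norm_num : (1 : ℝ) < 2)
  refine ⟨M + 1, ?_⟩
  ext x
  rw [sum_lev_indicator, if_pos]
  exact (hK x).trans_lt (hM.trans (pow_lt_pow_right₀ (by norm_num) (by omega)))

lemma volume_real_lev_le (hu : Nice u) {r : ℝ} (hr : 0 < r) {U : Set (ℝ × ℝ)} {c A : ℝ} (hc : 1 ≤ c)
    (hA : 0 ≤ A) (hUf : volume U ≠ ⊤) (hU : volume.real U ≤ c * A) (hsupp : ∀ x ∉ U, u x = 0)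
    (hI : ∫ x, |u x| ^ r ≤ A) (m : ℕ) :
    volume (lev u m) ≠ ⊤ ∧ volume.real (lev u m) ≤ c * 2 ^ (-(r * m)) * A := by
  have hsub : lev u m ⊆ U := fun x hx => by
    by_contra h; exact hx.1 (hsupp x h)
  refine ⟨measure_ne_top_of_subset hsub hUf, ?_⟩
  rcases Nat.eq_zero_or_pos m with rfl | hm
  · simp only [Nat.cast_zero, mul_zero, neg_zero, Real.rpow_zero, mul_one]
    exact (measureReal_mono hsub hUf).trans hU
  · have h1 := mul_meas_ge_le_integral_of_nonneg (μ := volume) (f := fun x => |u x| ^ r)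
      (.of_forall fun x => by positivity) (hu.abs_rpow hr).integrable ((2 : ℝ) ^ (r * m))
    have hsub2 : lev u m ⊆ {x | (2 : ℝ) ^ (r * m) ≤ |u x| ^ r} := by
      rintro x ⟨_, h2 | h2, _⟩
      · omega
      · rw [mem_ofPred_eq, mul_comm, Real.rpow_mul (by norm_num), Real.rpow_natCast]
        exact Real.rpow_le_rpow (by positivity) h2 hr.le
    have hfin : volume {x | (2 : ℝ) ^ (r * m) ≤ |u x| ^ r} ≠ ⊤ := by
      refine measure_ne_top_of_subset (fun x hx => ?_) hUf
      by_contra h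
      rw [mem_ofPred_eq, hsupp x h, abs_zero, Real.zero_rpow hr.ne'] at hx
      exact absurd hx (not_le.mpr (by positivity))
    have h3 := measureReal_mono hsub2 hfin
    have hp : (0 : ℝ) < 2 ^ (r * m) := by positivity
    rw [Real.rpow_neg (by norm_num)]
    have h4 : volume.real (lev u m) ≤ (2 ^ (r * m))⁻¹ * A := by
      rw [← div_eq_inv_mul, le_div_iff₀ hp, mul_comm]
      exact (mul_le_mul_of_nonneg_left h3 hp.le).trans (h1.trans hI)
    refine h4.trans ?_
    have : 0 ≤ (2 ^ (r * m) : ℝ)⁻¹ * A := by positivity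
    nlinarith

lemma EE_sum {ι : Type*} (s : Finset ι) (k : ℤ) {F : ι → ℝ × ℝ → ℝ} (h : ∀ i ∈ s, Nice (F i))
    (x : ℝ × ℝ) : EE k (fun x => ∑ i ∈ s, F i x) x = ∑ i ∈ s, EE k (F i) x := by
  unfold EE
  rw [integral_finsetSum s fun i hi => ((h i hi).integrable (μ := volume)).integrableOn, Finset.mul_sum]

lemma PP_sum {ι : Type*} (s : Finset ι) (k : ℤ) {F : ι → ℝ × ℝ → ℝ} (h : ∀ i ∈ s, Nice (F i)) :
    PP k (fun x => ∑ i ∈ s, F i x) = fun x => ∑ i ∈ s, PP k (F i) x := by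
  ext x
  simp only [PP]
  rw [EE_sum s k h, EE_sum s (k + 1) h, Finset.sum_sub_distrib]

lemma TT_sum {ι : Type*} (s : Finset ι) (j : ℤ) (e : ℝ) {F : ι → ℝ × ℝ → ℝ}
    (h : ∀ i ∈ s, Nice (F i)) : TT j e (fun x => ∑ i ∈ s, F i x) = fun x => ∑ i ∈ s, TT j e (F i) x := by
  ext x
  exact Top_sum s (nice_kap _ _) e h x

lemma integral_sum_mul_sum {ι κ : Type*} (s : Finset ι) (t : Finset κ) {F : ι → ℝ × ℝ → ℝ}
    {G : κ → ℝ × ℝ → ℝ} (hF : ∀ i ∈ s, Nice (F i)) (hG : ∀ i ∈ t, Nice (G i)) :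
    ∫ x, (∑ i ∈ s, F i x) * ∑ i ∈ t, G i x = ∑ i ∈ s, ∑ j ∈ t, ∫ x, F i x * G j x := by
  simp only [Finset.sum_mul_sum]
  rw [integral_finsetSum s fun i hi =>
    (nice_sum t fun j hj => (hF i hi).mul (hG j hj)).integrable]
  refine Finset.sum_congr rfl fun i hi => ?_
  exact integral_finsetSum t fun j hj => ((hF i hi).mul (hG j hj)).integrable

lemma pairing_sum {ι κ : Type*} (s : Finset ι) (t : Finset κ) {F : ι → ℝ × ℝ → ℝ}
    {G : κ → ℝ × ℝ → ℝ} (hF : ∀ i ∈ s, Nice (F i)) (hG : ∀ i ∈ t, Nice (G i)) (j k l : ℤ) (e : ℝ) :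
    pairing j k l e (fun x => ∑ i ∈ s, F i x) (fun x => ∑ i ∈ t, G i x) =
      ∑ i ∈ s, ∑ i' ∈ t, pairing j k l e (F i) (G i') := by
  unfold pairing
  rw [PP_sum s k hF, PP_sum t l hG, TT_sum s j e fun i hi => nice_PP k (hF i hi)]
  exact integral_sum_mul_sum s t (fun i hi => nice_TT j e (nice_PP k (hF i hi)))
    fun i hi => nice_PP l (hG i hi)

lemma sum_two_rpow_le {x : ℝ} (hx : 1 < x) (M : ℕ) :
    ∑ m ∈ Finset.range M, (2 : ℝ) ^ (m + 1) * (2 ^ (-(x * m)) : ℝ) ≤ 2 * (1 - 2 ^ (1 - x))⁻¹ := by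
  have h1 : (2 : ℝ) ^ (1 - x) < 1 := Real.rpow_lt_one_of_one_lt_of_neg (by norm_num) (by linarith)
  have h := sum_pow_le_of_injOn (q := (2 : ℝ) ^ (1 - x)) (by positivity) h1 (Finset.range M) id
    (fun _ _ _ _ h => h)
  calc _ = ∑ m ∈ Finset.range M, 2 * ((2 : ℝ) ^ (1 - x)) ^ (id m) := by
        refine Finset.sum_congr rfl fun m _ => ?_
        rw [id, ← Real.rpow_natCast _ m, ← Real.rpow_mul (by norm_num), pow_succ,
          ← Real.rpow_natCast 2 m, mul_right_comm, ← Real.rpow_add (by norm_num), mul_comm]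
        ring_nf
    _ ≤ _ := by rw [← Finset.mul_sum]; gcongr

/-- Decay of the single-scale pairing below the duality line. -/
lemma abs_pairing_le (E : Expo) {r σ : ℝ} (hr : 0 < r) (hσ : 0 < σ) (hra : 1 < r * E.al)
    (hσb : 1 < σ * E.be) : ∃ C : ℝ, 0 < C ∧ ∀ {e : ℝ}, e * e = 1 → ∀ {j k l : ℤ}, k ≤ j →
    ∀ {u v : ℝ × ℝ → ℝ}, Nice u → Nice v → ∀ {U V : Set (ℝ × ℝ)}, volume U ≠ ⊤ → volume V ≠ ⊤ →
    volume.real U ≤ 100 * 8 ^ j → volume.real V ≤ 100 * 8 ^ j → (∀ x ∉ U, u x = 0) →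
    (∀ x ∉ V, v x = 0) → ∫ x, |u x| ^ r ≤ 8 ^ j → ∫ x, |v x| ^ σ ≤ 8 ^ j →
    |pairing j k l e u v| ≤ C * E.q ^ ((k - j).natAbs + (l - j).natAbs) * 8 ^ j := by
  have hw : ∀ x : ℝ, 1 < x → 0 < (1 - (2 : ℝ) ^ (1 - x))⁻¹ := fun x hx => by
    have : (2 : ℝ) ^ (1 - x) < 1 := Real.rpow_lt_one_of_one_lt_of_neg (by norm_num) (by linarith)
    exact inv_pos.mpr (by linarith)
  have hC1 := hw _ hra
  have hC2 := hw _ hσb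
  refine ⟨120 * (100 ^ E.al * 100 ^ E.be) * ((2 * (1 - 2 ^ (1 - r * E.al))⁻¹) *
    (2 * (1 - 2 ^ (1 - σ * E.be))⁻¹)), by positivity, ?_⟩
  intro e he j k l hk u v hu hv U V hUf hVf hU hV hus hvs hIu hIv
  have hq := E.q_pos
  obtain ⟨M, hM⟩ := exists_sum_lev hu
  obtain ⟨N, hN⟩ := exists_sum_lev hv
  set n := (k - j).natAbs + (l - j).natAbs
  have nu : ∀ m, Nice ((lev u m).indicator u) := fun m => hu.indicator (measurableSet_lev hu.meas m)
  have nv : ∀ m, Nice ((lev v m).indicator v) := fun m => hv.indicator (measurableSet_lev hv.meas m)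
  have hbd : ∀ (u : ℝ × ℝ → ℝ) (m : ℕ) x, |(lev u m).indicator u x| ≤ 2 ^ (m + 1) := by
    intro u m x
    by_cases h : x ∈ lev u m
    · rw [indicator_of_mem h]; exact h.2.2.le
    · rw [indicator_of_notMem h, abs_zero]; positivity
  have hj : (0 : ℝ) ≤ 8 ^ j := by positivity
  have hexp : pairing j k l e u v = ∑ m ∈ Finset.range M, ∑ m' ∈ Finset.range N,
      pairing j k l e ((lev u m).indicator u) ((lev v m').indicator v) := by
    rw [← pairing_sum _ _ (fun m _ => nu m) (fun m _ => nv m), ← hM, ← hN]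
  rw [hexp]
  refine (Finset.abs_sum_le_sum_abs _ _).trans ((Finset.sum_le_sum fun m _ =>
    Finset.abs_sum_le_sum_abs _ _).trans ?_)
  have key : ∀ m m' : ℕ, |pairing j k l e ((lev u m).indicator u) ((lev v m').indicator v)| ≤
      120 * (100 ^ E.al * 100 ^ E.be) * E.q ^ n * 8 ^ j *
        (((2 : ℝ) ^ (m + 1) * 2 ^ (-(r * E.al * m))) * (2 ^ (m' + 1) * 2 ^ (-(σ * E.be * m')))) := by
    intro m m'
    obtain ⟨f1, l1⟩ := volume_real_lev_le hu hr (by norm_num : (1 : ℝ) ≤ 100) hj hUf hU hus hIu m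
    obtain ⟨f2, l2⟩ := volume_real_lev_le hv hσ (by norm_num : (1 : ℝ) ≤ 100) hj hVf hV hvs hIv m'
    refine (abs_pairing_le_restricted E (nu m) (nv m') he hk (hbd u m) (hbd v m') f1 f2
      (fun x hx => indicator_of_notMem hx _) (fun x hx => indicator_of_notMem hx _) l1 l2).trans
      (le_of_eq ?_)
    rw [Real.mul_rpow (by norm_num) (by positivity), Real.mul_rpow (by norm_num) (by positivity),
      ← Real.rpow_mul (by norm_num), ← Real.rpow_mul (by norm_num)]
    rw [show -(r * m) * E.al = -(r * E.al * m) by ring, show -(σ * m') * E.be = -(σ * E.be * m') by ring]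
    ring
  refine (Finset.sum_le_sum fun m _ => Finset.sum_le_sum fun m' _ => key m m').trans ?_
  simp only [← Finset.mul_sum, ← Finset.sum_mul]
  have s1 := sum_two_rpow_le hra M
  have s2 := sum_two_rpow_le hσb N
  calc _ ≤ 120 * (100 ^ E.al * 100 ^ E.be) * E.q ^ n * 8 ^ j *
        ((2 * (1 - 2 ^ (1 - r * E.al))⁻¹) * (2 * (1 - 2 ^ (1 - σ * E.be))⁻¹)) := by
        refine mul_le_mul_of_nonneg_left ?_ (by positivity)
        exact mul_le_mul s1 s2 (Finset.sum_nonneg fun _ _ => by positivity) (by positivity)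
    _ = _ := by ring

lemma DD_eq_sum_PP {m k : ℤ} (hmk : m ≤ k) (hm : EE m u = u) :
    DD k u = fun x => ∑ k' ∈ Finset.Ico m k, PP k' u x := by
  ext x; rw [sum_PP hmk, hm, DD]

lemma sum_Ico_pow_natAbs_le {q : ℝ} (h0 : 0 < q) (h1 : q < 1) {m k j : ℤ} (hkj : k ≤ j) :
    ∑ k' ∈ Finset.Ico m k, q ^ (k' - j).natAbs ≤ q ^ (j - k).natAbs * (1 - q)⁻¹ := by
  have h := sum_pow_le_of_injOn h0.le h1 (Finset.Ico m k) (fun k' => (k' - k).natAbs)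
    (fun i hi j hj h => by simp only [Finset.coe_Ico, mem_Ico] at hi hj; simp only at h; omega)
  calc _ = q ^ (j - k).natAbs * ∑ k' ∈ Finset.Ico m k, q ^ (k' - k).natAbs := by
        rw [Finset.mul_sum]
        refine Finset.sum_congr rfl fun k' hk' => ?_
        rw [Finset.mem_Ico] at hk'
        rw [← pow_add]; congr 1; omega
    _ ≤ _ := by gcongr

lemma Top_const_mul_fun (k : ℝ → ℝ) (e c : ℝ) (f : ℝ × ℝ → ℝ) :
    Top k e (fun x => c * f x) = fun x => c * Top k e f x := by
  ext x; exact Top_const_mul k e c f x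

lemma EE_const_mul (k : ℤ) (c : ℝ) (f : ℝ × ℝ → ℝ) :
    EE k (fun x => c * f x) = fun x => c * EE k f x := by
  ext x; unfold EE; rw [integral_const_mul]; ring

lemma DD_const_mul (k : ℤ) (c : ℝ) (f : ℝ × ℝ → ℝ) :
    DD k (fun x => c * f x) = fun x => c * DD k f x := by
  ext x; unfold DD; rw [EE_const_mul]; ring

/-- Decay of the pairing of doubly oscillating functions at a single scale. -/
lemma abs_integral_TT_DD_mul_DD_le (E : Expo) {r σ : ℝ} (hr : 0 < r) (hσ : 0 < σ)
    (hra : 1 < r * E.al) (hσb : 1 < σ * E.be) (hq : E.q < 1) :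
    ∃ C : ℝ, 0 < C ∧ ∀ {e : ℝ}, e * e = 1 → ∀ {m j k l : ℤ}, m ≤ k → k ≤ j → m ≤ l → l ≤ j →
    ∀ {u v : ℝ × ℝ → ℝ}, Nice u → Nice v → EE m u = u → EE m v = v → ∀ {U V : Set (ℝ × ℝ)},
    volume U ≠ ⊤ → volume V ≠ ⊤ →
    volume.real U ≤ 100 * 8 ^ j → volume.real V ≤ 100 * 8 ^ j → (∀ x ∉ U, u x = 0) →
    (∀ x ∉ V, v x = 0) → ∀ {α β : ℝ}, 0 < α → 0 < β → ∫ x, |u x| ^ r ≤ α ^ r * 8 ^ j →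
    ∫ x, |v x| ^ σ ≤ β ^ σ * 8 ^ j →
    |∫ x, TT j e (DD k u) x * DD l v x| ≤
      C * E.q ^ ((j - k).natAbs + (j - l).natAbs) * (α * β) * 8 ^ j := by
  obtain ⟨C, hC, h⟩ := abs_pairing_le E hr hσ hra hσb
  have hq0 := E.q_pos
  have hq1 : 0 < (1 - E.q)⁻¹ := inv_pos.mpr (by linarith)
  refine ⟨C * ((1 - E.q)⁻¹ * (1 - E.q)⁻¹), by positivity, ?_⟩
  intro e he m j k l hmk hkj hml hlj
  have unit : ∀ {u v : ℝ × ℝ → ℝ}, Nice u → Nice v → EE m u = u → EE m v = v →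
      ∀ {U V : Set (ℝ × ℝ)}, volume U ≠ ⊤ → volume V ≠ ⊤ →
      volume.real U ≤ 100 * 8 ^ j → volume.real V ≤ 100 * 8 ^ j → (∀ x ∉ U, u x = 0) →
      (∀ x ∉ V, v x = 0) → ∫ x, |u x| ^ r ≤ 8 ^ j → ∫ x, |v x| ^ σ ≤ 8 ^ j →
      |∫ x, TT j e (DD k u) x * DD l v x| ≤
        C * ((1 - E.q)⁻¹ * (1 - E.q)⁻¹) * E.q ^ ((j - k).natAbs + (j - l).natAbs) * 8 ^ j := by
    intro u v hu hv hmu hmv U V hUf hVf hU hV hus hvs hIu hIv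
    rw [DD_eq_sum_PP hmk hmu, DD_eq_sum_PP hml hmv, TT_sum _ _ _ fun k' _ => nice_PP k' hu,
      integral_sum_mul_sum _ _ (fun k' _ => nice_TT j e (nice_PP k' hu)) fun l' _ => nice_PP l' hv]
    refine (Finset.abs_sum_le_sum_abs _ _).trans ((Finset.sum_le_sum fun m _ =>
      Finset.abs_sum_le_sum_abs _ _).trans ?_)
    have key : ∀ k' ∈ Finset.Ico m k, ∀ l' ∈ Finset.Ico m l,
        |∫ x, TT j e (PP k' u) x * PP l' v x| ≤
          C * 8 ^ j * (E.q ^ (k' - j).natAbs * E.q ^ (l' - j).natAbs) := by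
      intro k' hk' l' _
      rw [Finset.mem_Ico] at hk'
      refine (h he (by omega) hu hv hUf hVf hU hV hus hvs hIu hIv).trans (le_of_eq ?_)
      rw [pow_add]; ring
    refine (Finset.sum_le_sum fun k' hk' => Finset.sum_le_sum fun l' hl' => key k' hk' l' hl').trans ?_
    simp only [← Finset.mul_sum, ← Finset.sum_mul]
    calc _ ≤ C * 8 ^ j * ((E.q ^ (j - k).natAbs * (1 - E.q)⁻¹) * (E.q ^ (j - l).natAbs * (1 - E.q)⁻¹)) := by
          gcongr
          · exact sum_Ico_pow_natAbs_le hq0 hq hkj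
          · exact sum_Ico_pow_natAbs_le hq0 hq hlj
      _ = _ := by rw [pow_add]; ring
  intro u v hu hv hmu hmv U V hUf hVf hU hV hus hvs α β hα hβ hIu hIv
  have scale : ∀ {u : ℝ × ℝ → ℝ} {α r : ℝ}, 0 < α → ∫ x, |u x| ^ r ≤ α ^ r * 8 ^ j →
      ∫ x, |α⁻¹ * u x| ^ r ≤ 8 ^ j := by
    intro u α r hα h
    have h1 : ∀ x, |α⁻¹ * u x| ^ r = (α ^ r)⁻¹ * |u x| ^ r := by
      intro x
      rw [abs_mul, abs_of_pos (inv_pos.mpr hα), Real.mul_rpow (by positivity) (abs_nonneg _),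
        Real.inv_rpow hα.le]
    simp only [h1]
    rw [integral_const_mul, inv_mul_le_iff₀ (by positivity)]
    exact h
  have h1 := unit (hu.const_mul α⁻¹) (hv.const_mul β⁻¹) (by rw [EE_const_mul, hmu])
    (by rw [EE_const_mul, hmv]) hUf hVf hU hV (fun x hx => by rw [hus x hx, mul_zero])
    (fun x hx => by rw [hvs x hx, mul_zero]) (scale hα hIu) (scale hβ hIv)
  rw [DD_const_mul, DD_const_mul, TT, Top_const_mul_fun] at h1
  have h2 : ∀ x, α⁻¹ * Top (kap j (j + 1)) e (DD k u) x * (β⁻¹ * DD l v x) =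
      (α⁻¹ * β⁻¹) * (TT j e (DD k u) x * DD l v x) := fun x => by rw [TT]; ring
  simp only [h2] at h1
  rw [integral_const_mul, abs_mul, abs_of_pos (by positivity), ← mul_inv, inv_mul_le_iff₀ (by positivity)] at h1
  refine h1.trans (le_of_eq (by ring))

end

section

variable {F G f g u v γ : ℝ × ℝ → ℝ} {lo i : ℤ} {E : ℤ → Set (ℝ × ℝ)}

lemma DMeas.inter {k : ℤ} {S T : Set (ℝ × ℝ)} (hS : DMeas k S) (hT : DMeas k T) :
    DMeas k (S ∩ T) :=
  fun x y h hx => ⟨hS x y h hx.1, hT x y h hx.2⟩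

lemma nbr_idx_sub_sh {e : ℝ} (he : e * e = 1) {k : ℤ} {t : ℝ} (ht : |t| < 2 ^ k) (x : ℝ × ℝ) :
    nbr (idx k x) (idx k (x - sh e t)) := by
  have he1 : |e| = 1 := abs_eq_one_of_sq he
  apply nbr_of_close
  · have : x.1 - (x - sh e t).1 = e * t := by simp [sh]
    rw [this, abs_mul, he1, one_mul]
    exact ht
  · have : x.2 - (x - sh e t).2 = e * t ^ 2 := by simp [sh]
    rw [this, abs_mul, he1, one_mul, abs_pow, four_zpow]
    gcongr

/-- `T_{[a, k)} f (x)` only depends on the values of `f` on the neighbouring cubes of scale `k`. -/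
lemma Top_kap_congr {e : ℝ} (he : e * e = 1) {a k : ℤ} {x : ℝ × ℝ}
    (h : ∀ y, nbr (idx k x) (idx k y) → f y = g y) :
    Top (kap a k) e f x = Top (kap a k) e g x := by
  unfold Top
  congr 1
  ext t
  by_cases h0 : kap a k t = 0
  · simp [h0]
  · rw [h _ (nbr_idx_sub_sh he (abs_lt_of_kap_ne_zero h0) x)]

lemma Top_kap_eq_zero {e : ℝ} (he : e * e = 1) {a k : ℤ} {x : ℝ × ℝ}
    (h : ∀ y, nbr (idx k x) (idx k y) → f y = 0) : Top (kap a k) e f x = 0 := by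
  rw [Top_kap_congr (g := fun _ => 0) he h]
  simp [Top]

/-- A partition of the plane into sets `E k`, `lo ≤ k < i`, where `E k` is a union of dyadic cubes
of scale `k`. -/
structure Part (lo i : ℤ) (E : ℤ → Set (ℝ × ℝ)) : Prop where
  dm : ∀ k, DMeas k (E k)
  disj : ∀ k ∈ Finset.Ico lo i, ∀ l ∈ Finset.Ico lo i, k ≠ l → Disjoint (E k) (E l)
  cover : ∀ x, ∃ k ∈ Finset.Ico lo i, x ∈ E k

lemma Part.sum_indicator_of_mem (hE : Part lo i E) {k : ℤ} (hk : k ∈ Finset.Ico lo i) {x : ℝ × ℝ}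
    (hx : x ∈ E k) (φ : ℤ → ℝ × ℝ → ℝ) :
    ∑ l ∈ Finset.Ico lo i, (E l).indicator (φ l) x = φ k x := by
  rw [Finset.sum_eq_single_of_mem k hk, indicator_of_mem hx]
  intro l hl hlk
  exact indicator_of_notMem (fun h => (Set.disjoint_left.mp (hE.disj l hl k hk hlk)) h hx) _

lemma Part.sum_indicator (hE : Part lo i E) (f : ℝ × ℝ → ℝ) (x : ℝ × ℝ) :
    ∑ l ∈ Finset.Ico lo i, (E l).indicator f x = f x := by
  obtain ⟨k, hk, hx⟩ := hE.cover x
  exact hE.sum_indicator_of_mem hk hx fun _ => f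

lemma Part.sum_setIntegral (hE : Part lo i E) (hf : Integrable f) :
    ∑ k ∈ Finset.Ico lo i, ∫ x in E k, f x = ∫ x, f x := by
  simp_rw [← integral_indicator (hE.dm _).measurableSet]
  rw [← integral_finsetSum _ fun k _ => hf.indicator (hE.dm k).measurableSet]
  exact integral_congr_ae (.of_forall fun x => hE.sum_indicator f x)

lemma Part.sum_volume (hE : Part lo i E) {W : Set (ℝ × ℝ)} (hW : MeasurableSet W)
    (hWf : volume W ≠ ⊤) :
    ∑ k ∈ Finset.Ico lo i, volume.real (E k ∩ W) = volume.real W := by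
  have h1 : Integrable (W.indicator fun _ => (1 : ℝ)) :=
    (integrable_indicator_iff hW).mpr (integrableOn_const hWf)
  have h := hE.sum_setIntegral h1
  rw [show (∫ x, W.indicator (fun _ => (1 : ℝ)) x) = volume.real W from integral_indicator_one hW] at h
  rw [← h]
  refine Finset.sum_congr rfl fun k _ => ?_
  rw [setIntegral_indicator hW, setIntegral_const, smul_eq_mul, mul_one]

/-- On each cube of the partition the `r`-th mean of `F` is controlled. -/
def Good (lo i : ℤ) (E : ℤ → Set (ℝ × ℝ)) (r : ℝ) (F : ℝ × ℝ → ℝ) : Prop :=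
  ∀ k ∈ Finset.Ico lo i, ∀ n, cube k n ⊆ E k → ∫ x in cube k n, |F x| ^ r ≤ 288 * 8 ^ k

lemma abs_EE_le_of_good (hE : Part lo i E) {r : ℝ} (hr : 1 ≤ r) (hF : Nice F)
    (hG : Good lo i E r F) {k : ℤ} (hk : k ∈ Finset.Ico lo i) {x : ℝ × ℝ} (hx : x ∈ E k) :
    |EE k F x| ≤ 288 := by
  have h1 := abs_EE_rpow_le k hF hr x
  have h2 : EE k (fun x => |F x| ^ r) x ≤ 288 := by
    have := hG k hk (idx k x) fun y hy => hE.dm k x y (mem_cube.mp hy).symm hx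
    rw [EE, inv_mul_le_iff₀ (by positivity)]
    linarith
  by_contra h3
  push Not at h3
  have := Real.self_le_rpow_of_one_le (by linarith : 1 ≤ |EE k F x|) hr
  linarith

lemma setIntegral_rpow_le_of_good (hE : Part lo i E) {r : ℝ} (hr : 1 ≤ r) (hF : Nice F)
    (hG : Good lo i E r F) {k : ℤ} (hk : k ∈ Finset.Ico lo i) {Q : Set (ℝ × ℝ)} (hQ : DMeas k Q)
    (hQf : volume Q ≠ ⊤) (hs : ∀ x ∉ Q, F x = 0) {R : Set (ℝ × ℝ)} (hR : DMeas k R) :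
    ∫ x in E k ∩ R, |F x| ^ r ≤ 288 * volume.real (E k ∩ R ∩ Q) := by
  have hF' : Integrable (fun x => |F x| ^ r) := (hF.abs_rpow (by linarith)).integrable
  have hS : DMeas k (E k ∩ R ∩ Q) := ((hE.dm k).inter hR).inter hQ
  have hψ : Integrable (Q.indicator fun _ => (288 : ℝ)) :=
    (integrable_indicator_iff hQ.measurableSet).mpr (integrableOn_const hQf)
  have h := abs_setIntegral_le_of_cube hS hF' hψ (fun n hn => by
    rw [setIntegral_indicator hQ.measurableSet, inter_eq_left.mpr (hn.trans inter_subset_right),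
      setIntegral_const, volume_real_cube, smul_eq_mul,
      abs_of_nonneg (integral_nonneg fun x => by positivity), mul_comm]
    exact hG k hk n (hn.trans (inter_subset_left.trans inter_subset_left)))
  rw [setIntegral_indicator hQ.measurableSet, inter_assoc _ Q Q, inter_self, setIntegral_const,
    smul_eq_mul, mul_comm] at h
  refine le_trans (le_of_eq ?_) ((le_abs_self _).trans h)
  rw [← integral_indicator ((hE.dm k).inter hR).measurableSet, ← integral_indicator hS.measurableSet]
  congr 1
  ext x
  by_cases h1 : x ∈ E k ∩ R
  · by_cases h2 : x ∈ Q
    · rw [indicator_of_mem h1, indicator_of_mem (show x ∈ E k ∩ R ∩ Q from ⟨h1, h2⟩)]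
    · rw [indicator_of_mem h1, indicator_of_notMem (fun h => h2 h.2), hs x h2, abs_zero,
        Real.zero_rpow (by linarith)]
  · rw [indicator_of_notMem h1, indicator_of_notMem (fun h => h1 h.1)]

lemma sum_Ico_add_sub_le {φ : ℤ → ℝ} (h : ∀ k, 0 ≤ φ k) (lo i : ℤ) (s : ℕ) :
    ∑ j ∈ Finset.Ico (lo + s) i, φ (j - s) ≤ ∑ k ∈ Finset.Ico lo i, φ k := by
  rw [← Finset.sum_image (f := φ) (g := fun j : ℤ => j - s) (by intro a _ b _ h; simpa using h)]
  refine Finset.sum_le_sum_of_subset_of_nonneg ?_ fun k _ _ => h k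
  intro k hk
  simp only [Finset.mem_image, Finset.mem_Ico] at hk ⊢
  omega

lemma TT_DD_indicator_add {S : Set (ℝ × ℝ)} (hS : MeasurableSet S) (j k : ℤ) (e : ℝ) (hu : Nice u)
    (hv : Nice v) (x : ℝ × ℝ) :
    TT j e (DD k (S.indicator fun x => u x + v x)) x =
      TT j e (DD k (S.indicator u)) x + TT j e (DD k (S.indicator v)) x := by
  have h1 : S.indicator (fun x => u x + v x) = fun x => S.indicator u x + S.indicator v x :=
    indicator_add S u v
  have h2 : DD k (S.indicator fun x => u x + v x) =
      fun x => DD k (S.indicator u) x + DD k (S.indicator v) x := by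
    ext x; rw [h1]; exact DD_add k (hu.indicator hS) (hv.indicator hS) x
  rw [h2]
  exact Top_add (nice_kap _ _) e (nice_DD k (hu.indicator hS)) (nice_DD k (hv.indicator hS)) x

lemma abs_integral_sum_TT_DD_small_le (hE : Part lo i E) (hF : Nice F) {r : ℝ} (h1 : 1 ≤ r)
    (h2 : r ≤ 2) {e : ℝ} (he : e * e = 1) (hγ : Nice γ) {K : ℝ} (hK : ∀ x, |γ x| ≤ K)
    {W : Set (ℝ × ℝ)} (hWf : volume W ≠ ⊤) (hW : ∀ x ∉ W, γ x = 0) (s : ℕ)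
    (hb : ∀ x, |F x| ≤ (15 / 14) ^ s) :
    |∫ x, (∑ j ∈ Finset.Ico (lo + s) i, TT j e (DD (j - s) ((E (j - s)).indicator F)) x) * γ x| ≤
      230 * K * (31 / 32) ^ s * ((∫ x, |F x| ^ r) + volume.real W) := by
  have hK0 : 0 ≤ K := (abs_nonneg _).trans (hK 0)
  set A := ∫ x, |F x| ^ r with hA
  have hA0 : 0 ≤ A := integral_nonneg fun x => by positivity
  have hFr : Integrable (fun x => |F x| ^ r) := (hF.abs_rpow (by linarith)).integrable
  have hn : ∀ k, Nice ((E k).indicator F) := fun k => hF.indicator (hE.dm k).measurableSet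
  set lam : ℝ := (15 / 14) ^ s with hlam
  have hlam1 : 1 ≤ lam := one_le_pow₀ (by norm_num)
  have hN : ∀ k, N2 ((E k).indicator F) ≤ lam * ∫ x in E k, |F x| ^ r := by
    intro k
    rw [← integral_const_mul, ← integral_indicator (hE.dm k).measurableSet]
    refine integral_mono (hn k).sq.integrable
      ((hFr.const_mul lam).indicator (hE.dm k).measurableSet) fun x => ?_
    by_cases hx : x ∈ E k
    · simp only [indicator_of_mem hx]
      rcases eq_or_ne (F x) 0 with h0 | h0
      · rw [h0]; simp only [abs_zero]; rw [Real.zero_rpow (by linarith)]; simp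
      · have hp : 0 < |F x| := abs_pos.mpr h0
        have e1 : F x ^ 2 = |F x| ^ (2 - r) * |F x| ^ r := by
          rw [← Real.rpow_add hp, sub_add_cancel, ← sq_abs]; norm_cast
        rw [e1]
        refine mul_le_mul_of_nonneg_right ?_ (by positivity)
        calc |F x| ^ (2 - r) ≤ lam ^ (2 - r) := Real.rpow_le_rpow hp.le (hb x) (by linarith)
          _ ≤ lam ^ (1 : ℝ) := Real.rpow_le_rpow_of_exponent_le hlam1 (by linarith)
          _ = lam := Real.rpow_one _
    · simp only [indicator_of_notMem hx]; norm_num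
  have hAO := N2_sum_TT_le (Finset.Ico (lo + s) i) (w := fun j => DD (j - s) ((E (j - s)).indicator F))
    (a := fun j => lam * ∫ x in E (j - s), |F x| ^ r) (ρ := 102 * (7 / 8) ^ s) he (by positivity)
    (fun j _ => nice_DD _ (hn _)) (fun j _ => (N2_DD_le _ (hn _)).trans (hN _)) (fun j _ => by
      have h3 := N2_TT_DD_le (hn (j - s)) he (j - s) s
      rw [sub_add_cancel] at h3
      have h4 := hN (j - s)
      have h5 : (10400 : ℝ) * (3 / 4) ^ s ≤ (102 * (7 / 8) ^ s) ^ 2 := by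
        rw [mul_pow, ← pow_mul, mul_comm s 2, pow_mul]
        have : ((3 : ℝ) / 4) ^ s ≤ ((7 / 8) ^ 2) ^ s := by gcongr; norm_num
        have h0 : (0 : ℝ) ≤ ((7 / 8) ^ 2) ^ s := by positivity
        nlinarith
      calc _ ≤ _ := h3
        _ ≤ (10400 : ℝ) * (3 / 4) ^ s * (lam * ∫ x in E (j - s), |F x| ^ r) := by gcongr
        _ ≤ _ := mul_le_mul_of_nonneg_right h5
          (mul_nonneg (by positivity) (integral_nonneg fun x => by positivity)))
  have hsum : ∑ j ∈ Finset.Ico (lo + s) i, lam * ∫ x in E (j - s), |F x| ^ r ≤ lam * A := by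
    rw [← Finset.mul_sum]
    refine mul_le_mul_of_nonneg_left ?_ (by positivity)
    refine (sum_Ico_add_sub_le (φ := fun k => ∫ x in E k, |F x| ^ r)
      (fun k => integral_nonneg fun x => by positivity) lo i s).trans ?_
    rw [hE.sum_setIntegral hFr]
  have hSum : N2 (fun x => ∑ j ∈ Finset.Ico (lo + s) i,
      TT j e (DD (j - s) ((E (j - s)).indicator F)) x) ≤ (229 * (31 / 32) ^ s) ^ 2 * A := by
    refine hAO.trans ?_
    have h6 : (7 / 8 : ℝ) ^ s * lam ≤ ((31 / 32) ^ 2) ^ s := by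
      rw [hlam, ← mul_pow]
      exact pow_le_pow_left₀ (by norm_num) (by norm_num) s
    calc 512 * (102 * (7 / 8) ^ s) * ∑ j ∈ Finset.Ico (lo + s) i, lam * ∫ x in E (j - s), |F x| ^ r
        ≤ 512 * (102 * (7 / 8) ^ s) * (lam * A) := by gcongr
      _ = 52224 * ((7 / 8) ^ s * lam) * A := by ring
      _ ≤ 52224 * ((31 / 32) ^ 2) ^ s * A := by gcongr
      _ ≤ (229 * (31 / 32) ^ s) ^ 2 * A := by
        rw [mul_pow, ← pow_mul, ← pow_mul, mul_comm s 2]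
        refine mul_le_mul_of_nonneg_right ?_ hA0
        refine mul_le_mul_of_nonneg_right (by norm_num) (by positivity)
  have hnS : Nice (fun x => ∑ j ∈ Finset.Ico (lo + s) i,
      TT j e (DD (j - s) ((E (j - s)).indicator F)) x) :=
    nice_sum _ fun j _ => nice_TT _ _ (nice_DD _ (hn _))
  have hW2 : N2 γ ≤ K ^ 2 * volume.real W := N2_le_of_bdd hγ hK hWf hW
  refine (abs_integral_mul_le hnS hγ).trans ?_
  have s1 : √(N2 (fun x => ∑ j ∈ Finset.Ico (lo + s) i,
      TT j e (DD (j - s) ((E (j - s)).indicator F)) x)) ≤ 229 * (31 / 32) ^ s * √A := by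
    refine (Real.sqrt_le_sqrt hSum).trans (le_of_eq ?_)
    rw [Real.sqrt_mul (by positivity), Real.sqrt_sq (by positivity)]
  have s2 : √(N2 γ) ≤ K * √(volume.real W) := by
    refine (Real.sqrt_le_sqrt hW2).trans (le_of_eq ?_)
    rw [Real.sqrt_mul (by positivity), Real.sqrt_sq hK0]
  have s3 : √A * √(volume.real W) ≤ A + volume.real W := by
    have := Real.sq_sqrt hA0
    have h7 := Real.sq_sqrt (measureReal_nonneg (μ := volume) (s := W))
    nlinarith [sq_nonneg (√A - √(volume.real W)), Real.sqrt_nonneg A,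
      Real.sqrt_nonneg (volume.real W)]
  calc _ ≤ (229 * (31 / 32) ^ s * √A) * (K * √(volume.real W)) := by gcongr
    _ = 229 * K * (31 / 32) ^ s * (√A * √(volume.real W)) := by ring
    _ ≤ 230 * K * (31 / 32) ^ s * (A + volume.real W) := by gcongr; norm_num

lemma abs_integral_sum_TT_DD_large_le (hE : Part lo i E) (hF : Nice F) {e : ℝ}
    (hγ : Nice γ) {K : ℝ} (hK : ∀ x, |γ x| ≤ K) (s : ℕ) :
    |∫ x, (∑ j ∈ Finset.Ico (lo + s) i, TT j e (DD (j - s) ((E (j - s)).indicator F)) x) * γ x| ≤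
      8 * K * ∫ x, |F x| := by
  have hK0 : 0 ≤ K := (abs_nonneg _).trans (hK 0)
  have hn : ∀ k, Nice ((E k).indicator F) := fun k => hF.indicator (hE.dm k).measurableSet
  have h1 : ∀ j : ℤ, |∫ x, TT j e (DD (j - s) ((E (j - s)).indicator F)) x * γ x| ≤
      8 * K * ∫ x in E (j - s), |F x| := by
    intro j
    refine (abs_integral_mul_le_of_bdd (nice_TT j e (nice_DD _ (hn _))) hγ hK).trans ?_
    have a1 := integral_abs_TT_le j e (nice_DD (j - s) (hn (j - s)))
    have a2 : ∫ x, |DD (j - s) ((E (j - s)).indicator F) x| ≤ 2 * ∫ x in E (j - s), |F x| := by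
      have a3 := integral_abs_EE_le (j - s) (hn (j - s))
      have a4 : ∫ x, |DD (j - s) ((E (j - s)).indicator F) x| ≤
          ∫ x, (|(E (j - s)).indicator F x| + |EE (j - s) ((E (j - s)).indicator F) x|) :=
        integral_mono (nice_DD _ (hn _)).abs.integrable
          ((hn _).abs.add (nice_EE _ (hn _)).abs).integrable fun x => abs_sub _ _
      rw [integral_add (hn _).abs.integrable (nice_EE _ (hn _)).abs.integrable] at a4
      have a5 : ∫ x, |(E (j - s)).indicator F x| = ∫ x in E (j - s), |F x| := by
        rw [← integral_indicator (hE.dm _).measurableSet]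
        congr 1; ext x
        by_cases hx : x ∈ E (j - s)
        · simp only [indicator_of_mem hx]
        · simp only [indicator_of_notMem hx, abs_zero]
      linarith
    nlinarith
  simp_rw [Finset.sum_mul]
  rw [integral_finsetSum _ fun j _ => ((nice_TT j e (nice_DD _ (hn _))).mul hγ).integrable]
  refine (Finset.abs_sum_le_sum_abs _ _).trans ((Finset.sum_le_sum fun j _ => h1 j).trans ?_)
  rw [← Finset.mul_sum]
  refine mul_le_mul_of_nonneg_left ?_ (by positivity)
  refine (sum_Ico_add_sub_le (φ := fun k => ∫ x in E k, |F x|)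
    (fun k => integral_nonneg fun x => by positivity) lo i s).trans ?_
  rw [hE.sum_setIntegral hF.abs.integrable]

lemma abs_integral_sum_TT_DD_diag_le (hE : Part lo i E) (hF : Nice F) {r : ℝ} (h1 : 1 ≤ r)
    (h2 : r ≤ 2) {e : ℝ} (he : e * e = 1) (hγ : Nice γ) {K : ℝ} (hK : ∀ x, |γ x| ≤ K)
    {W : Set (ℝ × ℝ)} (hWf : volume W ≠ ⊤) (hW : ∀ x ∉ W, γ x = 0) (s : ℕ) :
    |∫ x, (∑ j ∈ Finset.Ico (lo + s) i, TT j e (DD (j - s) ((E (j - s)).indicator F)) x) * γ x| ≤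
      K * (230 * (31 / 32) ^ s + 8 * ((15 / 14) ^ (1 - r)) ^ s) *
        ((∫ x, |F x| ^ r) + volume.real W) := by
  have hK0 : 0 ≤ K := (abs_nonneg _).trans (hK 0)
  set lam : ℝ := (15 / 14) ^ s with hlam
  have hlam1 : 1 ≤ lam := one_le_pow₀ (by norm_num)
  set S : Set (ℝ × ℝ) := {x | |F x| ≤ lam} with hS
  have hSm : MeasurableSet S := measurableSet_le hF.meas.abs measurable_const
  have hFr : Integrable (fun x => |F x| ^ r) := (hF.abs_rpow (by linarith)).integrable
  have hb : Nice (S.indicator F) := hF.indicator hSm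
  have hs : Nice (Sᶜ.indicator F) := hF.indicator hSm.compl
  have hsplit : F = fun x => S.indicator F x + Sᶜ.indicator F x := by
    ext x; exact (congrFun (indicator_self_add_compl S F) x).symm
  have hnn : ∀ {u : ℝ × ℝ → ℝ}, Nice u → Nice (fun x => ∑ j ∈ Finset.Ico (lo + s) i,
      TT j e (DD (j - s) ((E (j - s)).indicator u)) x) := fun hu =>
    nice_sum _ fun j _ => nice_TT _ _ (nice_DD _ (hu.indicator (hE.dm _).measurableSet))
  have hadd : ∫ x, (∑ j ∈ Finset.Ico (lo + s) i, TT j e (DD (j - s) ((E (j - s)).indicator F)) x) * γ x =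
      (∫ x, (∑ j ∈ Finset.Ico (lo + s) i,
        TT j e (DD (j - s) ((E (j - s)).indicator (S.indicator F))) x) * γ x) +
      ∫ x, (∑ j ∈ Finset.Ico (lo + s) i,
        TT j e (DD (j - s) ((E (j - s)).indicator (Sᶜ.indicator F))) x) * γ x := by
    rw [← integral_add ((hnn hb).mul hγ).integrable ((hnn hs).mul hγ).integrable]
    congr 1; ext x
    rw [← add_mul, ← Finset.sum_add_distrib]
    congr 1
    refine Finset.sum_congr rfl fun j _ => ?_
    rw [← TT_DD_indicator_add (hE.dm _).measurableSet j (j - s) e hb hs x, ← hsplit]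
  rw [hadd]
  refine (abs_add_le _ _).trans ?_
  have t1 := abs_integral_sum_TT_DD_small_le hE hb h1 h2 he hγ hK hWf hW s (fun x => by
    by_cases hx : x ∈ S
    · rw [indicator_of_mem hx]; exact hx
    · rw [indicator_of_notMem hx, abs_zero]; positivity)
  have t2 := abs_integral_sum_TT_DD_large_le (e := e) hE hs hγ hK s
  have t3 : ∫ x, |S.indicator F x| ^ r ≤ ∫ x, |F x| ^ r := by
    refine integral_mono (hb.abs_rpow (by linarith)).integrable hFr fun x => ?_
    by_cases hx : x ∈ S
    · simp only [indicator_of_mem hx]; exact le_rfl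
    · simp only [indicator_of_notMem hx, abs_zero]
      rw [Real.zero_rpow (by linarith)]; positivity
  have t4 : ∫ x, |Sᶜ.indicator F x| ≤ ((15 / 14) ^ (1 - r)) ^ s * ∫ x, |F x| ^ r := by
    rw [← integral_const_mul]
    refine integral_mono hs.abs.integrable (hFr.const_mul _) fun x => ?_
    by_cases hx : x ∈ S
    · have : x ∉ Sᶜ := fun h => h hx
      simp only [indicator_of_notMem this, abs_zero]; positivity
    · have hx' : lam < |F x| := not_le.mp hx
      simp only [indicator_of_mem (show x ∈ Sᶜ from hx)]
      have hp : 0 < |F x| := by linarith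
      have e1 : ((15 / 14 : ℝ) ^ (1 - r)) ^ s = lam ^ (1 - r) := by
        rw [hlam, ← Real.rpow_natCast, ← Real.rpow_natCast, ← Real.rpow_mul (by norm_num),
          ← Real.rpow_mul (by norm_num), mul_comm]
      rw [e1]
      calc |F x| = |F x| ^ (1 - r) * |F x| ^ r := by
            rw [← Real.rpow_add hp, sub_add_cancel, Real.rpow_one]
        _ ≤ lam ^ (1 - r) * |F x| ^ r := by
            refine mul_le_mul_of_nonneg_right ?_ (by positivity)
            exact Real.rpow_le_rpow_of_nonpos (by linarith) hx'.le (by linarith)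
  have hA0 : 0 ≤ ∫ x, |F x| ^ r := integral_nonneg fun x => by positivity
  have hW0 : 0 ≤ volume.real W := measureReal_nonneg
  calc _ ≤ 230 * K * (31 / 32) ^ s * ((∫ x, |F x| ^ r) + volume.real W) +
        8 * K * (((15 / 14) ^ (1 - r)) ^ s * ((∫ x, |F x| ^ r) + volume.real W)) := by
        refine add_le_add (t1.trans ?_) (t2.trans ?_)
        · refine mul_le_mul_of_nonneg_left ?_ (by positivity); linarith
        · refine mul_le_mul_of_nonneg_left (t4.trans ?_) (by positivity)
          refine mul_le_mul_of_nonneg_left ?_ (by positivity); linarith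
    _ = _ := by ring

lemma sum_triangle_eq_sum_diag (lo i : ℤ) (φ : ℤ → ℤ → ℝ) :
    ∑ k ∈ Finset.Ico lo i, ∑ j ∈ Finset.Ico k i, φ k j =
      ∑ s ∈ Finset.range (i - lo).toNat, ∑ j ∈ Finset.Ico (lo + s) i, φ (j - s) j := by
  rw [Finset.sum_sigma', Finset.sum_sigma']
  refine Finset.sum_bij' (fun p _ => ⟨(p.2 - p.1).toNat, p.2⟩) (fun p _ => ⟨p.2 - p.1, p.2⟩)
    ?_ ?_ ?_ ?_ ?_
  · rintro ⟨k, j⟩ h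
    simp only [Finset.mem_sigma, Finset.mem_Ico, Finset.mem_range] at h ⊢
    omega
  · rintro ⟨k, j⟩ h
    simp only [Finset.mem_sigma, Finset.mem_Ico, Finset.mem_range] at h ⊢
    omega
  · rintro ⟨k, j⟩ h
    simp only [Finset.mem_sigma, Finset.mem_Ico] at h
    have : j - ((j - k).toNat : ℤ) = k := by omega
    simp only [this]
  · rintro ⟨k, j⟩ h
    simp
  · rintro ⟨k, j⟩ h
    simp only [Finset.mem_sigma, Finset.mem_Ico] at h
    have : j - ((j - k).toNat : ℤ) = k := by omega
    simp only [this]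

/-- The contribution of the cancellative parts `D_k F_k` against a bounded function. -/
lemma abs_sum_integral_TT_DD_mul_bdd_le {r : ℝ} (h1 : 1 < r) (h2 : r ≤ 2) :
    ∃ C : ℝ, 0 < C ∧ ∀ {lo i : ℤ} {E : ℤ → Set (ℝ × ℝ)}, Part lo i E → ∀ {F γ : ℝ × ℝ → ℝ},
    Nice F → Nice γ → ∀ {e : ℝ}, e * e = 1 → ∀ {K : ℝ}, (∀ x, |γ x| ≤ K) → ∀ {W : Set (ℝ × ℝ)},
    volume W ≠ ⊤ → (∀ x ∉ W, γ x = 0) →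
    |∑ k ∈ Finset.Ico lo i, ∑ j ∈ Finset.Ico k i, ∫ x, TT j e (DD k ((E k).indicator F)) x * γ x| ≤
      C * K * ((∫ x, |F x| ^ r) + volume.real W) := by
  have hq : (15 / 14 : ℝ) ^ (1 - r) < 1 :=
    Real.rpow_lt_one_of_one_lt_of_neg (by norm_num) (by linarith)
  have hq0 : (0 : ℝ) < (15 / 14 : ℝ) ^ (1 - r) := by positivity
  refine ⟨230 * (1 - 31 / 32)⁻¹ + 8 * (1 - (15 / 14 : ℝ) ^ (1 - r))⁻¹, ?_, ?_⟩
  · have : 0 < (1 - (15 / 14 : ℝ) ^ (1 - r))⁻¹ := inv_pos.mpr (by linarith)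
    positivity
  intro lo i E hE F γ hF hγ e he K hK W hWf hW
  have hK0 : 0 ≤ K := (abs_nonneg _).trans (hK 0)
  have hA0 : 0 ≤ ∫ x, |F x| ^ r := integral_nonneg fun x => by positivity
  have hW0 : 0 ≤ volume.real W := measureReal_nonneg
  rw [sum_triangle_eq_sum_diag lo i
    fun k j => ∫ x, TT j e (DD k ((E k).indicator F)) x * γ x]
  refine (Finset.abs_sum_le_sum_abs _ _).trans ?_
  have h3 : ∀ s ∈ Finset.range (i - lo).toNat,
      |∑ j ∈ Finset.Ico (lo + s) i, ∫ x, TT j e (DD (j - s) ((E (j - s)).indicator F)) x * γ x| ≤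
      K * (230 * (31 / 32) ^ s + 8 * ((15 / 14) ^ (1 - r)) ^ s) *
        ((∫ x, |F x| ^ r) + volume.real W) := by
    intro s _
    have := abs_integral_sum_TT_DD_diag_le hE hF h1.le h2 he hγ hK hWf hW s
    simp_rw [Finset.sum_mul] at this
    rwa [integral_finsetSum _ fun j _ =>
      ((nice_TT j e (nice_DD _ (hF.indicator (hE.dm _).measurableSet))).mul hγ).integrable] at this
  refine (Finset.sum_le_sum h3).trans ?_
  rw [← Finset.sum_mul, ← Finset.mul_sum, Finset.sum_add_distrib, ← Finset.mul_sum,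
    ← Finset.mul_sum]
  have s1 := sum_pow_le_of_injOn (q := 31 / 32) (by norm_num) (by norm_num)
    (Finset.range (i - lo).toNat) id (injOn_id _)
  have s2 := sum_pow_le_of_injOn hq0.le hq (Finset.range (i - lo).toNat) id (injOn_id _)
  simp only [id] at s1 s2
  rw [mul_comm K]
  gcongr

end

section

variable {F G f g u v γ : ℝ × ℝ → ℝ} {lo i : ℤ} {E E' : ℤ → Set (ℝ × ℝ)}

lemma setLIntegral_indicator_one_eq {V S : Set (ℝ × ℝ)} (hV : MeasurableSet V) :
    ∫⁻ y in S, V.indicator 1 y = volume (S ∩ V) := by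
  rw [lintegral_indicator_one hV, Measure.restrict_apply hV, inter_comm]

lemma triAvg_eq_toReal (k : ℤ) {V : Set (ℝ × ℝ)} (hV : MeasurableSet V) (x : ℝ × ℝ) :
    (8 ^ k)⁻¹ * volume.real (tri k (idx k x) ∩ V) =
      ((ENNReal.ofReal (8 ^ k))⁻¹ * ∫⁻ y in tri k (idx k x), V.indicator 1 y).toReal := by
  rw [setLIntegral_indicator_one_eq hV, ENNReal.toReal_mul, ENNReal.toReal_inv,
    ENNReal.toReal_ofReal (by positivity)]
  rfl

lemma measurable_triAvg (k : ℤ) (V : Set (ℝ × ℝ)) :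
    Measurable fun x => (ENNReal.ofReal (8 ^ k))⁻¹ * ∫⁻ y in tri k (idx k x), V.indicator 1 y :=
  (measurable_of_countable fun n : ℤ × ℤ =>
    (ENNReal.ofReal (8 ^ k))⁻¹ * ∫⁻ y in tri k n, V.indicator 1 y).comp (measurable_idx k)

lemma lintegral_triAvg (k : ℤ) {V : Set (ℝ × ℝ)} (hV : MeasurableSet V) :
    ∫⁻ x, (ENNReal.ofReal (8 ^ k))⁻¹ * ∫⁻ y in tri k (idx k x), V.indicator 1 y =
      9 * volume V := by
  rw [lintegral_tri_avg, lintegral_indicator_one hV]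

lemma integrable_triAvg (k : ℤ) {V : Set (ℝ × ℝ)} (hV : MeasurableSet V) (hVf : volume V ≠ ⊤) :
    Integrable fun x => (8 ^ k)⁻¹ * volume.real (tri k (idx k x) ∩ V) := by
  simp_rw [triAvg_eq_toReal k hV]
  refine integrable_toReal_of_lintegral_ne_top (measurable_triAvg k V).aemeasurable ?_
  rw [lintegral_triAvg k hV]
  exact ENNReal.mul_ne_top (by norm_num) hVf

lemma integral_triAvg (k : ℤ) {V : Set (ℝ × ℝ)} (hV : MeasurableSet V) (hVf : volume V ≠ ⊤) :
    ∫ x, (8 ^ k)⁻¹ * volume.real (tri k (idx k x) ∩ V) = 9 * volume.real V := by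
  simp_rw [triAvg_eq_toReal k hV]
  rw [integral_toReal (measurable_triAvg k V).aemeasurable, lintegral_triAvg k hV,
    ENNReal.toReal_mul]
  · rfl
  · refine ae_lt_top (measurable_triAvg k V) ?_
    rw [lintegral_triAvg k hV]
    exact ENNReal.mul_ne_top (by norm_num) hVf

/-- The off-diagonal estimate with equal normalization of both functions. -/
lemma abs_integral_TT_DD_mul_DD_le_of_small (X : Expo) {r σ : ℝ} (hr : 1 ≤ r) (hσ : 1 ≤ σ)
    (hrσ : 1 ≤ 1 / r + 1 / σ) (hra : 1 < r * X.al) (hσb : 1 < σ * X.be) (hq : X.q < 1) :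
    ∃ C : ℝ, 0 < C ∧ ∀ {e : ℝ}, e * e = 1 → ∀ {m j k l : ℤ}, m ≤ k → k ≤ j → m ≤ l → l ≤ j →
    ∀ {u v : ℝ × ℝ → ℝ}, Nice u → Nice v → EE m u = u → EE m v = v → ∀ {U V : Set (ℝ × ℝ)},
    volume U ≠ ⊤ → volume V ≠ ⊤ →
    volume.real U ≤ 100 * 8 ^ j → volume.real V ≤ 100 * 8 ^ j → (∀ x ∉ U, u x = 0) →
    (∀ x ∉ V, v x = 0) → ∀ {w : ℝ}, 0 ≤ w → w ≤ 30000 * 8 ^ j → ∫ x, |u x| ^ r ≤ w →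
    ∫ x, |v x| ^ σ ≤ w →
    |∫ x, TT j e (DD k u) x * DD l v x| ≤ C * X.q ^ ((j - k).natAbs + (j - l).natAbs) * w := by
  obtain ⟨C, hC, h⟩ := abs_integral_TT_DD_mul_DD_le X (by linarith : 0 < r) (by linarith : 0 < σ)
    hra hσb hq
  refine ⟨C * 30001, by positivity, ?_⟩
  intro e he m j k l hmk hkj hml hlj u v hu hv hmu hmv U V hUf hVf hU hV hus hvs w hw0 hw hIu hIv
  have h8 : (0 : ℝ) < 8 ^ j := by positivity
  have hqn : 0 < X.q ^ ((j - k).natAbs + (j - l).natAbs) := pow_pos X.q_pos _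
  set c := C * 30001 * X.q ^ ((j - k).natAbs + (j - l).natAbs) with hc
  have hc0 : 0 < c := by positivity
  have key : ∀ ε : ℝ, 0 < ε → ε ≤ 1 →
      |∫ x, TT j e (DD k u) x * DD l v x| ≤ c * (w + ε * 8 ^ j) := by
    intro ε hε hε1
    set y := w / 8 ^ j + ε with hy
    have hy0 : 0 < y := by positivity
    have hyle : y ≤ 30001 := by
      have : w / 8 ^ j ≤ 30000 := by rw [div_le_iff₀ h8]; linarith
      linarith
    have hyw : y * 8 ^ j = w + ε * 8 ^ j := by rw [hy]; field_simp
    have hyw' : w ≤ y * 8 ^ j := by rw [hyw]; nlinarith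
    have := h he hmk hkj hml hlj hu hv hmu hmv hUf hVf hU hV hus hvs
      (α := y ^ (1 / r)) (β := y ^ (1 / σ)) (by positivity) (by positivity)
      (by rw [← Real.rpow_mul hy0.le, one_div_mul_cancel (by linarith), Real.rpow_one]; linarith)
      (by rw [← Real.rpow_mul hy0.le, one_div_mul_cancel (by linarith), Real.rpow_one]; linarith)
    refine this.trans ?_
    have hpow : y ^ (1 / r) * y ^ (1 / σ) ≤ 30001 * y := by
      rw [← Real.rpow_add hy0]
      have hr1 : 1 / r ≤ 1 := by rw [div_le_one (by linarith)]; exact hr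
      have hs1 : 1 / σ ≤ 1 := by rw [div_le_one (by linarith)]; exact hσ
      calc y ^ (1 / r + 1 / σ) = y ^ (1 / r + 1 / σ - 1) * y := by
            rw [Real.rpow_sub_one hy0.ne']; field_simp
        _ ≤ (30001 : ℝ) ^ (1 / r + 1 / σ - 1) * y := by
            refine mul_le_mul_of_nonneg_right ?_ hy0.le
            exact Real.rpow_le_rpow hy0.le hyle (by linarith)
        _ ≤ (30001 : ℝ) ^ (1 : ℝ) * y := by
            refine mul_le_mul_of_nonneg_right ?_ hy0.le
            exact Real.rpow_le_rpow_of_exponent_le (by norm_num) (by linarith)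
        _ = 30001 * y := by rw [Real.rpow_one]
    rw [← hyw]
    calc _ ≤ C * X.q ^ ((j - k).natAbs + (j - l).natAbs) * (30001 * y) * 8 ^ j := by gcongr
      _ = _ := by rw [hc]; ring
  refine le_of_forall_pos_le_add fun δ hδ => ?_
  have h1 := key (min 1 (δ / (c * 8 ^ j))) (by positivity) (min_le_left _ _)
  have h2 : min 1 (δ / (c * 8 ^ j)) * (c * 8 ^ j) ≤ δ := by
    rw [← le_div_iff₀ (by positivity)]; exact min_le_right _ _
  nlinarith

lemma integral_abs_rpow_indicator {S : Set (ℝ × ℝ)} (hS : MeasurableSet S) {r : ℝ} (hr : 0 < r)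
    (f : ℝ × ℝ → ℝ) : ∫ x, |S.indicator f x| ^ r = ∫ x in S, |f x| ^ r := by
  rw [← integral_indicator hS]
  congr 1; ext x
  by_cases hx : x ∈ S
  · simp only [indicator_of_mem hx]
  · simp only [indicator_of_notMem hx, abs_zero]; rw [Real.zero_rpow hr.ne']

/-- Localizing `⟨T_j D_k u, D_l v⟩` to a cube of scale `j + 1`. -/
lemma setIntegral_DD_mul_TT_DD {e : ℝ} (he : e * e = 1) {j k l : ℤ} (hk : k ≤ j) (hl : l ≤ j)
    (hu : Nice u) (hv : Nice v) (n : ℤ × ℤ) :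
    ∫ x in cube (j + 1) n, DD k u x * TT j (-e) (DD l v) x =
      ∫ x, TT j e (DD k ((cube (j + 1) n).indicator u)) x *
        DD l ((tri (j + 1) n).indicator v) x := by
  have he' : -e * -e = 1 := by rw [neg_mul_neg, he]
  have hR := measurableSet_cube (j + 1) n
  rw [show TT j e = Top (kap j (j + 1)) e from rfl, Top_adjoint (nice_kap _ _) e
    (nice_DD k (hu.indicator hR)) (nice_DD l (hv.indicator (measurableSet_tri _ _))),
    ← integral_indicator hR, DD_indicator (dMeas_cube (by omega) n),
    DD_indicator (dMeas_tri (by omega) n)]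
  congr 1; ext x
  by_cases hx : x ∈ cube (j + 1) n
  · rw [indicator_of_mem hx, indicator_of_mem hx]
    congr 1
    refine Top_kap_congr he' fun y hy => ?_
    rw [mem_cube.mp hx] at hy
    rw [indicator_of_mem (show y ∈ tri (j + 1) n from nbr_symm hy)]
  · rw [indicator_of_notMem hx, indicator_of_notMem hx, zero_mul]

/-- A single off-diagonal term of the double stopping-time decomposition. -/
lemma abs_integral_TT_DD_part_mul_DD_part_le (X : Expo) {r σ : ℝ} (hr : 1 ≤ r) (hσ : 1 ≤ σ)
    (hrσ : 1 ≤ 1 / r + 1 / σ) (hra : 1 < r * X.al) (hσb : 1 < σ * X.be) (hq : X.q < 1) :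
    ∃ C : ℝ, 0 < C ∧ ∀ {e : ℝ}, e * e = 1 → ∀ {lo i : ℤ} {E E' : ℤ → Set (ℝ × ℝ)}, Part lo i E →
    Part lo i E' → ∀ {F G : ℝ × ℝ → ℝ}, Nice F → Nice G → EE lo F = F → EE lo G = G →
    Good lo i E r F → Good lo i E' σ G → ∀ {Q W : Set (ℝ × ℝ)}, DMeas i Q → DMeas i W →
    volume Q ≠ ⊤ → volume W ≠ ⊤ → (∀ x ∉ Q, F x = 0) → (∀ x ∉ W, G x = 0) →
    ∀ {j k l : ℤ}, lo ≤ k → k ≤ j → lo ≤ l → l ≤ j → j < i →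
    |∫ x, TT j e (DD k ((E k).indicator F)) x * DD l ((E' l).indicator G) x| ≤
      C * X.q ^ ((j - k).natAbs + (j - l).natAbs) *
        (volume.real (E k ∩ Q) + volume.real (E' l ∩ W)) := by
  obtain ⟨C, hC, h⟩ := abs_integral_TT_DD_mul_DD_le_of_small X hr hσ hrσ hra hσb hq
  refine ⟨C * 288 * 9, by positivity, ?_⟩
  intro e he lo i E E' hE hE' F G hF hG hFm hGm hgF hgG Q W hQ hW hQf hWf hFs hGs j k l hk hkj hl hlj hji
  have hEm := (hE.dm k).measurableSet
  have hEm' := (hE'.dm l).measurableSet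
  have hFk : Nice ((E k).indicator F) := hF.indicator hEm
  have hGl : Nice ((E' l).indicator G) := hG.indicator hEm'
  have hV : MeasurableSet (E' l ∩ W) := hEm'.inter hW.measurableSet
  have hVf : volume (E' l ∩ W) ≠ ⊤ := measure_ne_top_of_subset inter_subset_right hWf
  have hU : MeasurableSet (E k ∩ Q) := hEm.inter hQ.measurableSet
  have hUf : volume (E k ∩ Q) ≠ ⊤ := measure_ne_top_of_subset inter_subset_right hQf
  set c := C * X.q ^ ((j - k).natAbs + (j - l).natAbs) * 288 with hc
  have hc0 : 0 < c := by have := pow_pos X.q_pos ((j - k).natAbs + (j - l).natAbs); positivity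
  rw [show TT j e = Top (kap j (j + 1)) e from rfl,
    Top_adjoint (nice_kap _ _) e (nice_DD k hFk) (nice_DD l hGl)]
  have hi1 : Integrable ((E k ∩ Q).indicator fun _ => (1 : ℝ)) :=
    (integrable_indicator_iff hU).mpr (integrableOn_const hUf)
  have hi2 := integrable_triAvg (j + 1) hV hVf
  have hfin := abs_setIntegral_le_of_cube (dMeas_univ (j + 1))
    (φ := fun x => DD k ((E k).indicator F) x * TT j (-e) (DD l ((E' l).indicator G)) x)
    (ψ := fun x => c * ((E k ∩ Q).indicator (fun _ => (1 : ℝ)) x +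
      (8 ^ (j + 1))⁻¹ * volume.real (tri (j + 1) (idx (j + 1) x) ∩ (E' l ∩ W))))
    ((nice_DD k hFk).mul (nice_TT j (-e) (nice_DD l hGl))).integrable
    ((hi1.add hi2).const_mul c) (fun n _ => by
      rw [setIntegral_DD_mul_TT_DD he hkj hlj hFk hGl n, integral_const_mul,
        integral_add hi1.integrableOn hi2.integrableOn]
      have hR := measurableSet_cube (j + 1) n
      have e1 : ∫ x in cube (j + 1) n, (E k ∩ Q).indicator (fun _ => (1 : ℝ)) x =
          volume.real (E k ∩ cube (j + 1) n ∩ Q) := by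
        rw [setIntegral_indicator hU, setIntegral_const, smul_eq_mul, mul_one]
        congr 1; ext x; simp only [mem_inter_iff]; tauto
      have e2 : ∫ x in cube (j + 1) n,
          (8 ^ (j + 1))⁻¹ * volume.real (tri (j + 1) (idx (j + 1) x) ∩ (E' l ∩ W)) =
          volume.real (E' l ∩ tri (j + 1) n ∩ W) := by
        have : ∀ x ∈ cube (j + 1) n,
            (8 ^ (j + 1))⁻¹ * volume.real (tri (j + 1) (idx (j + 1) x) ∩ (E' l ∩ W)) =
            ((8 : ℝ) ^ (j + 1))⁻¹ * volume.real (E' l ∩ tri (j + 1) n ∩ W) := fun x hx => by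
          rw [mem_cube.mp hx]
          congr 2; ext x; simp only [mem_inter_iff]; tauto
        rw [setIntegral_congr_fun hR this, setIntegral_const, volume_real_cube, smul_eq_mul,
          mul_inv_cancel_left₀ (by positivity)]
      rw [e1, e2]
      have b1 : volume.real (E k ∩ cube (j + 1) n ∩ Q) ≤ 8 * 8 ^ j := by
        refine (measureReal_mono (inter_subset_left.trans inter_subset_right)
          (volume_cube_ne_top _ _)).trans (le_of_eq ?_)
        rw [volume_real_cube, zpow_add_one₀ (by norm_num)]; ring
      have b2 : volume.real (E' l ∩ tri (j + 1) n ∩ W) ≤ 72 * 8 ^ j := by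
        refine (measureReal_mono (inter_subset_left.trans inter_subset_right)
          (volume_tri_ne_top _ _)).trans (le_of_eq ?_)
        rw [volume_real_tri, zpow_add_one₀ (by norm_num)]; ring
      have p1 : 0 ≤ volume.real (E k ∩ cube (j + 1) n ∩ Q) := measureReal_nonneg
      have p2 : 0 ≤ volume.real (E' l ∩ tri (j + 1) n ∩ W) := measureReal_nonneg
      have h8 : (0 : ℝ) < 8 ^ j := by positivity
      rw [indicator_indicator, indicator_indicator, inter_comm (cube _ _), inter_comm (tri _ _)]
      have := h he hk hkj hl hlj
        (u := (E k ∩ cube (j + 1) n).indicator F) (v := (E' l ∩ tri (j + 1) n).indicator G)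
        (U := cube (j + 1) n) (V := tri (j + 1) n)
        (hF.indicator (hEm.inter hR)) (hG.indicator (hEm'.inter (measurableSet_tri _ _)))
        (by rw [EE_indicator, hFm]
            exact ((hE.dm k).mono hk).inter (dMeas_cube (by omega) n))
        (by rw [EE_indicator, hGm]
            exact ((hE'.dm l).mono hl).inter (dMeas_tri (by omega) n))
        (volume_cube_ne_top _ _) (volume_tri_ne_top _ _)
        (by rw [volume_real_cube, zpow_add_one₀ (by norm_num)]; nlinarith)
        (by rw [volume_real_tri, zpow_add_one₀ (by norm_num)]; nlinarith)
        (fun x hx => indicator_of_notMem (fun h => hx h.2) _)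
        (fun x hx => indicator_of_notMem (fun h => hx h.2) _)
        (w := 288 * (volume.real (E k ∩ cube (j + 1) n ∩ Q) +
          volume.real (E' l ∩ tri (j + 1) n ∩ W))) (by positivity) (by nlinarith)
        (by
          rw [integral_abs_rpow_indicator (hEm.inter hR) (by linarith)]
          have := setIntegral_rpow_le_of_good hE hr hF hgF (Finset.mem_Ico.mpr ⟨hk, by omega⟩)
            (hQ.mono (by omega)) hQf hFs (dMeas_cube (by omega : k ≤ j + 1) n)
          linarith)
        (by
          rw [integral_abs_rpow_indicator (hEm'.inter (measurableSet_tri _ _)) (by linarith)]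
          have := setIntegral_rpow_le_of_good hE' hσ hG hgG (Finset.mem_Ico.mpr ⟨hl, by omega⟩)
            (hW.mono (by omega)) hWf hGs (dMeas_tri (by omega : l ≤ j + 1) n)
          linarith)
      refine this.trans (le_of_eq ?_)
      rw [hc]; ring)
  rw [setIntegral_univ, setIntegral_univ, integral_const_mul, integral_add hi1 hi2,
    integral_triAvg (j + 1) hV hVf,
    show (∫ x, (E k ∩ Q).indicator (fun _ => (1 : ℝ)) x) = volume.real (E k ∩ Q) from
      integral_indicator_one hU] at hfin
  refine hfin.trans ?_
  have p1 : 0 ≤ volume.real (E k ∩ Q) := measureReal_nonneg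
  calc _ ≤ c * (9 * (volume.real (E k ∩ Q) + volume.real (E' l ∩ W))) := by
        refine mul_le_mul_of_nonneg_left ?_ hc0.le; linarith
    _ = _ := by rw [hc]; ring

lemma sum_triple_pow_le {q : ℝ} (h0 : 0 ≤ q) (h1 : q < 1) (s : Finset ℤ) {x y : ℤ → ℝ}
    (hx : ∀ k, 0 ≤ x k) (hy : ∀ k, 0 ≤ y k) :
    ∑ k ∈ s, ∑ j ∈ s, ∑ l ∈ s, q ^ ((j - k).natAbs + (j - l).natAbs) * (x k + y l) ≤
      (2 * (1 - q)⁻¹) ^ 2 * (∑ k ∈ s, x k + ∑ l ∈ s, y l) := by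
  set A := 2 * (1 - q)⁻¹ with hA
  have hA0 : 0 ≤ A := by have := inv_pos.mpr (sub_pos.mpr h1); positivity
  have hs : ∀ j, ∑ l ∈ s, q ^ (j - l).natAbs ≤ A := fun j => by
    refine (Finset.sum_congr rfl fun l _ => ?_).trans_le (sum_pow_natAbs_le h0 h1 s j)
    rw [← Int.natAbs_neg, neg_sub]
  have hs' : ∀ k, ∑ j ∈ s, q ^ (j - k).natAbs ≤ A := fun k => sum_pow_natAbs_le h0 h1 s k
  have e1 : ∑ k ∈ s, ∑ j ∈ s, ∑ l ∈ s, q ^ ((j - k).natAbs + (j - l).natAbs) * (x k + y l) =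
      ∑ k ∈ s, x k * ∑ j ∈ s, q ^ (j - k).natAbs * ∑ l ∈ s, q ^ (j - l).natAbs +
      ∑ l ∈ s, y l * ∑ j ∈ s, q ^ (j - l).natAbs * ∑ k ∈ s, q ^ (j - k).natAbs := by
    have e2 : ∑ l ∈ s, y l * ∑ j ∈ s, q ^ (j - l).natAbs * ∑ k ∈ s, q ^ (j - k).natAbs =
        ∑ k ∈ s, ∑ j ∈ s, ∑ l ∈ s, q ^ ((j - k).natAbs + (j - l).natAbs) * y l := by
      simp_rw [Finset.mul_sum]
      rw [Finset.sum_comm]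
      refine Eq.trans ?_ Finset.sum_comm
      refine Finset.sum_congr rfl fun a _ => ?_
      rw [Finset.sum_comm]
      refine Finset.sum_congr rfl fun b _ => Finset.sum_congr rfl fun c _ => ?_
      rw [pow_add]; ring
    rw [e2, ← Finset.sum_add_distrib]
    refine Finset.sum_congr rfl fun k _ => ?_
    rw [Finset.mul_sum, ← Finset.sum_add_distrib]
    refine Finset.sum_congr rfl fun j _ => ?_
    rw [Finset.mul_sum, Finset.mul_sum, ← Finset.sum_add_distrib]
    refine Finset.sum_congr rfl fun l _ => ?_
    rw [pow_add]; ring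
  have e3 : ∀ k, ∑ j ∈ s, q ^ (j - k).natAbs * ∑ l ∈ s, q ^ (j - l).natAbs ≤ A ^ 2 := fun k => by
    calc _ ≤ ∑ j ∈ s, q ^ (j - k).natAbs * A :=
          Finset.sum_le_sum fun j _ => mul_le_mul_of_nonneg_left (hs j) (by positivity)
      _ = (∑ j ∈ s, q ^ (j - k).natAbs) * A := by rw [Finset.sum_mul]
      _ ≤ A * A := mul_le_mul_of_nonneg_right (hs' k) hA0
      _ = A ^ 2 := by ring
  rw [e1, mul_add, Finset.mul_sum, Finset.mul_sum]
  refine add_le_add (Finset.sum_le_sum fun k _ => ?_) (Finset.sum_le_sum fun k _ => ?_)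
  · rw [mul_comm]; exact mul_le_mul_of_nonneg_right (e3 k) (hx k)
  · rw [mul_comm]; exact mul_le_mul_of_nonneg_right (e3 k) (hy k)

/-- The contribution of the cancellative parts `D_k F_k` against the cancellative parts
`D_l G_l`. -/
lemma abs_sum_integral_TT_DD_mul_DD_le (X : Expo) {r σ : ℝ} (hr : 1 ≤ r) (hσ : 1 ≤ σ)
    (hrσ : 1 ≤ 1 / r + 1 / σ) (hra : 1 < r * X.al) (hσb : 1 < σ * X.be) (hq : X.q < 1) :
    ∃ C : ℝ, 0 < C ∧ ∀ {e : ℝ}, e * e = 1 → ∀ {lo i : ℤ} {E E' : ℤ → Set (ℝ × ℝ)}, Part lo i E →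
    Part lo i E' → ∀ {F G : ℝ × ℝ → ℝ}, Nice F → Nice G → EE lo F = F → EE lo G = G →
    Good lo i E r F → Good lo i E' σ G → ∀ {Q W : Set (ℝ × ℝ)}, DMeas i Q → DMeas i W →
    volume Q ≠ ⊤ → volume W ≠ ⊤ → (∀ x ∉ Q, F x = 0) → (∀ x ∉ W, G x = 0) →
    (∀ k l, lo ≤ k → k < l → l < i → ∀ x ∈ E' l, ∀ y ∈ E k, ¬ nbr (idx l x) (idx l y)) →
    |∑ k ∈ Finset.Ico lo i, ∑ j ∈ Finset.Ico k i, ∑ l ∈ Finset.Ico lo i,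
      ∫ x, TT j e (DD k ((E k).indicator F)) x * DD l ((E' l).indicator G) x| ≤
      C * (volume.real Q + volume.real W) := by
  obtain ⟨C, hC, h⟩ := abs_integral_TT_DD_part_mul_DD_part_le X hr hσ hrσ hra hσb hq
  have hinv : 0 < (1 - X.q)⁻¹ := inv_pos.mpr (by linarith)
  refine ⟨C * (2 * (1 - X.q)⁻¹) ^ 2, by positivity, ?_⟩
  intro e he lo i E E' hE hE' F G hF hG hFm hGm hgF hgG Q W hQ hW hQf hWf hFs hGs hsep
  have hq0 := X.q_pos
  set x : ℤ → ℝ := fun k => volume.real (E k ∩ Q) with hx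
  set y : ℤ → ℝ := fun l => volume.real (E' l ∩ W) with hy
  have hx0 : ∀ k, 0 ≤ x k := fun k => measureReal_nonneg
  have hy0 : ∀ k, 0 ≤ y k := fun k => measureReal_nonneg
  have hterm : ∀ k ∈ Finset.Ico lo i, ∀ j ∈ Finset.Ico k i, ∀ l ∈ Finset.Ico lo i,
      |∫ x, TT j e (DD k ((E k).indicator F)) x * DD l ((E' l).indicator G) x| ≤
      C * (X.q ^ ((j - k).natAbs + (j - l).natAbs) * (x k + y l)) := by
    intro k hk j hj l hl
    rw [Finset.mem_Ico] at hk hj hl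
    rcases le_or_gt l j with hlj | hlj
    · rw [← mul_assoc]
      exact h he hE hE' hF hG hFm hGm hgF hgG hQ hW hQf hWf hFs hGs hk.1 hj.1 hl.1 hlj hj.2
    · have hz : ∀ z, TT j e (DD k ((E k).indicator F)) z * DD l ((E' l).indicator G) z = 0 := by
        intro z
        rw [DD_indicator (hE'.dm l), DD_indicator (hE.dm k)]
        by_cases hzE : z ∈ E' l
        · rw [show TT j e = Top (kap j (j + 1)) e from rfl, Top_kap_eq_zero he, zero_mul]
          intro w hw
          refine indicator_of_notMem (fun hwE => ?_) _
          exact hsep k l hk.1 (by omega) hl.2 z hzE w hwE (nbr_mono (by omega) hw)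
        · rw [indicator_of_notMem hzE, mul_zero]
      simp only [hz, integral_zero, abs_zero]
      have := hx0 k; have := hy0 l
      positivity
  have hsub : ∀ k ∈ Finset.Ico lo i, Finset.Ico k i ⊆ Finset.Ico lo i := fun k hk =>
    Finset.Ico_subset_Ico (Finset.mem_Ico.mp hk).1 le_rfl
  calc _ ≤ ∑ k ∈ Finset.Ico lo i, ∑ j ∈ Finset.Ico k i, ∑ l ∈ Finset.Ico lo i,
        C * (X.q ^ ((j - k).natAbs + (j - l).natAbs) * (x k + y l)) := by
        refine (Finset.abs_sum_le_sum_abs _ _).trans (Finset.sum_le_sum fun k hk => ?_)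
        refine (Finset.abs_sum_le_sum_abs _ _).trans (Finset.sum_le_sum fun j hj => ?_)
        exact (Finset.abs_sum_le_sum_abs _ _).trans (Finset.sum_le_sum fun l hl => hterm k hk j hj l hl)
    _ ≤ ∑ k ∈ Finset.Ico lo i, ∑ j ∈ Finset.Ico lo i, ∑ l ∈ Finset.Ico lo i,
        C * (X.q ^ ((j - k).natAbs + (j - l).natAbs) * (x k + y l)) := by
        refine Finset.sum_le_sum fun k hk => ?_
        refine Finset.sum_le_sum_of_subset_of_nonneg (hsub k hk) fun j _ _ => ?_
        refine Finset.sum_nonneg fun l _ => ?_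
        have := hx0 k; have := hy0 l
        positivity
    _ ≤ C * ((2 * (1 - X.q)⁻¹) ^ 2 * (∑ k ∈ Finset.Ico lo i, x k + ∑ l ∈ Finset.Ico lo i, y l)) := by
        simp_rw [← Finset.mul_sum]
        exact mul_le_mul_of_nonneg_left (sum_triple_pow_le hq0.le hq _ hx0 hy0) hC.le
    _ = _ := by
        rw [hE.sum_volume hQ.measurableSet hQf, hE'.sum_volume hW.measurableSet hWf]; ring

end

section

variable {F G H f g u v γ : ℝ × ℝ → ℝ} {lo i : ℤ} {E E' : ℤ → Set (ℝ × ℝ)}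

/-- Pairings with truncations at scale `k` of functions living on a cube of scale `k` only see the
neighbouring cubes. -/
lemma integral_Top_kap_mul_indicator_tri {e : ℝ} (he : e * e = 1) {a k : ℤ} {n : ℤ × ℤ}
    (hf : ∀ x ∉ cube k n, f x = 0) (g : ℝ × ℝ → ℝ) :
    ∫ x, Top (kap a k) e f x * (tri k n).indicator g x = ∫ x, Top (kap a k) e f x * g x := by
  refine integral_congr_ae (.of_forall fun x => ?_)
  dsimp only
  by_cases hx : x ∈ tri k n
  · rw [indicator_of_mem hx]
  · rw [Top_kap_eq_zero he, zero_mul, zero_mul]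
    intro y hy
    refine hf y fun hyn => hx ?_
    rw [mem_cube] at hyn
    rw [mem_tri, ← hyn]
    exact hy

lemma abs_integral_Top_kap_mul_le_of_bdd {e : ℝ} (he : e * e = 1) {a k : ℤ} (hak : a ≤ k)
    {n : ℤ × ℤ} (hu : Nice u) {K : ℝ} (hK : ∀ x, |u x| ≤ K) (hs : ∀ x ∉ cube k n, u x = 0)
    (hG : Nice G) {L : ℝ} (hL : 0 ≤ L) (hGL : N2 ((tri k n).indicator G) ≤ L ^ 2 * 8 ^ k) :
    |∫ x, Top (kap a k) e u x * G x| ≤ 10000 * K * L * 8 ^ k := by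
  have hK0 : 0 ≤ K := (abs_nonneg _).trans (hK 0)
  have hG' : Nice ((tri k n).indicator G) := hG.indicator (measurableSet_tri k n)
  rw [← integral_Top_kap_mul_indicator_tri he hs G]
  refine (abs_integral_mul_le (nice_Top (nice_kap a k) e hu) hG').trans ?_
  have h1 := sqrt_N2_Top_kap_le hu hak he
  have h2 : √(N2 u) ≤ K * √(8 ^ k) := by
    rw [← Real.sqrt_sq hK0, ← Real.sqrt_mul (sq_nonneg K)]
    refine Real.sqrt_le_sqrt ?_
    have := N2_le_of_bdd hu hK (volume_cube_ne_top k n) hs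
    rwa [volume_real_cube] at this
  have h3 : √(N2 ((tri k n).indicator G)) ≤ L * √(8 ^ k) := by
    rw [← Real.sqrt_sq hL, ← Real.sqrt_mul (sq_nonneg L)]
    exact Real.sqrt_le_sqrt hGL
  have h4 : √((8 : ℝ) ^ k) * √(8 ^ k) = 8 ^ k := Real.mul_self_sqrt (by positivity)
  calc _ ≤ (10000 * (K * √(8 ^ k))) * (L * √(8 ^ k)) :=
        mul_le_mul (h1.trans (by linarith)) h3 (Real.sqrt_nonneg _) (by positivity)
    _ = 10000 * K * L * (√(8 ^ k) * √(8 ^ k)) := by ring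
    _ = _ := by rw [h4]

/-- The truncations at scales below `k`, applied to the cancellative part `D_k F_k`, reduce to
pairings over the stopping cubes. -/
lemma sum_abs_integral_Top_kap_DD_le {e : ℝ} (he : e * e = 1) (hE : Part lo i E) {r : ℝ}
    (hr : 1 ≤ r) (hF : Nice F) (hG : Nice G) (hgood : Good lo i E r F) {Q : Set (ℝ × ℝ)}
    (hQ : DMeas i Q) (hQf : volume Q ≠ ⊤) (hs : ∀ x ∉ Q, F x = 0)
    (hG3 : ∀ k ∈ Finset.Ico lo i, ∀ n, cube k n ⊆ E k →
      N2 ((tri k n).indicator G) ≤ 51 ^ 2 * 8 ^ k)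
    (hH : Integrable H) (hH0 : ∀ x, 0 ≤ H x) {Z : ℝ} (hZ : 0 ≤ Z)
    (hrec : ∀ k ∈ Finset.Ioo lo i, ∀ n, cube k n ⊆ E k → cube k n ⊆ Q →
      |∫ x, Top (kap lo k) e ((cube k n).indicator F) x * G x| ≤ Z * ∫ x in cube k n, H x) :
    ∑ k ∈ Finset.Ico lo i, |∫ x, Top (kap lo k) e (DD k ((E k).indicator F)) x * G x| ≤
      Z * (∫ x in Q \ E lo, H x) + 10000 * 288 * 51 * volume.real Q := by
  set c : ℝ := 10000 * 288 * 51 with hc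
  set A := Q \ E lo with hA
  have hQm := hQ.measurableSet
  have hAm : MeasurableSet A := hQm.diff (hE.dm lo).measurableSet
  set ψ : ℝ × ℝ → ℝ := fun x => Z * A.indicator H x + c * Q.indicator (fun _ => (1 : ℝ)) x with hψ
  have hi1 : Integrable (fun x => Z * A.indicator H x) := (hH.indicator hAm).const_mul Z
  have hi2 : Integrable (fun x => c * Q.indicator (fun _ => (1 : ℝ)) x) :=
    ((integrable_indicator_iff hQm).mpr (integrableOn_const hQf)).const_mul c
  have hψi : Integrable ψ := hi1.add hi2
  have hψ0 : ∀ x, 0 ≤ ψ x := fun x => by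
    have h1 : 0 ≤ A.indicator H x := indicator_nonneg (fun x _ => hH0 x) x
    have h2 : 0 ≤ Q.indicator (fun _ => (1 : ℝ)) x := indicator_nonneg (fun x _ => zero_le_one) x
    positivity
  have key : ∀ k ∈ Finset.Ico lo i,
      |∫ x, Top (kap lo k) e (DD k ((E k).indicator F)) x * G x| ≤ ∫ x in E k, ψ x := by
    intro k hk
    have hk' := Finset.mem_Ico.mp hk
    rcases eq_or_lt_of_le hk'.1 with rfl | hlk
    · have : ∀ x, Top (kap lo lo) e (DD lo ((E lo).indicator F)) x = 0 := fun x => by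
        simp [Top, kap_self]
      simp only [this, zero_mul, integral_zero, abs_zero]
      exact integral_nonneg hψ0
    have hFk := hF.indicator (hE.dm k).measurableSet
    rw [Top_adjoint (nice_kap lo k) e (nice_DD k hFk) hG]
    set h := Top (kap lo k) (-e) G with hh
    have hhN : Nice h := nice_Top (nice_kap lo k) (-e) hG
    have e1 : ∫ x, DD k ((E k).indicator F) x * h x = ∫ x in E k, DD k F x * h x := by
      rw [← integral_indicator (hE.dm k).measurableSet]
      refine integral_congr_ae (.of_forall fun x => ?_)
      dsimp only
      rw [DD_indicator (hE.dm k), indicator_mul_left]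
    rw [e1]
    refine abs_setIntegral_le_of_cube (hE.dm k) ((nice_DD k hF).mul hhN).integrable hψi ?_
    intro n hn
    have hcm := measurableSet_cube k n
    have hFc : Nice ((cube k n).indicator F) := hF.indicator hcm
    have hdc : DMeas k (cube k n) := dMeas_cube le_rfl n
    have e2 : ∫ x in cube k n, DD k F x * h x =
        (∫ x, Top (kap lo k) e ((cube k n).indicator F) x * G x) -
        ∫ x, Top (kap lo k) e (EE k ((cube k n).indicator F)) x * G x := by
      rw [Top_adjoint (nice_kap lo k) e hFc hG, Top_adjoint (nice_kap lo k) e (nice_EE k hFc) hG,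
        ← integral_sub (hFc.mul hhN).integrable ((nice_EE k hFc).mul hhN).integrable,
        ← integral_indicator hcm]
      refine integral_congr_ae (.of_forall fun x => ?_)
      dsimp only
      rw [indicator_mul_left, ← DD_indicator hdc]
      simp only [DD]; ring
    rcases (hQ.mono hk'.2.le).cube_subset_or n with hQn | hQn
    · have e3 : |∫ x, Top (kap lo k) e ((cube k n).indicator F) x * G x| ≤
          Z * ∫ x in cube k n, H x := hrec k (Finset.mem_Ioo.mpr ⟨hlk, hk'.2⟩) n hn hQn
      have e4 : |∫ x, Top (kap lo k) e (EE k ((cube k n).indicator F)) x * G x| ≤ c * 8 ^ k := by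
        have := abs_integral_Top_kap_mul_le_of_bdd he hk'.1 (n := n) (nice_EE k hFc) (K := 288)
          (fun x => ?_) (fun x hx => ?_) hG (L := 51) (by norm_num) (hG3 k hk n hn)
        · rwa [hc]
        · rw [EE_indicator hdc]
          by_cases hx : x ∈ cube k n
          · rw [indicator_of_mem hx]; exact abs_EE_le_of_good hE hr hF hgood hk (hn hx)
          · rw [indicator_of_notMem hx]; norm_num
        · rw [EE_indicator hdc, indicator_of_notMem hx]
      have hsub : cube k n ⊆ A := fun x hx => ⟨hQn hx, fun hxl =>
        Set.disjoint_left.mp (hE.disj lo (Finset.mem_Ico.mpr ⟨le_rfl, hlk.trans hk'.2⟩) k hk hlk.ne)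
          hxl (hn hx)⟩
      have e5 : ∫ x in cube k n, ψ x = Z * (∫ x in cube k n, H x) + c * 8 ^ k := by
        rw [hψ, integral_add hi1.integrableOn hi2.integrableOn, integral_const_mul,
          integral_const_mul, setIntegral_indicator hAm, inter_eq_left.mpr hsub,
          setIntegral_indicator hQm, inter_eq_left.mpr hQn, setIntegral_const, volume_real_cube]
        simp
      rw [e2, e5]
      exact (abs_sub _ _).trans (add_le_add e3 e4)
    · have hz : (cube k n).indicator F = fun _ => 0 := by
        ext x
        by_cases hx : x ∈ cube k n
        · rw [indicator_of_mem hx]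
          exact hs x fun hxQ => Set.disjoint_left.mp hQn hx hxQ
        · rw [indicator_of_notMem hx]
      have : ∫ x in cube k n, DD k F x * h x = 0 := by
        rw [e2, hz]
        simp [Top, EE]
      rw [this, abs_zero]
      exact integral_nonneg hψ0
  refine (Finset.sum_le_sum key).trans ?_
  rw [hE.sum_setIntegral hψi, hψ, integral_add hi1 hi2, integral_const_mul, integral_const_mul,
    integral_indicator hAm,
    show (∫ x, Q.indicator (fun _ => (1 : ℝ)) x) = volume.real Q from integral_indicator_one hQm]

end

section

variable {F G H f g u v γ : ℝ × ℝ → ℝ} {lo i : ℤ} {E E' S : ℤ → Set (ℝ × ℝ)}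

lemma exists_idx_eq (k : ℤ) (n : ℤ × ℤ) : ∃ x, idx k x = n := by
  have : (cube k n).Nonempty := nonempty_of_measure_ne_zero (μ := volume) (by
    rw [volume_cube]
    exact eight_pos k)
  exact this

/-- The stopping sets attached to the families `S k`, where everything is stopped at the bottom
scale `lo`. -/
def stopSet (lo i : ℤ) (S : ℤ → Set (ℝ × ℝ)) : ℤ → Set (ℝ × ℝ) :=
  topSet (fun k => if k = lo then univ else S k) (i - 1)

lemma part_stopSet (hli : lo < i) (hS : ∀ k, DMeas k (S k)) : Part lo i (stopSet lo i S) where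
  dm k := by
    refine dMeas_topSet (fun k => ?_) _ k
    by_cases h : k = lo
    · rw [if_pos h]; exact fun x y _ _ => mem_univ y
    · rw [if_neg h]; exact hS k
  disj k hk l hl hkl := by
    rw [Finset.mem_Ico] at hk hl
    exact disjoint_topSet _ (by omega) (by omega) hkl
  cover x := by
    obtain ⟨m, h1, h2, h3⟩ := exists_mem_topSet (fun k => if k = lo then univ else S k)
      (show lo ≤ i - 1 by omega) (x := x) (by simp)
    exact ⟨m, Finset.mem_Ico.mpr ⟨h1, by omega⟩, h3⟩

lemma notMem_of_mem_stopSet {k l : ℤ} (hlo : lo ≤ k) (hkl : k < l) (hli : l < i) {x : ℝ × ℝ}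
    (hx : x ∈ stopSet lo i S k) : x ∉ S l := by
  have := hx.2 l hkl (by omega)
  dsimp only at this
  rwa [if_neg (by omega)] at this

lemma mem_of_mem_stopSet {k : ℤ} (hk : lo < k) {x : ℝ × ℝ}
    (hx : x ∈ stopSet lo i S k) : x ∈ S k := by
  have := hx.1
  dsimp only at this
  rwa [if_neg (by omega)] at this

lemma compl_stopSet_subset (lo i : ℤ) (S : ℤ → Set (ℝ × ℝ)) :
    (stopSet lo i S lo)ᶜ ⊆ ⋃ k ∈ Finset.Icc (lo + 1) (i - 1), S k := by
  intro x hx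
  by_contra h
  refine hx ⟨by simp, fun m h1 h2 h3 => h ?_⟩
  dsimp only at h3
  rw [if_neg (by omega)] at h3
  exact mem_biUnion (Finset.mem_coe.mpr (Finset.mem_Icc.mpr ⟨by omega, h2⟩)) h3

lemma setIntegral_le_of_setLIntegral_le {φ : ℝ × ℝ → ℝ} (hφ : Integrable φ) (h0 : ∀ x, 0 ≤ φ x)
    {S : Set (ℝ × ℝ)} {c : ℝ} (hc : 0 ≤ c)
    (h : ∫⁻ x in S, ENNReal.ofReal (φ x) ≤ ENNReal.ofReal c) : ∫ x in S, φ x ≤ c := by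
  rwa [← ofReal_integral_eq_lintegral_ofReal hφ.integrableOn (.of_forall h0),
    ENNReal.ofReal_le_ofReal_iff hc] at h

lemma zpow_eight_succ (k : ℤ) : (8 : ℝ) ^ (k + 1) = 8 * 8 ^ k := by
  rw [zpow_add₀ (by norm_num), zpow_one, mul_comm]

lemma ofReal_36_mul (k : ℤ) :
    36 * ENNReal.ofReal (8 ^ (k + 1)) = ENNReal.ofReal (288 * 8 ^ k) := by
  rw [show (36 : ENNReal) = ENNReal.ofReal 36 by simp, ← ENNReal.ofReal_mul (by norm_num),
    zpow_eight_succ]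
  congr 1; ring

lemma setIntegral_cube_stopSet_le {φ : ℝ × ℝ → ℝ} (hφ : Integrable φ) (h0 : ∀ x, 0 ≤ φ x)
    (hInt : ∫ x, φ x ≤ 8 ^ i)
    (hS : ∀ k, heavy (fun x => ENNReal.ofReal (φ x)) 36 k ⊆ S k) {k : ℤ}
    (hk : k ∈ Finset.Ico lo i) {n : ℤ × ℤ} (hn : cube k n ⊆ stopSet lo i S k) :
    ∫ x in cube k n, φ x ≤ 288 * 8 ^ k := by
  obtain ⟨x, hx⟩ := exists_idx_eq k n
  rw [Finset.mem_Ico] at hk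
  by_cases hki : k + 1 < i
  · refine setIntegral_le_of_setLIntegral_le hφ h0 (by positivity) ?_
    have h1 : x ∉ heavy (fun x => ENNReal.ofReal (φ x)) 36 (k + 1) := fun h =>
      notMem_of_mem_stopSet hk.1 (lt_add_one k) hki (hn (mem_cube.mpr hx)) (hS _ h)
    simp only [heavy, mem_ofPred_eq, not_lt, ofReal_36_mul] at h1
    refine (lintegral_mono_set fun y hy => ?_).trans h1
    rw [mem_cube] at *
    exact idx_eq_mono (by omega) (hy.trans hx.symm)
  · have hi : i = k + 1 := by omega
    calc _ ≤ ∫ x, φ x := setIntegral_le_integral hφ (.of_forall h0)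
      _ ≤ 8 ^ i := hInt
      _ = 8 * 8 ^ k := by rw [hi, zpow_eight_succ]
      _ ≤ _ := by
        have : (0 : ℝ) < 8 ^ k := by positivity
        linarith

lemma setIntegral_tri_stopSet_le {φ : ℝ × ℝ → ℝ} (hφ : Integrable φ) (h0 : ∀ x, 0 ≤ φ x)
    (hInt : ∫ x, φ x ≤ 8 ^ i)
    (hS : ∀ k, nheavy (fun x => ENNReal.ofReal (φ x)) 36 k ⊆ S k) {k : ℤ}
    (hk : k ∈ Finset.Ico lo i) {n : ℤ × ℤ} (hn : cube k n ⊆ stopSet lo i S k) :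
    ∫ x in tri k n, φ x ≤ 2592 * 8 ^ k := by
  obtain ⟨x, hx⟩ := exists_idx_eq k n
  rw [Finset.mem_Ico] at hk
  by_cases hki : k + 1 < i
  · refine setIntegral_le_of_setLIntegral_le hφ h0 (by positivity) ?_
    have h1 : x ∉ nheavy (fun x => ENNReal.ofReal (φ x)) 36 (k + 1) := fun h =>
      notMem_of_mem_stopSet hk.1 (lt_add_one k) hki (hn (mem_cube.mpr hx)) (hS _ h)
    simp only [nheavy, mem_ofPred_eq, not_exists, not_and, not_lt, ofReal_36_mul] at h1
    have h2 : tri k n ⊆ tri (k + 1) (idx (k + 1) x) := fun y hy => by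
      rw [mem_tri] at *
      rw [← hx] at hy
      exact nbr_mono (by omega) hy
    refine (lintegral_mono_set h2).trans ?_
    rw [setLIntegral_tri]
    refine (Finset.sum_le_sum fun d hd => h1 _ (nbr_iff_offs.mpr ⟨d, hd, rfl⟩)).trans ?_
    rw [Finset.sum_const, card_offs, nsmul_eq_mul, show ((9 : ℕ) : ENNReal) = ENNReal.ofReal 9 by simp,
      ← ENNReal.ofReal_mul (by norm_num)]
    exact ENNReal.ofReal_le_ofReal (by linarith)
  · have hi : i = k + 1 := by omega
    calc _ ≤ ∫ x, φ x := setIntegral_le_integral hφ (.of_forall h0)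
      _ ≤ 8 ^ i := hInt
      _ = 8 * 8 ^ k := by rw [hi, zpow_eight_succ]
      _ ≤ _ := by
        have : (0 : ℝ) < 8 ^ k := by positivity
        linarith

lemma sq_le_one_add_rpow {σ : ℝ} (hσ : 2 ≤ σ) (t : ℝ) : t ^ 2 ≤ 1 + |t| ^ σ := by
  have h0 : 0 ≤ |t| ^ σ := by positivity
  rw [← sq_abs]
  rcases le_total |t| 1 with h | h
  · nlinarith [abs_nonneg t]
  · have := Real.rpow_le_rpow_of_exponent_le h hσ
    rw [show (2 : ℝ) = ((2 : ℕ) : ℝ) by norm_num, Real.rpow_natCast] at this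
    linarith

lemma N2_indicator_tri_le {σ : ℝ} (hσ : 2 ≤ σ) (hG : Nice G) (k : ℤ) (n : ℤ × ℤ) {c : ℝ}
    (h : ∫ x in tri k n, |G x| ^ σ ≤ c * 8 ^ k) :
    N2 ((tri k n).indicator G) ≤ (9 + c) * 8 ^ k := by
  have hm := measurableSet_tri k n
  have e1 : N2 ((tri k n).indicator G) = ∫ x in tri k n, G x ^ 2 := by
    rw [N2, ← integral_indicator hm]
    refine integral_congr_ae (.of_forall fun x => ?_)
    by_cases hx : x ∈ tri k n
    · simp only [indicator_of_mem hx]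
    · simp only [indicator_of_notMem hx]; norm_num
  have hi : Integrable fun x => |G x| ^ σ := (hG.abs_rpow (by linarith)).integrable
  have hc : IntegrableOn (fun _ : ℝ × ℝ => (1 : ℝ)) (tri k n) :=
    integrableOn_const (volume_tri_ne_top k n)
  calc N2 ((tri k n).indicator G) = ∫ x in tri k n, G x ^ 2 := e1
    _ ≤ ∫ x in tri k n, (1 + |G x| ^ σ) :=
        integral_mono hG.sq.integrable.integrableOn (hc.add hi.integrableOn)
          fun x => sq_le_one_add_rpow hσ _
    _ = 9 * 8 ^ k + ∫ x in tri k n, |G x| ^ σ := by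
        rw [integral_add hc hi.integrableOn, setIntegral_const, volume_real_tri]; simp
    _ ≤ _ := by linarith

lemma Top_kap_add (hu : Nice u) {a b c : ℤ} (hab : a ≤ b) (hbc : b ≤ c) (e : ℝ) (x : ℝ × ℝ) :
    Top (kap a c) e u x = Top (kap a b) e u x + Top (kap b c) e u x := by
  rw [Top_kap_eq_sum hu hab, Top_kap_eq_sum hu hbc, Top_kap_eq_sum hu (hab.trans hbc),
    ← Finset.Ico_union_Ico_eq_Ico hab hbc,
    Finset.sum_union (Finset.Ico_disjoint_Ico_consecutive a b c)]

/-- The averaged part of a function with respect to a partition into dyadic cubes. -/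
def coarse (lo i : ℤ) (E : ℤ → Set (ℝ × ℝ)) (F : ℝ × ℝ → ℝ) (x : ℝ × ℝ) : ℝ :=
  ∑ k ∈ Finset.Ico lo i, EE k ((E k).indicator F) x

lemma nice_coarse (hE : Part lo i E) (hF : Nice F) : Nice (coarse lo i E F) :=
  nice_sum _ fun k _ => nice_EE k (hF.indicator (hE.dm k).measurableSet)

lemma abs_coarse_le (hE : Part lo i E) {r : ℝ} (hr : 1 ≤ r) (hF : Nice F)
    (hgood : Good lo i E r F) (x : ℝ × ℝ) : |coarse lo i E F x| ≤ 288 := by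
  obtain ⟨k, hk, hx⟩ := hE.cover x
  unfold coarse
  simp_rw [EE_indicator (hE.dm _)]
  rw [hE.sum_indicator_of_mem hk hx fun k => EE k F]
  exact abs_EE_le_of_good hE hr hF hgood hk hx

lemma coarse_eq_zero {Q : Set (ℝ × ℝ)} (hQ : DMeas i Q) (hs : ∀ x ∉ Q, F x = 0) {x : ℝ × ℝ}
    (hx : x ∉ Q) : coarse lo i E F x = 0 := by
  refine Finset.sum_eq_zero fun k hk => ?_
  have hd : Disjoint (cube k (idx k x)) Q := by
    refine ((hQ.mono (Finset.mem_Ico.mp hk).2.le).cube_subset_or _).resolve_left fun h => ?_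
    exact hx (h (mem_cube.mpr rfl))
  rw [EE, setIntegral_eq_zero_of_forall_eq_zero, mul_zero]
  intro y hy
  have := hs y (Set.disjoint_left.mp hd hy)
  by_cases hyE : y ∈ E k
  · rw [indicator_of_mem hyE, this]
  · rw [indicator_of_notMem hyE]

lemma eq_coarse_add_sum_DD (hE : Part lo i E) (F : ℝ × ℝ → ℝ) (x : ℝ × ℝ) :
    F x = coarse lo i E F x + ∑ k ∈ Finset.Ico lo i, DD k ((E k).indicator F) x := by
  rw [coarse, ← Finset.sum_add_distrib, ← hE.sum_indicator F x]
  refine Finset.sum_congr rfl fun k _ => ?_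
  simp only [DD]; ring

/-- The bilinear form of a truncation, split along stopping partitions of both functions. -/
lemma integral_Top_kap_mul_eq (e : ℝ) (hE : Part lo i E) (hE' : Part lo i E')
    (hF : Nice F) (hG : Nice G) :
    ∫ x, Top (kap lo i) e F x * G x =
      (∫ x, Top (kap lo i) e (coarse lo i E F) x * G x) +
      (∑ k ∈ Finset.Ico lo i, ∫ x, Top (kap lo k) e (DD k ((E k).indicator F)) x * G x) +
      (∑ k ∈ Finset.Ico lo i, ∑ j ∈ Finset.Ico k i,
        ∫ x, TT j e (DD k ((E k).indicator F)) x * coarse lo i E' G x) +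
      ∑ k ∈ Finset.Ico lo i, ∑ j ∈ Finset.Ico k i, ∑ l ∈ Finset.Ico lo i,
        ∫ x, TT j e (DD k ((E k).indicator F)) x * DD l ((E' l).indicator G) x := by
  have hD : ∀ k, Nice (DD k ((E k).indicator F)) := fun k =>
    nice_DD k (hF.indicator (hE.dm k).measurableSet)
  have hD' : ∀ k, Nice (DD k ((E' k).indicator G)) := fun k =>
    nice_DD k (hG.indicator (hE'.dm k).measurableSet)
  have hc := nice_coarse hE hF
  have hc' := nice_coarse hE' hG
  have hT : ∀ (a b : ℤ) {u}, Nice u → Nice (Top (kap a b) e u) := fun a b u hu =>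
    nice_Top (nice_kap a b) e hu
  have e1 : ∀ x, Top (kap lo i) e F x = Top (kap lo i) e (coarse lo i E F) x +
      ∑ k ∈ Finset.Ico lo i, Top (kap lo i) e (DD k ((E k).indicator F)) x := fun x => by
    rw [← Top_sum _ (nice_kap lo i) e fun k _ => hD k,
      ← Top_add (nice_kap lo i) e hc (nice_sum _ fun k _ => hD k)]
    congr 1
    ext y
    exact eq_coarse_add_sum_DD hE F y
  have e2 : ∀ k ∈ Finset.Ico lo i, ∫ x, Top (kap lo i) e (DD k ((E k).indicator F)) x * G x =
      (∫ x, Top (kap lo k) e (DD k ((E k).indicator F)) x * G x) +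
      ((∑ j ∈ Finset.Ico k i,
        ∫ x, TT j e (DD k ((E k).indicator F)) x * coarse lo i E' G x) +
      ∑ j ∈ Finset.Ico k i, ∑ l ∈ Finset.Ico lo i,
        ∫ x, TT j e (DD k ((E k).indicator F)) x * DD l ((E' l).indicator G) x) := by
    intro k hk
    rw [Finset.mem_Ico] at hk
    have h1 : ∀ x, Top (kap lo i) e (DD k ((E k).indicator F)) x * G x =
        Top (kap lo k) e (DD k ((E k).indicator F)) x * G x +
        ∑ j ∈ Finset.Ico k i, TT j e (DD k ((E k).indicator F)) x * G x := fun x => by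
      rw [Top_kap_add (hD k) hk.1 hk.2.le, Top_kap_eq_sum (hD k) hk.2.le, add_mul, Finset.sum_mul]
    have hj : ∀ j, Nice (TT j e (DD k ((E k).indicator F))) := fun j => nice_TT j e (hD k)
    simp_rw [h1]
    rw [integral_add ((hT _ _ (hD k)).mul hG).integrable
      (nice_sum _ fun j _ => (hj j).mul hG).integrable, integral_finsetSum _ fun j _ =>
      ((hj j).mul hG).integrable, ← Finset.sum_add_distrib]
    congr 1
    refine Finset.sum_congr rfl fun j _ => ?_
    rw [← integral_finsetSum _ fun l _ => ((hj j).mul (hD' l)).integrable,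
      ← integral_add ((hj j).mul hc').integrable
        (nice_sum _ fun l _ => (hj j).mul (hD' l)).integrable]
    refine integral_congr_ae (.of_forall fun x => ?_)
    dsimp only
    rw [← Finset.mul_sum, ← mul_add, ← eq_coarse_add_sum_DD hE' G x]
  simp_rw [e1, add_mul, Finset.sum_mul]
  rw [integral_add ((hT _ _ hc).mul hG).integrable
    (nice_sum _ fun k _ => (hT _ _ (hD k)).mul hG).integrable,
    integral_finsetSum _ fun k _ => ((hT _ _ (hD k)).mul hG).integrable,
    Finset.sum_congr rfl e2, Finset.sum_add_distrib, Finset.sum_add_distrib]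
  ring

end

section

variable {F G H f g u v γ : ℝ × ℝ → ℝ} {lo i : ℤ} {E E' S : ℤ → Set (ℝ × ℝ)}

lemma volume_biUnion_nheavy_le {φ : ℝ × ℝ → ℝ} (hφ : Integrable φ) (h0 : ∀ x, 0 ≤ φ x)
    (hInt : ∫ x, φ x ≤ 8 ^ i) (a b : ℤ) :
    volume (⋃ k ∈ Finset.Icc a b, nheavy (fun x => ENNReal.ofReal (φ x)) 36 k) ≤
      ENNReal.ofReal (8 ^ i / 4) := by
  have h := mul_volume_nheavy_le (fun x => ENNReal.ofReal (φ x)) 36 a b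
  rw [← ofReal_integral_eq_lintegral_ofReal hφ (.of_forall h0)] at h
  have h2 : 9 * ENNReal.ofReal (∫ x, φ x) ≤ 36 * ENNReal.ofReal (8 ^ i / 4) := by
    rw [show (9 : ENNReal) = ENNReal.ofReal 9 by simp, show (36 : ENNReal) = ENNReal.ofReal 36 by simp,
      ← ENNReal.ofReal_mul (by norm_num), ← ENNReal.ofReal_mul (by norm_num)]
    exact ENNReal.ofReal_le_ofReal (by linarith)
  exact (ENNReal.mul_le_mul_iff_right (by norm_num) (by norm_num)).mp (h.trans h2)

/-- One step of the sparse-type recursion: after normalization, the truncated form on a cube is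
bounded by the volume of the cube, up to a contribution of the stopping cubes, which occupy at most
half of it. -/
lemma exists_stop_step (X : Expo) {r σ : ℝ} (hr : 1 < r) (hr2 : r ≤ 2) (hσ : 2 ≤ σ)
    (hrσ : 1 ≤ 1 / r + 1 / σ) (hra : 1 < r * X.al) (hσb : 1 < σ * X.be) (hq : X.q < 1) :
    ∃ C : ℝ, 0 < C ∧ ∀ {e : ℝ}, e * e = 1 → ∀ {lo i : ℤ}, lo < i → ∀ {n : ℤ × ℤ}
    {F G : ℝ × ℝ → ℝ}, Nice F → Nice G → EE lo F = F → EE lo G = G →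
    (∀ x ∉ cube i n, F x = 0) → (∀ x ∉ tri i n, G x = 0) →
    ∫ x, |F x| ^ r ≤ 8 ^ i → ∫ x, |G x| ^ σ ≤ 8 ^ i →
    ∀ {H : ℝ × ℝ → ℝ}, Integrable H → (∀ x, 0 ≤ H x) → ∀ {Z : ℝ}, 0 ≤ Z →
    (∀ k ∈ Finset.Ioo lo i, ∀ m, cube k m ⊆ cube i n →
      |∫ x, Top (kap lo k) e ((cube k m).indicator F) x * G x| ≤ Z * ∫ x in cube k m, H x) →
    ∃ A, MeasurableSet A ∧ A ⊆ cube i n ∧ volume.real A ≤ 8 ^ i / 2 ∧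
      |∫ x, Top (kap lo i) e F x * G x| ≤ C * 8 ^ i + Z * ∫ x in A, H x := by
  obtain ⟨C₁, hC₁, h₁⟩ := abs_sum_integral_TT_DD_mul_bdd_le hr hr2
  obtain ⟨C₂, hC₂, h₂⟩ := abs_sum_integral_TT_DD_mul_DD_le X hr.le (by linarith) hrσ hra hσb hq
  refine ⟨2 * (10000 * 288 * 51) + C₁ * 288 * 10 + C₂ * 10, by positivity, ?_⟩
  intro e he lo i hli n F G hF hG hFlo hGlo hFs hGs hFr hGσ H hH hH0 Z hZ hrec
  set φ : ℝ × ℝ → ℝ := fun x => |F x| ^ r with hφ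
  set ψ : ℝ × ℝ → ℝ := fun x => |G x| ^ σ with hψ
  have hφi : Integrable φ := (hF.abs_rpow (by linarith)).integrable
  have hψi : Integrable ψ := (hG.abs_rpow (by linarith)).integrable
  have hφ0 : ∀ x, 0 ≤ φ x := fun x => by positivity
  have hψ0 : ∀ x, 0 ≤ ψ x := fun x => by positivity
  set S : ℤ → Set (ℝ × ℝ) := fun k => heavy (fun x => ENNReal.ofReal (φ x)) 36 k ∪
    nheavy (fun x => ENNReal.ofReal (ψ x)) 36 k with hS
  set S' : ℤ → Set (ℝ × ℝ) := fun k => heavy (fun x => ENNReal.ofReal (ψ x)) 36 k with hS'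
  have hSd : ∀ k, DMeas k (S k) := fun k x y hxy hx =>
    hx.imp (dMeas_heavy _ _ k x y hxy) (dMeas_nheavy _ _ k x y hxy)
  have hE : Part lo i (stopSet lo i S) := part_stopSet hli hSd
  have hE' : Part lo i (stopSet lo i S') := part_stopSet hli fun k => dMeas_heavy _ _ k
  have hgF : Good lo i (stopSet lo i S) r F := fun k hk n hn =>
    setIntegral_cube_stopSet_le hφi hφ0 hFr (fun k => subset_union_left) hk hn
  have hgG : Good lo i (stopSet lo i S') σ G := fun k hk n hn =>
    setIntegral_cube_stopSet_le hψi hψ0 hGσ (fun k => subset_rfl) hk hn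
  have hG3 : ∀ k ∈ Finset.Ico lo i, ∀ n, cube k n ⊆ stopSet lo i S k →
      N2 ((tri k n).indicator G) ≤ 51 ^ 2 * 8 ^ k := fun k hk n hn => by
    have := N2_indicator_tri_le hσ hG k n
      (setIntegral_tri_stopSet_le hψi hψ0 hGσ (fun k => subset_union_right) hk hn)
    exact this.trans_eq (by norm_num)
  have hQd : DMeas i (cube i n) := dMeas_cube le_rfl n
  have hWd : DMeas i (tri i n) := dMeas_tri le_rfl n
  have hpos : (0 : ℝ) < 8 ^ i := by positivity
  refine ⟨cube i n \ stopSet lo i S lo, hQd.measurableSet.diff (hE.dm lo).measurableSet,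
    sdiff_subset, ?_, ?_⟩
  · have hsub : cube i n \ stopSet lo i S lo ⊆
        (⋃ k ∈ Finset.Icc (lo + 1) (i - 1), nheavy (fun x => ENNReal.ofReal (φ x)) 36 k) ∪
        ⋃ k ∈ Finset.Icc (lo + 1) (i - 1), nheavy (fun x => ENNReal.ofReal (ψ x)) 36 k := by
      intro x hx
      obtain ⟨k, hk, hxk⟩ := mem_iUnion₂.mp (compl_stopSet_subset lo i S hx.2)
      rcases hxk with h | h
      · exact Or.inl (mem_iUnion₂.mpr ⟨k, hk, heavy_subset_nheavy _ _ _ h⟩)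
      · exact Or.inr (mem_iUnion₂.mpr ⟨k, hk, h⟩)
    refine ENNReal.toReal_le_of_le_ofReal (by positivity) ?_
    refine (measure_mono hsub).trans ((measure_union_le _ _).trans ?_)
    refine (add_le_add (volume_biUnion_nheavy_le hφi hφ0 hFr _ _)
      (volume_biUnion_nheavy_le hψi hψ0 hGσ _ _)).trans_eq ?_
    rw [← ENNReal.ofReal_add (by positivity) (by positivity)]
    congr 1; ring
  · rw [integral_Top_kap_mul_eq e hE hE' hF hG]
    have b1 : |∫ x, Top (kap lo i) e (coarse lo i (stopSet lo i S) F) x * G x| ≤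
        10000 * 288 * 51 * 8 ^ i := by
      refine abs_integral_Top_kap_mul_le_of_bdd he hli.le (n := n) (nice_coarse hE hF)
        (abs_coarse_le hE hr.le hF hgF) (fun x hx => coarse_eq_zero hQd hFs hx) hG (by norm_num) ?_
      refine (N2_indicator_tri_le hσ hG i n (c := 1) ?_).trans ?_
      · rw [one_mul]
        exact (setIntegral_le_integral hψi (.of_forall hψ0)).trans hGσ
      · exact mul_le_mul_of_nonneg_right (by norm_num) hpos.le
    have b2 := sum_abs_integral_Top_kap_DD_le he hE hr.le hF hG hgF hQd (volume_cube_ne_top i n) hFs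
      hG3 hH hH0 hZ fun k hk m _ hm => hrec k hk m hm
    rw [volume_real_cube] at b2
    have b2' := (Finset.abs_sum_le_sum_abs (fun k => ∫ x, Top (kap lo k) e
      (DD k ((stopSet lo i S k).indicator F)) x * G x) (Finset.Ico lo i)).trans b2
    have b3 := h₁ hE hF (nice_coarse hE' hG) he (abs_coarse_le hE' (by linarith) hG hgG)
      (volume_tri_ne_top i n) fun x hx => coarse_eq_zero hWd hGs hx
    rw [volume_real_tri] at b3
    have b4 := h₂ he hE hE' hF hG hFlo hGlo hgF hgG hQd hWd (volume_cube_ne_top i n)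
      (volume_tri_ne_top i n) hFs hGs fun k l hk hkl hl x hx y hy hxy => by
        have hx' : x ∈ S' l := mem_of_mem_stopSet (by omega) hx
        refine notMem_of_mem_stopSet hk hkl hl hy (Or.inr ⟨idx l x, hxy, hx'⟩)
    rw [volume_real_cube, volume_real_tri] at b4
    have b3' : C₁ * 288 * ((∫ x, |F x| ^ r) + 9 * 8 ^ i) ≤ C₁ * 288 * (10 * 8 ^ i) :=
      mul_le_mul_of_nonneg_left (by linarith) (by positivity)
    refine (abs_add_le _ _).trans ?_
    refine (add_le_add ((abs_add_le _ _).trans (add_le_add ((abs_add_le _ _).trans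
      (add_le_add b1 b2')) (b3.trans b3'))) b4).trans_eq ?_
    ring

end

section

variable {F G H f g u v γ : ℝ × ℝ → ℝ} {lo i : ℤ}

/-- The `L^r` average of `F` over `S`, normalized by the volume of a cube of scale `k`. -/
def pav (r : ℝ) (k : ℤ) (S : Set (ℝ × ℝ)) (F : ℝ × ℝ → ℝ) : ℝ :=
  ((8 ^ k)⁻¹ * ∫ x in S, |F x| ^ r) ^ (1 / r)

lemma setIntegral_abs_rpow_nonneg (r : ℝ) (S : Set (ℝ × ℝ)) (F : ℝ × ℝ → ℝ) :
    0 ≤ ∫ x in S, |F x| ^ r := integral_nonneg fun x => by positivity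

lemma pav_nonneg (r : ℝ) (k : ℤ) (S : Set (ℝ × ℝ)) (F : ℝ × ℝ → ℝ) : 0 ≤ pav r k S F := by
  have := setIntegral_abs_rpow_nonneg r S F
  unfold pav; positivity

lemma setIntegral_eq_pav {r : ℝ} (hr : 0 < r) (k : ℤ) (S : Set (ℝ × ℝ)) (F : ℝ × ℝ → ℝ) :
    ∫ x in S, |F x| ^ r = pav r k S F ^ r * 8 ^ k := by
  have := setIntegral_abs_rpow_nonneg r S F
  have h8 : (8 : ℝ) ^ k ≠ 0 := by positivity
  rw [pav, ← Real.rpow_mul (by positivity), one_div_mul_cancel hr.ne', Real.rpow_one]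
  field_simp

lemma ae_eq_zero_of_pav_eq_zero {r : ℝ} (hr : 0 < r) {k : ℤ} {S : Set (ℝ × ℝ)}
    (hS : MeasurableSet S) (hF : Nice F) (h : pav r k S F = 0) : S.indicator F =ᵐ[volume] 0 := by
  have h1 : ∫ x in S, |F x| ^ r = 0 := by
    rw [setIntegral_eq_pav hr k, h, Real.zero_rpow hr.ne', zero_mul]
  have h2 := (setIntegral_eq_zero_iff_of_nonneg_ae (.of_forall fun x => by positivity)
    (hF.abs_rpow hr).integrable.integrableOn).mp h1
  rw [EventuallyEq, ae_restrict_iff' hS] at h2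
  filter_upwards [h2] with x hx
  by_cases hxS : x ∈ S
  · rw [indicator_of_mem hxS]
    have := hx hxS
    simpa [Real.rpow_eq_zero_iff_of_nonneg, hr.ne'] using this
  · rw [indicator_of_notMem hxS]; rfl

lemma integral_normalized_rpow {r : ℝ} (hr : 0 < r) {k : ℤ} {S : Set (ℝ × ℝ)}
    (hS : MeasurableSet S) (h : 0 < pav r k S F) :
    ∫ x, |(pav r k S F)⁻¹ * S.indicator F x| ^ r = 8 ^ k := by
  set α := pav r k S F with hα
  have h1 : ∀ x, |α⁻¹ * S.indicator F x| ^ r = (α ^ r)⁻¹ * S.indicator (fun x => |F x| ^ r) x := by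
    intro x
    rw [abs_mul, Real.mul_rpow (abs_nonneg _) (abs_nonneg _), abs_of_pos (inv_pos.mpr h),
      Real.inv_rpow h.le]
    congr 1
    by_cases hx : x ∈ S
    · simp only [indicator_of_mem hx]
    · simp only [indicator_of_notMem hx, abs_zero, Real.zero_rpow hr.ne']
  simp_rw [h1]
  rw [integral_const_mul, integral_indicator hS, setIntegral_eq_pav hr k, ← hα, ← mul_assoc,
    inv_mul_cancel₀ (by positivity), one_mul]

lemma tri_subset_tri {k i : ℤ} (hki : k ≤ i) {m n : ℤ × ℤ} (h : cube k m ⊆ cube i n) :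
    tri k m ⊆ tri i n := by
  obtain ⟨x, hx⟩ := exists_idx_eq k m
  intro y hy
  have h1 := h (mem_cube.mpr hx)
  rw [mem_cube] at h1
  rw [mem_tri] at *
  rw [← hx] at hy
  rw [← h1]
  exact nbr_mono hki hy

lemma integral_Top_kap_indicator_eq {e : ℝ} {a b : ℤ} {S : Set (ℝ × ℝ)} (hS : MeasurableSet S)
    (hF : Nice F) (hG : Nice G) :
    ∫ x, Top (kap a b) e (S.indicator F) x * G x =
      ∫ x in S, F x * Top (kap a b) (-e) G x := by
  rw [Top_adjoint (nice_kap a b) e (hF.indicator hS) hG, ← integral_indicator hS]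
  refine integral_congr_ae (.of_forall fun x => ?_)
  dsimp only
  rw [indicator_mul_left]

/-- The truncated form is dominated by the integral of any function which dominates the products of
averages of `F` and `G`. -/
theorem abs_integral_Top_kap_mul_le (X : Expo) {r σ : ℝ} (hr : 1 < r) (hr2 : r ≤ 2) (hσ : 2 ≤ σ)
    (hrσ : 1 ≤ 1 / r + 1 / σ) (hra : 1 < r * X.al) (hσb : 1 < σ * X.be) (hq : X.q < 1) :
    ∃ C : ℝ, 0 < C ∧ ∀ {e : ℝ}, e * e = 1 → ∀ {lo hi : ℤ}, lo ≤ hi → ∀ {F G : ℝ × ℝ → ℝ},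
    Nice F → Nice G → EE lo F = F → EE lo G = G →
    ∀ {H : ℝ × ℝ → ℝ}, Integrable H → (∀ x, 0 ≤ H x) →
    (∀ k, lo ≤ k → k ≤ hi → ∀ x,
      pav r k (cube k (idx k x)) F * pav σ k (tri k (idx k x)) G ≤ H x) →
    |∫ x, Top (kap lo hi) e F x * G x| ≤ C * ∫ x, H x := by
  obtain ⟨C, hC, hstep⟩ := exists_stop_step X hr hr2 hσ hrσ hra hσb hq
  refine ⟨2 * C, by positivity, ?_⟩
  intro e he lo hi hlh F G hF hG hFlo hGlo H hH hH0 hdom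
  have main : ∀ d : ℕ, ∀ i, lo ≤ i → i ≤ hi → i - lo ≤ d → ∀ n,
      |∫ x, Top (kap lo i) e ((cube i n).indicator F) x * G x| ≤
        2 * C * ∫ x in cube i n, H x := by
    intro d
    induction d with
    | zero =>
      intro i h1 h2 h3 n
      obtain rfl : lo = i := by simp at h3; omega
      have : ∀ x, Top (kap lo lo) e ((cube lo n).indicator F) x = 0 := fun x => by
        simp [Top, kap_self]
      simp only [this, zero_mul, integral_zero, abs_zero]
      have : 0 ≤ ∫ x in cube lo n, H x := integral_nonneg hH0
      positivity
    | succ d ih =>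
      intro i h1 h2 h3 n
      by_cases hd : i - lo ≤ d
      · exact ih i h1 h2 hd n
      have hli : lo < i := by omega
      have hQm := measurableSet_cube i n
      have hWm := measurableSet_tri i n
      have hHQ : 0 ≤ ∫ x in cube i n, H x := integral_nonneg hH0
      have hsuppF : ∀ x ∉ cube i n, (cube i n).indicator F x = 0 := fun x hx =>
        indicator_of_notMem hx F
      set α := pav r i (cube i n) F with hα
      set β := pav σ i (tri i n) G with hβ
      have hα0 : 0 ≤ α := pav_nonneg _ _ _ _
      have hβ0 : 0 ≤ β := pav_nonneg _ _ _ _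
      rcases hα0.eq_or_lt with hα1 | hα1
      · have h0 := ae_eq_zero_of_pav_eq_zero (by linarith) hQm hF hα1.symm
        rw [Top_adjoint (nice_kap lo i) e (hF.indicator hQm) hG]
        have : ∫ x, (cube i n).indicator F x * Top (kap lo i) (-e) G x = 0 := by
          refine integral_eq_zero_of_ae ?_
          filter_upwards [h0] with x hx
          rw [hx]; simp
        rw [this, abs_zero]; positivity
      rcases hβ0.eq_or_lt with hβ1 | hβ1
      · have h0 := ae_eq_zero_of_pav_eq_zero (by linarith) hWm hG hβ1.symm
        rw [← integral_Top_kap_mul_indicator_tri he hsuppF]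
        have : ∫ x, Top (kap lo i) e ((cube i n).indicator F) x * (tri i n).indicator G x = 0 := by
          refine integral_eq_zero_of_ae ?_
          filter_upwards [h0] with x hx
          rw [hx]; simp
        rw [this, abs_zero]; positivity
      have hαβ : 0 < α * β := by positivity
      set F' : ℝ × ℝ → ℝ := fun x => α⁻¹ * (cube i n).indicator F x with hF'
      set G' : ℝ × ℝ → ℝ := fun x => β⁻¹ * (tri i n).indicator G x with hG'
      have hpair : ∀ (k : ℤ) (m : ℤ × ℤ), k ≤ i → cube k m ⊆ cube i n →
          ∫ x, Top (kap lo k) e ((cube k m).indicator F') x * G' x =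
            (α * β)⁻¹ * ∫ x, Top (kap lo k) e ((cube k m).indicator F) x * G x := by
        intro k m hk hm
        have e1 : (cube k m).indicator F' = fun x => α⁻¹ * (cube k m).indicator F x := by
          ext x
          by_cases hx : x ∈ cube k m
          · rw [indicator_of_mem hx, indicator_of_mem hx, hF']
            simp only [indicator_of_mem (hm hx)]
          · rw [indicator_of_notMem hx, indicator_of_notMem hx, mul_zero]
        have e2 : ∀ x, Top (kap lo k) e ((cube k m).indicator F') x * G' x =
            (α * β)⁻¹ *
              (Top (kap lo k) e ((cube k m).indicator F) x * (tri i n).indicator G x) := by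
          intro x
          rw [e1, Top_const_mul, mul_inv, hG']; ring
        simp_rw [e2]
        rw [integral_const_mul]
        congr 1
        have hs : ∀ x ∉ cube k m, (cube k m).indicator F x = 0 := fun x hx =>
          indicator_of_notMem hx F
        rw [← integral_Top_kap_mul_indicator_tri he hs, indicator_indicator,
          inter_eq_left.mpr (tri_subset_tri hk hm), integral_Top_kap_mul_indicator_tri he hs]
      have hF'n : Nice F' := (hF.indicator hQm).const_mul _
      have hG'n : Nice G' := (hG.indicator hWm).const_mul _
      obtain ⟨A, hAm, hAQ, hAv, hA⟩ := hstep he hli hF'n hG'n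
        (by
          ext x
          rw [hF', EE_const_mul, EE_indicator (dMeas_cube h1 n), hFlo])
        (by
          ext x
          rw [hG', EE_const_mul, EE_indicator (dMeas_tri h1 n), hGlo])
        (n := n) (fun x hx => by rw [hF']; simp only [indicator_of_notMem hx, mul_zero])
        (fun x hx => by rw [hG']; simp only [indicator_of_notMem hx, mul_zero])
        (integral_normalized_rpow (by linarith) hQm hα1).le
        (integral_normalized_rpow (by linarith) hWm hβ1).le
        (H := fun x => (α * β)⁻¹ * H x) (hH.const_mul _)
        (fun x => mul_nonneg (by positivity) (hH0 x)) (Z := 2 * C) (by positivity)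
        (fun k hk m hm => by
          rw [Finset.mem_Ioo] at hk
          rw [hpair k m hk.2.le hm, abs_mul, abs_of_pos (by positivity), integral_const_mul]
          have := ih k hk.1.le (by omega) (by omega) m
          calc _ ≤ (α * β)⁻¹ * (2 * C * ∫ x in cube k m, H x) :=
                mul_le_mul_of_nonneg_left this (by positivity)
            _ = _ := by ring)
      have hFF : F' = (cube i n).indicator F' := by
        ext x
        by_cases hx : x ∈ cube i n
        · rw [indicator_of_mem hx]
        · rw [indicator_of_notMem hx, hF']; simp only [indicator_of_notMem hx, mul_zero]
      rw [hFF, hpair i n le_rfl subset_rfl, abs_mul, abs_of_pos (inv_pos.mpr hαβ),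
        integral_const_mul, inv_mul_le_iff₀ hαβ] at hA
      refine hA.trans ?_
      have hlow : α * β * (8 ^ i / 2) ≤ ∫ x in cube i n \ A, H x := by
        have hv : 8 ^ i / 2 ≤ volume.real (cube i n \ A) := by
          have := measureReal_sdiff (μ := volume) hAQ hAm
            (volume_cube_ne_top i n)
          rw [this, volume_real_cube]; linarith
        have hfin : volume (cube i n \ A) ≠ ⊤ :=
          ((measure_mono sdiff_subset).trans_lt (volume_cube_ne_top i n).lt_top).ne
        have : ∫ _ in cube i n \ A, α * β ≤ ∫ x in cube i n \ A, H x := by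
          refine setIntegral_mono_on (integrableOn_const hfin) hH.integrableOn
            (hQm.diff hAm) fun x hx => ?_
          have := hdom i h1 h2 x
          rwa [mem_cube.mp hx.1] at this
        rw [setIntegral_const, smul_eq_mul] at this
        nlinarith
      have hsplit : ∫ x in cube i n, H x = (∫ x in A, H x) + ∫ x in cube i n \ A, H x := by
        rw [← setIntegral_union disjoint_sdiff_right (hQm.diff hAm) hH.integrableOn hH.integrableOn,
          union_sdiff_cancel hAQ]
      rw [hsplit]
      have : α * β * (C * 8 ^ i + 2 * C * ((α * β)⁻¹ * ∫ x in A, H x)) =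
          2 * C * (α * β * (8 ^ i / 2)) + 2 * C * ∫ x in A, H x := by
        field_simp
      rw [this]
      nlinarith
  rw [Top_adjoint (nice_kap lo hi) e hF hG]
  have hfin := abs_setIntegral_le_of_cube (S := univ) (dMeas_univ hi)
    (hF.mul (nice_Top (nice_kap lo hi) (-e) hG)).integrable (hH.const_mul (2 * C)) fun n _ => by
      rw [← integral_Top_kap_indicator_eq (measurableSet_cube hi n) hF hG, integral_const_mul]
      exact main (hi - lo).toNat hi hlh le_rfl (by omega) n
  rwa [setIntegral_univ, setIntegral_univ, integral_const_mul] at hfin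

end

section

variable {f g β : ℝ × ℝ → ℝ} {m : ℤ} {μ : ℤ → ℤ × ℤ → ℝ}

/-! ### Exponential integrability of functions of bounded mean oscillation -/

lemma isBounded_cube (k : ℤ) (n : ℤ × ℤ) : Bornology.IsBounded (cube k n) := by
  obtain ⟨y, hy⟩ := exists_idx_eq k n
  refine (Metric.isBounded_iff_subset_closedBall y).mpr ⟨max (2 ^ k) (4 ^ k), fun x hx => ?_⟩
  have := close_of_idx_eq ((mem_cube.mp hx).trans hy.symm)
  rw [Metric.mem_closedBall, Prod.dist_eq, Real.dist_eq, Real.dist_eq]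
  exact max_le_max this.1.le this.2.le

lemma isBounded_tri (k : ℤ) (n : ℤ × ℤ) : Bornology.IsBounded (tri k n) := by
  rw [tri_eq_biUnion]
  exact (Bornology.isBounded_biUnion_finset offs).mpr fun d _ => isBounded_cube k _

lemma nice_indicator_one {S : Set (ℝ × ℝ)} (hS : MeasurableSet S) (hb : Bornology.IsBounded S) :
    Nice (S.indicator fun _ => (1 : ℝ)) where
  meas := measurable_const.indicator hS
  bdd := ⟨1, fun x => by
    by_cases hx : x ∈ S
    · rw [indicator_of_mem hx, abs_one]
    · rw [indicator_of_notMem hx]; simp⟩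
  supp := by
    obtain ⟨R, hR⟩ := hb.exists_norm_le
    exact ⟨R, fun x hx => indicator_of_notMem (fun h => (hR x h).not_gt hx) _⟩

/-- Symbols which are constant on dyadic cubes of scale `m`, locally bounded, and of mean
oscillation at most `1` around the constants `μ k n`. -/
structure Sym (m : ℤ) (β : ℝ × ℝ → ℝ) (μ : ℤ → ℤ × ℤ → ℝ) : Prop where
  meas : Measurable β
  const : ∀ x y, idx m x = idx m y → β x = β y
  bdd : ∀ R, ∃ M, ∀ x, ‖x‖ ≤ R → |β x| ≤ M
  osc : ∀ k, m ≤ k → ∀ n, ∫ x in tri k n, |β x - μ k n| ≤ 8 ^ k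

lemma Sym.nice_mul_comp (h : Sym m β μ) (hf : Nice f) {φ : ℝ → ℝ} (hφ : Continuous φ) :
    Nice fun x => f x * φ (β x) := by
  obtain ⟨R, hR⟩ := hf.supp
  obtain ⟨K, hK⟩ := hf.bdd
  obtain ⟨M, hM⟩ := h.bdd R
  obtain ⟨L, hL⟩ := (isCompact_Icc (a := -M) (b := M)).exists_bound_of_continuousOn hφ.continuousOn
  refine ⟨hf.meas.mul (hφ.measurable.comp h.meas), ⟨K * |L|, fun x => ?_⟩, ⟨R, fun x hx => ?_⟩⟩
  · by_cases hx : R < ‖x‖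
    · rw [hR x hx, zero_mul, abs_zero]
      have := (abs_nonneg _).trans (hK 0)
      positivity
    · rw [abs_mul]
      refine mul_le_mul (hK x) ?_ (abs_nonneg _) ((abs_nonneg _).trans (hK 0))
      exact (hL _ (abs_le.mp (hM x (not_lt.mp hx)))).trans (le_abs_self L)
  · rw [hR x hx, zero_mul]

lemma Sym.integrableOn_comp (h : Sym m β μ) {S : Set (ℝ × ℝ)} (hS : MeasurableSet S)
    (hb : Bornology.IsBounded S) {φ : ℝ → ℝ} (hφ : Continuous φ) :
    IntegrableOn (fun x => φ (β x)) S := by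
  rw [← integrable_indicator_iff hS]
  refine (h.nice_mul_comp (nice_indicator_one hS hb) hφ).integrable.congr (.of_forall fun x => ?_)
  by_cases hx : x ∈ S
  · simp only [indicator_of_mem hx, one_mul]
  · simp only [indicator_of_notMem hx, zero_mul]

lemma Sym.setIntegral_osc_le (h : Sym m β μ) {k : ℤ} (hk : m ≤ k) {n : ℤ × ℤ} {S : Set (ℝ × ℝ)}
    (hS : S ⊆ tri k n) : ∫ x in S, |β x - μ k n| ≤ 8 ^ k :=
  (setIntegral_mono_set (h.integrableOn_comp (φ := fun t => |t - μ k n|) (measurableSet_tri k n)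
    (isBounded_tri k n) (by fun_prop)) (.of_forall fun x => abs_nonneg _)
    (LE.le.eventuallyLE hS)).trans (h.osc k hk n)

lemma Sym.abs_sub_mul_le (h : Sym m β μ) (a b : ℝ) (k : ℤ) (n : ℤ × ℤ) :
    |a - b| * 8 ^ k ≤ (∫ x in cube k n, |β x - a|) + ∫ x in cube k n, |β x - b| := by
  have hi : ∀ a : ℝ, IntegrableOn (fun x => |β x - a|) (cube k n) := fun a =>
    h.integrableOn_comp (φ := fun t => |t - a|) (measurableSet_cube k n) (isBounded_cube k n)
      (by fun_prop)
  rw [← integral_add (hi a) (hi b)]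
  have : ∫ _ in cube k n, |a - b| ≤ ∫ x in cube k n, (|β x - a| + |β x - b|) := by
    refine integral_mono (integrableOn_const (volume_cube_ne_top k n)) ((hi a).add (hi b)) fun x => ?_
    rw [abs_sub_comm (β x) a]
    exact abs_sub_le a (β x) b
  rwa [setIntegral_const, volume_real_cube, smul_eq_mul, mul_comm] at this

lemma setIntegral_exp_le_of_sub_le (h : Sym m β μ) {a b c d K : ℝ} (hc : 0 ≤ c) (hab : |a - b| ≤ d)
    {k : ℤ} {n : ℤ × ℤ} (hK : ∫ x in cube k n, Real.exp (c * |β x - a|) ≤ K) :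
    ∫ x in cube k n, Real.exp (c * |β x - b|) ≤ Real.exp (c * d) * K := by
  have hi : ∀ a : ℝ, IntegrableOn (fun x => Real.exp (c * |β x - a|)) (cube k n) := fun a =>
    h.integrableOn_comp (φ := fun t => Real.exp (c * |t - a|)) (measurableSet_cube k n)
      (isBounded_cube k n) (by fun_prop)
  calc _ ≤ ∫ x in cube k n, Real.exp (c * d) * Real.exp (c * |β x - a|) := by
        refine integral_mono (hi b) ((hi a).const_mul _) fun x => ?_
        dsimp only
        rw [← Real.exp_add]
        refine Real.exp_le_exp.mpr ?_
        have := abs_sub_le (β x) a b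
        nlinarith
    _ ≤ _ := by
        rw [integral_const_mul]
        exact mul_le_mul_of_nonneg_left hK (by positivity)

/-- The John–Nirenberg inequality on dyadic cubes. -/
lemma Sym.setIntegral_cube_exp_le (h : Sym m β μ) {k : ℤ} (hk : m ≤ k) (n : ℤ × ℤ) :
    ∫ x in cube k n, Real.exp (1 / 900 * |β x - μ k n|) ≤ 4 * 8 ^ k := by
  have he1 : Real.exp (1 / 900 * 289) ≤ 2 := by
    have h1 := Real.exp_one_lt_d9
    have h2 : Real.exp (1 / 900 * 289) ^ 3 = Real.exp (867 / 900) := by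
      rw [← Real.exp_nat_mul]; norm_num
    have h3 : Real.exp (867 / 900) ≤ Real.exp 1 := Real.exp_le_exp.mpr (by norm_num)
    by_contra hcon
    push Not at hcon
    have := pow_lt_pow_left₀ hcon (by norm_num) (n := 3) (by norm_num)
    linarith
  suffices main : ∀ d : ℕ, ∀ k, m ≤ k → k - m ≤ d → ∀ n,
      ∫ x in cube k n, Real.exp (1 / 900 * |β x - μ k n|) ≤ 4 * 8 ^ k from
    main (k - m).toNat k hk (by omega) n
  have hexp : ∀ (b : ℝ) (k : ℤ) (n : ℤ × ℤ),
      IntegrableOn (fun x => Real.exp (1 / 900 * |β x - b|)) (cube k n) := fun b k n =>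
    h.integrableOn_comp (φ := fun t => Real.exp (1 / 900 * |t - b|)) (measurableSet_cube k n)
      (isBounded_cube k n) (by fun_prop)
  have hsmall : ∀ (b : ℝ) (n : ℤ × ℤ), ∫ x in cube m n, |β x - b| ≤ 289 * 8 ^ m →
      ∫ x in cube m n, Real.exp (1 / 900 * |β x - b|) ≤ Real.exp (1 / 900 * 289) * 8 ^ m := by
    intro b n hb
    obtain ⟨y, hy⟩ := exists_idx_eq m n
    have hc : ∀ x ∈ cube m n, β x = β y := fun x hx => h.const x y ((mem_cube.mp hx).trans hy.symm)
    rw [setIntegral_congr_fun (measurableSet_cube m n) fun x hx => by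
      show |β x - b| = |β y - b|
      rw [hc x hx], setIntegral_const, volume_real_cube, smul_eq_mul, mul_comm] at hb
    rw [setIntegral_congr_fun (measurableSet_cube m n) fun x hx => by
      show Real.exp (1 / 900 * |β x - b|) = Real.exp (1 / 900 * |β y - b|)
      rw [hc x hx], setIntegral_const, volume_real_cube, smul_eq_mul, mul_comm]
    have := le_of_mul_le_mul_right hb (by positivity)
    gcongr
  intro d
  induction d with
  | zero =>
    intro k h1 h2 n
    obtain rfl : m = k := by simp at h2; omega
    have hpos : (0 : ℝ) < 8 ^ m := by positivity
    refine (hsmall _ n ((h.setIntegral_osc_le le_rfl (cube_subset_tri m n)).trans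
      (by linarith))).trans ?_
    nlinarith
  | succ d ih =>
    intro K h1 h2 n
    by_cases hd : K - m ≤ d
    · exact ih K h1 hd n
    have hmK : m < K := by omega
    have hQm := measurableSet_cube K n
    set Q := cube K n with hQ
    set b := μ K n with hb
    have hgi' : IntegrableOn (fun x => |β x - b|) Q :=
      h.integrableOn_comp (φ := fun t => |t - b|) hQm (isBounded_cube K n) (by fun_prop)
    set G : ℝ × ℝ → ℝ := Q.indicator fun x => |β x - b| with hG
    have hGi : Integrable G := (integrable_indicator_iff hQm).mpr hgi'
    have hG0 : ∀ x, 0 ≤ G x := indicator_nonneg fun x _ => abs_nonneg _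
    have hGint : ∫ x, G x ≤ 8 ^ K := by
      rw [integral_indicator hQm]
      exact h.setIntegral_osc_le h1 (cube_subset_tri K n)
    set S : ℤ → Set (ℝ × ℝ) := fun k => heavy (fun x => ENNReal.ofReal (G x)) 36 k with hS
    have hE : Part m K (stopSet m K S) := part_stopSet hmK fun k => dMeas_heavy _ _ k
    have hQd : DMeas K Q := dMeas_cube le_rfl n
    set φ : ℝ × ℝ → ℝ := Q.indicator fun x => Real.exp (1 / 900 * |β x - b|) with hφ
    set ψ : ℝ × ℝ → ℝ := fun x => Real.exp (1 / 900 * 289) *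
      (Q.indicator (fun _ => (1 : ℝ)) x + G x) with hψ
    have hφi : Integrable φ := (integrable_indicator_iff hQm).mpr (hexp b K n)
    have h1i : Integrable (Q.indicator fun _ => (1 : ℝ)) :=
      (nice_indicator_one hQm (isBounded_cube K n)).integrable
    have hψi : Integrable ψ := (h1i.add hGi).const_mul _
    have h10 : ∀ x, 0 ≤ Q.indicator (fun _ => (1 : ℝ)) x := indicator_nonneg fun x _ => zero_le_one
    have hcube : ∀ k ∈ Finset.Ico m K, ∀ n', cube k n' ⊆ stopSet m K S k →
        |∫ x in cube k n', φ x| ≤ ∫ x in cube k n', ψ x := by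
      intro k hk n' hn'
      have hk' := Finset.mem_Ico.mp hk
      rw [abs_of_nonneg (integral_nonneg (indicator_nonneg fun x _ => (Real.exp_pos _).le))]
      rcases (hQd.mono hk'.2.le).cube_subset_or n' with hsub | hdis
      · have e1 : ∀ u : ℝ × ℝ → ℝ, ∫ x in cube k n', Q.indicator u x = ∫ x in cube k n', u x :=
          fun u => setIntegral_congr_fun (measurableSet_cube k n') fun x hx =>
            indicator_of_mem (hsub hx) u
        have hGb := setIntegral_cube_stopSet_le hGi hG0 hGint (fun _ => Subset.rfl) hk hn'
        rw [e1] at hGb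
        have hψ' : ∫ x in cube k n', ψ x = Real.exp (1 / 900 * 289) *
            (8 ^ k + ∫ x in cube k n', |β x - b|) := by
          rw [integral_const_mul, integral_add h1i.integrableOn hGi.integrableOn, e1, e1,
            setIntegral_const, volume_real_cube, smul_eq_mul, mul_one]
        have hnn : 0 ≤ ∫ x in cube k n', |β x - b| := integral_nonneg fun x => abs_nonneg _
        have h8 : (0 : ℝ) < 8 ^ k := by positivity
        rw [e1, hψ']
        rcases hk'.1.eq_or_lt with rfl | hlt
        · refine (hsmall b n' (hGb.trans (by linarith))).trans ?_
          gcongr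
          linarith
        · have hd1 : |μ k n' - b| ≤ 289 := by
            have := h.abs_sub_mul_le (μ k n') b k n'
            have := h.setIntegral_osc_le hk'.1 (cube_subset_tri k n')
            refine le_of_mul_le_mul_right ?_ h8
            linarith
          refine (setIntegral_exp_le_of_sub_le h (by norm_num) hd1
            (ih k hk'.1 (by push_cast at h2; omega) n')).trans ?_
          gcongr
          obtain ⟨y, hy⟩ := exists_idx_eq k n'
          have hheavy : y ∈ S k := mem_of_mem_stopSet hlt (hn' (mem_cube.mpr hy))
          simp only [hS, heavy, mem_ofPred_eq, hy] at hheavy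
          rw [← ofReal_integral_eq_lintegral_ofReal hGi.integrableOn (.of_forall hG0), e1,
            show (36 : ENNReal) = ENNReal.ofReal 36 by simp, ← ENNReal.ofReal_mul (by norm_num)]
            at hheavy
          have := (ENNReal.ofReal_lt_ofReal_iff_of_nonneg (by positivity)).mp hheavy
          linarith
      · rw [setIntegral_congr_fun (measurableSet_cube k n') fun x hx =>
          indicator_of_notMem (disjoint_left.mp hdis hx) _]
        simp only [integral_zero]
        refine integral_nonneg fun x => ?_
        have := h10 x
        have := hG0 x
        positivity
    have hsum : ∫ x, φ x ≤ ∫ x, ψ x := by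
      rw [← hE.sum_setIntegral hφi, ← hE.sum_setIntegral hψi]
      exact Finset.sum_le_sum fun k hk => (le_abs_self _).trans
        (abs_setIntegral_le_of_cube (hE.dm k) hφi hψi fun n' hn' => hcube k hk n' hn')
    rw [integral_indicator hQm, integral_const_mul, integral_add h1i hGi,
      show (∫ x, Q.indicator (fun _ => (1 : ℝ)) x) = volume.real Q from integral_indicator_one hQm,
      volume_real_cube] at hsum
    have h8 : (0 : ℝ) < 8 ^ K := by positivity
    have := Real.exp_pos (1 / 900 * 289)
    nlinarith

lemma Sym.setIntegral_tri_exp_le (h : Sym m β μ) {k : ℤ} (hk : m ≤ k) (n : ℤ × ℤ) :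
    ∫ x in tri k n, Real.exp (1 / 900 * |β x - μ k n|) ≤ 72 * 8 ^ k := by
  have h8 : (0 : ℝ) < 8 ^ k := by positivity
  have hi : IntegrableOn (fun x => Real.exp (1 / 900 * |β x - μ k n|)) (tri k n) :=
    h.integrableOn_comp (φ := fun t => Real.exp (1 / 900 * |t - μ k n|)) (measurableSet_tri k n)
      (isBounded_tri k n) (by fun_prop)
  have hc : ∀ d ∈ offs, ∫ x in cube k (n + d), Real.exp (1 / 900 * |β x - μ k n|) ≤ 8 * 8 ^ k := by
    intro d hd
    have hs : cube k (n + d) ⊆ tri k n := by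
      rw [tri_eq_biUnion]
      exact subset_biUnion_of_mem (u := fun d => cube k (n + d)) hd
    have hd1 : |μ k (n + d) - μ k n| ≤ 2 := by
      have h1 := h.abs_sub_mul_le (μ k (n + d)) (μ k n) k (n + d)
      have h2 := h.setIntegral_osc_le hk (cube_subset_tri k (n + d))
      have h3 := h.setIntegral_osc_le hk hs
      refine le_of_mul_le_mul_right ?_ h8
      linarith
    refine (setIntegral_exp_le_of_sub_le h (by norm_num) hd1
      (h.setIntegral_cube_exp_le hk (n + d))).trans ?_
    have : Real.exp (1 / 900 * 2) ≤ 2 := by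
      have h1 := Real.exp_bound_div_one_sub_of_interval (x := 1 / 900 * 2) (by norm_num) (by norm_num)
      refine h1.trans (by norm_num)
    nlinarith
  rw [tri_eq_biUnion] at hi ⊢
  rw [integral_biUnion_finset offs (s := fun d => cube k (n + d)) (fun d _ => measurableSet_cube k _) (fun d _ d' _ hdd =>
    pairwise_disjoint_cube k (by simpa using hdd)) fun d hd => hi.mono_set
      (subset_biUnion_of_mem (u := fun d => cube k (n + d)) hd)]
  refine (Finset.sum_le_card_nsmul _ _ _ hc).trans ?_
  rw [card_offs, nsmul_eq_mul]
  push_cast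
  linarith

end

section

variable {f g β : ℝ × ℝ → ℝ} {m : ℤ} {μ : ℤ → ℤ × ℤ → ℝ}

/-! ### Averages twisted by exponentials of the symbol -/

lemma Sym.pav_twist_le (h : Sym m β μ) (hf : Nice f) {r a s : ℝ} (hr : 1 ≤ r) (hra : r < a)
    (hs : |s| * (r * (a / (a - r))) ≤ 1 / 900) {φ : ℝ → ℝ} (hφ : Continuous φ)
    (hφ1 : ∀ t, |φ t| ≤ 1) {k : ℤ} (hk : m ≤ k) (n : ℤ × ℤ) {S : Set (ℝ × ℝ)}
    (hS : S ⊆ tri k n) :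
    pav r k S (fun x => f x * (Real.exp (s * β x) * φ (β x))) ≤
      Real.exp (s * μ k n) * (72 * pav a k (tri k n) f) := by
  have hr0 : 0 < r := by linarith
  have ha0 : 0 < a := by linarith
  have har : 0 < a - r := by linarith
  have h8 : (0 : ℝ) < 8 ^ k := by positivity
  have hP := pav_nonneg a k (tri k n) f
  set P := pav a k (tri k n) f with hPdef
  set w : ℝ → ℝ := fun t => Real.exp (r * |s| * |t - μ k n|) with hw
  have hwc : Continuous w := by fun_prop
  have hT := measurableSet_tri k n
  have hconj : (a / r).HolderConjugate (a / (a - r)) := by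
    rw [Real.holderConjugate_iff]
    refine ⟨(one_lt_div hr0).mpr hra, ?_⟩
    field_simp
    ring
  have hnf : Nice fun x => |f x| ^ r := hf.abs_rpow hr0
  have hnw := h.nice_mul_comp (nice_indicator_one hT (isBounded_tri k n)) hwc
  have hi1 : Nice fun x => |f x| ^ r * w (β x) := h.nice_mul_comp hnf hwc
  have hi0 : Nice fun x => |f x * (Real.exp (s * β x) * φ (β x))| ^ r :=
    (h.nice_mul_comp hf (φ := fun t => Real.exp (s * t) * φ t) (by fun_prop)).abs_rpow hr0
  have hpt : ∀ x, |f x * (Real.exp (s * β x) * φ (β x))| ^ r ≤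
      Real.exp (s * μ k n) ^ r * (|f x| ^ r * w (β x)) := by
    intro x
    have h1 : |f x * (Real.exp (s * β x) * φ (β x))| ≤
        Real.exp (s * μ k n) * (|f x| * Real.exp (|s| * |β x - μ k n|)) := by
      rw [abs_mul, abs_mul, Real.abs_exp, mul_left_comm (Real.exp (s * μ k n)),
        ← Real.exp_add]
      refine mul_le_mul_of_nonneg_left ?_ (abs_nonneg _)
      calc _ ≤ Real.exp (s * β x) * 1 := by gcongr; exact hφ1 _
        _ ≤ _ := by
            rw [mul_one]
            refine Real.exp_le_exp.mpr ?_
            have := le_abs_self (s * (β x - μ k n))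
            rw [abs_mul] at this
            linarith
    calc _ ≤ (Real.exp (s * μ k n) * (|f x| * Real.exp (|s| * |β x - μ k n|))) ^ r := by gcongr
      _ = _ := by
          rw [Real.mul_rpow (by positivity) (by positivity),
            Real.mul_rpow (by positivity) (by positivity), ← Real.exp_mul (|s| * _) r, hw]
          congr 2
          rw [mul_right_comm, mul_comm |s| r]
  have hhol : ∫ x in tri k n, |f x| ^ r * w (β x) ≤ P ^ r * 72 ^ r * 8 ^ k := by
    have h1 := integral_mul_le_Lp_mul_Lq_of_nonneg (μ := volume.restrict (tri k n)) hconj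
      (f := fun x => |f x| ^ r) (g := fun x => w (β x)) (.of_forall fun x => by positivity)
      (.of_forall fun x => by positivity) ?_ ?_
    · refine h1.trans ?_
      have e1 : ∀ x, (|f x| ^ r) ^ (a / r) = |f x| ^ a := fun x => by
        rw [← Real.rpow_mul (abs_nonneg _)]; congr 1; field_simp
      simp only [e1]
      rw [setIntegral_eq_pav ha0 k, ← hPdef]
      have h2 : ∫ x in tri k n, w (β x) ^ (a / (a - r)) ≤ 72 * 8 ^ k := by
        refine le_trans (integral_mono ?_ ?_ fun x => ?_) (h.setIntegral_tri_exp_le hk n)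
        · exact h.integrableOn_comp (φ := fun t => w t ^ (a / (a - r))) hT (isBounded_tri k n)
            (hwc.rpow_const fun t => .inl (Real.exp_pos _).ne')
        · exact h.integrableOn_comp (φ := fun t => Real.exp (1 / 900 * |t - μ k n|)) hT
            (isBounded_tri k n) (by fun_prop)
        · simp only [hw]
          rw [← Real.exp_mul]
          refine Real.exp_le_exp.mpr ?_
          have := mul_le_mul_of_nonneg_right hs (abs_nonneg (β x - μ k n))
          linarith
      have e2 : (1 : ℝ) / (a / r) = r / a := one_div_div a r
      have e3 : 1 / (a / (a - r)) = 1 - r / a := by field_simp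
      have hra1 : 0 ≤ 1 - r / a := by
        rw [sub_nonneg, div_le_one ha0]; exact hra.le
      rw [e2, e3]
      calc (P ^ a * 8 ^ k) ^ (r / a) * (∫ x in tri k n, w (β x) ^ (a / (a - r))) ^ (1 - r / a)
          ≤ (P ^ a * 8 ^ k) ^ (r / a) * (72 * 8 ^ k) ^ (1 - r / a) := by
            refine mul_le_mul_of_nonneg_left (Real.rpow_le_rpow ?_ h2 hra1) (by positivity)
            exact integral_nonneg fun x => by positivity
        _ = P ^ r * 72 ^ (1 - r / a) * ((8 ^ k) ^ (r / a) * (8 ^ k) ^ (1 - r / a)) := by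
            rw [Real.mul_rpow (by positivity) h8.le, Real.mul_rpow (by norm_num) h8.le,
              ← Real.rpow_mul hP, mul_div_cancel₀ r ha0.ne']
            ring
        _ = P ^ r * 72 ^ (1 - r / a) * 8 ^ k := by
            rw [← Real.rpow_add h8, add_sub_cancel, Real.rpow_one]
        _ ≤ _ := by
            gcongr
            · norm_num
            · have : 0 ≤ r / a := by positivity
              linarith
    · exact (memLp_top_of_bound hnf.meas.aestronglyMeasurable hnf.bdd.choose (.of_forall
        hnf.bdd.choose_spec)).mono_exponent_of_measure_support_ne_top
          (fun x hx => absurd (mem_univ x) hx) (by simpa using volume_tri_ne_top k n) le_top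
    · have hmem : MemLp (fun x => (tri k n).indicator (fun _ => (1 : ℝ)) x * w (β x)) ⊤
          (volume.restrict (tri k n)) := memLp_top_of_bound hnw.meas.aestronglyMeasurable
            hnw.bdd.choose (.of_forall hnw.bdd.choose_spec)
      refine ((memLp_congr_ae ?_).mp hmem).mono_exponent_of_measure_support_ne_top
        (fun x hx => absurd (mem_univ x) hx) (by simpa using volume_tri_ne_top k n) le_top
      refine (ae_restrict_iff' hT).mpr (.of_forall fun x hx => ?_)
      simp only [indicator_of_mem hx, one_mul]
  have hInt : ∫ x in S, |f x * (Real.exp (s * β x) * φ (β x))| ^ r ≤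
      (Real.exp (s * μ k n) * (72 * P)) ^ r * 8 ^ k := by
    calc _ ≤ ∫ x in tri k n, |f x * (Real.exp (s * β x) * φ (β x))| ^ r :=
          setIntegral_mono_set hi0.integrable.integrableOn (.of_forall fun x => by positivity)
            (LE.le.eventuallyLE hS)
      _ ≤ ∫ x in tri k n, Real.exp (s * μ k n) ^ r * (|f x| ^ r * w (β x)) :=
          integral_mono hi0.integrable.integrableOn (hi1.integrable.const_mul _).integrableOn hpt
      _ ≤ Real.exp (s * μ k n) ^ r * (P ^ r * 72 ^ r * 8 ^ k) := by
          rw [integral_const_mul]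
          exact mul_le_mul_of_nonneg_left hhol (by positivity)
      _ = _ := by
          rw [Real.mul_rpow (by positivity) (by positivity), Real.mul_rpow (by norm_num) hP]
          ring
  unfold pav
  refine (Real.rpow_le_rpow (mul_nonneg (by positivity)
    (setIntegral_abs_rpow_nonneg _ _ _)) (z := 1 / r) (y := (Real.exp (s * μ k n) * (72 * P)) ^ r)
      ?_ (by positivity)).trans (le_of_eq ?_)
  · rw [inv_mul_le_iff₀ h8, mul_comm]
    exact hInt
  · rw [← Real.rpow_mul (by positivity), mul_one_div_cancel hr0.ne', Real.rpow_one]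

/-- The `L^p` norm, for nice functions. -/
def nrm (p : ℝ) (f : ℝ × ℝ → ℝ) : ℝ := (∫ x, |f x| ^ p) ^ (1 / p)

lemma nrm_nonneg (p : ℝ) (f : ℝ × ℝ → ℝ) : 0 ≤ nrm p f :=
  Real.rpow_nonneg (integral_nonneg fun x => by positivity) _

lemma pav_tri_le_MF (hf : Nice f) {a : ℝ} (ha : 0 < a) {lo hi k : ℤ} (h1 : lo ≤ k) (h2 : k ≤ hi)
    (x : ℝ × ℝ) : ENNReal.ofReal (pav a k (tri k (idx k x)) f) ≤
      MF lo hi (fun x => ENNReal.ofReal (|f x| ^ a)) x ^ (1 / a) := by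
  have := setIntegral_abs_rpow_nonneg a (tri k (idx k x)) f
  rw [pav, ← ENNReal.ofReal_rpow_of_nonneg (by positivity) (by positivity)]
  refine ENNReal.rpow_le_rpow ?_ (by positivity)
  rw [ENNReal.ofReal_mul (by positivity), ENNReal.ofReal_inv_of_pos (by positivity),
    ofReal_integral_eq_lintegral_ofReal (hf.abs_rpow ha).integrable.integrableOn
      (.of_forall fun x => by positivity)]
  exact le_MF h1 h2 _ x

lemma exists_lintegral_MF_le {a p : ℝ} (ha : 0 < a) (hap : a < p) :
    ∃ C : ℝ, 0 < C ∧ ∀ {lo hi : ℤ} {f : ℝ × ℝ → ℝ}, Nice f →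
      (∫⁻ x, (MF lo hi (fun x => ENNReal.ofReal (|f x| ^ a)) x ^ (1 / a)) ^ p) ^ (1 / p) ≤
        ENNReal.ofReal (C * nrm p f) := by
  have hp : 0 < p := ha.trans hap
  have hq : 1 < p / a := (one_lt_div ha).mpr hap
  have hq1 : 0 < p / a - 1 := by linarith
  refine ⟨(p / a * 162 * 18 ^ (p / a - 1) / (p / a - 1)) ^ (1 / p), by positivity, ?_⟩
  intro lo hi f hf
  obtain ⟨M, hM⟩ := (hf.abs_rpow ha).bdd
  have h1 := lintegral_MF_rpow_le hq (lo := lo) (hi := hi) (hf.abs_rpow ha).meas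
    (fun x => by positivity) fun x => (le_abs_self _).trans (hM x)
  have e1 : ∀ y : ENNReal, (y ^ (1 / a)) ^ p = y ^ (p / a) := fun y => by
    rw [← ENNReal.rpow_mul]; congr 1; field_simp
  have e2 : ∀ x, (|f x| ^ a) ^ (p / a) = |f x| ^ p := fun x => by
    rw [← Real.rpow_mul (abs_nonneg _), mul_div_cancel₀ p ha.ne']
  simp only [e1]
  simp only [e2] at h1
  refine (ENNReal.rpow_le_rpow h1 (by positivity)).trans (le_of_eq ?_)
  rw [← ofReal_integral_eq_lintegral_ofReal (hf.abs_rpow hp).integrable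
      (.of_forall fun x => by positivity), ← ENNReal.ofReal_mul (by positivity),
    ENNReal.ofReal_rpow_of_nonneg (mul_nonneg (by positivity)
      (integral_nonneg fun x => by positivity)) (by positivity),
    Real.mul_rpow (by positivity) (integral_nonneg fun x => by positivity), nrm]

lemma exists_dominating {p p' a b : ℝ} (hpp : p.HolderConjugate p') (ha : 0 < a) (hap : a < p)
    (hb : 0 < b) (hbp : b < p') :
    ∃ C : ℝ, 0 < C ∧ ∀ {lo hi : ℤ} {f g : ℝ × ℝ → ℝ}, Nice f → Nice g →
      ∃ H : ℝ × ℝ → ℝ, Integrable H ∧ (∀ x, 0 ≤ H x) ∧ (∀ k, lo ≤ k → k ≤ hi → ∀ x,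
        pav a k (tri k (idx k x)) f * pav b k (tri k (idx k x)) g ≤ H x) ∧
        ∫ x, H x ≤ C * (nrm p f * nrm p' g) := by
  obtain ⟨C₁, hC₁, h₁⟩ := exists_lintegral_MF_le ha hap
  obtain ⟨C₂, hC₂, h₂⟩ := exists_lintegral_MF_le hb hbp
  refine ⟨C₁ * C₂, by positivity, ?_⟩
  intro lo hi f g hf hg
  have hfin : ∀ {a : ℝ} {f : ℝ × ℝ → ℝ}, 0 < a → Nice f → ∀ x,
      MF lo hi (fun x => ENNReal.ofReal (|f x| ^ a)) x ^ (1 / a) ≠ ⊤ := by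
    intro a f ha hf x
    obtain ⟨M, hM⟩ := (hf.abs_rpow ha).bdd
    refine ENNReal.rpow_ne_top_of_nonneg (by positivity) ?_
    exact ne_top_of_le_ne_top (b := 9 * ENNReal.ofReal M)
      (ENNReal.mul_ne_top (by simp) ENNReal.ofReal_ne_top)
      (MF_le_const (fun x => ENNReal.ofReal_le_ofReal ((le_abs_self _).trans (hM x))) x)
  set U := fun x => MF lo hi (fun x => ENNReal.ofReal (|f x| ^ a)) x ^ (1 / a) with hU
  set V := fun x => MF lo hi (fun x => ENNReal.ofReal (|g x| ^ b)) x ^ (1 / b) with hV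
  have hUm : Measurable U := (measurable_MF lo hi _).pow_const _
  have hVm : Measurable V := (measurable_MF lo hi _).pow_const _
  have hlin : ∫⁻ x, U x * V x ≤ ENNReal.ofReal (C₁ * C₂ * (nrm p f * nrm p' g)) := by
    refine (ENNReal.lintegral_mul_le_Lp_mul_Lq volume hpp hUm.aemeasurable
      hVm.aemeasurable).trans ((mul_le_mul' (h₁ hf) (h₂ hg)).trans (le_of_eq ?_))
    rw [← ENNReal.ofReal_mul (mul_nonneg hC₁.le (nrm_nonneg _ _))]
    congr 1
    ring
  have htop : ∫⁻ x, U x * V x ≠ ⊤ := ne_top_of_le_ne_top ENNReal.ofReal_ne_top hlin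
  have hUV : ∀ x, U x * V x ≠ ⊤ := fun x => ENNReal.mul_ne_top (hfin ha hf x) (hfin hb hg x)
  refine ⟨fun x => (U x * V x).toReal, integrable_toReal_of_lintegral_ne_top
    (hUm.mul hVm).aemeasurable htop, fun x => ENNReal.toReal_nonneg, ?_, ?_⟩
  · intro k hk1 hk2 x
    rw [← ENNReal.ofReal_le_iff_le_toReal (hUV x), ENNReal.ofReal_mul (pav_nonneg _ _ _ _)]
    exact mul_le_mul' (pav_tri_le_MF hf ha hk1 hk2 x) (pav_tri_le_MF hg hb hk1 hk2 x)
  · rw [integral_toReal (f := fun x => U x * V x) (hUm.mul hVm).aemeasurable (.of_forall fun x => (hUV x).lt_top)]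
    exact ENNReal.toReal_le_of_le_ofReal (mul_nonneg (by positivity)
      (mul_nonneg (nrm_nonneg _ _) (nrm_nonneg _ _))) hlin

end

section

variable {f g β : ℝ × ℝ → ℝ} {m : ℤ} {μ : ℤ → ℤ × ℤ → ℝ}

/-! ### The twisted bilinear form -/

lemma exists_expo {p p' : ℝ} (hpp : p.HolderConjugate p') (hp2 : p < 2) :
    ∃ (X : Expo) (r σ : ℝ), 1 < r ∧ r < p ∧ 2 ≤ σ ∧ σ < p' ∧ 1 < r * X.al ∧ 1 < σ * X.be ∧
      X.q < 1 := by
  have hp1 := hpp.lt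
  have hp0 := hpp.pos
  have hp0' := hpp.symm.pos
  have hsum := hpp.inv_add_inv_eq_one
  have hpinv : 2⁻¹ < p⁻¹ := inv_strictAnti₀ hp0 hp2
  have hpinv' : 0 < p'⁻¹ := by positivity
  have hp'2 : 2 < p' := by
    by_contra hcon
    have := inv_anti₀ hp0' (not_lt.mp hcon)
    norm_num at *
    linarith
  have hlim : Tendsto (fun η : ℝ => (15 / 16 : ℝ) ^ ((1 - η) * (2 * p'⁻¹)) * 8 ^ η)
      (nhdsWithin 0 (Ioi 0)) (nhds ((15 / 16 : ℝ) ^ ((1 - 0) * (2 * p'⁻¹)) * 8 ^ (0 : ℝ))) := by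
    refine Tendsto.mono_left (Continuous.tendsto ?_ 0) nhdsWithin_le_nhds
    refine Continuous.mul ?_ ?_
    · exact continuous_const.rpow (by fun_prop) fun x => .inl (by norm_num)
    · exact continuous_const.rpow continuous_id fun x => .inl (by norm_num)
  have hlt : (15 / 16 : ℝ) ^ ((1 - 0) * (2 * p'⁻¹)) * 8 ^ (0 : ℝ) < 1 := by
    rw [Real.rpow_zero, mul_one]
    exact Real.rpow_lt_one (by norm_num) (by norm_num) (by simp; positivity)
  obtain ⟨η, hηq, hη0, hη1⟩ := ((hlim.eventually_lt_const hlt).and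
    (Ioo_mem_nhdsGT (zero_lt_one (α := ℝ)))).exists
  set X : Expo := ⟨(1 - η) * (2 * p'⁻¹), (1 - η) * (1 - 2 * p'⁻¹), η,
    mul_nonneg (by linarith) (by positivity), mul_nonneg (by linarith) (by linarith), hη0.le,
    by ring⟩ with hX
  have hal : p⁻¹ < X.al := by
    have : X.al = p⁻¹ + η * p'⁻¹ := by
      simp only [Expo.al, hX]
      linear_combination -hsum
    rw [this]
    exact lt_add_of_pos_right _ (by positivity)
  have hbe : p'⁻¹ < X.be := by
    have : X.be = p'⁻¹ + η * p⁻¹ := by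
      simp only [Expo.be, hX]
      linear_combination -η * hsum
    rw [this]
    exact lt_add_of_pos_right _ (by positivity)
  have hal0 : 0 < X.al := lt_trans (by positivity) hal
  have hbe0 : 0 < X.be := hpinv'.trans hbe
  obtain ⟨r, hr1, hr2⟩ := exists_between (max_lt hp1 (inv_lt_of_inv_lt₀ hp0 hal))
  obtain ⟨σ, hσ1, hσ2⟩ := exists_between (max_lt hp'2 (inv_lt_of_inv_lt₀ hp0' hbe))
  rw [max_lt_iff] at hr1 hσ1
  exact ⟨X, r, σ, hr1.1, hr2, hσ1.1.le, hσ2, (inv_lt_iff_one_lt_mul₀ hal0).mp hr1.2,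
    (inv_lt_iff_one_lt_mul₀ hbe0).mp hσ1.2, hηq⟩

lemma EE_eq_self (hc : ∀ x y, idx m x = idx m y → f x = f y) : EE m f = f := by
  ext x
  rw [EE, setIntegral_congr_fun (g := fun _ => f x) (measurableSet_cube m _) fun y hy =>
    hc y x (mem_cube.mp hy), setIntegral_const, volume_real_cube, smul_eq_mul,
    inv_mul_cancel_left₀ (by positivity)]

lemma eq_of_EE_eq_self (h : EE m f = f) {x y : ℝ × ℝ} (hxy : idx m x = idx m y) : f x = f y := by
  rw [← h]; exact EE_of_idx_eq _ hxy

lemma Sym.EE_mul_comp (h : Sym m β μ) (hf : EE m f = f) (φ : ℝ → ℝ) :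
    EE m (fun x => f x * φ (β x)) = fun x => f x * φ (β x) :=
  EE_eq_self fun x y hxy => by rw [eq_of_EE_eq_self hf hxy, h.const x y hxy]

lemma exists_twisted_bound {p p' : ℝ} (hpp : p.HolderConjugate p') (hp2 : p < 2) :
    ∃ C c : ℝ, 0 < C ∧ 0 < c ∧ ∀ {e : ℝ}, e * e = 1 → ∀ {m hi : ℤ}, m ≤ hi →
      ∀ {β : ℝ × ℝ → ℝ} {μ : ℤ → ℤ × ℤ → ℝ}, Sym m β μ → ∀ {f g : ℝ × ℝ → ℝ}, Nice f → Nice g →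
      EE m f = f → EE m g = g → ∀ {s : ℝ}, |s| ≤ c → ∀ {φ ψ : ℝ → ℝ}, Continuous φ → Continuous ψ →
      (∀ t, |φ t| ≤ 1) → (∀ t, |ψ t| ≤ 1) →
      |∫ x, Top (kap m hi) e (fun x => f x * (Real.exp (-s * β x) * φ (β x))) x *
        (g x * (Real.exp (s * β x) * ψ (β x)))| ≤ C * (nrm p f * nrm p' g) := by
  obtain ⟨X, r, σ, hr1, hrp, hσ2, hσp, hra, hσb, hq⟩ := exists_expo hpp hp2
  have hσ0 : 0 < σ := by linarith
  have hrσ : 1 ≤ 1 / r + 1 / σ := by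
    rw [one_div, one_div, ← hpp.inv_add_inv_eq_one]
    gcongr
  obtain ⟨a, hra', hap⟩ := exists_between hrp
  obtain ⟨b, hσb', hbp⟩ := exists_between hσp
  obtain ⟨C₁, hC₁, h₁⟩ := abs_integral_Top_kap_mul_le X hr1 (by linarith) hσ2 hrσ hra hσb hq
  obtain ⟨C₂, hC₂, h₂⟩ := exists_dominating hpp (a := a) (b := b) (by linarith) hap (by linarith) hbp
  have hA : 0 < r * (a / (a - r)) := mul_pos (by linarith) (div_pos (by linarith) (by linarith))
  have hB : 0 < σ * (b / (b - σ)) := mul_pos (by linarith) (div_pos (by linarith) (by linarith))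
  refine ⟨C₁ * (72 * 72 * C₂), min (1 / 900 / (r * (a / (a - r)))) (1 / 900 / (σ * (b / (b - σ)))),
    by positivity, lt_min (by positivity) (by positivity), ?_⟩
  intro e he m hi hmh β μ h f g hf hg hfm hgm s hs φ ψ hφ hψ hφ1 hψ1
  obtain ⟨H, hHi, hH0, hHd, hHb⟩ := h₂ (lo := m) (hi := hi) hf hg
  rw [le_min_iff, le_div_iff₀ hA, le_div_iff₀ hB] at hs
  refine (h₁ he hmh (h.nice_mul_comp hf (φ := fun t => Real.exp (-s * t) * φ t) (by fun_prop))
    (h.nice_mul_comp hg (φ := fun t => Real.exp (s * t) * ψ t) (by fun_prop))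
    (h.EE_mul_comp hfm fun t => Real.exp (-s * t) * φ t)
    (h.EE_mul_comp hgm fun t => Real.exp (s * t) * ψ t) (H := fun x => 72 * 72 * H x)
    (hHi.const_mul _) (fun x => by have := hH0 x; positivity) ?_).trans ?_
  · intro k hk1 hk2 x
    refine (mul_le_mul (h.pav_twist_le hf hr1.le hra' (by rw [abs_neg]; exact hs.1) hφ hφ1 hk1
      (idx k x) (cube_subset_tri k _)) (h.pav_twist_le hg (by linarith) hσb' hs.2 hψ hψ1 hk1
      (idx k x) Subset.rfl) (pav_nonneg _ _ _ _) (mul_nonneg (Real.exp_pos _).le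
        (mul_nonneg (by norm_num) (pav_nonneg _ _ _ _)))).trans ?_
    have e1 : Real.exp (-s * μ k (idx k x)) * Real.exp (s * μ k (idx k x)) = 1 := by
      rw [← Real.exp_add, neg_mul, neg_add_cancel, Real.exp_zero]
    have := hHd k hk1 hk2 x
    calc _ = (Real.exp (-s * μ k (idx k x)) * Real.exp (s * μ k (idx k x))) * (72 * 72 *
          (pav a k (tri k (idx k x)) f * pav b k (tri k (idx k x)) g)) := by ring
      _ ≤ _ := by rw [e1, one_mul]; gcongr
  · rw [integral_const_mul, mul_assoc C₁ (72 * 72 * C₂), mul_assoc (72 * 72) C₂]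
    gcongr

end

section

variable {f g β : ℝ × ℝ → ℝ} {m : ℤ} {μ : ℤ → ℤ × ℤ → ℝ}

/-! ### From the twisted form to the commutator -/

/-- The commutator of multiplication by `b` with `Top κ e`. -/
def cm (κ : ℝ → ℝ) (e : ℝ) (b f : ℝ × ℝ → ℝ) (x : ℝ × ℝ) : ℝ :=
  b x * Top κ e f x - Top κ e (fun y => b y * f y) x

/-- Cauchy's estimate for the first moment of `D` against `K`. -/
lemma abs_integral_mul_le_of_exp {X : Type*} [MeasurableSpace X] {ν : Measure X} {K D : X → ℝ}
    (hK : Integrable K ν) (hD : Measurable D) {M c B : ℝ} (hM : ∀ x, K x ≠ 0 → |D x| ≤ M)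
    (hc : 0 < c)
    (hB : ∀ z : ℂ, ‖z‖ = c → ‖∫ x, (K x : ℂ) * Complex.exp (z * D x) ∂ν‖ ≤ B) :
    |∫ x, K x * D x ∂ν| ≤ B / c := by
  have hKm : AEStronglyMeasurable (fun x => (K x : ℂ)) ν :=
    Complex.continuous_ofReal.comp_aestronglyMeasurable hK.1
  have hm : ∀ z : ℂ, AEStronglyMeasurable (fun x => (K x : ℂ) * Complex.exp (z * D x)) ν :=
    fun z => hKm.mul (by fun_prop : Measurable _).aestronglyMeasurable
  have hb : ∀ (z : ℂ) (R : ℝ), ‖z‖ ≤ R → ∀ x, K x ≠ 0 →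
      ‖Complex.exp (z * D x)‖ ≤ Real.exp (R * M) := by
    intro z R hz x hx
    rw [Complex.norm_exp]
    refine Real.exp_le_exp.mpr ((Complex.re_le_norm _).trans ?_)
    rw [norm_mul, Complex.norm_real, Real.norm_eq_abs]
    exact mul_le_mul hz (hM x hx) (abs_nonneg _) ((norm_nonneg z).trans hz)
  have hder : ∀ z : ℂ, HasDerivAt (fun z : ℂ => ∫ x, (K x : ℂ) * Complex.exp (z * D x) ∂ν)
      (∫ x, (K x : ℂ) * (Complex.exp (z * D x) * D x) ∂ν) z := by
    intro z
    refine (hasDerivAt_integral_of_dominated_loc_of_deriv_le (s := Metric.ball z 1)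
      (F' := fun z x => (K x : ℂ) * (Complex.exp (z * D x) * D x))
      (bound := fun x => |K x| * (Real.exp ((‖z‖ + 1) * M) * M))
      (Metric.ball_mem_nhds z one_pos) (.of_forall hm) ?_ ?_ ?_ (hK.abs.mul_const _) ?_).2
    · refine (hK.abs.mul_const (Real.exp (‖z‖ * M))).mono' (hm z) (.of_forall fun x => ?_)
      rw [norm_mul, Complex.norm_real, Real.norm_eq_abs]
      by_cases hx : K x = 0
      · simp [hx]
      · exact mul_le_mul_of_nonneg_left (hb z _ le_rfl x hx) (abs_nonneg _)
    · exact hKm.mul (by fun_prop : Measurable _).aestronglyMeasurable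
    · refine .of_forall fun x w hw => ?_
      rw [norm_mul, norm_mul, Complex.norm_real, Complex.norm_real, Real.norm_eq_abs,
        Real.norm_eq_abs]
      by_cases hx : K x = 0
      · simp [hx]
      · have hw' : ‖w‖ ≤ ‖z‖ + 1 := by
          rw [Metric.mem_ball, dist_eq_norm] at hw
          have := norm_sub_norm_le w z
          linarith
        exact mul_le_mul_of_nonneg_left (mul_le_mul (hb w _ hw' x hx) (hM x hx) (abs_nonneg _)
          (Real.exp_pos _).le) (abs_nonneg _)
    · refine .of_forall fun x w _ => ?_
      have := (((hasDerivAt_id w).mul_const (D x : ℂ)).cexp).const_mul (K x : ℂ)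
      simpa using this
  have h1 := Complex.norm_deriv_le_of_forall_mem_sphere_norm_le (c := 0) hc
    (f := fun z : ℂ => ∫ x, (K x : ℂ) * Complex.exp (z * D x) ∂ν)
    (Differentiable.diffContOnCl fun z => (hder z).differentiableAt)
    fun z hz => hB z (by simpa using hz)
  rw [(hder 0).deriv] at h1
  have e1 : ∫ x, (K x : ℂ) * (Complex.exp (0 * D x) * D x) ∂ν = ((∫ x, K x * D x ∂ν : ℝ) : ℂ) := by
    rw [← integral_complex_ofReal]
    simp
  rwa [e1, Complex.norm_real, Real.norm_eq_abs] at h1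

lemma nice_form_integrand {κ : ℝ → ℝ} (hκ : Nice κ) (e : ℝ) (hf : Nice f) (hg : Nice g) :
    Nice fun p : (ℝ × ℝ) × ℝ => κ p.2 * f (p.1 - sh e p.2) * g p.1 :=
  (nice_Top_integrand hκ e hf).mul_bdd (hg.meas.comp measurable_fst)
    ⟨hg.bdd.choose, fun p => hg.bdd.choose_spec p.1⟩

lemma integral_Top_mul {κ : ℝ → ℝ} (hκ : Nice κ) (e : ℝ) (hf : Nice f) (hg : Nice g) :
    ∫ x, Top κ e f x * g x =
      ∫ p : (ℝ × ℝ) × ℝ, κ p.2 * f (p.1 - sh e p.2) * g p.1 := by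
  have h := integral_prod (μ := volume) (ν := volume) _ (nice_form_integrand hκ e hf hg).integrable
  simp only [integral_mul_const] at h
  exact h.symm

lemma Sym.nice_mul (h : Sym m β μ) (hf : Nice f) : Nice fun x => β x * f x := by
  simpa only [mul_comm] using h.nice_mul_comp hf (φ := fun t => t) continuous_id

lemma exists_cm_bound_of_lt_two {p p' : ℝ} (hpp : p.HolderConjugate p') (hp2 : p < 2) :
    ∃ C : ℝ, 0 < C ∧ ∀ {e : ℝ}, e * e = 1 → ∀ {m hi : ℤ}, m ≤ hi →
      ∀ {β : ℝ × ℝ → ℝ} {μ : ℤ → ℤ × ℤ → ℝ}, Sym m β μ → ∀ {f g : ℝ × ℝ → ℝ}, Nice f → Nice g →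
      EE m f = f → EE m g = g →
      |∫ x, cm (kap m hi) e β f x * g x| ≤ C * (nrm p f * nrm p' g) := by
  obtain ⟨C, c, hC, hc, hmain⟩ := exists_twisted_bound hpp hp2
  refine ⟨4 * C / c, by positivity, ?_⟩
  intro e he m hi hmh β μ h f g hf hg hfm hgm
  have hκ := nice_kap m hi
  set κ := kap m hi with hκdef
  set K : (ℝ × ℝ) × ℝ → ℝ := fun p => κ p.2 * f (p.1 - sh e p.2) * g p.1 with hKdef
  set D : (ℝ × ℝ) × ℝ → ℝ := fun p => β p.1 - β (p.1 - sh e p.2) with hDdef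
  have hKi : Integrable K := (nice_form_integrand hκ e hf hg).integrable
  have hshm : Measurable fun p : (ℝ × ℝ) × ℝ => p.1 - sh e p.2 := by unfold sh; fun_prop
  have hDm : Measurable D := (h.meas.comp measurable_fst).sub (h.meas.comp hshm)
  obtain ⟨R₁, hR₁⟩ := hf.supp
  obtain ⟨R₂, hR₂⟩ := hg.supp
  obtain ⟨M₁, hM₁⟩ := h.bdd R₁
  obtain ⟨M₂, hM₂⟩ := h.bdd R₂
  have hM : ∀ p, K p ≠ 0 → |D p| ≤ M₂ + M₁ := by
    intro p hp
    have h1 : ‖p.1 - sh e p.2‖ ≤ R₁ := by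
      by_contra hcon
      exact hp (by simp only [hKdef, hR₁ _ (not_le.mp hcon), mul_zero, zero_mul])
    have h2 : ‖p.1‖ ≤ R₂ := by
      by_contra hcon
      exact hp (by simp only [hKdef, hR₂ _ (not_le.mp hcon), mul_zero])
    exact (abs_sub _ _).trans (add_le_add (hM₂ _ h2) (hM₁ _ h1))
  have hform : ∫ x, cm κ e β f x * g x = ∫ p, K p * D p := by
    have hbg := h.nice_mul hg
    have hbf := h.nice_mul hf
    have e1 : ∀ x, cm κ e β f x * g x =
        Top κ e f x * (β x * g x) - Top κ e (fun y => β y * f y) x * g x := fun x => by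
      simp only [cm]; ring
    simp only [e1]
    rw [integral_sub ((nice_Top hκ e hf).mul hbg).integrable ((nice_Top hκ e hbf).mul hg).integrable,
      integral_Top_mul hκ e hf hbg, integral_Top_mul hκ e hbf hg,
      ← integral_sub (nice_form_integrand hκ e hf hbg).integrable
        (nice_form_integrand hκ e hbf hg).integrable]
    refine integral_congr_ae (.of_forall fun p => ?_)
    simp only [hKdef, hDdef]
    ring
  rw [hform, mul_div_right_comm, mul_right_comm, mul_comm_div, ← mul_div_assoc]
  refine (abs_integral_mul_le_of_exp hKi hDm hM hc (B := 4 * (C * (nrm p f * nrm p' g)))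
    fun z hz => ?_).trans (le_of_eq (by ring))
  have hre : |z.re| ≤ c := (Complex.abs_re_le_norm z).trans hz.le
  have hF : ∀ {φ : ℝ → ℝ}, Continuous φ →
      Nice fun x => f x * (Real.exp (-z.re * β x) * φ (β x)) := fun {φ} hφ =>
    h.nice_mul_comp hf (φ := fun t => Real.exp (-z.re * t) * φ t) (by fun_prop)
  have hG : ∀ {φ : ℝ → ℝ}, Continuous φ →
      Nice fun x => g x * (Real.exp (z.re * β x) * φ (β x)) := fun {φ} hφ =>
    h.nice_mul_comp hg (φ := fun t => Real.exp (z.re * t) * φ t) (by fun_prop)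
  set W : (ℝ → ℝ) → (ℝ → ℝ) → (ℝ × ℝ) × ℝ → ℝ := fun φ ψ p => κ p.2 *
    (f (p.1 - sh e p.2) * (Real.exp (-z.re * β (p.1 - sh e p.2)) * φ (β (p.1 - sh e p.2)))) *
    (g p.1 * (Real.exp (z.re * β p.1) * ψ (β p.1))) with hW
  have hWi : ∀ {φ ψ : ℝ → ℝ}, Continuous φ → Continuous ψ → Integrable (W φ ψ) :=
    fun hφ hψ => (nice_form_integrand hκ e (hF hφ) (hG hψ)).integrable
  have hWb : ∀ {φ ψ : ℝ → ℝ}, Continuous φ → Continuous ψ → (∀ t, |φ t| ≤ 1) → (∀ t, |ψ t| ≤ 1) →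
      |∫ p, W φ ψ p| ≤ C * (nrm p f * nrm p' g) := by
    intro φ ψ hφ hψ hφ1 hψ1
    have := hmain he hmh h hf hg hfm hgm hre hφ hψ hφ1 hψ1
    rwa [integral_Top_mul hκ e (hF hφ) (hG hψ)] at this
  have hcc : Continuous fun t => Real.cos (z.im * t) := by fun_prop
  have hsc : Continuous fun t => Real.sin (z.im * t) := by fun_prop
  have hc1 : ∀ t, |Real.cos (z.im * t)| ≤ 1 := fun t => Real.abs_cos_le_one _
  have hs1 : ∀ t, |Real.sin (z.im * t)| ≤ 1 := fun t => Real.abs_sin_le_one _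
  set co : ℝ → ℝ := fun t => Real.cos (z.im * t) with hco
  set si : ℝ → ℝ := fun t => Real.sin (z.im * t) with hsi
  have hpt : ∀ p, (K p : ℂ) * Complex.exp (z * D p) =
      ((W co co p + W si si p : ℝ) : ℂ) + ((W co si p - W si co p : ℝ) : ℂ) * Complex.I := by
    intro p
    have e1 : Complex.exp (z * D p) = ((Real.exp (z.re * D p) * Real.cos (z.im * D p) : ℝ) : ℂ) +
        ((Real.exp (z.re * D p) * Real.sin (z.im * D p) : ℝ) : ℂ) * Complex.I := by
      conv_lhs => rw [← Complex.re_add_im z, add_mul, Complex.exp_add, mul_right_comm,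
        Complex.exp_mul_I]
      push_cast
      ring
    rw [e1]
    have e2 : Real.exp (z.re * D p) = Real.exp (-z.re * β (p.1 - sh e p.2)) *
        Real.exp (z.re * β p.1) := by
      rw [← Real.exp_add]; congr 1; simp only [hDdef]; ring
    have e3 : Real.cos (z.im * D p) = co (β p.1) * co (β (p.1 - sh e p.2)) +
        si (β p.1) * si (β (p.1 - sh e p.2)) := by
      rw [hDdef, mul_sub, Real.cos_sub]
    have e4 : Real.sin (z.im * D p) = si (β p.1) * co (β (p.1 - sh e p.2)) -
        co (β p.1) * si (β (p.1 - sh e p.2)) := by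
      rw [hDdef, mul_sub, Real.sin_sub]
    rw [e2, e3, e4]
    simp only [hKdef, hW]
    push_cast
    ring
  have hInt : ∫ p, (K p : ℂ) * Complex.exp (z * D p) =
      (((∫ p, W co co p) + ∫ p, W si si p : ℝ) : ℂ) +
        (((∫ p, W co si p) - ∫ p, W si co p : ℝ) : ℂ) * Complex.I := by
    rw [← integral_add (hWi hcc hcc) (hWi hsc hsc), ← integral_sub (hWi hcc hsc) (hWi hsc hcc),
      ← integral_complex_ofReal, ← integral_complex_ofReal, ← integral_mul_const,
      ← integral_add ((hWi hcc hcc).add (hWi hsc hsc)).ofReal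
        (((hWi hcc hsc).sub (hWi hsc hcc)).ofReal.mul_const _)]
    exact integral_congr_ae (.of_forall hpt)
  rw [hInt]
  refine (norm_add_le _ _).trans ?_
  rw [norm_mul, Complex.norm_I, mul_one, Complex.norm_real, Complex.norm_real, Real.norm_eq_abs,
    Real.norm_eq_abs]
  have b1 := hWb hcc hcc hc1 hc1
  have b2 := hWb hsc hsc hs1 hs1
  have b3 := hWb hcc hsc hc1 hs1
  have b4 := hWb hsc hcc hs1 hc1
  have t1 := abs_add_le (∫ p, W co co p) (∫ p, W si si p)
  have t2 := abs_sub (∫ p, W co si p) (∫ p, W si co p)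
  linarith

end

section

variable {f g b : ℝ × ℝ → ℝ} {m : ℤ} {μ : ℤ → ℤ × ℤ → ℝ} {κ : ℝ → ℝ} {e : ℝ}

/-! ### Bounded symbols -/

lemma nice_cm (hκ : Nice κ) (e : ℝ) (hb : Measurable b) (hbM : ∃ M, ∀ x, |b x| ≤ M) (hf : Nice f) :
    Nice (cm κ e b f) := by
  have h1 := (nice_Top hκ e hf).mul_bdd hb hbM
  have h2 := nice_Top hκ e (hf.mul_bdd hb hbM)
  simp only [mul_comm _ (b _)] at h1 h2
  exact h1.sub h2

lemma integral_cm_mul (hκ : Nice κ) (e : ℝ) (hf : Nice f) (hg : Nice g)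
    (hbf : Nice fun x => b x * f x) (hbg : Nice fun x => b x * g x) :
    ∫ x, cm κ e b f x * g x =
      (∫ x, Top κ e f x * (b x * g x)) - ∫ x, Top κ e (fun x => b x * f x) x * g x := by
  rw [← integral_sub ((nice_Top hκ e hf).mul hbg).integrable ((nice_Top hκ e hbf).mul hg).integrable]
  refine integral_congr_ae (.of_forall fun x => ?_)
  simp only [cm]
  ring

lemma integral_cm_mul_adjoint (hκ : Nice κ) (e : ℝ) (hf : Nice f) (hg : Nice g)
    (hbf : Nice fun x => b x * f x) (hbg : Nice fun x => b x * g x) :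
    ∫ x, cm κ e b f x * g x = -∫ x, cm κ (-e) b g x * f x := by
  rw [integral_cm_mul hκ e hf hg hbf hbg, integral_cm_mul hκ (-e) hg hf hbg hbf,
    Top_adjoint hκ e hf hbg, Top_adjoint hκ e hbf hg]
  simp only [mul_comm (Top _ _ _ _)]
  ring

lemma exists_cm_bound_of_ne_two {p p' : ℝ} (hpp : p.HolderConjugate p') (hp2 : p ≠ 2) :
    ∃ C : ℝ, 0 < C ∧ ∀ {e : ℝ}, e * e = 1 → ∀ {m hi : ℤ}, m ≤ hi →
      ∀ {β : ℝ × ℝ → ℝ} {μ : ℤ → ℤ × ℤ → ℝ}, Sym m β μ → ∀ {f g : ℝ × ℝ → ℝ}, Nice f → Nice g →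
      EE m f = f → EE m g = g →
      |∫ x, cm (kap m hi) e β f x * g x| ≤ C * (nrm p f * nrm p' g) := by
  rcases lt_or_gt_of_ne hp2 with hlt | hgt
  · exact exists_cm_bound_of_lt_two hpp hlt
  · have hp' : p' < 2 := by
      have h1 := hpp.inv_add_inv_eq_one
      have h2 := inv_strictAnti₀ two_pos hgt
      by_contra hcon
      have h3 := inv_anti₀ two_pos (not_lt.mp hcon)
      norm_num at *
      linarith
    obtain ⟨C, hC, h⟩ := exists_cm_bound_of_lt_two hpp.symm hp'
    refine ⟨C, hC, fun {e} he {m hi} hmh {β μ} hβ {f g} hf hg hfm hgm => ?_⟩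
    rw [integral_cm_mul_adjoint (nice_kap m hi) e hf hg (hβ.nice_mul hf) (hβ.nice_mul hg), abs_neg,
      mul_comm (nrm p f)]
    exact h (by linarith) hmh hβ hg hf hgm hfm

/-- Bounded symbols of mean oscillation at most `1` around the constants `μ k n`. -/
structure BSym (b : ℝ × ℝ → ℝ) (μ : ℤ → ℤ × ℤ → ℝ) : Prop where
  meas : Measurable b
  bdd : ∃ M, ∀ x, |b x| ≤ M
  osc : ∀ k n, ∫ x in tri k n, |b x - μ k n| ≤ 8 ^ k

lemma BSym.nice_mul (h : BSym b μ) (hf : Nice f) : Nice fun x => b x * f x := by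
  simpa only [mul_comm] using hf.mul_bdd h.meas h.bdd

lemma integrableOn_of_bdd {u : ℝ × ℝ → ℝ} (hu : Measurable u) (hM : ∃ M, ∀ x, |u x| ≤ M)
    {S : Set (ℝ × ℝ)} (hS : volume S ≠ ⊤) : IntegrableOn u S :=
  Measure.integrableOn_of_bounded hS hu.aestronglyMeasurable (M := hM.choose)
    (.of_forall hM.choose_spec)

lemma BSym.sym_EE (h : BSym b μ) (m : ℤ) : Sym m (EE m b) μ where
  meas := measurable_EE m b
  const := fun x y hxy => EE_of_idx_eq b hxy
  bdd := fun R => h.bdd.imp fun M hM x _ => abs_EE_le_of_bdd fun y _ => hM y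
  osc := fun k hk n => by
    obtain ⟨M, hM⟩ := h.bdd
    have hT := measurableSet_tri k n
    have hbd : ∀ {u : ℝ × ℝ → ℝ}, (∀ x, |u x| ≤ M) → ∃ M', ∀ x, |(|u x - μ k n|)| ≤ M' :=
      fun {u} hu => ⟨M + |μ k n|, fun x => by
        rw [abs_abs]
        exact (abs_sub _ _).trans (add_le_add (hu x) le_rfl)⟩
    have hEm := measurable_EE m b
    have hbm := h.meas
    have h1 : Integrable ((tri k n).indicator fun x => |EE m b x - μ k n|) :=
      (integrable_indicator_iff hT).mpr (integrableOn_of_bdd (by fun_prop)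
        (hbd fun x => abs_EE_le_of_bdd fun y _ => hM y) (volume_tri_ne_top k n))
    have h2 : Integrable ((tri k n).indicator fun x => |b x - μ k n|) :=
      (integrable_indicator_iff hT).mpr (integrableOn_of_bdd (by fun_prop) (hbd hM)
        (volume_tri_ne_top k n))
    have h3 := abs_setIntegral_le_of_cube (dMeas_tri hk n) h1 h2 fun n' hn' => ?_
    · rw [setIntegral_indicator hT, setIntegral_indicator hT, inter_self] at h3
      exact (le_abs_self _).trans (h3.trans (h.osc k n))
    · have h8 : (0 : ℝ) < 8 ^ m := by positivity
      have hC := measurableSet_cube m n'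
      rw [setIntegral_congr_fun (f := (tri k n).indicator fun x => |EE m b x - μ k n|)
          (g := fun x => |EE m b x - μ k n|) hC fun x hx =>
          indicator_of_mem (hn' hx) _,
        setIntegral_congr_fun (f := (tri k n).indicator fun x => |b x - μ k n|)
          (g := fun x => |b x - μ k n|) hC fun x hx =>
          indicator_of_mem (hn' hx) _,
        setIntegral_congr_fun (f := fun x => |EE m b x - μ k n|)
          (g := fun _ => |(8 ^ m)⁻¹ * (∫ y in cube m n', b y) - μ k n|) hC
          fun x hx => by simp only [EE_of_mem b hx],
        setIntegral_const, volume_real_cube, smul_eq_mul, abs_mul, abs_abs, ← abs_mul, mul_sub,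
        mul_inv_cancel_left₀ h8.ne']
      have hbi : IntegrableOn b (cube m n') :=
        integrableOn_of_bdd hbm ⟨M, hM⟩ (volume_cube_ne_top m n')
      have e1 : (∫ y in cube m n', b y) - 8 ^ m * μ k n = ∫ y in cube m n', (b y - μ k n) := by
        rw [integral_sub hbi (integrableOn_const (volume_cube_ne_top m n')), setIntegral_const,
          volume_real_cube, smul_eq_mul]
      rw [e1]
      exact abs_integral_le_integral_abs

lemma nrm_EE_le {p : ℝ} (hp : 1 ≤ p) (m : ℤ) (hf : Nice f) : nrm p (EE m f) ≤ nrm p f :=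
  Real.rpow_le_rpow (integral_nonneg fun x => by positivity) (integral_abs_EE_rpow_le m hf hp)
    (by positivity)

lemma norm_sub_le_of_idx_eq (hm : m ≤ 0) {x y : ℝ × ℝ} (h : idx m x = idx m y) :
    ‖x - y‖ ≤ 2 ^ m := by
  have h1 := close_of_idx_eq h
  have h2 : (4 : ℝ) ^ m ≤ 2 ^ m := by
    rw [four_zpow]
    have := zpow_le_one_of_nonpos₀ (one_le_two (α := ℝ)) hm
    have : (0 : ℝ) < 2 ^ m := by positivity
    nlinarith
  rw [Prod.norm_def]
  exact max_le h1.1.le (h1.2.le.trans h2)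

lemma tendsto_integral_abs_EE_sub (hf : Nice f) :
    Tendsto (fun m => ∫ x, |EE m f x - f x|) atBot (nhds 0) := by
  rw [Metric.tendsto_nhds]
  intro ε hε
  obtain ⟨h, hhs, hh, hhc, hhi⟩ := Integrable.exists_hasCompactSupport_integral_sub_le
    (μ := volume) hf.integrable (ε := ε / 4) (by positivity)
  obtain ⟨R, hR⟩ := hhs.isCompact.isBounded.exists_norm_le
  have hsupp : ∀ x, R < ‖x‖ → h x = 0 := fun x hx =>
    image_eq_zero_of_notMem_tsupport fun hx' => (hR x hx').not_gt hx
  have hn : Nice h := ⟨hhc.measurable, by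
    obtain ⟨M, hM⟩ := hhs.exists_bound_of_continuous hhc
    exact ⟨M, hM⟩, R, hsupp⟩
  set B := Metric.closedBall (0 : ℝ × ℝ) (R + 1) with hB
  set V := volume.real B with hV
  have hV0 : 0 ≤ V := measureReal_nonneg
  obtain ⟨δ, hδ, hδu⟩ := Metric.uniformContinuous_iff.mp (hhs.uniformContinuous_of_continuous hhc)
    (ε / (4 * (V + 1))) (by positivity)
  obtain ⟨N, hN⟩ := exists_pow_lt_of_lt_one hδ (by norm_num : (1 / 2 : ℝ) < 1)
  filter_upwards [eventually_le_atBot (-N : ℤ), eventually_le_atBot (0 : ℤ)] with m hmN hm0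
  have hm : (2 : ℝ) ^ m < δ := by
    refine (zpow_le_zpow_right₀ one_le_two hmN).trans_lt ?_
    rwa [zpow_neg, zpow_natCast, ← inv_pow, ← one_div]
  have hEh := nice_EE m hn
  have hcube : ∀ x, |EE m h x - h x| ≤ B.indicator (fun _ => ε / (4 * (V + 1))) x := by
    intro x
    by_cases hx : x ∈ B
    · rw [indicator_of_mem hx]
      have e1 : EE m h x - h x = EE m (fun y => h y - h x) x := by
        have h8 : (0 : ℝ) < 8 ^ m := by positivity
        simp only [EE]
        rw [integral_sub hn.integrable.integrableOn (integrableOn_const (volume_cube_ne_top m _)),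
          setIntegral_const, volume_real_cube, smul_eq_mul, mul_sub, inv_mul_cancel_left₀ h8.ne']
      rw [e1]
      refine abs_EE_le_of_bdd fun y hy => ?_
      have := hδu (a := y) (b := x) (by
        rw [dist_eq_norm]
        exact (norm_sub_le_of_idx_eq hm0 (mem_cube.mp hy)).trans_lt hm)
      exact this.le
    · rw [indicator_of_notMem hx]
      rw [hB, mem_closedBall_zero_iff, not_le] at hx
      have h3 := zpow_le_one_of_nonpos₀ (one_le_two (α := ℝ)) hm0
      have hz : ∀ y ∈ cube m (idx m x), |h y| ≤ 0 := by
        intro y hy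
        have h1 := norm_sub_le_of_idx_eq hm0 (mem_cube.mp hy)
        have h2 := norm_sub_norm_le x y
        rw [norm_sub_rev] at h2
        rw [hsupp y (by linarith), abs_zero]
      rw [hsupp x (by linarith), sub_zero]
      exact abs_EE_le_of_bdd hz
  have h1 : ∫ x, |EE m h x - h x| ≤ ε / 4 := by
    refine (integral_mono (hEh.sub hn).abs.integrable ?_ hcube).trans ?_
    · exact (integrable_indicator_iff measurableSet_closedBall).mpr
        (integrableOn_const measure_closedBall_lt_top.ne)
    · rw [integral_indicator measurableSet_closedBall, setIntegral_const, smul_eq_mul, ← hV]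
      rw [mul_div_assoc', div_le_div_iff₀ (by positivity) (by norm_num)]
      nlinarith
  have h2 := integral_abs_EE_rpow_le m (hf.sub hn) (r := 1) le_rfl
  simp only [Real.rpow_one, EE_sub m hf hn] at h2
  have h3 : ∫ x, |EE m f x - f x| ≤
      (∫ x, |EE m f x - EE m h x|) + (∫ x, |EE m h x - h x|) + ∫ x, |f x - h x| := by
    have i1 : Integrable fun x => |EE m f x - EE m h x| := ((nice_EE m hf).sub hEh).abs.integrable
    have i2 : Integrable fun x => |EE m h x - h x| := (hEh.sub hn).abs.integrable
    have i12 : Integrable fun x => |EE m f x - EE m h x| + |EE m h x - h x| := i1.add i2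
    rw [← integral_add i1 i2, ← integral_add i12 (hf.sub hn).abs.integrable]
    refine integral_mono ((nice_EE m hf).sub hf).abs.integrable
      (i12.add (hf.sub hn).abs.integrable) fun x => ?_
    have t1 := abs_sub_le (EE m f x) (EE m h x) (f x)
    have t2 := abs_sub_le (EE m h x) (h x) (f x)
    rw [abs_sub_comm (h x)] at t2
    linarith
  have hhi' : ∫ x, |f x - h x| ≤ ε / 4 := hh
  rw [Real.dist_eq, sub_zero, abs_of_nonneg (integral_nonneg fun x => abs_nonneg _)]
  linarith

end

section

variable {f g b : ℝ × ℝ → ℝ} {m : ℤ} {μ : ℤ → ℤ × ℤ → ℝ} {κ : ℝ → ℝ} {e : ℝ}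

/-! ### Passage to the limit in the dyadic discretization -/

/-- Bounded convergence in `L¹` within the class of bounded functions of bounded support. -/
structure ConvL1 (u : ℤ → ℝ × ℝ → ℝ) (w : ℝ × ℝ → ℝ) : Prop where
  nice : ∀ m, Nice (u m)
  nice_lim : Nice w
  bdd : ∃ M, ∀ m x, |u m x| ≤ M
  lim : Tendsto (fun m => ∫ x, |u m x - w x|) atBot (nhds 0)

section ConvL1

variable {u v : ℤ → ℝ × ℝ → ℝ} {w z : ℝ × ℝ → ℝ}

lemma convL1_EE (hf : Nice f) : ConvL1 (fun m => EE m f) f where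
  nice m := nice_EE m hf
  nice_lim := hf
  bdd := hf.bdd.imp fun _ hM _ _ => abs_EE_le_of_bdd fun y _ => hM y
  lim := tendsto_integral_abs_EE_sub hf

lemma ConvL1.mul (hu : ConvL1 u w) (hv : ConvL1 v z) :
    ConvL1 (fun m x => u m x * v m x) (fun x => w x * z x) := by
  obtain ⟨M, hM⟩ := hu.bdd
  obtain ⟨M', hM'⟩ := hv.bdd
  obtain ⟨N, hN0, hN⟩ := hv.nice_lim.exists_pos_bdd
  refine ⟨fun m => (hu.nice m).mul (hv.nice m), hu.nice_lim.mul hv.nice_lim, ⟨M * M', fun m x => ?_⟩,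
    ?_⟩
  · rw [abs_mul]
    exact mul_le_mul (hM m x) (hM' m x) (abs_nonneg _) ((abs_nonneg _).trans (hM m x))
  · have h := (hv.lim.const_mul M).add (hu.lim.const_mul N)
    rw [mul_zero, mul_zero, add_zero] at h
    refine squeeze_zero (fun m => integral_nonneg fun x => abs_nonneg _) (fun m => ?_) h
    have i1 : Integrable fun x => M * |v m x - z x| :=
      (((hv.nice m).sub hv.nice_lim).abs.const_mul M).integrable
    have i2 : Integrable fun x => N * |u m x - w x| :=
      (((hu.nice m).sub hu.nice_lim).abs.const_mul N).integrable
    rw [← integral_const_mul, ← integral_const_mul, ← integral_add i1 i2]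
    refine integral_mono
      (((hu.nice m).mul (hv.nice m)).sub (hu.nice_lim.mul hv.nice_lim)).abs.integrable
      (i1.add i2) fun x => ?_
    have e1 : u m x * v m x - w x * z x = u m x * (v m x - z x) + z x * (u m x - w x) := by ring
    simp only [e1]
    refine (abs_add_le _ _).trans ?_
    rw [abs_mul, abs_mul]
    exact add_le_add (mul_le_mul_of_nonneg_right (hM m x) (abs_nonneg _))
      (mul_le_mul_of_nonneg_right (hN x) (abs_nonneg _))

lemma ConvL1.Top (hκ : Nice κ) (e : ℝ) (hu : ConvL1 u w) :
    ConvL1 (fun m => Top κ e (u m)) (Top κ e w) := by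
  obtain ⟨M, hM⟩ := hu.bdd
  refine ⟨fun m => nice_Top hκ e (hu.nice m), nice_Top hκ e hu.nice_lim,
    ⟨_, fun m x => abs_Top_le_of_bdd hκ e (hu.nice m) (hM m) x⟩, ?_⟩
  have h := hu.lim.const_mul (∫ t, |κ t|)
  rw [mul_zero] at h
  refine squeeze_zero (fun m => integral_nonneg fun x => abs_nonneg _) (fun m => ?_) h
  simp only [← Top_sub hκ e (hu.nice m) hu.nice_lim]
  exact integral_abs_Top_le hκ e ((hu.nice m).sub hu.nice_lim)

lemma ConvL1.tendsto_integral (hu : ConvL1 u w) :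
    Tendsto (fun m => ∫ x, u m x) atBot (nhds (∫ x, w x)) := by
  rw [tendsto_iff_norm_sub_tendsto_zero]
  refine squeeze_zero (fun m => norm_nonneg _) (fun m => ?_) hu.lim
  rw [← integral_sub (hu.nice m).integrable hu.nice_lim.integrable]
  exact abs_integral_le_integral_abs

end ConvL1

lemma EE_mul_EE_eq_indicator {R : ℝ} (hm : m ≤ 0) (hf : ∀ x, R < ‖x‖ → f x = 0) (b : ℝ × ℝ → ℝ)
    (x : ℝ × ℝ) : EE m b x * EE m f x =
      EE m ((Metric.closedBall 0 (R + 1)).indicator b) x * EE m f x := by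
  by_cases h : ∀ y ∈ cube m (idx m x), f y = 0
  · have : EE m f x = 0 := abs_nonpos_iff.mp (abs_EE_le_of_bdd fun y hy => by simp [h y hy])
    rw [this, mul_zero, mul_zero]
  · push Not at h
    obtain ⟨y, hy, hfy⟩ := h
    have hyR : ‖y‖ ≤ R := by
      by_contra hcon
      exact hfy (hf y (not_le.mp hcon))
    congr 1
    simp only [EE]
    congr 1
    refine setIntegral_congr_fun (measurableSet_cube m _) fun z hz => ?_
    refine (indicator_of_mem ?_ _).symm
    rw [mem_closedBall_zero_iff]
    have h1 := norm_sub_le_of_idx_eq hm ((mem_cube.mp hz).trans (mem_cube.mp hy).symm)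
    have h2 := norm_sub_norm_le z y
    have h3 := zpow_le_one_of_nonpos₀ (one_le_two (α := ℝ)) hm
    linarith

lemma cm_kap_add {lo mid hi : ℤ} (h₁ : lo ≤ mid) (h₂ : mid ≤ hi) (e : ℝ) (hf : Nice f)
    (hbf : Nice fun x => b x * f x) (x : ℝ × ℝ) :
    cm (kap lo hi) e b f x = cm (kap lo mid) e b f x + cm (kap mid hi) e b f x := by
  simp only [cm, Top_kap_add hf h₁ h₂, Top_kap_add hbf h₁ h₂]
  ring

lemma exists_cm_bound_of_bSym {p p' : ℝ} (hpp : p.HolderConjugate p') (hp2 : p ≠ 2) :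
    ∃ C : ℝ, 0 < C ∧ ∀ {e : ℝ}, e * e = 1 → ∀ {lo hi : ℤ}, lo ≤ hi →
      ∀ {b : ℝ × ℝ → ℝ} {μ : ℤ → ℤ × ℤ → ℝ}, BSym b μ → ∀ {f g : ℝ × ℝ → ℝ}, Nice f → Nice g →
      |∫ x, cm (kap lo hi) e b f x * g x| ≤ C * (nrm p f * nrm p' g) := by
  obtain ⟨C, hC, h⟩ := exists_cm_bound_of_ne_two hpp hp2
  refine ⟨2 * C, by positivity, fun {e} he {lo hi} hlh {b μ} hb {f g} hf hg => ?_⟩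
  obtain ⟨R₁, hR₁⟩ := hf.supp
  obtain ⟨R₂, hR₂⟩ := hg.supp
  set R := max R₁ R₂
  have hfR : ∀ x, R < ‖x‖ → f x = 0 := fun x hx => hR₁ x ((le_max_left _ _).trans_lt hx)
  have hgR : ∀ x, R < ‖x‖ → g x = 0 := fun x hx => hR₂ x ((le_max_right _ _).trans_lt hx)
  set b' := (Metric.closedBall (0 : ℝ × ℝ) (R + 1)).indicator b
  have hb' : Nice b' := by
    refine ⟨hb.meas.indicator measurableSet_closedBall, ?_, R + 1, fun x hx =>
      indicator_of_notMem (fun hx' => ?_) _⟩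
    · obtain ⟨M, hM⟩ := hb.bdd
      exact ⟨M, fun x => (norm_indicator_le_norm_self b x).trans (hM x)⟩
    · exact (mem_closedBall_zero_iff.mp hx').not_gt hx
  have hmul : ∀ {u : ℝ × ℝ → ℝ}, (∀ x, R < ‖x‖ → u x = 0) → ∀ x, b' x * u x = b x * u x := by
    intro u hu x
    by_cases hx : x ∈ Metric.closedBall (0 : ℝ × ℝ) (R + 1)
    · simp only [b', indicator_of_mem hx]
    · rw [mem_closedBall_zero_iff, not_le] at hx
      rw [hu x (by linarith), mul_zero, mul_zero]
  have hκ := nice_kap lo hi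
  have cf := convL1_EE hf
  have cg := convL1_EE hg
  have cb := convL1_EE hb'
  have lim := ((cf.Top hκ e).mul (cb.mul cg)).tendsto_integral.sub
    (((cb.mul cf).Top hκ e).mul cg).tendsto_integral
  simp only [hmul hfR, hmul hgR] at lim
  rw [← integral_cm_mul hκ e hf hg (hb.nice_mul hf) (hb.nice_mul hg)] at lim
  refine le_of_tendsto lim.abs ?_
  filter_upwards [eventually_le_atBot lo, eventually_le_atBot (0 : ℤ)] with m hm hm0
  have hS := hb.sym_EE m
  have nf := nice_EE m hf
  have ng := nice_EE m hg
  simp only [b', ← EE_mul_EE_eq_indicator hm0 hfR b, ← EE_mul_EE_eq_indicator hm0 hgR b]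
  rw [← integral_cm_mul hκ e nf ng (hS.nice_mul nf) (hS.nice_mul ng)]
  have hEE : ∀ u : ℝ × ℝ → ℝ, EE m (EE m u) = EE m u := fun u =>
    EE_eq_self fun x y hxy => EE_of_idx_eq u hxy
  have key : ∀ {hi : ℤ}, m ≤ hi →
      |∫ x, cm (kap m hi) e (EE m b) (EE m f) x * EE m g x| ≤ C * (nrm p f * nrm p' g) :=
    fun {hi} hmh => (h he hmh hS nf ng (hEE f) (hEE g)).trans <|
      mul_le_mul_of_nonneg_left (mul_le_mul (nrm_EE_le hpp.lt.le m hf)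
        (nrm_EE_le hpp.symm.lt.le m hg) (nrm_nonneg _ _) (nrm_nonneg _ _)) hC.le
  have ncm : ∀ hi, Integrable fun x => cm (kap m hi) e (EE m b) (EE m f) x * EE m g x := fun hi =>
    ((nice_cm (nice_kap m hi) e (measurable_EE m b)
      (hb.bdd.imp fun M hM x => abs_EE_le_of_bdd fun y _ => hM y) nf).mul ng).integrable
  have e1 : ∫ x, cm (kap lo hi) e (EE m b) (EE m f) x * EE m g x =
      (∫ x, cm (kap m hi) e (EE m b) (EE m f) x * EE m g x) -
        ∫ x, cm (kap m lo) e (EE m b) (EE m f) x * EE m g x := by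
    rw [← integral_sub (ncm hi) (ncm lo)]
    refine integral_congr_ae (.of_forall fun x => ?_)
    simp only [cm_kap_add hm hlh e nf (hS.nice_mul nf)]
    ring
  rw [e1]
  have k1 := key (hm.trans hlh)
  have k2 := key hm
  exact (abs_sub _ _).trans (by linarith)

end

section

variable {f g h b : ℝ × ℝ → ℝ} {μ : ℤ → ℤ × ℤ → ℝ} {p : ℝ}

/-! ### Operator norm bounds for bounded symbols -/

lemma nrm_rpow (hp : 0 < p) (f : ℝ × ℝ → ℝ) : nrm p f ^ p = ∫ x, |f x| ^ p := by
  rw [nrm, ← Real.rpow_mul (integral_nonneg fun x => by positivity), one_div_mul_cancel hp.ne',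
    Real.rpow_one]

lemma nrm_le_of_dual {p' K : ℝ} (hpp : p.HolderConjugate p') (hh : Nice h) (hK : 0 ≤ K)
    (H : ∀ g : ℝ × ℝ → ℝ, Nice g → |∫ x, h x * g x| ≤ K * nrm p' g) : nrm p h ≤ K := by
  have hp1 := hpp.lt
  set g : ℝ × ℝ → ℝ := fun x => if 0 ≤ h x then |h x| ^ (p - 1) else -|h x| ^ (p - 1)
  have hhm := hh.meas
  have hga : ∀ x, |g x| = |h x| ^ (p - 1) := by
    intro x
    have : 0 ≤ |h x| ^ (p - 1) := by positivity
    simp only [g]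
    split_ifs
    · exact abs_of_nonneg this
    · rw [abs_neg, abs_of_nonneg this]
  have hhg : ∀ x, h x * g x = |h x| ^ p := by
    intro x
    have e : |h x| ^ p = |h x| * |h x| ^ (p - 1) := by
      conv_rhs => enter [1]; rw [← Real.rpow_one |h x|]
      rw [← Real.rpow_add' (abs_nonneg _) (by linarith), add_sub_cancel]
    rw [e]
    simp only [g]
    split_ifs with h0
    · rw [abs_of_nonneg h0]
    · rw [abs_of_neg (not_le.mp h0)]
      ring
  have hr := hh.abs_rpow (r := p - 1) (by linarith)
  have hg : Nice g := by
    refine hr.of_supp (Measurable.ite (measurableSet_le measurable_const hhm) (by fun_prop)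
      (by fun_prop)) ?_ fun x hx => ?_
    · obtain ⟨M, hM⟩ := hr.bdd
      exact ⟨M, fun x => by rw [hga]; exact (le_abs_self _).trans (hM x)⟩
    · rw [← abs_eq_zero, hga, hx]
  have h1 := H g hg
  simp only [hhg] at h1
  set A := ∫ x, |h x| ^ p with hA
  have hA0 : 0 ≤ A := integral_nonneg fun x => by positivity
  have hng : nrm p' g = A ^ (1 / p') := by
    simp only [nrm, hga]
    congr 2
    ext x
    rw [← Real.rpow_mul (abs_nonneg _), hpp.sub_one_mul_conj]
  rw [hng, abs_of_nonneg hA0] at h1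
  rcases hA0.eq_or_lt with h0 | h0
  · rwa [nrm, ← hA, ← h0, Real.zero_rpow (by rw [one_div]; exact hpp.inv_ne_zero)]
  · have hs : A = A ^ (1 / p) * A ^ (1 / p') := by
      rw [← Real.rpow_add h0, one_div, one_div, hpp.inv_add_inv_eq_one, Real.rpow_one]
    conv_lhs at h1 => rw [hs]
    exact le_of_mul_le_mul_right h1 (Real.rpow_pos_of_pos h0 _)

/-- The integrand of the real interpolation between `L^{3/2}` and `L³`. -/
def marK (t s : ℝ) : ℝ :=
  if t < s then t ^ (3 / 2 - 2 : ℝ) * s ^ (3 / 2 : ℝ) else t ^ (-2 : ℝ) * s ^ (3 : ℝ)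

lemma lintegral_marK_le {s : ℝ} (hs : 0 ≤ s) :
    ∫⁻ t in Ioi 0, ENNReal.ofReal (marK t s) ≤ ENNReal.ofReal (3 * s ^ (2 : ℝ)) := by
  rcases hs.eq_or_lt with rfl | h0
  · rw [setLIntegral_congr_fun (g := fun _ => 0) measurableSet_Ioi fun t (ht : 0 < t) => by
      simp [marK, ht.not_gt], lintegral_zero]
    exact zero_le
  · rw [← Ioo_union_Ici_eq_Ioi h0]
    refine (lintegral_union_le _ _ _).trans ?_
    rw [setLIntegral_congr_fun (f := fun t => ENNReal.ofReal (marK t s))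
        (g := fun t => ENNReal.ofReal (t ^ (3 / 2 - 2 : ℝ)) * ENNReal.ofReal (s ^ (3 / 2 : ℝ)))
        measurableSet_Ioo fun t ht => by
          have := Real.rpow_nonneg ht.1.le (3 / 2 - 2)
          simp only [marK, if_pos ht.2, ENNReal.ofReal_mul this],
      setLIntegral_congr_fun (f := fun t => ENNReal.ofReal (marK t s))
        (g := fun t => ENNReal.ofReal (t ^ (-2 : ℝ)) * ENNReal.ofReal (s ^ (3 : ℝ)))
        measurableSet_Ici fun t (ht : s ≤ t) => by
          have := Real.rpow_nonneg (h0.trans_le ht).le (-2)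
          simp only [marK, if_neg ht.not_gt, ENNReal.ofReal_mul this],
      lintegral_mul_const' _ _ ENNReal.ofReal_ne_top, lintegral_mul_const' _ _ ENNReal.ofReal_ne_top,
      lintegral_Ioo_rpow (by norm_num) hs,
      Measure.restrict_congr_set (Ioi_ae_eq_Ici (μ := volume)).symm,
      ← ofReal_integral_eq_lintegral_ofReal (integrableOn_Ioi_rpow_of_lt (by norm_num) h0)
        (by filter_upwards [ae_restrict_mem measurableSet_Ioi] with t (ht : s < t)
            exact Real.rpow_nonneg (h0.trans ht).le _),
      integral_Ioi_rpow_of_lt (by norm_num) h0, ← ENNReal.ofReal_mul (by norm_num; positivity),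
      ← ENNReal.ofReal_mul (by norm_num; positivity),
      ← ENNReal.ofReal_add (by norm_num; positivity) (by norm_num; positivity)]
    refine ENNReal.ofReal_le_ofReal (le_of_eq ?_)
    have e1 : s ^ (3 / 2 - 1 : ℝ) * s ^ (3 / 2 : ℝ) = s ^ (2 : ℝ) := by
      rw [← Real.rpow_add h0]; norm_num
    have e2 : s ^ (-2 + 1 : ℝ) * s ^ (3 : ℝ) = s ^ (2 : ℝ) := by
      rw [← Real.rpow_add h0]; norm_num
    linear_combination 2 * e1 + e2

lemma volume_lt_abs_le {r t : ℝ} (hh : Nice h) (hr : 0 < r) (ht : 0 < t) :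
    volume {x | t < |h x|} ≤ ENNReal.ofReal (t ^ (-r) * ∫ x, |h x| ^ r) := by
  have hm := hh.meas
  have htr : 0 < t ^ r := Real.rpow_pos_of_pos ht r
  rw [Real.rpow_neg ht.le, inv_mul_eq_div, ENNReal.ofReal_div_of_pos htr,
    ofReal_integral_eq_lintegral_ofReal (hh.abs_rpow hr).integrable
      (.of_forall fun x => by positivity)]
  refine (measure_mono fun x hx => ?_).trans (meas_ge_le_lintegral_div (by fun_prop)
    (ENNReal.ofReal_pos.mpr htr).ne' ENNReal.ofReal_ne_top)
  exact ENNReal.ofReal_le_ofReal (Real.rpow_le_rpow ht.le (le_of_lt hx) hr.le)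

/-- Real interpolation at the exponent `2`, for linear operators on bounded functions of bounded
support. -/
lemma integral_abs_sq_le_of_interpolation {T : (ℝ × ℝ → ℝ) → ℝ × ℝ → ℝ} {A : ℝ} (hA : 0 ≤ A)
    (hT : ∀ f, Nice f → Nice (T f))
    (hadd : ∀ f g, Nice f → Nice g → ∀ x, T (fun y => f y + g y) x = T f x + T g x)
    (h₁ : ∀ f, Nice f → ∫ x, |T f x| ^ (3 / 2 : ℝ) ≤ A * ∫ x, |f x| ^ (3 / 2 : ℝ))
    (h₂ : ∀ f, Nice f → ∫ x, |T f x| ^ (3 : ℝ) ≤ A * ∫ x, |f x| ^ (3 : ℝ)) (hf : Nice f) :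
    ∫ x, |T f x| ^ (2 : ℝ) ≤ 48 * A * ∫ x, |f x| ^ (2 : ℝ) := by
  have hfm := hf.meas
  have hTm := (hT f hf).meas
  have hweak : ∀ t : ℝ, 0 < t → volume {x | t < |T f x|} * ENNReal.ofReal (t ^ (2 - 1 : ℝ)) ≤
      ENNReal.ofReal (8 * A) * ∫⁻ x, ENNReal.ofReal (marK t |f x|) := by
    intro t ht
    set S := {x | t < |f x|}
    have hS : MeasurableSet S := measurableSet_lt measurable_const (by fun_prop)
    set u := S.indicator f
    set v := Sᶜ.indicator f
    have hu : Nice u := hf.indicator hS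
    have hv : Nice v := hf.indicator hS.compl
    have huv : f = fun y => u y + v y := by
      ext y; exact (indicator_self_add_compl_apply S f y).symm
    have hsub : {x | t < |T f x|} ⊆ {x | t / 2 < |T u x|} ∪ {x | t / 2 < |T v x|} := by
      intro x (hx : t < |T f x|)
      rw [huv, hadd u v hu hv] at hx
      have := abs_add_le (T u x) (T v x)
      by_contra hcon
      simp only [mem_union, mem_ofPred_eq, not_or, not_lt] at hcon
      linarith
    have i1 : Integrable fun x => t ^ (3 / 2 - 2 : ℝ) * |u x| ^ (3 / 2 : ℝ) :=
      ((hu.abs_rpow (by norm_num)).const_mul _).integrable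
    have i2 : Integrable fun x => t ^ (-2 : ℝ) * |v x| ^ (3 : ℝ) :=
      ((hv.abs_rpow (by norm_num)).const_mul _).integrable
    have i12 : Integrable fun x =>
      t ^ (3 / 2 - 2 : ℝ) * |u x| ^ (3 / 2 : ℝ) + t ^ (-2 : ℝ) * |v x| ^ (3 : ℝ) := i1.add i2
    have hk : ∀ x, marK t |f x| =
        t ^ (3 / 2 - 2 : ℝ) * |u x| ^ (3 / 2 : ℝ) + t ^ (-2 : ℝ) * |v x| ^ (3 : ℝ) := by
      intro x
      by_cases hx : t < |f x|
      · have e1 : u x = f x := indicator_of_mem (show x ∈ S from hx) _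
        have e2 : v x = 0 := indicator_of_notMem (not_not.mpr (show x ∈ S from hx)) _
        rw [marK, if_pos hx, e1, e2]; simp
      · have e1 : u x = 0 := indicator_of_notMem (show x ∉ S from hx) _
        have e2 : v x = f x := indicator_of_mem (show x ∈ Sᶜ from hx) _
        rw [marK, if_neg hx, e1, e2]; simp
    simp only [hk]
    rw [← ofReal_integral_eq_lintegral_ofReal i12 (.of_forall fun x => by positivity),
      integral_add i1 i2, integral_const_mul, integral_const_mul, ← ENNReal.ofReal_mul (by positivity)]
    have ht2 : 0 < t / 2 := by positivity
    refine (mul_le_mul_left ((measure_mono hsub).trans ((measure_union_le _ _).trans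
      (add_le_add (volume_lt_abs_le (hT u hu) (r := 3 / 2) (by norm_num) ht2)
        (volume_lt_abs_le (hT v hv) (r := 3) (by norm_num) ht2)))) _).trans ?_
    have n1 : 0 ≤ ∫ x, |T u x| ^ (3 / 2 : ℝ) := integral_nonneg fun x => by positivity
    have n2 : 0 ≤ ∫ x, |T v x| ^ (3 : ℝ) := integral_nonneg fun x => by positivity
    have n3 : 0 ≤ ∫ x, |u x| ^ (3 / 2 : ℝ) := integral_nonneg fun x => by positivity
    rw [← ENNReal.ofReal_add (by positivity) (by positivity), ← ENNReal.ofReal_mul (by positivity)]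
    refine ENNReal.ofReal_le_ofReal ?_
    have e0 : ∀ r : ℝ, (t / 2) ^ (-r) = 2 ^ r * t ^ (-r) := fun r => by
      rw [Real.div_rpow ht.le (by norm_num), Real.rpow_neg (by norm_num : (0 : ℝ) ≤ 2),
        div_inv_eq_mul, mul_comm]
    have e1 : t ^ (-(3 / 2) : ℝ) * t ^ (2 - 1 : ℝ) = t ^ (3 / 2 - 2 : ℝ) := by
      rw [← Real.rpow_add ht]; norm_num
    have e2 : t ^ (-3 : ℝ) * t ^ (2 - 1 : ℝ) = t ^ (-2 : ℝ) := by
      rw [← Real.rpow_add ht]; norm_num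
    have e3 : (2 : ℝ) ^ (3 : ℝ) = 8 := by norm_num
    have e4 : (2 : ℝ) ^ (3 / 2 : ℝ) ≤ 8 :=
      (Real.rpow_le_rpow_of_exponent_le one_le_two (by norm_num)).trans_eq e3
    calc _ = 2 ^ (3 / 2 : ℝ) * (t ^ (3 / 2 - 2 : ℝ) * ∫ x, |T u x| ^ (3 / 2 : ℝ)) +
          8 * (t ^ (-2 : ℝ) * ∫ x, |T v x| ^ (3 : ℝ)) := by
            rw [e0, e0, e3, ← e1, ← e2]; ring
      _ ≤ 8 * (t ^ (3 / 2 - 2 : ℝ) * (A * ∫ x, |u x| ^ (3 / 2 : ℝ))) +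
          8 * (t ^ (-2 : ℝ) * (A * ∫ x, |v x| ^ (3 : ℝ))) := by
            gcongr
            · exact h₁ u hu
            · exact h₂ v hv
      _ = _ := by ring
  have hi : ∀ {u : ℝ × ℝ → ℝ}, Nice u → ENNReal.ofReal (∫ x, |u x| ^ (2 : ℝ)) =
      ∫⁻ x, ENNReal.ofReal (|u x| ^ (2 : ℝ)) := fun hu =>
    ofReal_integral_eq_lintegral_ofReal (hu.abs_rpow two_pos).integrable
      (.of_forall fun x => by positivity)
  have n0 : 0 ≤ ∫ x, |f x| ^ (2 : ℝ) := integral_nonneg fun x => by positivity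
  rw [← ENNReal.ofReal_le_ofReal_iff (by positivity), hi (hT f hf),
    lintegral_rpow_eq_lintegral_meas_lt_mul volume (.of_forall fun x => abs_nonneg _)
      (by fun_prop) two_pos]
  have hkm : Measurable fun z : ℝ × (ℝ × ℝ) => ENNReal.ofReal (marK z.1 |f z.2|) := by
    unfold marK
    exact (Measurable.ite (measurableSet_lt measurable_fst (by fun_prop)) (by fun_prop)
      (by fun_prop)).ennreal_ofReal
  calc _ ≤ ENNReal.ofReal 2 * ∫⁻ t in Ioi 0, ENNReal.ofReal (8 * A) *
        ∫⁻ x, ENNReal.ofReal (marK t |f x|) :=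
      mul_le_mul_right (setLIntegral_mono' measurableSet_Ioi hweak) _
    _ = ENNReal.ofReal 2 * (ENNReal.ofReal (8 * A) *
        ∫⁻ x, ∫⁻ t in Ioi 0, ENNReal.ofReal (marK t |f x|)) := by
      rw [lintegral_const_mul' _ _ ENNReal.ofReal_ne_top,
        lintegral_lintegral_swap (by exact hkm.aemeasurable)]
    _ ≤ ENNReal.ofReal 2 * (ENNReal.ofReal (8 * A) * ∫⁻ x, ENNReal.ofReal 3 *
        ENNReal.ofReal (|f x| ^ (2 : ℝ))) := by
      refine mul_le_mul_right (mul_le_mul_right (lintegral_mono fun x => ?_) _) _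
      rw [← ENNReal.ofReal_mul (by norm_num)]
      exact lintegral_marK_le (abs_nonneg _)
    _ = _ := by
      rw [lintegral_const_mul' _ _ ENNReal.ofReal_ne_top, ← hi hf,
        ← ENNReal.ofReal_mul (by norm_num), ← ENNReal.ofReal_mul (by positivity),
        ← ENNReal.ofReal_mul (by norm_num)]
      congr 1
      ring

/-- The uniform bound for truncated commutators with bounded symbols. -/
lemma exists_nrm_cm_le (hp : 1 < p) :
    ∃ C : ℝ, 0 < C ∧ ∀ {e : ℝ}, e * e = 1 → ∀ {lo hi : ℤ}, lo ≤ hi →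
      ∀ {b : ℝ × ℝ → ℝ} {μ : ℤ → ℤ × ℤ → ℝ}, BSym b μ → ∀ {f : ℝ × ℝ → ℝ}, Nice f →
      ∫ x, |cm (kap lo hi) e b f x| ^ p ≤ C * ∫ x, |f x| ^ p := by
  have main : ∀ {p : ℝ}, 1 < p → p ≠ 2 → ∃ C : ℝ, 0 < C ∧ ∀ {e : ℝ}, e * e = 1 →
      ∀ {lo hi : ℤ}, lo ≤ hi → ∀ {b : ℝ × ℝ → ℝ} {μ : ℤ → ℤ × ℤ → ℝ}, BSym b μ →
      ∀ {f : ℝ × ℝ → ℝ}, Nice f → ∫ x, |cm (kap lo hi) e b f x| ^ p ≤ C * ∫ x, |f x| ^ p := by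
    intro p hp hp2
    have hpp := Real.HolderConjugate.conjExponent hp
    have hp0 := hpp.pos
    obtain ⟨C, hC, h⟩ := exists_cm_bound_of_bSym hpp hp2
    refine ⟨C ^ p, by positivity, fun {e} he {lo hi} hlh {b μ} hb {f} hf => ?_⟩
    have h1 : nrm p (cm (kap lo hi) e b f) ≤ C * nrm p f :=
      nrm_le_of_dual hpp (nice_cm (nice_kap lo hi) e hb.meas hb.bdd hf)
        (mul_nonneg hC.le (nrm_nonneg _ _)) fun g hg =>
        (h he hlh hb hf hg).trans_eq (mul_assoc _ _ _).symm
    have h2 := Real.rpow_le_rpow (nrm_nonneg _ _) h1 hp0.le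
    rwa [Real.mul_rpow hC.le (nrm_nonneg _ _), nrm_rpow hp0, nrm_rpow hp0] at h2
  by_cases hp2 : p = 2
  · subst hp2
    obtain ⟨C₁, hC₁, h₁⟩ := main (p := 3 / 2) (by norm_num) (by norm_num)
    obtain ⟨C₂, hC₂, h₂⟩ := main (p := 3) (by norm_num) (by norm_num)
    refine ⟨48 * max C₁ C₂, by positivity, fun {e} he {lo hi} hlh {b μ} hb {f} hf => ?_⟩
    refine integral_abs_sq_le_of_interpolation (T := cm (kap lo hi) e b) (by positivity)
      (fun f hf => nice_cm (nice_kap lo hi) e hb.meas hb.bdd hf) (fun f g hf hg x => ?_)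
      (fun f hf => (h₁ he hlh hb hf).trans (mul_le_mul_of_nonneg_right (le_max_left _ _)
        (integral_nonneg fun x => by positivity)))
      (fun f hf => (h₂ he hlh hb hf).trans (mul_le_mul_of_nonneg_right (le_max_right _ _)
        (integral_nonneg fun x => by positivity))) hf
    simp only [cm, mul_add, Top_add (nice_kap lo hi) e hf hg,
      Top_add (nice_kap lo hi) e (hb.nice_mul hf) (hb.nice_mul hg)]
    ring
  · exact main hp hp2

end

section

variable {f b : ℝ × ℝ → ℝ} {μ : ℤ → ℤ × ℤ → ℝ} {p : ℝ} {κ : ℝ → ℝ}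

/-! ### Real symbols of bounded mean oscillation -/

lemma eLpNorm_eq_nrm (hp : 0 < p) (hf : Nice f) :
    eLpNorm f (ENNReal.ofReal p) volume = ENNReal.ofReal (nrm p f) := by
  have h0 : ENNReal.ofReal p ≠ 0 := (ENNReal.ofReal_pos.mpr hp).ne'
  have hr := ENNReal.toReal_ofReal hp.le
  have hm : MemLp f (ENNReal.ofReal p) volume := by
    rw [← integrable_norm_rpow_iff hf.meas.aestronglyMeasurable h0 ENNReal.ofReal_ne_top, hr]
    exact (hf.abs_rpow hp).integrable
  rw [hm.eLpNorm_eq_integral_rpow_norm h0 ENNReal.ofReal_ne_top, hr, nrm, one_div]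
  rfl

lemma LocallyIntegrable.integrable_mul (hb : Measurable b) (hbl : LocallyIntegrable b volume)
    (hf : Nice f) : Integrable fun x => b x * f x := by
  obtain ⟨M, hM⟩ := hf.bdd
  obtain ⟨R, hR⟩ := hf.supp
  have hfm := hf.meas
  have h1 := (hbl.integrableOn_isCompact (isCompact_closedBall (0 : ℝ × ℝ) R)).norm.const_mul M
  have h2 := (integrable_indicator_iff measurableSet_closedBall).mpr h1
  refine h2.mono' (by fun_prop) (.of_forall fun x => ?_)
  by_cases hx : x ∈ Metric.closedBall (0 : ℝ × ℝ) R
  · rw [indicator_of_mem hx, norm_mul, mul_comm]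
    exact mul_le_mul_of_nonneg_right (hM x) (norm_nonneg _)
  · rw [mem_closedBall_zero_iff, not_le] at hx
    rw [hR x hx, mul_zero, norm_zero]
    exact indicator_nonneg (fun y _ => mul_nonneg ((abs_nonneg _).trans (hM y)) (norm_nonneg _)) _

lemma ae_integrable_mul_comp_sub_sh (hκ : Nice κ) (e : ℝ) {u : ℝ × ℝ → ℝ} (hu : Measurable u)
    (hui : Integrable u) : ∀ᵐ x : ℝ × ℝ, Integrable fun t => κ t * u (x - sh e t) := by
  have hκm := hκ.meas
  have h : Integrable (fun z : (ℝ × ℝ) × ℝ => κ z.2 * u (z.1 - sh e z.2)) (volume.prod volume) := by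
    rw [integrable_prod_iff' (by fun_prop)]
    refine ⟨.of_forall fun t => (hui.comp_sub_right (sh e t)).const_mul (κ t), ?_⟩
    simp only [norm_mul, integral_const_mul]
    simp only [integral_sub_right_eq_self fun x => ‖u x‖]
    exact hκ.integrable.norm.mul_const _
  exact h.prod_right_ae

lemma measurable_Top (hκ : Measurable κ) (e : ℝ) (hf : Measurable f) : Measurable (Top κ e f) :=
  (StronglyMeasurable.integral_prod_right' (ν := volume)
    (f := fun z : (ℝ × ℝ) × ℝ => κ z.2 * f (z.1 - sh e z.2))
    (by fun_prop : Measurable _).stronglyMeasurable).measurable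

lemma measurable_cm (hκ : Measurable κ) (e : ℝ) (hb : Measurable b) (hf : Measurable f) :
    Measurable (cm κ e b f) :=
  (hb.mul (measurable_Top hκ e hf)).sub (measurable_Top hκ e (hb.mul hf))

lemma cm_const_mul (κ : ℝ → ℝ) (e c : ℝ) (b f : ℝ × ℝ → ℝ) (x : ℝ × ℝ) :
    cm κ e (fun y => c * b y) f x = c * cm κ e b f x := by
  simp only [cm, mul_assoc, Top_const_mul]
  ring

/-- Truncation of a real number at height `L`. -/
def clip (L a : ℝ) : ℝ := max (min a L) (-L)

@[fun_prop]
lemma measurable_clip (L : ℝ) : Measurable (clip L) := by unfold clip; fun_prop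

lemma abs_clip_sub_clip_le (L a c : ℝ) : |clip L a - clip L c| ≤ |a - c| :=
  (abs_max_sub_max_le_abs _ _ _).trans (abs_inf_sub_inf_le_abs a c L)

lemma abs_clip_le {L : ℝ} (hL : 0 ≤ L) (a : ℝ) : |clip L a| ≤ L :=
  abs_le.mpr ⟨le_max_right _ _, max_le (min_le_right _ _) (by linarith)⟩

lemma abs_clip_le_abs {L : ℝ} (hL : 0 ≤ L) (a : ℝ) : |clip L a| ≤ |a| := by
  simpa [clip, hL] using abs_clip_sub_clip_le L a 0

lemma clip_eq_self {L a : ℝ} (h : |a| ≤ L) : clip L a = a := by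
  rw [clip, min_eq_left (abs_le.mp h).2, max_eq_left (abs_le.mp h).1]

lemma integrableOn_tri (hbl : LocallyIntegrable b volume) (k : ℤ) (n : ℤ × ℤ) :
    IntegrableOn b (tri k n) :=
  (hbl.integrableOn_isCompact (isBounded_tri k n).isCompact_closure).mono_set subset_closure

lemma bSym_clip (hb : Measurable b) (hbl : LocallyIntegrable b volume)
    (hosc : ∀ k n, ∫ x in tri k n, |b x - μ k n| ≤ 8 ^ k) {L : ℝ} (hL : 0 ≤ L) :
    BSym (fun x => clip L (b x)) fun k n => clip L (μ k n) where
  meas := by fun_prop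
  bdd := ⟨L, fun x => abs_clip_le hL _⟩
  osc k n := by
    have hi : IntegrableOn (fun x => |b x - μ k n|) (tri k n) :=
      ((integrableOn_tri hbl k n).sub (integrableOn_const (volume_tri_ne_top k n))).abs
    refine (integral_mono ?_ hi fun x => abs_clip_sub_clip_le L _ _).trans (hosc k n)
    exact hi.mono' (by fun_prop : Measurable _).aestronglyMeasurable
      (.of_forall fun x => by rw [Real.norm_eq_abs, abs_abs]; exact abs_clip_sub_clip_le L _ _)

lemma exists_eLpNorm_cm_le (hp : 1 < p) :
    ∃ C : ℝ, 0 < C ∧ ∀ {e : ℝ}, e * e = 1 → ∀ {lo hi : ℤ}, lo ≤ hi →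
      ∀ {b : ℝ × ℝ → ℝ} {μ : ℤ → ℤ × ℤ → ℝ} {D : ℝ}, Measurable b → LocallyIntegrable b volume →
      0 < D → (∀ k n, ∫ x in tri k n, |b x - μ k n| ≤ D * 8 ^ k) → ∀ {f : ℝ × ℝ → ℝ}, Nice f →
      eLpNorm (cm (kap lo hi) e b f) (ENNReal.ofReal p) volume ≤
        ENNReal.ofReal (C * D) * eLpNorm f (ENNReal.ofReal p) volume := by
  obtain ⟨C, hC, h⟩ := exists_nrm_cm_le hp
  have hp0 : 0 < p := by linarith
  have unit : ∀ {e : ℝ}, e * e = 1 → ∀ {lo hi : ℤ}, lo ≤ hi →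
      ∀ {b : ℝ × ℝ → ℝ} {μ : ℤ → ℤ × ℤ → ℝ}, Measurable b → LocallyIntegrable b volume →
      (∀ k n, ∫ x in tri k n, |b x - μ k n| ≤ 8 ^ k) → ∀ {f : ℝ × ℝ → ℝ}, Nice f →
      eLpNorm (cm (kap lo hi) e b f) (ENNReal.ofReal p) volume ≤
        ENNReal.ofReal (C ^ (1 / p)) * eLpNorm f (ENNReal.ofReal p) volume := by
    intro e he lo hi hlh b μ hb hbl hosc f hf
    have hκ := nice_kap lo hi
    have hS := fun L : ℕ => bSym_clip hb hbl hosc (Nat.cast_nonneg (α := ℝ) L)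
    have hn := fun L : ℕ => nice_cm hκ e (hS L).meas (hS L).bdd hf
    refine (Lp.eLpNorm_lim_le_liminf_eLpNorm (fun L => (hn L).meas.aestronglyMeasurable) _ ?_).trans
      (liminf_le_of_frequently_le' (.of_forall fun L => ?_))
    · filter_upwards [ae_integrable_mul_comp_sub_sh hκ e (hb.mul hf.meas)
        (LocallyIntegrable.integrable_mul hb hbl hf)] with x hx
      have hlim : ∀ a : ℝ, Tendsto (fun L : ℕ => clip L a) atTop (nhds a) := fun a =>
        tendsto_const_nhds.congr' <| (eventually_ge_atTop ⌈|a|⌉₊).mono fun L hL =>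
          (clip_eq_self (Nat.ceil_le.mp hL)).symm
      refine ((hlim (b x)).mul_const _).sub ?_
      have hbm := hf.meas
      have hkm := hκ.meas
      have hsm : Measurable fun t => x - sh e t := by fun_prop
      refine tendsto_integral_of_dominated_convergence _ (fun L => by fun_prop) hx.norm
        (fun L => .of_forall fun t => ?_)
        (.of_forall fun t => ((hlim _).mul_const _).const_mul _)
      simp only [norm_mul, Pi.mul_apply]
      gcongr
      exact abs_clip_le_abs (Nat.cast_nonneg _) _
    · rw [eLpNorm_eq_nrm hp0 (hn L), eLpNorm_eq_nrm hp0 hf, ← ENNReal.ofReal_mul (by positivity)]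
      refine ENNReal.ofReal_le_ofReal ?_
      rw [nrm, nrm, ← Real.mul_rpow hC.le (integral_nonneg fun x => by positivity)]
      exact Real.rpow_le_rpow (integral_nonneg fun x => by positivity) (h he hlh (hS L) hf)
        (by positivity)
  refine ⟨C ^ (1 / p), by positivity, fun {e} he {lo hi} hlh {b μ D} hb hbl hD hosc {f} hf => ?_⟩
  have h1 := unit (b := fun x => D⁻¹ * b x) (μ := fun k n => D⁻¹ * μ k n) he hlh (by fun_prop)
    (hbl.smul D⁻¹) (fun k n => by
      simp only [← mul_sub, abs_mul, abs_inv, abs_of_pos hD, integral_const_mul]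
      rw [inv_mul_le_iff₀ hD]
      exact hosc k n) hf
  have h2 : cm (kap lo hi) e b f = D • cm (kap lo hi) e (fun x => D⁻¹ * b x) f := by
    ext x
    rw [Pi.smul_apply, cm_const_mul, smul_eq_mul, mul_inv_cancel_left₀ hD.ne']
  rw [h2, eLpNorm_const_smul, Real.enorm_of_nonneg hD.le, mul_comm (C ^ (1 / p)),
    ENNReal.ofReal_mul hD.le, mul_assoc]
  gcongr

end

section

variable {κ : ℝ → ℝ} {b f : ℝ × ℝ → ℂ}

/-! ### Complex symbols and principal values -/

lemma ae_ae_comp_sub_sh {P : ℝ × ℝ → Prop} (h : ∀ᵐ x, P x) (e : ℝ) :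
    ∀ᵐ x : ℝ × ℝ, ∀ᵐ t : ℝ, P (x - sh e t) := by
  obtain ⟨N, hsub, hN, hN0⟩ := exists_measurable_superset_of_null h
  set S : Set ((ℝ × ℝ) × ℝ) := {z | z.1 - sh e z.2 ∈ N}
  have hS : MeasurableSet S := (by fun_prop : Measurable fun z : (ℝ × ℝ) × ℝ => z.1 - sh e z.2) hN
  have hS0 : (volume.prod volume) S = 0 := by
    rw [Measure.prod_apply_symm hS]
    refine (lintegral_congr fun t => ?_).trans lintegral_zero
    exact ((measurePreserving_sub_right volume (sh e t)).measure_preimage hN.nullMeasurableSet).trans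
      hN0
  filter_upwards [Measure.measure_ae_null_of_prod_null hS0] with x hx
  refine measure_mono_null (fun t ht => ?_) hx
  exact hsub ht

/-- The absolutely convergent form of the truncated commutator. -/
lemma ae_integral_eq_cm (hκ : Nice κ) (e : ℝ) {β u : ℝ × ℝ → ℝ} (hβ : Measurable β)
    (hβl : LocallyIntegrable β volume) (hu : Nice u) :
    ∀ᵐ x : ℝ × ℝ, Integrable (fun t => κ t * ((β x - β (x - sh e t)) * u (x - sh e t))) ∧
      ∫ t, κ t * ((β x - β (x - sh e t)) * u (x - sh e t)) = cm κ e β u x := by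
  filter_upwards [ae_integrable_mul_comp_sub_sh hκ e hu.meas hu.integrable,
    ae_integrable_mul_comp_sub_sh hκ e (hβ.mul hu.meas)
      (LocallyIntegrable.integrable_mul hβ hβl hu)] with x h1 h2
  have e1 : (fun t => κ t * ((β x - β (x - sh e t)) * u (x - sh e t))) =
      fun t => β x * (κ t * u (x - sh e t)) - κ t * (β * u) (x - sh e t) := by
    ext t
    simp only [Pi.mul_apply]
    ring
  rw [e1]
  have h3 := (h1.const_mul (β x)).sub h2
  refine ⟨h3, ?_⟩
  rw [integral_sub (h1.const_mul (β x)) h2, integral_const_mul]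
  rfl

lemma indicator_commKer {N : ℕ} {x : ℝ × ℝ} {t : ℝ} (ht : |t| ≠ 2 ^ (N : ℤ)) :
    {t : ℝ | (2 : ℝ) ^ (-N : ℤ) ≤ |t| ∧ |t| ≤ ((2 : ℝ) ^ (-N : ℤ))⁻¹}.indicator (commKer b f x) t =
      (kap (-N) N t : ℂ) * ((b x - b (x - sh 1 t)) * f (x - sh 1 t)) := by
  have hsh : sh 1 t = pgamma t := by simp [sh, pgamma]
  have hset : t ∈ {t : ℝ | (2 : ℝ) ^ (-N : ℤ) ≤ |t| ∧ |t| ≤ ((2 : ℝ) ^ (-N : ℤ))⁻¹} ↔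
      (2 : ℝ) ^ (-N : ℤ) ≤ |t| ∧ |t| < 2 ^ (N : ℤ) := by
    rw [mem_ofPred_eq, ← zpow_neg, neg_neg, ht.le_iff_lt]
  by_cases h : (2 : ℝ) ^ (-N : ℤ) ≤ |t| ∧ |t| < 2 ^ (N : ℤ)
  · rw [indicator_of_mem (hset.mpr h), kap, if_pos h, commKer, hsh]
    push_cast
    ring
  · rw [indicator_of_notMem (mt hset.mp h), kap, if_neg h, Complex.ofReal_zero, zero_mul]

lemma setIntegral_commKer_ae_eq (hb : LocallyIntegrable b volume) {b' : ℝ × ℝ → ℂ}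
    (hb' : Measurable b') (hbb : b =ᵐ[volume] b') (hfr : Nice fun x => (f x).re)
    (hfi : Nice fun x => (f x).im) (N : ℕ) :
    (fun x => ∫ t in {t : ℝ | (2 : ℝ) ^ (-N : ℤ) ≤ |t| ∧ |t| ≤ ((2 : ℝ) ^ (-N : ℤ))⁻¹},
      commKer b f x t) =ᵐ[volume] fun x =>
      ((cm (kap (-N) N) 1 (fun x => (b' x).re) (fun x => (f x).re) x -
        cm (kap (-N) N) 1 (fun x => (b' x).im) (fun x => (f x).im) x : ℝ) : ℂ) +
      ((cm (kap (-N) N) 1 (fun x => (b' x).re) (fun x => (f x).im) x +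
        cm (kap (-N) N) 1 (fun x => (b' x).im) (fun x => (f x).re) x : ℝ) : ℂ) * Complex.I := by
  have hκ := nice_kap (-N) N
  have hbl : LocallyIntegrable b' volume := hb.congr hbb
  have hre : LocallyIntegrable (fun x => (b' x).re) volume := fun x =>
    (hbl x).imp fun _ h => ⟨h.1, h.2.re⟩
  have him : LocallyIntegrable (fun x => (b' x).im) volume := fun x =>
    (hbl x).imp fun _ h => ⟨h.1, h.2.im⟩
  have hrm : Measurable fun x => (b' x).re := by fun_prop
  have hrm' : Measurable fun x => (b' x).im := by fun_prop
  filter_upwards [hbb, ae_ae_comp_sub_sh hbb 1, ae_integral_eq_cm hκ 1 hrm hre hfr,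
    ae_integral_eq_cm hκ 1 hrm hre hfi, ae_integral_eq_cm hκ 1 hrm' him hfr,
    ae_integral_eq_cm hκ 1 hrm' him hfi] with x hx hxt ⟨i1, e1⟩ ⟨i2, e2⟩ ⟨i3, e3⟩ ⟨i4, e4⟩
  have hmeas : MeasurableSet {t : ℝ | (2 : ℝ) ^ (-N : ℤ) ≤ |t| ∧ |t| ≤ ((2 : ℝ) ^ (-N : ℤ))⁻¹} :=
    (measurableSet_le measurable_const measurable_norm).inter
      (measurableSet_le measurable_norm measurable_const)
  have hne : ∀ᵐ t : ℝ, |t| ≠ 2 ^ (N : ℤ) := by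
    filter_upwards [Measure.ae_ne volume ((2 : ℝ) ^ (N : ℤ)),
      Measure.ae_ne volume (-(2 : ℝ) ^ (N : ℤ))] with t h1 h2 h
    rcases abs_choice t with h3 | h3
    · exact h1 (h3 ▸ h)
    · exact h2 (by linarith)
  rw [← integral_indicator hmeas, ← e1, ← e2, ← e3, ← e4, ← integral_sub i1 i4, ← integral_add i2 i3,
    ← integral_complex_ofReal, ← integral_complex_ofReal, ← integral_mul_const,
    ← integral_add (i1.sub i4).ofReal ((i2.add i3).ofReal.mul_const _)]
  refine integral_congr_ae ?_
  filter_upwards [hxt, hne] with t ht htn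
  rw [indicator_commKer htn, hx, ht]
  apply Complex.ext <;> simp <;> ring

lemma oscC_congr {b' : ℝ × ℝ → ℂ} (h : b =ᵐ[volume] b') (Q : Set (ℝ × ℝ)) :
    oscC Q b = oscC Q b' := by
  have h1 : avgC Q b = avgC Q b' := by
    rw [avgC, avgC, integral_congr_ae (ae_restrict_of_ae h)]
  rw [oscC, oscC, h1]
  congr 1
  refine integral_congr_ae (ae_restrict_of_ae ?_)
  filter_upwards [h] with x hx
  rw [hx]

lemma exists_isPCube_tri_subset (k : ℤ) (n : ℤ × ℤ) :
    ∃ Q l, IsPCube Q l ∧ tri k n ⊆ Q ∧ (volume Q).toReal = 27 * 8 ^ k ∧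
      Bornology.IsBounded Q := by
  have h2 : (0 : ℝ) < 2 ^ k := by positivity
  have h4 : (0 : ℝ) < 4 ^ k := by positivity
  have e4 := four_zpow k
  refine ⟨_, 3 * 2 ^ k, ⟨by positivity, (n.1 - 1) * 2 ^ k, (n.2 - 1) * 4 ^ k, rfl⟩, ?_, ?_, ?_⟩
  · intro x hx
    obtain ⟨h5, h6⟩ := mem_tri.mp hx
    rw [abs_le] at h5 h6
    simp only [idx] at h5 h6
    have a1 := Int.floor_le (x.1 / 2 ^ k)
    have a2 := Int.lt_floor_add_one (x.1 / 2 ^ k)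
    have a3 := Int.floor_le (x.2 / 4 ^ k)
    have a4 := Int.lt_floor_add_one (x.2 / 4 ^ k)
    have b1 : (n.1 : ℝ) - 1 ≤ ⌊x.1 / 2 ^ k⌋ := by exact_mod_cast (by omega)
    have b2 : (⌊x.1 / 2 ^ k⌋ : ℝ) ≤ n.1 + 1 := by exact_mod_cast (by omega)
    have b3 : (n.2 : ℝ) - 1 ≤ ⌊x.2 / 4 ^ k⌋ := by exact_mod_cast (by omega)
    have b4 : (⌊x.2 / 4 ^ k⌋ : ℝ) ≤ n.2 + 1 := by exact_mod_cast (by omega)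
    have c1 := (le_div_iff₀ h2).mp (b1.trans a1)
    have c2 := (div_lt_iff₀ h2).mp (a2.trans_le (add_le_add_left b2 1))
    have c3 := (le_div_iff₀ h4).mp (b3.trans a3)
    have c4 := (div_lt_iff₀ h4).mp (a4.trans_le (add_le_add_left b4 1))
    refine ⟨⟨c1, by linarith⟩, ⟨c3, ?_⟩⟩
    have : (3 * (2 : ℝ) ^ k) ^ 2 = 9 * 4 ^ k := by rw [e4]; ring
    rw [this]
    linarith
  · rw [Measure.volume_eq_prod, Measure.prod_prod, Real.volume_Ico, Real.volume_Ico,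
      ENNReal.toReal_mul, ENNReal.toReal_ofReal (by linarith), ENNReal.toReal_ofReal (by
        rw [add_sub_cancel_left]; positivity), eight_zpow]
    simp only [e4]
    ring
  · exact (Metric.isBounded_Ico _ _).prod (Metric.isBounded_Ico _ _)

lemma exists_osc_tri_le (hb : LocallyIntegrable b volume) {B : ℝ}
    (hB : ∀ Q l, IsPCube Q l → oscC Q b ≤ B) (φ : ℂ →L[ℝ] ℝ) (hφ : ∀ z, |φ z| ≤ ‖z‖) :
    ∃ μ : ℤ → ℤ × ℤ → ℝ, ∀ k n, ∫ x in tri k n, |φ (b x) - μ k n| ≤ 27 * B * 8 ^ k := by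
  choose Q l hQ hsub hvol hbd using exists_isPCube_tri_subset
  refine ⟨fun k n => φ (avgC (Q k n) b), fun k n => ?_⟩
  have h1 := hB _ _ (hQ k n)
  have h8 : (0 : ℝ) < 27 * 8 ^ k := by positivity
  rw [oscC, hvol, inv_mul_le_iff₀ h8] at h1
  have hfin : volume (Q k n) ≠ ⊤ := (hbd k n).measure_lt_top.ne
  have hi : IntegrableOn (fun x => b x - avgC (Q k n) b) (Q k n) :=
    ((hb.integrableOn_isCompact (hbd k n).isCompact_closure).mono_set subset_closure).sub
      (integrableOn_const hfin)
  have hi' : IntegrableOn (fun x => |φ (b x) - φ (avgC (Q k n) b)|) (Q k n) := by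
    simp only [← map_sub]
    exact (φ.integrable_comp hi).abs
  calc _ ≤ ∫ x in Q k n, |φ (b x) - φ (avgC (Q k n) b)| :=
        setIntegral_mono_set hi' (.of_forall fun x => abs_nonneg _) (hsub k n).eventuallyLE
    _ ≤ ∫ x in Q k n, ‖b x - avgC (Q k n) b‖ := integral_mono hi' hi.norm fun x => by
        simp only [← map_sub]
        exact hφ _
    _ ≤ _ := h1.trans_eq (by ring)

lemma nice_of_hasCompactSupport {u : ℝ × ℝ → ℝ} (hu : Continuous u) (hs : HasCompactSupport u) :
    Nice u := by
  obtain ⟨R, hR⟩ := hs.isCompact.isBounded.exists_norm_le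
  exact ⟨hu.measurable, hs.exists_bound_of_continuous hu, R, fun x hx =>
    image_eq_zero_of_notMem_tsupport fun hx' => (hR x hx').not_gt hx⟩

lemma eLpNorm_complex_le {p C : ENNReal} (hp : 1 ≤ p) {c₁ c₂ c₃ c₄ : ℝ × ℝ → ℝ}
    (m₁ : Measurable c₁) (m₂ : Measurable c₂) (m₃ : Measurable c₃) (m₄ : Measurable c₄)
    (h₁ : eLpNorm c₁ p volume ≤ C) (h₂ : eLpNorm c₂ p volume ≤ C) (h₃ : eLpNorm c₃ p volume ≤ C)
    (h₄ : eLpNorm c₄ p volume ≤ C) :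
    eLpNorm (fun x => ((c₁ x - c₂ x : ℝ) : ℂ) + ((c₃ x + c₄ x : ℝ) : ℂ) * Complex.I) p volume ≤
      4 * C := by
  have hpt : ∀ x, ‖((c₁ x - c₂ x : ℝ) : ℂ) + ((c₃ x + c₄ x : ℝ) : ℂ) * Complex.I‖ ≤
      ‖((‖c₁ x‖ + ‖c₂ x‖) + (‖c₃ x‖ + ‖c₄ x‖))‖ := by
    intro x
    refine ((norm_add_le _ _).trans (add_le_add ?_ ?_)).trans (le_abs_self _)
    · rw [Complex.norm_real]; exact norm_sub_le _ _
    · rw [norm_mul, Complex.norm_I, mul_one, Complex.norm_real]; exact norm_add_le _ _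
  have n₁ := m₁.norm.aestronglyMeasurable (μ := volume)
  have n₂ := m₂.norm.aestronglyMeasurable (μ := volume)
  have n₃ := m₃.norm.aestronglyMeasurable (μ := volume)
  have n₄ := m₄.norm.aestronglyMeasurable (μ := volume)
  refine (eLpNorm_mono hpt).trans ((eLpNorm_add_le (n₁.add n₂) (n₃.add n₄) hp).trans
    ((add_le_add (eLpNorm_add_le n₁ n₂ hp) (eLpNorm_add_le n₃ n₄ hp)).trans ?_))
  simp only [eLpNorm_norm]
  refine (add_le_add (add_le_add h₁ h₂) (add_le_add h₃ h₄)).trans_eq ?_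
  ring

end

end ParabolicCommutator

open ParabolicCommutator

/-- If `b ∈ BMO_γ` then for each `p ∈ (1,∞)` there is `C = C(p)` such that
`‖[b, H_γ] f‖_{L^p} ≤ C ‖b‖_{BMO_γ} ‖f‖_{L^p}` for all compactly supported smooth `f`
for which the principal value defining `[b, H_γ] f` exists. -/
theorem parabolic_commutator_upper_bound :
    ∀ p : ℝ, 1 < p →
    ∃ C : ℝ, 0 < C ∧
      ∀ b : ℝ × ℝ → ℂ, LocallyIntegrable b volume →
      ∀ B : ℝ, (∀ Q l, IsPCube Q l → oscC Q b ≤ B) →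
      ∀ f g : ℝ × ℝ → ℂ, ContDiff ℝ (⊤ : ℕ∞) f → HasCompactSupport f →
        (∀ x, HasPV (commKer b f x) (g x)) →
        eLpNorm g (ENNReal.ofReal p) volume ≤
          ENNReal.ofReal (C * B) * eLpNorm f (ENNReal.ofReal p) volume := by
  intro p hp
  obtain ⟨C, hC, hmain⟩ := exists_eLpNorm_cm_le hp
  refine ⟨4 * (C * 27), by positivity, fun b hb B hB f g hf hfs hg => ?_⟩
  have hfc : Continuous f := hf.continuous
  have hfr : Nice fun x => (f x).re :=
    nice_of_hasCompactSupport (by fun_prop) (hfs.comp_left (g := Complex.re) rfl)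
  have hfi : Nice fun x => (f x).im :=
    nice_of_hasCompactSupport (by fun_prop) (hfs.comp_left (g := Complex.im) rfl)
  set F := eLpNorm f (ENNReal.ofReal p) volume
  have hF : F ≠ ⊤ := (hfc.memLp_of_hasCompactSupport hfs).2.ne
  have hFr : eLpNorm (fun x => (f x).re) (ENNReal.ofReal p) volume ≤ F :=
    eLpNorm_mono fun x => Complex.abs_re_le_norm _
  have hFi : eLpNorm (fun x => (f x).im) (ENNReal.ofReal p) volume ≤ F :=
    eLpNorm_mono fun x => Complex.abs_im_le_norm _
  have hB0 : 0 ≤ B := by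
    obtain ⟨Q, l, hQ, -⟩ := exists_isPCube_tri_subset 0 0
    exact le_trans (mul_nonneg (by positivity) (integral_nonneg fun x => norm_nonneg _)) (hB Q l hQ)
  obtain ⟨b', hb'm, hbb⟩ := hb.aestronglyMeasurable.aemeasurable
  have hbl : LocallyIntegrable b' volume := hb.congr hbb
  have hre : LocallyIntegrable (fun x => (b' x).re) volume := fun x =>
    (hbl x).imp fun _ h => ⟨h.1, h.2.re⟩
  have him : LocallyIntegrable (fun x => (b' x).im) volume := fun x =>
    (hbl x).imp fun _ h => ⟨h.1, h.2.im⟩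
  have hrm : Measurable fun x => (b' x).re := by fun_prop
  have hrm' : Measurable fun x => (b' x).im := by fun_prop
  have hB' : ∀ Q l, IsPCube Q l → oscC Q b' ≤ B := fun Q l hQ => oscC_congr hbb Q ▸ hB Q l hQ
  obtain ⟨μr, hμr⟩ := exists_osc_tri_le hbl hB' Complex.reCLM Complex.abs_re_le_norm
  obtain ⟨μi, hμi⟩ := exists_osc_tri_le hbl hB' Complex.imCLM Complex.abs_im_le_norm
  have key : ∀ δ : ℝ, 0 < δ →
      eLpNorm g (ENNReal.ofReal p) volume ≤ ENNReal.ofReal (4 * (C * 27) * (B + δ)) * F := by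
    intro δ hδ
    have hD : 0 < 27 * (B + δ) := by positivity
    have hle : ∀ k : ℤ, 27 * B * 8 ^ k ≤ 27 * (B + δ) * 8 ^ k := fun k => by gcongr; linarith
    have hNb := fun N : ℕ => setIntegral_commKer_ae_eq hb hb'm hbb hfr hfi N
    have hlim : Tendsto (fun N : ℕ => (2 : ℝ) ^ (-N : ℤ)) atTop (nhdsWithin 0 (Ioi 0)) := by
      rw [tendsto_nhdsWithin_iff]
      refine ⟨?_, .of_forall fun N => by rw [mem_Ioi]; positivity⟩
      simp only [zpow_neg, zpow_natCast, ← inv_pow]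
      exact tendsto_pow_atTop_nhds_zero_of_lt_one (by norm_num) (by norm_num)
    have hκ := fun N : ℕ => measurable_kap (-N) N
    have hM := fun N : ℕ => (((measurable_cm (hκ N) 1 hrm hfr.meas).sub
      (measurable_cm (hκ N) 1 hrm' hfi.meas)).complex_ofReal.add
      (((measurable_cm (hκ N) 1 hrm hfi.meas).add
      (measurable_cm (hκ N) 1 hrm' hfr.meas)).complex_ofReal.mul_const Complex.I))
    refine (Lp.eLpNorm_lim_le_liminf_eLpNorm
      (fun N => (hM N).aestronglyMeasurable.congr (hNb N).symm) g
      (.of_forall fun x => (hg x).comp hlim)).trans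
      (liminf_le_of_frequently_le' (.of_forall fun N => ?_))
    have hN : (-N : ℤ) ≤ N := by omega
    have hone : (1 : ℝ) * 1 = 1 := one_mul 1
    have r := fun {u : ℝ × ℝ → ℝ} (hu : Nice u)
        (huF : eLpNorm u (ENNReal.ofReal p) volume ≤ F) =>
      (hmain hone hN hrm hre hD (fun k n => (hμr k n).trans (hle k)) hu).trans
        (mul_le_mul_right huF _)
    have i := fun {u : ℝ × ℝ → ℝ} (hu : Nice u)
        (huF : eLpNorm u (ENNReal.ofReal p) volume ≤ F) =>
      (hmain hone hN hrm' him hD (fun k n => (hμi k n).trans (hle k)) hu).trans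
        (mul_le_mul_right huF _)
    rw [eLpNorm_congr_ae (hNb N)]
    refine (eLpNorm_complex_le (by simpa using ENNReal.ofReal_le_ofReal hp.le)
      (measurable_cm (hκ N) 1 hrm hfr.meas) (measurable_cm (hκ N) 1 hrm' hfi.meas)
      (measurable_cm (hκ N) 1 hrm hfi.meas) (measurable_cm (hκ N) 1 hrm' hfr.meas)
      (r hfr hFr) (i hfi hFi) (r hfi hFi) (i hfr hFr)).trans_eq ?_
    rw [← mul_assoc, show (4 : ENNReal) = ENNReal.ofReal 4 by simp,
      ← ENNReal.ofReal_mul (by norm_num)]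
    congr 2
    ring
  have hcont : Tendsto (fun δ : ℝ => ENNReal.ofReal (4 * (C * 27) * (B + δ)) * F)
      (nhdsWithin 0 (Ioi 0)) (nhds (ENNReal.ofReal (4 * (C * 27) * (B + 0)) * F)) := by
    refine ENNReal.Tendsto.mul_const ?_ (Or.inr hF)
    refine ENNReal.tendsto_ofReal (Tendsto.mono_left ?_ nhdsWithin_le_nhds)
    exact (by fun_prop : Continuous fun δ : ℝ => 4 * (C * 27) * (B + δ)).tendsto 0
  rw [add_zero] at hcont
  exact ge_of_tendsto hcont (eventually_mem_nhdsWithin.mono key)
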